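/- Suppose o_Ram(κ) = α > 0. Then for every A ⊆ κ and every β < α there is an A-good Ramsey measure U on κ such that M_U is ω-special and N_U ⊨ o_Ram(κ) = β; consequently M_U* is ω-special and M_U* ⊨ o_Ram(κ) = β. -/

import Mathlib

noncomputable section

namespace MPaper

open ZFSet

attribute [local instance] Classical.propDecidable

/-! ### Basic set-theoretic vocabulary over `ZFSet` -/

/-- The (external) cardinality of a ZFC set. -/
def zcard (x : ZFSet) : Cardinal := Cardinal.mk x.toSet

/-- `x` is a von Neumann ordinal: a transitive set of transitive sets. -/
def IsOrd (x : ZFSet) : Prop := x.IsTransitive ∧ ∀ y ∈ x, ZFSet.IsTransitive y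

/-- `κ` is a cardinal: an ordinal not equinumerous with any of its members. -/
def IsCard (κ : ZFSet) : Prop := IsOrd κ ∧ ∀ α ∈ κ, zcard α < zcard κ

/-- The ordinal `κ⁺`, the cardinal successor of `κ`. -/
def cardSuccOrd (κ : ZFSet) : Ordinal := (Order.succ (zcard κ)).ord

/-- `f` is a set-coded function with domain `d` (a set of Kuratowski pairs). -/
def IsZFunc (d f : ZFSet) : Prop :=
  (∀ p ∈ f, ∃ a ∈ d, ∃ b, p = ZFSet.pair a b) ∧ ∀ a ∈ d, ∃! b, ZFSet.pair a b ∈ f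

/-- Application of a set-coded function. -/
def fapp (f a : ZFSet) : ZFSet :=
  ⋃₀ (ZFSet.sep (fun b => ZFSet.pair a b ∈ f) (⋃₀ (⋃₀ f)))

/-- `f` maps `d` into `y`. -/
def MapsInto (f d y : ZFSet) : Prop := ∀ a ∈ d, fapp f a ∈ y

/-- `f` maps `d` onto `y`. -/
def SurjOnto (f d y : ZFSet) : Prop := MapsInto f d y ∧ ∀ b ∈ y, ∃ a ∈ d, fapp f a = b

/-- `f` is injective on `d`. -/
def InjOnZ (f d : ZFSet) : Prop := ∀ a ∈ d, ∀ b ∈ d, fapp f a = fapp f b → a = b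

/-- `f` is a bijection from `d` onto `y`. -/
def IsBij (f d y : ZFSet) : Prop := IsZFunc d f ∧ SurjOnto f d y ∧ InjOnZ f d

/-- The tail `κ ∖ α = {ξ ∈ κ | α ≤ ξ}` (for ordinals `α ∈ κ`). -/
def tailSet (κ α : ZFSet) : ZFSet := ZFSet.sep (fun ξ => ξ ∉ α) κ

/-- The relative complement `κ ∖ A`. -/
def compl (κ A : ZFSet) : ZFSet := ZFSet.sep (fun ξ => ξ ∉ A) κ

/-! ### First-order satisfaction in ∈-structures -/

/-- First order formulas in the language of set theory, with variables indexed by `ℕ`. -/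
inductive Fml : Type
  | mem : ℕ → ℕ → Fml
  | eq : ℕ → ℕ → Fml
  | impl : Fml → Fml → Fml
  | neg : Fml → Fml
  | all : ℕ → Fml → Fml

/-- Tarskian satisfaction of a formula in the ∈-structure with domain `D`. -/
def Sat (D : Set ZFSet) : Fml → (ℕ → ZFSet) → Prop
  | .mem i j, v => v i ∈ v j
  | .eq i j, v => v i = v j
  | .impl φ ψ, v => Sat D φ v → Sat D ψ v
  | .neg φ, v => ¬ Sat D φ v
  | .all n φ, v => ∀ x ∈ D, Sat D φ (Function.update v n x)

/-- `D` is an elementary substructure of `E` (as ∈-structures). -/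
def ElemSub (D E : Set ZFSet) : Prop :=
  D ⊆ E ∧ ∀ (φ : Fml) (v : ℕ → ZFSet), (∀ n, v n ∈ D) → (Sat D φ v ↔ Sat E φ v)

/-- `r` is a well-ordering of `x` (coded as a set of Kuratowski pairs). -/
def IsWellOrderOn (x r : ZFSet) : Prop :=
  (∀ p ∈ r, ∃ a ∈ x, ∃ b ∈ x, p = ZFSet.pair a b) ∧
  (∀ a ∈ x, ∀ b ∈ x, a = b ∨ ZFSet.pair a b ∈ r ∨ ZFSet.pair b a ∈ r) ∧
  (∀ a ∈ x, ∀ b ∈ x, ∀ c ∈ x,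
    ZFSet.pair a b ∈ r → ZFSet.pair b c ∈ r → ZFSet.pair a c ∈ r) ∧
  (∀ a ∈ x, ZFSet.pair a a ∉ r) ∧
  (∀ S : Set ZFSet, S ⊆ x.toSet → S.Nonempty → ∃ a ∈ S, ∀ b ∈ S, ZFSet.pair b a ∉ r)

/-- A transitive model of `ZFC⁻` (ZFC minus power set): a transitive set closed under
pairing and union, containing `ω`, satisfying the separation and collection schemes for
first-order formulas, and choice in the guise of the well-ordering principle.
(Extensionality and foundation hold automatically in transitive sets.) -/
def IsTransModel (M : ZFSet) : Prop :=
  M.IsTransitive ∧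
  ZFSet.omega ∈ M ∧
  (∀ x ∈ M, ∀ y ∈ M, ({x, y} : ZFSet) ∈ M) ∧
  (∀ x ∈ M, (⋃₀ x : ZFSet) ∈ M) ∧
  (∀ (φ : Fml) (v : ℕ → ZFSet), (∀ n, v n ∈ M) → ∀ a ∈ M,
    ∃ b ∈ M, ∀ x, x ∈ b ↔ x ∈ a ∧ Sat M.toSet φ (Function.update v 0 x)) ∧
  (∀ (φ : Fml) (v : ℕ → ZFSet), (∀ n, v n ∈ M) → ∀ a ∈ M,
    (∀ x ∈ a, ∃ y ∈ M, Sat M.toSet φ (Function.update (Function.update v 0 x) 1 y)) →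
    ∃ b ∈ M, ∀ x ∈ a, ∃ y ∈ b, Sat M.toSet φ (Function.update (Function.update v 0 x) 1 y)) ∧
  (∀ x ∈ M, ∃ r ∈ M, IsWellOrderOn x r)

/-! ### Weak κ-models, κ-models, M-ultrafilters -/

/-- A weak `κ`-model: a transitive model of ZFC⁻ of size `κ` with `κ ∈ M`. -/
def IsWeakModel (κ M : ZFSet) : Prop :=
  IsTransModel M ∧ κ ∈ M ∧ zcard M = zcard κ

/-- `M` is closed under `<κ`-sequences (of its elements). -/
def SeqClosed (κ M : ZFSet) : Prop :=
  ∀ γ ∈ κ, ∀ f : ZFSet, IsZFunc γ f → (∀ a ∈ γ, fapp f a ∈ M) → f ∈ M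

/-- A `κ`-model: a weak `κ`-model closed under `<κ`-sequences. -/
def IsKappaModel (κ M : ZFSet) : Prop := IsWeakModel κ M ∧ SeqClosed κ M

/-- `U` is an `M`-ultrafilter on `κ`: `⟨M, ∈, U⟩` thinks `U` is a normal ultrafilter on `κ`
containing all tail sets. -/
def IsMUltrafilter (κ M U : ZFSet) : Prop :=
  (∀ A ∈ U, A ∈ M ∧ A ⊆ κ) ∧
  (∀ α ∈ κ, tailSet κ α ∈ U) ∧
  (∅ : ZFSet) ∉ U ∧
  (∀ A ∈ U, ∀ B ∈ U, A ∩ B ∈ U) ∧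
  (∀ A ∈ U, ∀ B, B ∈ M → B ⊆ κ → A ⊆ B → B ∈ U) ∧
  (∀ B, B ∈ M → B ⊆ κ → B ∈ U ∨ compl κ B ∈ U) ∧
  (∀ f ∈ M, IsZFunc κ f → ZFSet.sep (fun ξ => fapp f ξ ∈ ξ) κ ∈ U →
    ∃ γ ∈ κ, ZFSet.sep (fun ξ => fapp f ξ = γ) κ ∈ U)

/-- `U` is weakly amenable for `M`: for every `X ∈ M` of size at most `κ` in `M`,
the intersection `X ∩ U` belongs to `M`. -/
def WeaklyAmenable (κ M U : ZFSet) : Prop :=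
  ∀ X ∈ M, (∃ f ∈ M.toSet, IsZFunc κ f ∧ ∀ y ∈ X, ∃ ξ ∈ κ, fapp f ξ = y) →
    X ∩ U ∈ M

/-- `U` is `ω₁`-intersecting: every countable collection of its members has a common element. -/
def OmegaOneIntersecting (U : ZFSet) : Prop :=
  ∀ s : ℕ → ZFSet, (∀ n, s n ∈ U) → ∃ x, ∀ n, x ∈ s n

/-- `M` contains (its version of) `V_κ`, i.e. the set of all sets of rank `< κ`. -/
def HasVkappa (κ M : ZFSet) : Prop :=
  ∃ v ∈ M.toSet, ∀ x, x ∈ v ↔ ZFSet.rank x < ZFSet.rank κ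

/-! ### Small universe measures and the associated models `M_U`, `N_U` -/

/-- `M` is the minimal model associated to `U` (the collection of Mostowski collapses of
well-founded relations on `κ` coded by sets in `U` and their complements): a weak `κ`-model
with `V_κ ∈ M` for which `U` is an `M`-ultrafilter, contained in every transitive
ZFC⁻-model `M'` with `κ ∈ M'` for which `U` is an `M'`-ultrafilter. -/
def IsMUModel (κ U M : ZFSet) : Prop :=
  IsWeakModel κ M ∧ HasVkappa κ M ∧ IsMUltrafilter κ M U ∧
  ∀ M', IsTransModel M' → κ ∈ M' → IsMUltrafilter κ M' U → M ⊆ M'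

/-- A small universe measure on `κ`: a set `U` of subsets of `κ` of size `κ` whose associated
minimal model `M_U` exists (is a weak `κ`-model with `V_κ ∈ M_U` and `U` an `M_U`-ultrafilter). -/
def IsSUMeasure (κ U : ZFSet) : Prop :=
  zcard U = zcard κ ∧ (∀ A ∈ U, A ⊆ κ) ∧ ∃ M, IsMUModel κ U M

/-- The minimal model `M_U` associated to a small universe measure `U`. -/
def MU (κ U : ZFSet) : ZFSet :=
  if h : ∃ M, IsMUModel κ U M then h.choose else ∅

/-- `j : M → N` is (up to isomorphism) the ultrapower embedding of `M` by the
`M`-ultrafilter `U` on `κ`, with `N` transitive (so the ultrapower is well-founded):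
`j` is elementary, every element of `N` has the form `j(f)(κ)` for `f : κ → M` in `M`,
and `U` is the `M`-ultrafilter derived from `j` with seed `κ`. -/
def IsUltrapowerEmb (κ M U N : ZFSet) (j : ZFSet → ZFSet) : Prop :=
  N.IsTransitive ∧
  (∀ x ∈ M, j x ∈ N) ∧
  (∀ (φ : Fml) (v : ℕ → ZFSet), (∀ n, v n ∈ M) →
    (Sat M.toSet φ v ↔ Sat N.toSet φ (fun n => j (v n)))) ∧
  (∀ a ∈ N, ∃ f ∈ M.toSet, IsZFunc κ f ∧ MapsInto f κ M ∧ fapp (j f) κ = a) ∧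
  (∀ A ∈ M, A ⊆ κ → (A ∈ U ↔ κ ∈ j A))

/-- The ultrapower of `M_U` by `U` is well-founded. -/
def UltrapowerWF (κ U : ZFSet) : Prop :=
  ∃ (N : ZFSet) (j : ZFSet → ZFSet), IsUltrapowerEmb κ (MU κ U) U N j

/-- A choice of transitive collapse of the ultrapower of `M_U` by `U`, with its embedding. -/
def upData (κ U : ZFSet) : ZFSet × (ZFSet → ZFSet) :=
  if h : ∃ p : ZFSet × (ZFSet → ZFSet), IsUltrapowerEmb κ (MU κ U) U p.1 p.2
  then h.choose else (∅, id)

/-- `N_U`: the transitive collapse of the ultrapower of `M_U` by `U` (when well-founded). -/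
def NU (κ U : ZFSet) : ZFSet := (upData κ U).1

/-- The ultrapower embedding `j_U : M_U → N_U`. -/
def jU (κ U : ZFSet) : ZFSet → ZFSet := (upData κ U).2

/-- `M_U⋆ = V_{j(κ)}^{N_U}`, the rank-initial segment of `N_U` below `j_U(κ)`. -/
def MUstar (κ U : ZFSet) : ZFSet :=
  ZFSet.sep (fun x => ZFSet.rank x < ZFSet.rank (jU κ U κ)) (NU κ U)

/-! ### Hereditary size, `H_{κ⁺}`, elementarity -/

/-- `x` has hereditary size at most `κ`. -/
def HeredLE (κ : ZFSet) : ZFSet → Prop :=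
  WellFounded.fix ZFSet.mem_wf
    (fun x ih => zcard x ≤ zcard κ ∧ ∀ y, ∀ h : y ∈ x, ih y h)

/-- The class `H_{κ⁺}` of sets of hereditary size at most `κ`. -/
def Hclass (κ : ZFSet) : Set ZFSet := { x | HeredLE κ x }

/-! ### The measures witnessing Ramsey and Ramsey-like cardinals -/

/-- A Ramsey measure on `κ`: a weakly amenable `ω₁`-intersecting small universe measure. -/
def IsRamseyMeasure (κ U : ZFSet) : Prop :=
  IsSUMeasure κ U ∧ WeaklyAmenable κ (MU κ U) U ∧ OmegaOneIntersecting U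

/-- A strong Ramsey measure on `κ`: a weakly amenable small universe measure whose
minimal model `M_U` is a `κ`-model. -/
def IsStrongRamseyMeasure (κ U : ZFSet) : Prop :=
  IsSUMeasure κ U ∧ WeaklyAmenable κ (MU κ U) U ∧ SeqClosed κ (MU κ U)

/-- A super Ramsey measure on `κ`: a strong Ramsey measure with `M_U ≺ H_{κ⁺}`. -/
def IsSuperRamseyMeasure (κ U : ZFSet) : Prop :=
  IsStrongRamseyMeasure κ U ∧ ElemSub (MU κ U).toSet (Hclass κ)

/-- `I` certifies `U`: `I` is an unbounded subset of `κ` and the sets in `U` are exactly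
the subsets of `κ` in `M_U` containing a tail of `I`. -/
def Certifies (κ U : ZFSet) (I : Set ZFSet) : Prop :=
  (∀ ξ ∈ I, ξ ∈ κ) ∧ (∀ α ∈ κ, ∃ ξ ∈ I, ξ ∉ α) ∧
  ∀ X ∈ (MU κ U).toSet, X ⊆ κ →
    (X ∈ U ↔ ∃ α ∈ κ.toSet, ∀ ξ ∈ I, ξ ∉ α → ξ ∈ X)

/-- A certified Ramsey measure on `κ`: a weakly amenable small universe measure which is
certified by some unbounded `I ⊆ κ`. -/
def IsCertifiedRamseyMeasure (κ U : ZFSet) : Prop :=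
  IsSUMeasure κ U ∧ WeaklyAmenable κ (MU κ U) U ∧ ∃ I : Set ZFSet, Certifies κ U I

/-! ### Relativized (internal) versions of the measure predicates -/

/-- `ω₁`-intersecting from the point of view of the transitive model `N`: every
`ω`-sequence of members of `U` lying in `N` has a common element. -/
def OmegaOneIntersectingIn (N U : ZFSet) : Prop :=
  ∀ f ∈ N.toSet, IsZFunc ZFSet.omega f → (∀ n ∈ ZFSet.omega, fapp f n ∈ U) →
    ∃ x, ∀ n ∈ ZFSet.omega, x ∈ fapp f n

/-- `N ⊨ U is a Ramsey measure on κ`, for a transitive ZFC⁻-model `N`: all components are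
absolute except `ω₁`-intersectingness, which is evaluated using sequences in `N`. -/
def RamseyMeasureIn (N κ U : ZFSet) : Prop :=
  U ∈ N ∧ IsSUMeasure κ U ∧ WeaklyAmenable κ (MU κ U) U ∧ OmegaOneIntersectingIn N U

/-- `N ⊨ U is a strong Ramsey measure on κ`: closure of `M_U` under `<κ`-sequences is
evaluated using the sequences lying in `N`. -/
def StrongRamseyMeasureIn (N κ U : ZFSet) : Prop :=
  U ∈ N ∧ IsSUMeasure κ U ∧ WeaklyAmenable κ (MU κ U) U ∧
  ∀ f ∈ N.toSet, ∀ γ ∈ κ, IsZFunc γ f → (∀ a ∈ γ, fapp f a ∈ MU κ U) → f ∈ MU κ U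

/-- The class `H_{κ⁺}` as computed in `N`. -/
def HclassIn (N κ : ZFSet) : Set ZFSet := { x | x ∈ N ∧ HeredLE κ x }

/-- `N ⊨ U is a super Ramsey measure on κ`. -/
def SuperRamseyMeasureIn (N κ U : ZFSet) : Prop :=
  StrongRamseyMeasureIn N κ U ∧ ElemSub (MU κ U).toSet (HclassIn N κ)

/-- `N ⊨ U is a certified Ramsey measure on κ` (the certifying set is required to lie in `N`). -/
def CertifiedRamseyMeasureIn (N κ U : ZFSet) : Prop :=
  U ∈ N ∧ IsSUMeasure κ U ∧ WeaklyAmenable κ (MU κ U) U ∧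
  ∃ I ∈ N.toSet, Certifies κ U I.toSet

/-! ### Goodness, witness collections, and the M-order -/

/-- `U` is `A`-good: `A ∈ M_U`. -/
def AGood (κ A U : ZFSet) : Prop := A ∈ MU κ U

/-- A witness collection of `Pm`-measures on `κ`: a collection of `Pm`-measures containing
an `A`-good one for every `A ⊆ κ`. -/
def IsWitness (Pm : ZFSet → ZFSet → Prop) (κ : ZFSet) (𝒰 : Set ZFSet) : Prop :=
  (∀ U ∈ 𝒰, Pm κ U) ∧ ∀ A : ZFSet, A ⊆ κ → ∃ U ∈ 𝒰, AGood κ A U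

/-- The M-order on witness collections of `Pm`-measures on `κ`; `PmIn N κ U` is the
relativization `N ⊨ U is a Pm-measure on κ`.  `MOrder Pm PmIn κ 𝒰 𝒲` says `𝒰 ◁ 𝒲`. -/
def MOrder (Pm : ZFSet → ZFSet → Prop) (PmIn : ZFSet → ZFSet → ZFSet → Prop)
    (κ : ZFSet) (𝒰 𝒲 : Set ZFSet) : Prop :=
  IsWitness Pm κ 𝒰 ∧ IsWitness Pm κ 𝒲 ∧
  (∀ W ∈ 𝒲, ∀ A ∈ (NU κ W).toSet, A ⊆ κ →
    ∃ U ∈ 𝒰, U ∈ NU κ W ∧ AGood κ A U ∧ PmIn (NU κ W) κ U) ∧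
  (∀ U ∈ 𝒰, ∃ W ∈ 𝒲, U ∈ NU κ W)

/-! ### Ranks -/

/-- The rank of a point in an arbitrary binary relation (`0` at non-accessible points). -/
def relRank {X : Type*} (r : X → X → Prop) (x : X) : Ordinal :=
  if h : Acc r x then h.rank else 0

/-- The M-rank `o_Pm(κ)`: the strict supremum of the M-ranks of all witness collections of
`Pm`-measures on `κ` (and `0` if there are none). -/
def oRank (Pm : ZFSet → ZFSet → Prop) (PmIn : ZFSet → ZFSet → ZFSet → Prop)
    (κ : ZFSet) : Ordinal :=
  sSup { o : Ordinal |
    ∃ 𝒰 : Set ZFSet, IsWitness Pm κ 𝒰 ∧ o = relRank (MOrder Pm PmIn κ) 𝒰 + 1 }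

/-- `N ⊨ o_Pm(κ) ≥ α`, defined by the recursion: for every `A ⊆ κ` in `N` and every `β < α`
there is an `A`-good `Pm`-measure `W` in `N` (in the sense of `N`) whose ultrapower satisfies
`o_Pm(κ) ≥ β`. -/
def oGEin (PmIn : ZFSet → ZFSet → ZFSet → Prop) (κ : ZFSet) : Ordinal → ZFSet → Prop :=
  WellFounded.fix wellFounded_lt fun α ih N =>
    ∀ A ∈ N.toSet, A ⊆ κ → ∀ β, ∀ h : β < α,
      ∃ W ∈ N.toSet, PmIn N κ W ∧ AGood κ A W ∧ ih β h (NU κ W)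

/-- `N ⊨ o_Pm(κ) = α`. -/
def oEQin (PmIn : ZFSet → ZFSet → ZFSet → Prop) (κ : ZFSet) (α : Ordinal) (N : ZFSet) : Prop :=
  oGEin PmIn κ α N ∧ ¬ oGEin PmIn κ (α + 1) N

/-! ### The M-order and M-rank relativized to a model `ℳ` -/

/-- A witness collection (coded as a set) of `Pm`-measures in the sense of the model `ℳ`. -/
def IsWitnessIn (PmIn : ZFSet → ZFSet → ZFSet → Prop) (ℳ κ 𝒰 : ZFSet) : Prop :=
  𝒰 ∈ ℳ ∧ (∀ U ∈ 𝒰, PmIn ℳ κ U) ∧ ∀ A ∈ ℳ.toSet, A ⊆ κ → ∃ U ∈ 𝒰.toSet, AGood κ A U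

/-- The M-order on witness collections as computed in `ℳ`. -/
def MOrderIn (PmIn : ZFSet → ZFSet → ZFSet → Prop) (ℳ κ : ZFSet) (𝒰 𝒲 : ZFSet) : Prop :=
  IsWitnessIn PmIn ℳ κ 𝒰 ∧ IsWitnessIn PmIn ℳ κ 𝒲 ∧
  (∀ W ∈ 𝒲, ∀ A ∈ (NU κ W).toSet, A ⊆ κ →
    ∃ U ∈ 𝒰.toSet, U ∈ NU κ W ∧ AGood κ A U ∧ PmIn (NU κ W) κ U) ∧
  (∀ U ∈ 𝒰, ∃ W ∈ 𝒲.toSet, U ∈ NU κ W)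

/-- The M-rank `o_Pm(κ)` as computed in `ℳ`. -/
def oRankIn (PmIn : ZFSet → ZFSet → ZFSet → Prop) (ℳ κ : ZFSet) : Ordinal :=
  sSup { o : Ordinal |
    ∃ 𝒰 : ZFSet, IsWitnessIn PmIn ℳ κ 𝒰 ∧ o = relRank (MOrderIn PmIn ℳ κ) 𝒰 + 1 }

/-! ### Practical models, cover and approximation properties -/

/-- `ℳ` is practical for `κ`: a transitive ZFC⁻-model containing `κ` in which
`V_{κ+3}` exists. -/
def Practical (κ ℳ : ZFSet) : Prop :=
  IsTransModel ℳ ∧ κ ∈ ℳ ∧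
  ∃ v ∈ ℳ.toSet, ∀ x, x ∈ v ↔ (x ∈ ℳ ∧ ZFSet.rank x < ZFSet.rank κ + 3)

/-- `x` has size less than `δ` as witnessed inside the class `D`:
some `f ∈ D` injects `x` into an ordinal `γ ∈ δ`. -/
def SizeLTin (D : Set ZFSet) (x δ : ZFSet) : Prop :=
  ∃ γ ∈ δ.toSet, ∃ f ∈ D, IsZFunc x f ∧ MapsInto f x γ ∧ InjOnZ f x

/-- The pair `D ⊆ D'` has the `δ`-cover property. -/
def CoverProperty (δ : ZFSet) (D D' : Set ZFSet) : Prop :=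
  ∀ X ∈ D', X.toSet ⊆ D → SizeLTin D' X δ →
    ∃ Y ∈ D, X ⊆ Y ∧ SizeLTin D Y δ

/-- The pair `D ⊆ D'` has the `δ`-approximation property. -/
def ApproxProperty (δ : ZFSet) (D D' : Set ZFSet) : Prop :=
  ∀ X ∈ D', X.toSet ⊆ D → (∀ x ∈ D, SizeLTin D x δ → X ∩ x ∈ D) → X ∈ D

/-- `δ` is a cardinal from the point of view of the class `D`. -/
def IsCardIn (D : Set ZFSet) (δ : ZFSet) : Prop :=
  IsOrd δ ∧ δ ∈ D ∧ ∀ γ ∈ δ, ¬ ∃ f ∈ D, IsZFunc γ f ∧ SurjOnto f γ δ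

/-- `δ` is a regular (infinite) cardinal from the point of view of the class `D`. -/
def IsRegularIn (D : Set ZFSet) (δ : ZFSet) : Prop :=
  IsCardIn D δ ∧ ZFSet.omega ⊆ δ ∧
  ∀ γ ∈ δ, ∀ f ∈ D, IsZFunc γ f → MapsInto f γ δ →
    ∃ β ∈ δ, ∀ a ∈ γ, fapp f a ∈ β

/-- `H_λ` as computed in the model `V`: the members of `V` having, in `V`,
a transitive superset of size `< λ`. -/
def HIn (V lam : ZFSet) : Set ZFSet :=
  { x | x ∈ V ∧ ∃ t ∈ V.toSet, x ⊆ t ∧ t.IsTransitive ∧ SizeLTin V.toSet t lam }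

/-- `V` and `V'` have the same ordinals. -/
def SameOrdinals (D D' : Set ZFSet) : Prop :=
  ∀ α, IsOrd α → (α ∈ D ↔ α ∈ D')

/-- Every `ω`-sequence of elements of `ℳ` lying in `ℳ'` is an element of `ℳ`. -/
def OmegaSeqClosedPair (ℳ ℳ' : ZFSet) : Prop :=
  ∀ f ∈ ℳ'.toSet, IsZFunc ZFSet.omega f → (∀ n ∈ ZFSet.omega, fapp f n ∈ ℳ) → f ∈ ℳ

/-! ### Large cardinal properties -/

/-- `κ` is Ramsey: every `A ⊆ κ` belongs to a weak `κ`-model `M` carrying a weakly amenable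
`ω₁`-intersecting `M`-ultrafilter on `κ`. -/
def IsRamseyCard (κ : ZFSet) : Prop :=
  IsCard κ ∧ ∀ A : ZFSet, A ⊆ κ →
    ∃ M, IsWeakModel κ M ∧ A ∈ M ∧
      ∃ U, IsMUltrafilter κ M U ∧ WeaklyAmenable κ M U ∧ OmegaOneIntersecting U

/-- `κ` is strongly Ramsey: the model `M` can moreover be taken to be a `κ`-model. -/
def IsStronglyRamseyCard (κ : ZFSet) : Prop :=
  IsCard κ ∧ ∀ A : ZFSet, A ⊆ κ →
    ∃ M, IsKappaModel κ M ∧ A ∈ M ∧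
      ∃ U, IsMUltrafilter κ M U ∧ WeaklyAmenable κ M U ∧ OmegaOneIntersecting U

/-- `κ` is super Ramsey: the model `M` can moreover be taken to be a `κ`-model
elementary in `H_{κ⁺}`. -/
def IsSuperRamseyCard (κ : ZFSet) : Prop :=
  IsCard κ ∧ ∀ A : ZFSet, A ⊆ κ →
    ∃ M, IsKappaModel κ M ∧ ElemSub M.toSet (Hclass κ) ∧ A ∈ M ∧
      ∃ U, IsMUltrafilter κ M U ∧ WeaklyAmenable κ M U ∧ OmegaOneIntersecting U

/-- `κ` is weakly super Ramsey: the model `M` is a weak `κ`-model elementary in `H_{κ⁺}`. -/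
def IsWeaklySuperRamseyCard (κ : ZFSet) : Prop :=
  IsCard κ ∧ ∀ A : ZFSet, A ⊆ κ →
    ∃ M, IsWeakModel κ M ∧ ElemSub M.toSet (Hclass κ) ∧ A ∈ M ∧
      ∃ U, IsMUltrafilter κ M U ∧ WeaklyAmenable κ M U ∧ OmegaOneIntersecting U

/-- `κ` is measurable: there is a `κ`-complete nonprincipal ultrafilter on (all) subsets
of `κ`. -/
def IsMeasurableCard (κ : ZFSet) : Prop :=
  IsCard κ ∧ ZFSet.omega ∈ κ ∧
  ∃ 𝒰 : Set ZFSet,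
    (∀ A ∈ 𝒰, A ⊆ κ) ∧ (∅ : ZFSet) ∉ 𝒰 ∧ κ ∈ 𝒰 ∧
    (∀ A ∈ 𝒰, ∀ B : ZFSet, B ⊆ κ → A ⊆ B → B ∈ 𝒰) ∧
    (∀ A : ZFSet, A ⊆ κ → (A ∈ 𝒰 ∨ compl κ A ∈ 𝒰)) ∧
    (∀ γ ∈ κ.toSet, ∀ s : ZFSet → ZFSet, (∀ i ∈ γ, s i ∈ 𝒰) →
      ZFSet.sep (fun ξ => ∀ i ∈ γ, ξ ∈ s i) κ ∈ 𝒰)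

/-! ### Relativized large-cardinal properties -/

/-- `N ⊨ κ is Ramsey` (for a transitive model `N`): the witnessing models and ultrafilters
lie in `N`, smallness of the models is witnessed in `N`, and `ω₁`-intersectingness is
evaluated using the sequences in `N`. -/
def RamseyCardIn (N κ : ZFSet) : Prop :=
  ∀ A ∈ N.toSet, A ⊆ κ →
    ∃ M ∈ N.toSet, A ∈ M ∧ IsTransModel M ∧ κ ∈ M ∧
      (∃ f ∈ N.toSet, IsZFunc κ f ∧ SurjOnto f κ M) ∧
      ∃ U ∈ N.toSet, IsMUltrafilter κ M U ∧ WeaklyAmenable κ M U ∧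
        OmegaOneIntersectingIn N U

/-- `N ⊨ κ is strongly Ramsey`. -/
def StronglyRamseyCardIn (N κ : ZFSet) : Prop :=
  ∀ A ∈ N.toSet, A ⊆ κ →
    ∃ M ∈ N.toSet, A ∈ M ∧ IsTransModel M ∧ κ ∈ M ∧
      (∃ f ∈ N.toSet, IsZFunc κ f ∧ SurjOnto f κ M) ∧
      (∀ f ∈ N.toSet, ∀ γ ∈ κ, IsZFunc γ f → (∀ a ∈ γ, fapp f a ∈ M) → f ∈ M) ∧
      ∃ U ∈ N.toSet, IsMUltrafilter κ M U ∧ WeaklyAmenable κ M U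

/-- `N ⊨ κ is super Ramsey`. -/
def SuperRamseyCardIn (N κ : ZFSet) : Prop :=
  ∀ A ∈ N.toSet, A ⊆ κ →
    ∃ M ∈ N.toSet, A ∈ M ∧ IsTransModel M ∧ κ ∈ M ∧
      (∃ f ∈ N.toSet, IsZFunc κ f ∧ SurjOnto f κ M) ∧
      (∀ f ∈ N.toSet, ∀ γ ∈ κ, IsZFunc γ f → (∀ a ∈ γ, fapp f a ∈ M) → f ∈ M) ∧
      ElemSub M.toSet (HclassIn N κ) ∧
      ∃ U ∈ N.toSet, IsMUltrafilter κ M U ∧ WeaklyAmenable κ M U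

/-! ### ω-special models -/

/-- A weak `κ`-model `M` is `ω`-special: it is the union of a chain
`M₀ ≺ M₁ ≺ ⋯` of elementary substructures of `M` with each `Mₙ ∈ M` and `|Mₙ|^M = κ`. -/
def OmegaSpecial (κ M : ZFSet) : Prop :=
  ∃ s : ℕ → ZFSet,
    (∀ n, s n ∈ M) ∧
    (∀ n, (s n).toSet ⊆ (s (n + 1)).toSet) ∧
    (∀ n, ElemSub (s n).toSet M.toSet) ∧
    (∀ n, ∃ f ∈ M.toSet, IsBij f κ (s n)) ∧
    (∀ x, x ∈ M ↔ ∃ n, x ∈ s n)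

/-! ### Iterated ultrapowers and α-iterability -/

/-- `U` is an `α`-iterable `M`-ultrafilter on `κ`: there is a coherent system of transitive
models `Mod β` (`β ≤ α`), with commuting elementary embeddings `e β γ : Mod β → Mod γ`,
critical sequence `cr β` and ultrafilter sequence `Us β`, starting at `(M, κ, U)`, where each
successor step is given by an ultrapower and each limit step is a (collapsed) direct limit. -/
def IsAlphaIterable (κ M U : ZFSet) (α : Ordinal) : Prop :=
  ∃ (Mod : Ordinal → ZFSet) (cr : Ordinal → ZFSet) (Us : Ordinal → ZFSet)
    (e : Ordinal → Ordinal → ZFSet → ZFSet),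
    Mod 0 = M ∧ cr 0 = κ ∧ Us 0 = U ∧
    (∀ β ≤ α, (Mod β).IsTransitive) ∧
    (∀ β ≤ α, ∀ x ∈ Mod β, e β β x = x) ∧
    (∀ β γ ρ : Ordinal, β ≤ γ → γ ≤ ρ → ρ ≤ α →
      ∀ x ∈ Mod β, e γ ρ (e β γ x) = e β ρ x) ∧
    (∀ β γ : Ordinal, β ≤ γ → γ ≤ α →
      (∀ x ∈ Mod β, e β γ x ∈ Mod γ) ∧
      ∀ (φ : Fml) (v : ℕ → ZFSet), (∀ n, v n ∈ Mod β) →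
        (Sat (Mod β).toSet φ v ↔ Sat (Mod γ).toSet φ (fun n => e β γ (v n)))) ∧
    (∀ β : Ordinal, β + 1 ≤ α →
      IsUltrapowerEmb (cr β) (Mod β) (Us β) (Mod (β + 1)) (e β (β + 1)) ∧
      cr (β + 1) = e β (β + 1) (cr β) ∧
      (∀ A, A ∈ Us (β + 1) ↔
        ∃ X ∈ (Mod β).toSet, X ∩ Us β ∈ Mod β ∧ A ∈ e β (β + 1) (X ∩ Us β))) ∧
    (∀ lam : Ordinal, lam ≤ α → lam ≠ 0 → (∀ β < lam, β + 1 < lam) →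
      (∀ x ∈ Mod lam, ∃ β < lam, ∃ y ∈ (Mod β).toSet, e β lam y = x) ∧
      cr lam = e 0 lam κ ∧
      (∀ A, A ∈ Us lam ↔ ∃ β < lam, ∃ B, B ∈ Us β ∧ e β lam B = A))

/-- `N ⊨ κ is α-iterable`: every `A ⊆ κ` in `N` belongs to a weak `κ`-model `M ∈ N` for
which there is a weakly amenable `α`-iterable `M`-ultrafilter `U ∈ N` on `κ`. -/
def AlphaIterableCardIn (N κ : ZFSet) (α : Ordinal) : Prop :=
  ∀ A ∈ N.toSet, A ⊆ κ →
    ∃ M ∈ N.toSet, A ∈ M ∧ IsTransModel M ∧ κ ∈ M ∧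
      (∃ f ∈ N.toSet, IsZFunc κ f ∧ SurjOnto f κ M) ∧
      ∃ U ∈ N.toSet, IsMUltrafilter κ M U ∧ WeaklyAmenable κ M U ∧
        IsAlphaIterable κ M U α

/-! ### Forcing -/

/-- `R` codes a partial order (of forcing conditions) on `P`: `pair p q ∈ R` means `p ≤ q`. -/
def IsPoset (P R : ZFSet) : Prop :=
  (∀ p ∈ R, ∃ a ∈ P, ∃ b ∈ P, p = ZFSet.pair a b) ∧
  (∀ p ∈ P, ZFSet.pair p p ∈ R) ∧
  (∀ p ∈ P, ∀ q ∈ P, ∀ r ∈ P,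
    ZFSet.pair p q ∈ R → ZFSet.pair q r ∈ R → ZFSet.pair p r ∈ R)

/-- `G` is an `ℳ`-generic filter on the poset `(P, R)`. -/
def IsGenericFilter (ℳ P R : ZFSet) (G : Set ZFSet) : Prop :=
  G ⊆ P.toSet ∧ G.Nonempty ∧
  (∀ p ∈ G, ∀ q ∈ G, ∃ r ∈ G, ZFSet.pair r p ∈ R ∧ ZFSet.pair r q ∈ R) ∧
  (∀ p ∈ G, ∀ q ∈ P.toSet, ZFSet.pair p q ∈ R → q ∈ G) ∧
  ∀ Dset ∈ ℳ.toSet, Dset ⊆ P →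
    (∀ p ∈ P.toSet, ∃ q ∈ Dset.toSet, ZFSet.pair q p ∈ R) →
    ∃ q ∈ G, q ∈ Dset

/-- `ℳ'` is the generic extension `ℳ[G]`: the least transitive ZFC⁻-model containing `ℳ`
and (a set coding) `G`, with the same ordinals as `ℳ`. -/
def IsGenericExt (ℳ ℳ' : ZFSet) (G : Set ZFSet) : Prop :=
  IsTransModel ℳ' ∧ ℳ ⊆ ℳ' ∧ (∃ g ∈ ℳ'.toSet, g.toSet = G) ∧
  SameOrdinals ℳ.toSet ℳ'.toSet ∧
  ∀ N', IsTransModel N' → ℳ ⊆ N' → (∃ g ∈ N'.toSet, g.toSet = G) → ℳ' ⊆ N'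

/-- `f ∈ D` is a cofinal map from `γ` into the ordinal `α`. -/
def CofinalMapIn (D : Set ZFSet) (γ α f : ZFSet) : Prop :=
  f ∈ D ∧ IsZFunc γ f ∧ MapsInto f γ α ∧
  ∀ b ∈ α, ∃ a ∈ γ, b ∈ fapp f a ∨ b = fapp f a

/-- `γ` is the cofinality of the ordinal `α` as computed in `D`. -/
def IsCofIn (D : Set ZFSet) (α γ : ZFSet) : Prop :=
  IsOrd γ ∧ (∃ f, CofinalMapIn D γ α f) ∧ ∀ γ' ∈ γ, ¬ ∃ f, CofinalMapIn D γ' α f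

/-- The pair `ℳ ⊆ ℳ'` preserves all cofinalities. -/
def PreservesCofinalities (ℳ ℳ' : ZFSet) : Prop :=
  ∀ α ∈ ℳ.toSet, IsOrd α → ∀ γ, (IsCofIn ℳ.toSet α γ ↔ IsCofIn ℳ'.toSet α γ)

set_option linter.all false

section

universe u

/-! ## Part 0: definability -/

/-- A bound for the variables of a formula. -/
def Fml.bd : Fml → ℕ
  | .mem i j => max i j + 1
  | .eq i j => max i j + 1
  | .impl φ ψ => max φ.bd ψ.bd
  | .neg φ => φ.bd
  | .all n φ => max (n + 1) φ.bd

theorem sat_bd (D : Set ZFSet) (φ : Fml) : ∀ (v w : ℕ → ZFSet),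
    (∀ n < φ.bd, v n = w n) → (Sat D φ v ↔ Sat D φ w) := by
  induction φ with
  | mem i j => intro v w h; simp [Sat, Fml.bd] at *; rw [h i (by omega), h j (by omega)]
  | eq i j => intro v w h; simp [Sat, Fml.bd] at *; rw [h i (by omega), h j (by omega)]
  | impl φ ψ ih1 ih2 =>
    intro v w h; simp only [Sat, Fml.bd] at *
    rw [ih1 v w fun n hn => h n (by omega), ih2 v w fun n hn => h n (by omega)]
  | neg φ ih =>
    intro v w h; simp only [Sat, Fml.bd] at *
    rw [ih v w h]
  | all n φ ih =>
    intro v w h; simp only [Sat, Fml.bd] at *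
    refine forall_congr' fun x => imp_congr_right fun _ => ih _ _ fun k hk => ?_
    by_cases hkn : k = n
    · subst hkn; simp
    · simp [hkn]; exact h k (by omega)

theorem exists_fresh (σ : ℕ → ℕ) (B : ℕ) : ∃ m, ∀ k < B, σ k < m := by
  refine ⟨(Finset.range B).sup σ + 1, fun k hk => ?_⟩
  have := Finset.le_sup (f := σ) (Finset.mem_range.2 hk)
  omega

theorem sat_ren (φ : Fml) : ∀ σ : ℕ → ℕ, ∃ ψ : Fml, ∀ (D : Set ZFSet) (v : ℕ → ZFSet),
    Sat D ψ v ↔ Sat D φ (fun n => v (σ n)) := by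
  induction φ with
  | mem i j => intro σ; exact ⟨.mem (σ i) (σ j), fun D v => Iff.rfl⟩
  | eq i j => intro σ; exact ⟨.eq (σ i) (σ j), fun D v => Iff.rfl⟩
  | impl φ ψ ih1 ih2 =>
    intro σ
    obtain ⟨a, ha⟩ := ih1 σ
    obtain ⟨b, hb⟩ := ih2 σ
    exact ⟨.impl a b, fun D v => by simp only [Sat, ha, hb]⟩
  | neg φ ih =>
    intro σ
    obtain ⟨a, ha⟩ := ih σ
    exact ⟨.neg a, fun D v => by simp only [Sat, ha]⟩
  | all n φ ih =>
    intro σ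
    obtain ⟨m, hm⟩ := exists_fresh σ φ.bd
    obtain ⟨a, ha⟩ := ih (Function.update σ n m)
    refine ⟨.all m a, fun D v => ?_⟩
    simp only [Sat, ha]
    refine forall_congr' fun x => imp_congr_right fun _ => sat_bd _ _ _ _ fun k hk => ?_
    by_cases hkn : k = n
    · subst hkn; simp
    · have := hm k hk
      simp [hkn, Function.update_of_ne (show σ k ≠ m by omega)]

theorem sat_qall (φ : Fml) : ∃ ψ : Fml, ∀ (D : Set ZFSet) (v : ℕ → ZFSet),
    Sat D ψ v ↔ ∀ x ∈ D, Sat D φ (fun n => Nat.casesOn n x v) := by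
  obtain ⟨a, ha⟩ := sat_ren φ (fun n => Nat.casesOn n φ.bd (fun k => k))
  refine ⟨.all φ.bd a, fun D v => ?_⟩
  show (∀ x ∈ D, Sat D a _) ↔ _
  refine forall_congr' fun x => imp_congr_right fun _ => (ha _ _).trans
    (sat_bd _ _ _ _ fun k hk => ?_)
  cases k with
  | zero => simp
  | succ k => simp [Function.update_of_ne (show k ≠ φ.bd by omega)]

theorem sat_closure (φ : Fml) : ∃ ψ : Fml, ∀ (D : Set ZFSet) (w : ℕ → ZFSet), (∀ n, w n ∈ D) →
    (Sat D ψ w ↔ ∀ v, (∀ n, v n ∈ D) → Sat D φ v) := by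
  have key : ∀ B : ℕ, ∃ ψ : Fml, ∀ (D : Set ZFSet) (w : ℕ → ZFSet), (∀ n, w n ∈ D) →
    (Sat D ψ w ↔ ∀ v, (∀ n, v n ∈ D) → (∀ n, B ≤ n → v n = w n) → Sat D φ v) := by
    intro B
    induction B with
    | zero =>
      refine ⟨φ, fun D w hw => ⟨fun h v hv hvw => ?_, fun h => h w hw (by simp)⟩⟩
      have : v = w := funext fun n => hvw n (by omega)
      rwa [this]
    | succ B ih =>
      obtain ⟨ψ, hψ⟩ := ih
      refine ⟨.all B ψ, fun D w hw => ?_⟩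
      simp only [Sat]
      have hu : ∀ x ∈ D, ∀ n, Function.update w B x n ∈ D := by
        intro x hx n
        by_cases hn : n = B
        · subst hn; simpa
        · simpa [hn] using hw n
      constructor
      · intro h v hv hvw
        refine (hψ D _ (hu _ (hv B))).1 (h _ (hv B)) v hv fun n hn => ?_
        by_cases hnB : n = B
        · subst hnB; simp
        · simp [hnB]; exact hvw n (by omega)
      · intro h x hx
        refine (hψ D _ (hu x hx)).2 fun v hv hvw => h v hv fun n hn => ?_
        rw [hvw n (by omega)]; simp [show n ≠ B by omega]
  obtain ⟨ψ, hψ⟩ := key φ.bd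
  refine ⟨ψ, fun D w hw => (hψ D w hw).trans ⟨fun h v hv => ?_, fun h v hv _ => h v hv⟩⟩
  let v' : ℕ → ZFSet := fun n => if n < φ.bd then v n else w n
  have := h v' (fun n => by by_cases hn : n < φ.bd <;> simp [v', hn, hv, hw])
    (fun n hn => by simp [v', show ¬ n < φ.bd by omega])
  exact (sat_bd D φ v' v fun n hn => by simp [v', hn]).1 this

/-- Transitive premodels: pairing, union, separation, collection. -/
structure PM (D : ZFSet) : Prop where
  tr : D.IsTransitive
  ne : (∅ : ZFSet) ∈ D
  pr : ∀ x ∈ D, ∀ y ∈ D, ({x, y} : ZFSet) ∈ D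
  un : ∀ x ∈ D, (⋃₀ x : ZFSet) ∈ D
  sp : ∀ (φ : Fml) (v : ℕ → ZFSet), (∀ n, v n ∈ D) → ∀ a ∈ D,
    ∃ b ∈ D, ∀ x, x ∈ b ↔ x ∈ a ∧ Sat D.toSet φ (Function.update v 0 x)
  co : ∀ (φ : Fml) (v : ℕ → ZFSet), (∀ n, v n ∈ D) → ∀ a ∈ D,
    (∀ x ∈ a, ∃ y ∈ D, Sat D.toSet φ (Function.update (Function.update v 0 x) 1 y)) →
    ∃ b ∈ D, ∀ x ∈ a, ∃ y ∈ b, Sat D.toSet φ (Function.update (Function.update v 0 x) 1 y)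

theorem PM.mem {D x y : ZFSet} (h : PM D) (hx : x ∈ D) (hy : y ∈ x) : y ∈ D :=
  h.tr.mem_trans hy hx

/-- Uniform definability over premodels. -/
class Def (P : ZFSet → (ℕ → ZFSet) → Prop) : Prop where
  ex : ∃ φ : Fml, ∀ D, PM D → ∀ v : ℕ → ZFSet, (∀ n, v n ∈ D) → (Sat D.toSet φ v ↔ P D v)

theorem Def.congr {P Q : ZFSet → (ℕ → ZFSet) → Prop} (hQ : Def Q)
    (h : ∀ D, PM D → ∀ v : ℕ → ZFSet, (∀ n, v n ∈ D) → (P D v ↔ Q D v)) : Def P := by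
  obtain ⟨φ, hφ⟩ := hQ.ex
  exact ⟨φ, fun D hD v hv => (hφ D hD v hv).trans (h D hD v hv).symm⟩

/-- Definable terms. -/
class TDef (t : ZFSet → (ℕ → ZFSet) → ZFSet) : Prop where
  cl : ∀ D, PM D → ∀ v : ℕ → ZFSet, (∀ n, v n ∈ D) → t D v ∈ D
  df : Def (fun D v => v 0 = t D (fun n => v (n + 1)))

instance Def.imp {P Q : ZFSet → (ℕ → ZFSet) → Prop} [hP : Def P] [hQ : Def Q] :
    Def (fun D v => P D v → Q D v) := by
  obtain ⟨φ, hφ⟩ := hP.ex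
  obtain ⟨ψ, hψ⟩ := hQ.ex
  exact ⟨.impl φ ψ, fun D hD v hv => by simp only [Sat, hφ D hD v hv, hψ D hD v hv]⟩

instance Def.not {P : ZFSet → (ℕ → ZFSet) → Prop} [hP : Def P] :
    Def (fun D v => ¬ P D v) := by
  obtain ⟨φ, hφ⟩ := hP.ex
  exact ⟨.neg φ, fun D hD v hv => by simp only [Sat, hφ D hD v hv]⟩

instance Def.and {P Q : ZFSet → (ℕ → ZFSet) → Prop} [hP : Def P] [hQ : Def Q] :
    Def (fun D v => P D v ∧ Q D v) :=
  Def.congr (Q := fun D v => ¬ (P D v → ¬ Q D v)) inferInstance fun D _ v _ => by tauto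

instance Def.or {P Q : ZFSet → (ℕ → ZFSet) → Prop} [hP : Def P] [hQ : Def Q] :
    Def (fun D v => P D v ∨ Q D v) :=
  Def.congr (Q := fun D v => (¬ P D v → Q D v)) inferInstance fun D _ v _ => by tauto

instance Def.iff {P Q : ZFSet → (ℕ → ZFSet) → Prop} [hP : Def P] [hQ : Def Q] :
    Def (fun D v => P D v ↔ Q D v) :=
  Def.congr (Q := fun D v => (P D v → Q D v) ∧ (Q D v → P D v)) inferInstance
    fun D _ v _ => by tauto

theorem Def.ren {P : ZFSet → (ℕ → ZFSet) → Prop} (hP : Def P) (σ : ℕ → ℕ) :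
    Def (fun D v => P D (fun n => v (σ n))) := by
  obtain ⟨φ, hφ⟩ := hP.ex
  obtain ⟨ψ, hψ⟩ := sat_ren φ σ
  exact ⟨ψ, fun D hD v hv => (hψ _ v).trans (hφ D hD _ fun n => hv _)⟩

instance (priority := low) Def.allD {Q : ZFSet → ZFSet → (ℕ → ZFSet) → Prop}
    [h : Def (fun D v => Q D (v 0) (fun n => v (n + 1)))] :
    Def (fun D v => ∀ x, x ∈ D → Q D x v) := by
  obtain ⟨φ, hφ⟩ := h.ex
  obtain ⟨ψ, hψ⟩ := sat_qall φ
  refine ⟨ψ, fun D hD v hv => (hψ _ v).trans (forall_congr' fun x => imp_congr_right fun hx => ?_)⟩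
  refine hφ D hD _ fun n => ?_
  cases n with
  | zero => exact hx
  | succ n => exact hv n

instance (priority := low) Def.exD {Q : ZFSet → ZFSet → (ℕ → ZFSet) → Prop}
    [h : Def (fun D v => Q D (v 0) (fun n => v (n + 1)))] :
    Def (fun D v => ∃ x, x ∈ D ∧ Q D x v) :=
  Def.congr (Q := fun D v => ¬ ∀ x, x ∈ D → ¬ Q D x v) inferInstance fun D _ v _ => by
    push Not; rfl

instance TDef.var (i : ℕ) : TDef (fun _ v => v i) :=
  ⟨fun _ _ _ hv => hv i, ⟨.eq 0 (i + 1), fun _ _ _ _ => Iff.rfl⟩⟩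

theorem def_mem0 (i j : ℕ) : Def (fun _ v => v i ∈ v j) := ⟨.mem i j, fun _ _ _ _ => Iff.rfl⟩

instance TDef.shift {t : ZFSet → (ℕ → ZFSet) → ZFSet} [h : TDef t] :
    TDef (fun D v => t D (fun n => v (n + 1))) :=
  ⟨fun D hD v hv => h.cl D hD _ fun n => hv _,
   Def.ren (P := fun D v => v 0 = t D (fun n => v (n + 1))) h.df
    (fun n => Nat.casesOn n 0 (fun k => k + 2))⟩

instance TDef.shift2 {t : ZFSet → (ℕ → ZFSet) → ZFSet} [h : TDef t] :
    TDef (fun D v => t D (fun n => v (n + 1 + 1))) :=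
  TDef.shift (t := fun D v => t D (fun n => v (n + 1)))

instance TDef.shift3 {t : ZFSet → (ℕ → ZFSet) → ZFSet} [h : TDef t] :
    TDef (fun D v => t D (fun n => v (n + 1 + 1 + 1))) :=
  TDef.shift (t := fun D v => t D (fun n => v (n + 1 + 1)))

instance TDef.shift4 {t : ZFSet → (ℕ → ZFSet) → ZFSet} [h : TDef t] :
    TDef (fun D v => t D (fun n => v (n + 1 + 1 + 1 + 1))) :=
  TDef.shift (t := fun D v => t D (fun n => v (n + 1 + 1 + 1)))

instance TDef.shift5 {t : ZFSet → (ℕ → ZFSet) → ZFSet} [h : TDef t] :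
    TDef (fun D v => t D (fun n => v (n + 1 + 1 + 1 + 1 + 1))) :=
  TDef.shift (t := fun D v => t D (fun n => v (n + 1 + 1 + 1 + 1)))

/-- substituting a term for the first variable -/
theorem Def.subst0 {Q : ZFSet → ZFSet → (ℕ → ZFSet) → Prop} {t : ZFSet → (ℕ → ZFSet) → ZFSet}
    [ht : TDef t] (h : Def (fun D v => Q D (v 0) (fun n => v (n + 1)))) :
    Def (fun D v => Q D (t D v) v) :=
  have := ht.df
  Def.congr (Q := fun D v => ∃ x, x ∈ D ∧ (x = t D v ∧ Q D x v)) inferInstance fun D hD v hv =>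
    ⟨fun h => ⟨_, ht.cl D hD v hv, rfl, h⟩, by rintro ⟨x, _, rfl, h⟩; exact h⟩

theorem Def.subst1 {Q : ZFSet → ZFSet → Prop} {s : ZFSet → (ℕ → ZFSet) → ZFSet}
    [hs : TDef s]
    (h : Def (fun D v => Q D (v 0))) : Def (fun D v => Q D (s D v)) :=
  Def.subst0 (Q := fun D x _ => Q D x) h

theorem Def.subst2 {Q : ZFSet → ZFSet → ZFSet → Prop} {s t : ZFSet → (ℕ → ZFSet) → ZFSet}
    [hs : TDef s] [ht : TDef t]
    (h : Def (fun D v => Q D (v 0) (v 1))) : Def (fun D v => Q D (s D v) (t D v)) :=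
  Def.subst0 (Q := fun D x v => Q D x (t D v))
    (Def.subst0 (Q := fun D y v => Q D (v 0) y) (t := fun D v => t D (fun n => v (n + 1)))
      (Def.ren (P := fun D v => Q D (v 0) (v 1)) h (fun n => Nat.casesOn n 1 (fun _ => 0))))

theorem Def.subst3 {Q : ZFSet → ZFSet → ZFSet → ZFSet → Prop}
    {s t r : ZFSet → (ℕ → ZFSet) → ZFSet} [hs : TDef s] [ht : TDef t] [hr : TDef r]
    (h : Def (fun D v => Q D (v 0) (v 1) (v 2))) :
    Def (fun D v => Q D (s D v) (t D v) (r D v)) :=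
  Def.subst0 (Q := fun D x v => Q D x (t D v) (r D v))
    (Def.subst0 (Q := fun D y v => Q D (v 0) y (r D (fun n => v (n + 1))))
      (t := fun D v => t D (fun n => v (n + 1)))
      (Def.subst0 (Q := fun D y v => Q D (v 1) (v 0) y)
        (t := fun D v => r D (fun n => v (n + 1 + 1)))
        (ht := TDef.shift (t := fun D v => r D (fun n => v (n + 1))))
        (Def.ren (P := fun D v => Q D (v 0) (v 1) (v 2)) h
          (fun n => Nat.casesOn n 2 (fun n => Nat.casesOn n 1 (fun _ => 0))))))

instance Def.mem {s t : ZFSet → (ℕ → ZFSet) → ZFSet} [hs : TDef s] [ht : TDef t] :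
    Def (fun D v => s D v ∈ t D v) :=
  Def.subst2 (Q := fun _ x y => x ∈ y) (def_mem0 0 1)

instance Def.eq {s t : ZFSet → (ℕ → ZFSet) → ZFSet} [hs : TDef s] [ht : TDef t] :
    Def (fun D v => s D v = t D v) :=
  Def.subst2 (Q := fun _ x y => x = y) ⟨.eq 0 1, fun _ _ _ _ => Iff.rfl⟩

instance Def.ball {Q : ZFSet → ZFSet → (ℕ → ZFSet) → Prop} {t : ZFSet → (ℕ → ZFSet) → ZFSet}
    [ht : TDef t] [h : Def (fun D v => Q D (v 0) (fun n => v (n + 1)))] :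
    Def (fun D v => ∀ x, x ∈ t D v → Q D x v) :=
  Def.congr (Q := fun D v => ∀ x, x ∈ D → (x ∈ t D v → Q D x v)) inferInstance
    fun D hD v hv => ⟨fun h x _ hx => h x hx, fun h x hx => h x (hD.mem (ht.cl D hD v hv) hx) hx⟩

instance Def.bex {Q : ZFSet → ZFSet → (ℕ → ZFSet) → Prop} {t : ZFSet → (ℕ → ZFSet) → ZFSet}
    [ht : TDef t] [h : Def (fun D v => Q D (v 0) (fun n => v (n + 1)))] :
    Def (fun D v => ∃ x, x ∈ t D v ∧ Q D x v) :=
  Def.congr (Q := fun D v => ∃ x, x ∈ D ∧ (x ∈ t D v ∧ Q D x v)) inferInstance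
    fun D hD v hv => ⟨fun ⟨x, hx, h⟩ => ⟨x, hD.mem (ht.cl D hD v hv) hx, hx, h⟩,
      fun ⟨x, _, hx, h⟩ => ⟨x, hx, h⟩⟩

instance Def.subset {s t : ZFSet → (ℕ → ZFSet) → ZFSet} [hs : TDef s] [ht : TDef t] :
    Def (fun D v => s D v ⊆ t D v) :=
  Def.congr (Q := fun D v => ∀ x, x ∈ s D v → x ∈ t D v) inferInstance fun _ _ _ _ => Iff.rfl

/-- terms given by a definable membership relation -/
theorem TDef.ofMem {t : ZFSet → (ℕ → ZFSet) → ZFSet}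
    (cl : ∀ D, PM D → ∀ v : ℕ → ZFSet, (∀ n, v n ∈ D) → t D v ∈ D)
    {Q : ZFSet → ZFSet → (ℕ → ZFSet) → Prop}
    [hQ : Def (fun D v => Q D (v 0) (fun n => v (n + 1)))]
    (h : ∀ D, PM D → ∀ v : ℕ → ZFSet, (∀ n, v n ∈ D) → ∀ x ∈ D, (x ∈ t D v ↔ Q D x v)) :
    TDef t := by
  refine ⟨cl, ?_⟩
  have : Def (fun D v => Q D (v 0) (fun n => v (n + 1 + 1))) :=
    Def.ren hQ (fun n => Nat.casesOn n 0 (fun k => k + 2))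
  refine Def.congr (Q := fun D v => ∀ x, x ∈ D → (x ∈ v 0 ↔ Q D x (fun n => v (n + 1))))
    inferInstance fun D hD v hv => ?_
  have hc := cl D hD (fun n => v (n + 1)) fun n => hv _
  constructor
  · intro e x hx; rw [e]; exact h D hD _ (fun n => hv _) x hx
  · intro e
    ext x
    constructor
    · intro hx
      have := hD.mem (hv 0) hx
      exact (h D hD _ (fun n => hv _) x this).2 ((e x this).1 hx)
    · intro hx
      have := hD.mem hc hx
      exact (e x this).2 ((h D hD _ (fun n => hv _) x this).1 hx)

theorem PM.sep {D : ZFSet} (hD : PM D) (Q : ZFSet → ZFSet → (ℕ → ZFSet) → Prop)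
    [hQ : Def (fun D v => Q D (v 0) (fun n => v (n + 1)))] (v : ℕ → ZFSet) (hv : ∀ n, v n ∈ D)
    {a : ZFSet} (ha : a ∈ D) : ZFSet.sep (fun x => Q D x v) a ∈ D := by
  obtain ⟨φ, hφ⟩ := hQ.ex
  have hw : ∀ x ∈ D, ∀ n : ℕ, (Nat.casesOn n x v : ZFSet) ∈ D := by
    intro x hx n; cases n with
    | zero => exact hx
    | succ n => exact hv n
  obtain ⟨b, hb, h⟩ := hD.sp φ (fun n => Nat.casesOn n ∅ v) (hw _ hD.ne) a ha
  have : b = ZFSet.sep (fun x => Q D x v) a := by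
    ext x
    rw [h, ZFSet.mem_sep]
    refine and_congr_right fun hx => ?_
    have : Function.update (fun n => Nat.casesOn n ∅ v : ℕ → ZFSet) 0 x =
        (fun n => Nat.casesOn n x v) := by
      funext n; cases n <;> simp
    rw [this]
    exact hφ D hD _ (hw x (hD.mem ha hx))
  exact this ▸ hb

theorem PM.coll {D : ZFSet} (hD : PM D) (Q : ZFSet → ZFSet → ZFSet → (ℕ → ZFSet) → Prop)
    [hQ : Def (fun D v => Q D (v 0) (v 1) (fun n => v (n + 2)))] (v : ℕ → ZFSet)
    (hv : ∀ n, v n ∈ D)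
    {a : ZFSet} (ha : a ∈ D) (h : ∀ x ∈ a, ∃ y ∈ D, Q D x y v) :
    ∃ b ∈ D, ∀ x ∈ a, ∃ y ∈ b, Q D x y v := by
  obtain ⟨φ, hφ⟩ := hQ.ex
  have hw : ∀ x ∈ D, ∀ y ∈ D, ∀ n : ℕ,
      (Nat.casesOn n x (fun n => Nat.casesOn n y v) : ZFSet) ∈ D := by
    intro x hx y hy n; rcases n with _ | _ | n
    · exact hx
    · exact hy
    · exact hv n
  have e : ∀ x y, Function.update (Function.update
      (fun n => Nat.casesOn n ∅ (fun n => Nat.casesOn n ∅ v) : ℕ → ZFSet) 0 x) 1 y =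
        (fun n => Nat.casesOn n x (fun n => Nat.casesOn n y v)) := by
    intro x y; funext n; rcases n with _ | _ | n <;> simp
  obtain ⟨b, hb, h'⟩ := hD.co φ (fun n => Nat.casesOn n ∅ (fun n => Nat.casesOn n ∅ v))
    (hw _ hD.ne _ hD.ne) a ha (fun x hx => by
      obtain ⟨y, hy, hQ⟩ := h x hx
      refine ⟨y, hy, ?_⟩
      rw [e]
      exact (hφ D hD _ (hw x (hD.mem ha hx) y hy)).2 hQ)
  refine ⟨b, hb, fun x hx => ?_⟩
  obtain ⟨y, hy, hQ⟩ := h' x hx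
  rw [e] at hQ
  exact ⟨y, hy, (hφ D hD _ (hw x (hD.mem ha hx) y (hD.mem hb hy))).1 hQ⟩

/-- environments from lists -/
def env : List ZFSet → ℕ → ZFSet
  | [], _ => ∅
  | a :: _, 0 => a
  | _ :: l, n + 1 => env l n

theorem env_in {D : ZFSet} (hD : PM D) {l : List ZFSet} (h : ∀ a ∈ l, a ∈ D) (n : ℕ) :
    env l n ∈ D := by
  induction l generalizing n with
  | nil => exact hD.ne
  | cons a l ih =>
    cases n with
    | zero => exact h a (by simp)
    | succ n => exact ih (fun a ha => h a (by simp [ha])) n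

/-! ## Part A: toolkit for premodels -/

instance TDef.upair {s t : ZFSet → (ℕ → ZFSet) → ZFSet} [hs : TDef s] [ht : TDef t] :
    TDef (fun D v => ({s D v, t D v} : ZFSet)) :=
  TDef.ofMem (Q := fun D x v => x = s D v ∨ x = t D v)
    (fun D hD v hv => hD.pr _ (hs.cl D hD v hv) _ (ht.cl D hD v hv))
    (fun D hD v hv x _ => by simp)

instance TDef.single {s : ZFSet → (ℕ → ZFSet) → ZFSet} [hs : TDef s] :
    TDef (fun D v => ({s D v} : ZFSet)) :=
  TDef.ofMem (Q := fun D x v => x = s D v)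
    (fun D hD v hv => by
      have := hD.pr _ (hs.cl D hD v hv) _ (hs.cl D hD v hv)
      rwa [ZFSet.pair_eq_singleton] at this)
    (fun D hD v hv x _ => by simp)

instance TDef.sUnion {s : ZFSet → (ℕ → ZFSet) → ZFSet} [hs : TDef s] :
    TDef (fun D v => (⋃₀ (s D v) : ZFSet)) :=
  TDef.ofMem (Q := fun D x v => ∃ y, y ∈ s D v ∧ x ∈ y)
    (fun D hD v hv => hD.un _ (hs.cl D hD v hv))
    (fun D hD v hv x _ => by simp)

instance TDef.pair {s t : ZFSet → (ℕ → ZFSet) → ZFSet} [hs : TDef s] [ht : TDef t] :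
    TDef (fun D v => ZFSet.pair (s D v) (t D v)) := by
  unfold ZFSet.pair; infer_instance

instance TDef.union {s t : ZFSet → (ℕ → ZFSet) → ZFSet} [hs : TDef s] [ht : TDef t] :
    TDef (fun D v => s D v ∪ t D v) := by
  have : (fun D v => s D v ∪ t D v) = (fun D v => ⋃₀ ({s D v, t D v} : ZFSet)) := by
    funext D v; ext; simp
  rw [this]; infer_instance

instance TDef.insert {s t : ZFSet → (ℕ → ZFSet) → ZFSet} [hs : TDef s] [ht : TDef t] :
    TDef (fun D v => (Insert.insert (s D v) (t D v) : ZFSet)) := by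
  have : (fun D v => (Insert.insert (s D v) (t D v) : ZFSet)) =
      (fun D v => {s D v} ∪ t D v) := by funext D v; ext; simp
  rw [this]; infer_instance

instance TDef.sep {t : ZFSet → (ℕ → ZFSet) → ZFSet} {Q : ZFSet → ZFSet → (ℕ → ZFSet) → Prop}
    [ht : TDef t] [hQ : Def (fun D v => Q D (v 0) (fun n => v (n + 1)))] :
    TDef (fun D v => ZFSet.sep (fun x => Q D x v) (t D v)) :=
  TDef.ofMem (Q := fun D x v => x ∈ t D v ∧ Q D x v)
    (fun D hD v hv => hD.sep Q v hv (ht.cl D hD v hv))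
    (fun D hD v hv x _ => by simp)

instance TDef.inter {s t : ZFSet → (ℕ → ZFSet) → ZFSet} [hs : TDef s] [ht : TDef t] :
    TDef (fun D v => s D v ∩ t D v) := by
  have : (fun D v => s D v ∩ t D v) = (fun D v => ZFSet.sep (fun z => z ∈ t D v) (s D v)) := by
    funext D v; ext; simp
  rw [this]; infer_instance

instance TDef.empty : TDef (fun _ _ => (∅ : ZFSet)) :=
  TDef.ofMem (Q := fun D x v => ¬ x = x) (fun D hD _ _ => hD.ne) (fun D hD v hv x _ => by simp)

instance TDef.fapp {s t : ZFSet → (ℕ → ZFSet) → ZFSet} [hs : TDef s] [ht : TDef t] :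
    TDef (fun D v => fapp (s D v) (t D v)) := by
  unfold MPaper.fapp; infer_instance

instance TDef.compl {s t : ZFSet → (ℕ → ZFSet) → ZFSet} [hs : TDef s] [ht : TDef t] :
    TDef (fun D v => compl (s D v) (t D v)) := by
  unfold MPaper.compl; infer_instance

instance TDef.tailSet {s t : ZFSet → (ℕ → ZFSet) → ZFSet} [hs : TDef s] [ht : TDef t] :
    TDef (fun D v => tailSet (s D v) (t D v)) := by
  unfold MPaper.tailSet; infer_instance

instance Def.isTransitive {s : ZFSet → (ℕ → ZFSet) → ZFSet} [hs : TDef s] :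
    Def (fun D v => (s D v).IsTransitive) := by
  unfold ZFSet.IsTransitive; infer_instance

instance Def.isOrd {s : ZFSet → (ℕ → ZFSet) → ZFSet} [hs : TDef s] :
    Def (fun D v => IsOrd (s D v)) := by
  unfold IsOrd; infer_instance

theorem PM.pair_snd {D p a b : ZFSet} (hD : PM D) (h : ZFSet.pair a b ∈ D) : b ∈ D := by
  have : ({a, b} : ZFSet) ∈ D := hD.mem h (by simp [ZFSet.pair])
  exact hD.mem this (by simp)

theorem PM.pair_fst {D p a b : ZFSet} (hD : PM D) (h : ZFSet.pair a b ∈ D) : a ∈ D := by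
  have : ({a, b} : ZFSet) ∈ D := hD.mem h (by simp [ZFSet.pair])
  exact hD.mem this (by simp)

theorem PM.pair_mem {D a b : ZFSet} (hD : PM D) (ha : a ∈ D) (hb : b ∈ D) :
    ZFSet.pair a b ∈ D :=
  TDef.cl (t := fun D v => ZFSet.pair (v 0) (v 1)) D hD (env [a, b])
    (env_in hD (by simp [ha, hb]))

instance Def.isZFunc {s t : ZFSet → (ℕ → ZFSet) → ZFSet} [hs : TDef s] [ht : TDef t] :
    Def (fun D v => IsZFunc (s D v) (t D v)) :=
  Def.congr (Q := fun D v => (∀ p, p ∈ t D v → ∃ a, a ∈ s D v ∧ ∃ b, b ∈ D ∧ p = ZFSet.pair a b) ∧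
    ∀ a, a ∈ s D v → ∃ b, b ∈ D ∧ (ZFSet.pair a b ∈ t D v ∧
      ∀ c, c ∈ D → ZFSet.pair a c ∈ t D v → c = b)) inferInstance fun D hD v hv => by
    have h1 := ht.cl D hD v hv
    unfold IsZFunc
    refine and_congr (forall_congr' fun p => forall_congr' fun hp => exists_congr fun a =>
      and_congr_right fun ha => exists_congr fun b => ?_)
      (forall_congr' fun a => forall_congr' fun ha => ?_)
    · constructor
      · rintro rfl; exact ⟨hD.pair_snd (hD.mem h1 hp) (p := a), rfl⟩
      · exact fun h => h.2
    · constructor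
      · rintro ⟨b, hb, hb'⟩
        exact ⟨b, hD.pair_snd (hD.mem h1 hb) (p := a), hb, fun c _ hc => hb' c hc⟩
      · rintro ⟨b, _, hb, hb'⟩
        exact ⟨b, hb, fun c hc => hb' c (hD.pair_snd (hD.mem h1 hc) (p := a)) hc⟩

instance Def.mapsInto {s t r : ZFSet → (ℕ → ZFSet) → ZFSet} [hs : TDef s] [ht : TDef t]
    [hr : TDef r] : Def (fun D v => MapsInto (s D v) (t D v) (r D v)) := by
  unfold MapsInto; infer_instance

instance Def.surjOnto {s t r : ZFSet → (ℕ → ZFSet) → ZFSet} [hs : TDef s] [ht : TDef t]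
    [hr : TDef r] : Def (fun D v => SurjOnto (s D v) (t D v) (r D v)) := by
  unfold SurjOnto; infer_instance

instance Def.injOnZ {s t : ZFSet → (ℕ → ZFSet) → ZFSet} [hs : TDef s] [ht : TDef t] :
    Def (fun D v => InjOnZ (s D v) (t D v)) := by
  unfold InjOnZ; infer_instance

instance Def.isBij {s t r : ZFSet → (ℕ → ZFSet) → ZFSet} [hs : TDef s] [ht : TDef t]
    [hr : TDef r] : Def (fun D v => IsBij (s D v) (t D v) (r D v)) := by
  unfold IsBij; infer_instance

/-- satisfaction of a fixed formula in the domain, with term arguments -/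
theorem def_sat_dom (φ : Fml) : ∀ t : ℕ → ZFSet → (ℕ → ZFSet) → ZFSet, (∀ k, TDef (t k)) →
    Def (fun D v => Sat D.toSet φ (fun k => t k D v)) := by
  induction φ with
  | mem i j => intro t ht; have := ht i; have := ht j; simp only [Sat]; infer_instance
  | eq i j => intro t ht; have := ht i; have := ht j; simp only [Sat]; infer_instance
  | impl φ ψ ih1 ih2 =>
    intro t ht; have := ih1 t ht; have := ih2 t ht
    simp only [Sat]; infer_instance
  | neg φ ih =>
    intro t ht; have := ih t ht
    simp only [Sat]; infer_instance
  | all n φ ih =>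
    intro t ht
    have := ih (fun k => if k = n then (fun D v => v 0) else (fun D v => t k D (fun n => v (n + 1))))
      (fun k => by
        have := ht k
        by_cases hk : k = n
        · simp only [hk, if_true]; infer_instance
        · simp only [hk, if_false]; infer_instance)
    have h2 : Def (fun D v => Sat D.toSet φ (Function.update
        (fun k => t k D (fun n => v (n + 1))) n (v 0))) := by
      convert this using 5 with D v
      rename_i k
      by_cases hk : k = n
      · subst hk; simp
      · simp [hk]
    simp only [Sat]
    exact Def.allD (Q := fun D x v => Sat D.toSet φ (Function.update (fun k => t k D v) n x))

theorem def_sat_in (φ : Fml) : ∀ (m : ZFSet → (ℕ → ZFSet) → ZFSet)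
    (t : ℕ → ZFSet → (ℕ → ZFSet) → ZFSet), TDef m → (∀ k, TDef (t k)) →
    Def (fun D v => Sat (m D v).toSet φ (fun k => t k D v)) := by
  induction φ with
  | mem i j => intro m t hm ht; have := ht i; have := ht j; simp only [Sat]; infer_instance
  | eq i j => intro m t hm ht; have := ht i; have := ht j; simp only [Sat]; infer_instance
  | impl φ ψ ih1 ih2 =>
    intro m t hm ht; have := ih1 m t hm ht; have := ih2 m t hm ht
    simp only [Sat]; infer_instance
  | neg φ ih =>
    intro m t hm ht; have := ih m t hm ht
    simp only [Sat]; infer_instance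
  | all n φ ih =>
    intro m t hm ht
    have := ih (fun D v => m D (fun n => v (n + 1)))
      (fun k => if k = n then (fun D v => v 0) else (fun D v => t k D (fun n => v (n + 1))))
      inferInstance
      (fun k => by
        have := ht k
        by_cases hk : k = n
        · simp only [hk, if_true]; infer_instance
        · simp only [hk, if_false]; infer_instance)
    have h2 : Def (fun D v => Sat (m D (fun n => v (n + 1))).toSet φ (Function.update
        (fun k => t k D (fun n => v (n + 1))) n (v 0))) := by
      convert this using 5 with D v
      rename_i k
      by_cases hk : k = n
      · subst hk; simp
      · simp [hk]
    simp only [Sat]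
    exact Def.ball (Q := fun D x v => Sat (m D v).toSet φ (Function.update (fun k => t k D v) n x))

/-! ### functions as graphs -/

theorem fapp_eq {d f a b : ZFSet} (hf : IsZFunc d f) (h : ZFSet.pair a b ∈ f) : fapp f a = b := by
  obtain ⟨a', ha', b', e⟩ := hf.1 _ h
  obtain ⟨rfl, rfl⟩ := ZFSet.pair_inj.1 e
  obtain ⟨c, hc, huniq⟩ := hf.2 a ha'
  have hu : ∀ z, ZFSet.pair a z ∈ f → z = b := fun z hz => (huniq z hz).trans (huniq b h).symm
  unfold fapp
  have : ZFSet.sep (fun b => ZFSet.pair a b ∈ f) (⋃₀ (⋃₀ f)) = {b} := by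
    ext z
    simp only [ZFSet.mem_sep, ZFSet.mem_singleton]
    constructor
    · exact fun hz => hu z hz.2
    · rintro rfl
      refine ⟨?_, h⟩
      rw [ZFSet.mem_sUnion]
      exact ⟨{a, z}, by rw [ZFSet.mem_sUnion]; exact ⟨_, h, by simp [ZFSet.pair]⟩, by simp⟩
  rw [this]; ext; simp

theorem pair_fapp {d f a : ZFSet} (hf : IsZFunc d f) (ha : a ∈ d) :
    ZFSet.pair a (fapp f a) ∈ f := by
  obtain ⟨b, hb, -⟩ := hf.2 a ha
  rwa [fapp_eq hf hb]

theorem pair_mem_iff {d f a b : ZFSet} (hf : IsZFunc d f) (ha : a ∈ d) :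
    ZFSet.pair a b ∈ f ↔ fapp f a = b :=
  ⟨fapp_eq hf, fun h => h ▸ pair_fapp hf ha⟩

theorem dom_of_pair {d f a b : ZFSet} (hf : IsZFunc d f) (h : ZFSet.pair a b ∈ f) : a ∈ d := by
  obtain ⟨a', ha', b', e⟩ := hf.1 _ h
  obtain ⟨rfl, rfl⟩ := ZFSet.pair_inj.1 e
  exact ha'

theorem func_ext {d f g : ZFSet} (hf : IsZFunc d f) (hg : IsZFunc d g)
    (h : ∀ a ∈ d, fapp f a = fapp g a) : f = g := by
  have key : ∀ {f g : ZFSet}, IsZFunc d f → IsZFunc d g → (∀ a ∈ d, fapp f a = fapp g a) →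
      f ⊆ g := by
    intro f g hf hg h p hp
    obtain ⟨a, ha, b, rfl⟩ := hf.1 p hp
    rw [pair_mem_iff hg ha, ← h a ha]; exact fapp_eq hf hp
  exact HasSubset.Subset.antisymm (key hf hg h) (key hg hf fun a ha => (h a ha).symm)

/-- image of a set under an arbitrary external function -/
def img (F : ZFSet → ZFSet) (a : ZFSet) : ZFSet :=
  @ZFSet.image F (Classical.allZFSetDefinable _) a

theorem mem_img {F : ZFSet → ZFSet} {a y : ZFSet} : y ∈ img F a ↔ ∃ x ∈ a, F x = y := by
  unfold img
  rw [@ZFSet.mem_image F (Classical.allZFSetDefinable _)]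

/-- graph of an external function on a set -/
def grf (F : ZFSet → ZFSet) (a : ZFSet) : ZFSet := img (fun x => ZFSet.pair x (F x)) a

theorem mem_grf {F : ZFSet → ZFSet} {a p : ZFSet} :
    p ∈ grf F a ↔ ∃ x ∈ a, ZFSet.pair x (F x) = p := mem_img

theorem pair_mem_grf {F : ZFSet → ZFSet} {a x y : ZFSet} :
    ZFSet.pair x y ∈ grf F a ↔ x ∈ a ∧ y = F x := by
  rw [mem_grf]
  constructor
  · rintro ⟨z, hz, e⟩
    obtain ⟨rfl, rfl⟩ := ZFSet.pair_inj.1 e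
    exact ⟨hz, rfl⟩
  · rintro ⟨hx, rfl⟩; exact ⟨x, hx, rfl⟩

theorem grf_func (F : ZFSet → ZFSet) (a : ZFSet) : IsZFunc a (grf F a) := by
  constructor
  · intro p hp
    obtain ⟨x, hx, rfl⟩ := mem_grf.1 hp
    exact ⟨x, hx, _, rfl⟩
  · intro x hx
    exact ⟨F x, pair_mem_grf.2 ⟨hx, rfl⟩, fun y hy => (pair_mem_grf.1 hy).2⟩

theorem grf_app {F : ZFSet → ZFSet} {a x : ZFSet} (hx : x ∈ a) : fapp (grf F a) x = F x :=
  fapp_eq (grf_func F a) (pair_mem_grf.2 ⟨hx, rfl⟩)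

theorem PM.fapp_mem {D f a : ZFSet} (hD : PM D) (hf : f ∈ D) (ha : a ∈ D) : fapp f a ∈ D :=
  TDef.cl (t := fun D v => fapp (v 0) (v 1)) D hD (env [f, a]) (env_in hD (by simp [hf, ha]))

theorem PM.inter_mem {D f a : ZFSet} (hD : PM D) (hf : f ∈ D) (ha : a ∈ D) : f ∩ a ∈ D :=
  TDef.cl (t := fun D v => (v 0) ∩ (v 1)) D hD (env [f, a]) (env_in hD (by simp [hf, ha]))

theorem PM.union_mem {D f a : ZFSet} (hD : PM D) (hf : f ∈ D) (ha : a ∈ D) : f ∪ a ∈ D :=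
  TDef.cl (t := fun D v => (v 0) ∪ (v 1)) D hD (env [f, a]) (env_in hD (by simp [hf, ha]))

theorem PM.insert_mem {D f a : ZFSet} (hD : PM D) (hf : f ∈ D) (ha : a ∈ D) :
    (Insert.insert f a : ZFSet) ∈ D :=
  TDef.cl (t := fun D v => (Insert.insert (v 0) (v 1) : ZFSet)) D hD (env [f, a])
    (env_in hD (by simp [hf, ha]))

theorem PM.compl_mem {D f a : ZFSet} (hD : PM D) (hf : f ∈ D) (ha : a ∈ D) : compl f a ∈ D :=
  TDef.cl (t := fun D v => compl (v 0) (v 1)) D hD (env [f, a]) (env_in hD (by simp [hf, ha]))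

/-- replacement -/
theorem PM.repl {D : ZFSet} (hD : PM D) (Q : ZFSet → ZFSet → ZFSet → (ℕ → ZFSet) → Prop)
    [hQ : Def (fun D v => Q D (v 0) (v 1) (fun n => v (n + 2)))] (l : List ZFSet)
    (hl : ∀ x ∈ l, x ∈ D) {a : ZFSet} (ha : a ∈ D) {F : ZFSet → ZFSet} (hF : ∀ x ∈ a, F x ∈ D)
    (h : ∀ x ∈ a, ∀ y ∈ D, (Q D x y (env l) ↔ y = F x)) : img F a ∈ D := by
  have hv := env_in hD hl
  obtain ⟨b, hb, hb'⟩ := hD.coll Q (env l) hv ha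
    (fun x hx => ⟨F x, hF x hx, (h x hx _ (hF x hx)).2 rfl⟩)
  have := hD.sep (fun D y v => ∃ x, x ∈ v 0 ∧ Q D x y (fun n => v (n + 1)))
    (hQ := @Def.bex (fun D x v => Q D x (v 0) (fun n => v (n + 2))) (fun D v => v 1) _
      (Def.ren hQ (fun n => Nat.casesOn n 0 (fun n => Nat.casesOn n 1 (fun k => k + 3)))))
    (env (a :: l)) (env_in hD (by simpa [ha] using hl)) hb
  convert this using 1
  ext y
  rw [mem_img, ZFSet.mem_sep]
  constructor
  · rintro ⟨x, hx, rfl⟩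
    obtain ⟨y, hy, hQ⟩ := hb' x hx
    rw [h x hx y (hD.mem hb hy)] at hQ
    subst hQ
    exact ⟨hy, x, hx, (h x hx _ (hF x hx)).2 rfl⟩
  · rintro ⟨hy, x, hx, hQ⟩
    exact ⟨x, hx, ((h x hx y (hD.mem hb hy)).1 hQ).symm⟩

theorem PM.grf {D : ZFSet} (hD : PM D) (Q : ZFSet → ZFSet → ZFSet → (ℕ → ZFSet) → Prop)
    [hQ : Def (fun D v => Q D (v 0) (v 1) (fun n => v (n + 2)))] (l : List ZFSet)
    (hl : ∀ x ∈ l, x ∈ D) {a : ZFSet} (ha : a ∈ D) {F : ZFSet → ZFSet} (hF : ∀ x ∈ a, F x ∈ D)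
    (h : ∀ x ∈ a, ∀ y ∈ D, (Q D x y (env l) ↔ y = F x)) : grf F a ∈ D :=
  hD.repl (fun D x p v => ∃ y, y ∈ D ∧ (p = ZFSet.pair x y ∧ Q D x y v))
    (hQ := @Def.exD (fun D y v => v 1 = ZFSet.pair (v 0) y ∧ Q D (v 0) y (fun n => v (n + 2)))
      (@Def.and _ _ _ (Def.ren hQ (fun n => Nat.casesOn n 1 (fun n => Nat.casesOn n 0
        (fun k => k + 3)))))) l hl ha
    (fun x hx => hD.pair_mem (hD.mem ha hx) (hF x hx))
    (fun x hx p hp => by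
      constructor
      · rintro ⟨y, hy, rfl, hQ⟩; rw [(h x hx y hy).1 hQ]
      · rintro rfl; exact ⟨_, hF x hx, rfl, (h x hx _ (hF x hx)).2 rfl⟩)

/-- graph of a term-function -/
theorem PM.grfT {D : ZFSet} (hD : PM D) (t : ZFSet → (ℕ → ZFSet) → ZFSet) [ht : TDef t]
    (l : List ZFSet) (hl : ∀ x ∈ l, x ∈ D) {a : ZFSet} (ha : a ∈ D) :
    MPaper.grf (fun x => t D (env (x :: l))) a ∈ D :=
  hD.grf (fun D x y v => y = t D (fun n => Nat.casesOn n x v))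
    (hQ := by
      have := Def.ren ht.df (fun n => Nat.casesOn n 1 (fun n => Nat.casesOn n 0
        (fun k => k + 2)))
      have e : (fun (D : ZFSet) (v : ℕ → ZFSet) => v 1 = t D (fun n => Nat.casesOn n (v 0)
          (fun n => v (n + 2)))) = (fun D v => v 1 = t D (fun n =>
          v (Nat.casesOn n 0 (fun k => k + 2)))) := by
        funext D v
        congr 2
        funext n
        cases n <;> rfl
      rw [e]
      exact this) l hl ha
    (fun x hx => ht.cl D hD _ (env_in hD (by simpa [hD.mem ha hx] using hl)))
    (fun x hx y hy => by
      have : (fun n => Nat.casesOn n x (env l) : ℕ → ZFSet) = env (x :: l) := by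
        funext n; cases n <;> rfl
      rw [this])

theorem PM.imgT {D : ZFSet} (hD : PM D) (t : ZFSet → (ℕ → ZFSet) → ZFSet) [ht : TDef t]
    (l : List ZFSet) (hl : ∀ x ∈ l, x ∈ D) {a : ZFSet} (ha : a ∈ D) :
    img (fun x => t D (env (x :: l))) a ∈ D :=
  hD.repl (fun D x y v => y = t D (fun n => Nat.casesOn n x v))
    (hQ := by
      have := Def.ren ht.df (fun n => Nat.casesOn n 1 (fun n => Nat.casesOn n 0
        (fun k => k + 2)))
      have e : (fun (D : ZFSet) (v : ℕ → ZFSet) => v 1 = t D (fun n => Nat.casesOn n (v 0)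
          (fun n => v (n + 2)))) = (fun D v => v 1 = t D (fun n =>
          v (Nat.casesOn n 0 (fun k => k + 2)))) := by
        funext D v
        congr 2
        funext n
        cases n <;> rfl
      rw [e]
      exact this) l hl ha
    (fun x hx => ht.cl D hD _ (env_in hD (by simpa [hD.mem ha hx] using hl)))
    (fun x hx y hy => by
      have : (fun n => Nat.casesOn n x (env l) : ℕ → ZFSet) = env (x :: l) := by
        funext n; cases n <;> rfl
      rw [this])

theorem PM.prod_mem {D a b : ZFSet} (hD : PM D) (ha : a ∈ D) (hb : b ∈ D) : ZFSet.prod a b ∈ D := by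
  have h1 : ∀ x ∈ a, img (fun y => ZFSet.pair x y) b ∈ D := fun x hx =>
    hD.imgT (fun D v => ZFSet.pair (v 1) (v 0)) [x] (by simp [hD.mem ha hx]) hb
  have h2 : img (fun x => img (fun y => ZFSet.pair x y) b) a ∈ D := by
    refine hD.repl (fun D x z v => ∀ p, p ∈ D → (p ∈ z ↔ ∃ y, y ∈ v 0 ∧ p = ZFSet.pair x y)) [b]
      (by simp [hb]) ha h1 fun x hx z hz => ?_
    constructor
    · intro h
      ext p
      constructor
      · intro hp
        obtain ⟨y, hy, rfl⟩ := (h p (hD.mem hz hp)).1 hp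
        exact mem_img.2 ⟨y, hy, rfl⟩
      · intro hp
        obtain ⟨y, hy, rfl⟩ := mem_img.1 hp
        exact (h _ (hD.pair_mem (hD.mem ha hx) (hD.mem hb hy))).2 ⟨y, hy, rfl⟩
    · rintro rfl p hp
      rw [mem_img]
      exact ⟨fun ⟨y, hy, e⟩ => ⟨y, hy, e.symm⟩, fun ⟨y, hy, e⟩ => ⟨y, hy, e.symm⟩⟩
  have h3 := hD.un _ h2
  convert h3 using 1
  ext p
  simp only [ZFSet.mem_prod, ZFSet.mem_sUnion, mem_img]
  constructor
  · rintro ⟨x, hx, y, hy, rfl⟩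
    exact ⟨_, ⟨x, hx, rfl⟩, mem_img.2 ⟨y, hy, rfl⟩⟩
  · rintro ⟨z, ⟨x, hx, rfl⟩, hp⟩
    obtain ⟨y, hy, rfl⟩ := mem_img.1 hp
    exact ⟨x, hx, y, hy, rfl⟩

instance TDef.prod {s t : ZFSet → (ℕ → ZFSet) → ZFSet} [hs : TDef s] [ht : TDef t] :
    TDef (fun D v => ZFSet.prod (s D v) (t D v)) :=
  TDef.ofMem (Q := fun D p v => ∃ x, x ∈ s D v ∧ ∃ y, y ∈ t D v ∧ p = ZFSet.pair x y)
    (fun D hD v hv => hD.prod_mem (hs.cl D hD v hv) (ht.cl D hD v hv))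
    (fun D hD v hv x _ => by simp [ZFSet.mem_prod])

/-! ## Part B: recursion along relations -/

theorem snd_mem_UU {a b f : ZFSet} (h : ZFSet.pair a b ∈ f) : b ∈ (⋃₀ (⋃₀ f) : ZFSet) := by
  rw [ZFSet.mem_sUnion]
  exact ⟨{a, b}, by rw [ZFSet.mem_sUnion]; exact ⟨_, h, by simp [ZFSet.pair]⟩, by simp⟩

theorem fst_mem_UU {a b f : ZFSet} (h : ZFSet.pair a b ∈ f) : a ∈ (⋃₀ (⋃₀ f) : ZFSet) := by
  rw [ZFSet.mem_sUnion]
  exact ⟨{a, b}, by rw [ZFSet.mem_sUnion]; exact ⟨_, h, by simp [ZFSet.pair]⟩, by simp⟩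

/-- partial collapses -/
def Approx (a d R : ZFSet) : Prop :=
  ∀ p, p ∈ a → ∃ f, f ∈ d ∧ ∃ y, y ∈ (⋃₀ (⋃₀ a) : ZFSet) ∧ (p = ZFSet.pair f y ∧
    ((∀ g, g ∈ d → ZFSet.pair g f ∈ R → ∃ z, z ∈ y ∧ ZFSet.pair g z ∈ a) ∧
     (∀ z, z ∈ y → ∃ g, g ∈ d ∧ (ZFSet.pair g f ∈ R ∧ ZFSet.pair g z ∈ a))))

instance Def.approx {s t r : ZFSet → (ℕ → ZFSet) → ZFSet} [hs : TDef s] [ht : TDef t]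
    [hr : TDef r] : Def (fun D v => Approx (s D v) (t D v) (r D v)) := by
  unfold Approx; infer_instance

/-- `G` collapses the relation `R` on `d`. -/
def Collapses (G : ZFSet.{u} → ZFSet.{u}) (d R : ZFSet.{u}) : Prop :=
  ∀ f ∈ d, ∀ y, y ∈ G f ↔ ∃ g ∈ d, ZFSet.pair g f ∈ R ∧ y = G g

theorem Approx.val {a d R : ZFSet} (ha : Approx a d R) {G : ZFSet → ZFSet}
    (hG : Collapses G d R) : ∀ w f y, w = G f → ZFSet.pair f y ∈ a → y = G f := by
  intro w
  induction w using ZFSet.inductionOn with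
  | _ w ih =>
    intro f y hw hp
    obtain ⟨f', hf', y', hy', e, h1, h2⟩ := ha _ hp
    obtain ⟨rfl, rfl⟩ := ZFSet.pair_inj.1 e
    ext z
    rw [hG f hf']
    constructor
    · intro hz
      obtain ⟨g, hg, hgf, hgz⟩ := h2 z hz
      have : G g ∈ w := by rw [hw, hG f hf']; exact ⟨g, hg, hgf, rfl⟩
      exact ⟨g, hg, hgf, ih _ this g z rfl hgz⟩
    · rintro ⟨g, hg, hgf, rfl⟩
      obtain ⟨z, hz, hgz⟩ := h1 g hg hgf
      have : G g ∈ w := by rw [hw, hG f hf']; exact ⟨g, hg, hgf, rfl⟩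
      rwa [← ih _ this g z rfl hgz]

theorem PM.approx_ex {N d R : ZFSet} (hN : PM N) (hd : d ∈ N) (hR : R ∈ N) {G : ZFSet → ZFSet}
    (hG : Collapses G d R) : ∀ w, ∀ f ∈ d, w = G f →
      ∃ a ∈ N, Approx a d R ∧ ZFSet.pair f (G f) ∈ a := by
  intro w
  induction w using ZFSet.inductionOn with
  | _ w ih =>
    intro f hf hw
    have hfN := hN.mem hd hf
    have hpN : ZFSet.sep (fun g => ZFSet.pair g f ∈ R) d ∈ N :=
      hN.sep (fun D g v => ZFSet.pair g (v 0) ∈ v 1) (env [f, R])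
        (env_in hN (by simp [hfN, hR])) hd
    set p := ZFSet.sep (fun g => ZFSet.pair g f ∈ R) d with hp
    have hpm : ∀ g, g ∈ p ↔ g ∈ d ∧ ZFSet.pair g f ∈ R := fun g => by rw [hp, ZFSet.mem_sep]
    obtain ⟨b, hb, hb'⟩ := hN.coll
      (fun D g a v => Approx a (v 0) (v 1) ∧ ∃ z, z ∈ D ∧ ZFSet.pair g z ∈ a) (env [d, R])
      (env_in hN (by simp [hd, hR])) hpN (fun g hg => by
        obtain ⟨hgd, hgf⟩ := (hpm g).1 hg
        obtain ⟨a, haN, ha, hga⟩ := ih (G g) (by rw [hw, hG f hf]; exact ⟨g, hgd, hgf, rfl⟩) g hgd rfl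
        exact ⟨a, haN, ha, G g, hN.pair_snd (hN.mem haN hga) (p := g), hga⟩)
    have hcN : (⋃₀ (ZFSet.sep (fun a => Approx a d R) b) : ZFSet) ∈ N :=
      hN.un _ (hN.sep (fun D a v => Approx a (v 0) (v 1)) (env [d, R])
        (env_in hN (by simp [hd, hR])) hb)
    set c := (⋃₀ (ZFSet.sep (fun a => Approx a d R) b) : ZFSet) with hc
    have hcm : ∀ q, q ∈ c ↔ ∃ a ∈ b, Approx a d R ∧ q ∈ a := by
      intro q
      simp only [hc, ZFSet.mem_sUnion, ZFSet.mem_sep, and_assoc]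
    have hcA : ∀ q ∈ c, ∃ f, f ∈ d ∧ ∃ y, (q = ZFSet.pair f y ∧
        ((∀ g, g ∈ d → ZFSet.pair g f ∈ R → ∃ z, z ∈ y ∧ ZFSet.pair g z ∈ c) ∧
        (∀ z, z ∈ y → ∃ g, g ∈ d ∧ (ZFSet.pair g f ∈ R ∧ ZFSet.pair g z ∈ c)))) := by
      intro q hq
      obtain ⟨a, hab, ha, hqa⟩ := (hcm q).1 hq
      obtain ⟨f, hf, y, hy, e, h1, h2⟩ := ha q hqa
      refine ⟨f, hf, y, e, fun g hg hgf => ?_, fun z hz => ?_⟩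
      · obtain ⟨z, hz, h⟩ := h1 g hg hgf
        exact ⟨z, hz, (hcm _).2 ⟨a, hab, ha, h⟩⟩
      · obtain ⟨g, hg, hgf, h⟩ := h2 z hz
        exact ⟨g, hg, hgf, (hcm _).2 ⟨a, hab, ha, h⟩⟩
    have hcval : ∀ g z, ZFSet.pair g z ∈ c → z = G g := by
      intro g z h
      obtain ⟨a, hab, ha, hqa⟩ := (hcm _).1 h
      exact ha.val hG _ g z rfl hqa
    have hcin : ∀ g ∈ p, ZFSet.pair g (G g) ∈ c := by
      intro g hg
      obtain ⟨a, hab, ha, z, hz, h⟩ := hb' g hg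
      have := ha.val hG _ g z rfl h
      rw [← this]
      exact (hcm _).2 ⟨a, hab, ha, h⟩
    have hGf : G f ∈ N := by
      have : ZFSet.sep (fun z => ∃ g, g ∈ p ∧ ZFSet.pair g z ∈ c) (⋃₀ (⋃₀ c)) ∈ N :=
        hN.sep (fun D z v => ∃ g, g ∈ v 0 ∧ ZFSet.pair g z ∈ v 1) (env [p, c])
          (env_in hN (by simp [hpN, hcN])) (hN.un _ (hN.un _ hcN))
      convert this using 1
      ext z
      rw [hG f hf, ZFSet.mem_sep]
      constructor
      · rintro ⟨g, hg, hgf, rfl⟩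
        have h := hcin g ((hpm g).2 ⟨hg, hgf⟩)
        exact ⟨snd_mem_UU h, g, (hpm g).2 ⟨hg, hgf⟩, h⟩
      · rintro ⟨-, g, hg, h⟩
        exact ⟨g, ((hpm g).1 hg).1, ((hpm g).1 hg).2, hcval g z h⟩
    refine ⟨Insert.insert (ZFSet.pair f (G f)) c, hN.insert_mem (hN.pair_mem hfN hGf) hcN, ?_,
      by simp⟩
    intro q hq
    have key : ∃ f, f ∈ d ∧ ∃ y, (q = ZFSet.pair f y ∧
        ((∀ g, g ∈ d → ZFSet.pair g f ∈ R → ∃ z, z ∈ y ∧ ZFSet.pair g z ∈ c) ∧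
        (∀ z, z ∈ y → ∃ g, g ∈ d ∧ (ZFSet.pair g f ∈ R ∧ ZFSet.pair g z ∈ c)))) := by
      rcases ZFSet.mem_insert_iff.1 hq with rfl | hq
      · refine ⟨f, hf, G f, rfl, fun g hg hgf => ?_, fun z hz => ?_⟩
        · exact ⟨G g, (hG f hf _).2 ⟨g, hg, hgf, rfl⟩, hcin g ((hpm g).2 ⟨hg, hgf⟩)⟩
        · obtain ⟨g, hg, hgf, rfl⟩ := (hG f hf _).1 hz
          exact ⟨g, hg, hgf, hcin g ((hpm g).2 ⟨hg, hgf⟩)⟩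
      · exact hcA q hq
    obtain ⟨f', hf', y, rfl, h1, h2⟩ := key
    refine ⟨f', hf', y, snd_mem_UU hq, rfl, fun g hg hgf => ?_, fun z hz => ?_⟩
    · obtain ⟨z, hz, h⟩ := h1 g hg hgf
      exact ⟨z, hz, ZFSet.mem_insert_iff.2 (Or.inr h)⟩
    · obtain ⟨g, hg, hgf, h⟩ := h2 z hz
      exact ⟨g, hg, hgf, ZFSet.mem_insert_iff.2 (Or.inr h)⟩

/-- The collapse of a relation in `N` is in `N`. -/
theorem PM.collapse {N d R : ZFSet} (hN : PM N) (hd : d ∈ N) (hR : R ∈ N) {G : ZFSet → ZFSet}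
    (hG : Collapses G d R) : MPaper.grf G d ∈ N := by
  have hGN : ∀ f ∈ d, G f ∈ N := by
    intro f hf
    obtain ⟨a, ha, _, h⟩ := hN.approx_ex hd hR hG _ f hf rfl
    exact hN.pair_snd (hN.mem ha h) (p := f)
  refine hN.grf (fun D f y v => ∃ a, a ∈ D ∧ (Approx a (v 0) (v 1) ∧ ZFSet.pair f y ∈ a)) [d, R]
    (by simp [hd, hR]) hd hGN fun f hf y hy => ?_
  constructor
  · rintro ⟨a, _, ha, h⟩; exact Approx.val ha hG _ f y rfl h
  · rintro rfl; exact hN.approx_ex hd hR hG _ f hf rfl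

theorem PM.img_of_grf {N d : ZFSet} (hN : PM N) {G : ZFSet → ZFSet} (hd : d ∈ N)
    (h : MPaper.grf G d ∈ N) :
    img G d ∈ N := by
  have : ZFSet.sep (fun y => ∃ x, x ∈ d ∧ ZFSet.pair x y ∈ MPaper.grf G d)
      (⋃₀ (⋃₀ (MPaper.grf G d))) ∈ N :=
    hN.sep (fun D y v => ∃ x, x ∈ v 0 ∧ ZFSet.pair x y ∈ v 1) (env [d, MPaper.grf G d])
      (env_in hN (by simp [hd, h])) (hN.un _ (hN.un _ h))
  convert this using 1
  ext y
  rw [mem_img, ZFSet.mem_sep]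
  constructor
  · rintro ⟨x, hx, rfl⟩
    have : ZFSet.pair x (G x) ∈ MPaper.grf G d := pair_mem_grf.2 ⟨hx, rfl⟩
    exact ⟨snd_mem_UU this, x, hx, this⟩
  · rintro ⟨-, x, hx, h⟩
    exact ⟨x, hx, (pair_mem_grf.1 h).2.symm⟩

/-- existence of a collapse of an (external) well-founded relation -/
theorem exists_collapse (d R : ZFSet.{u})
    (hwf : WellFounded (fun g f : ZFSet.{u} => g ∈ d ∧ f ∈ d ∧ ZFSet.pair g f ∈ R)) :
    ∃ G, Collapses G d R := by
  let G : ZFSet.{u} → ZFSet.{u} := hwf.fix fun f ih =>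
    img (fun g => if h : g ∈ d ∧ f ∈ d ∧ ZFSet.pair g f ∈ R then ih g h else ∅)
      (ZFSet.sep (fun g => ZFSet.pair g f ∈ R) d)
  refine ⟨G, fun f hf y => ?_⟩
  have e : G f = img (fun g => if h : g ∈ d ∧ f ∈ d ∧ ZFSet.pair g f ∈ R then G g else ∅)
      (ZFSet.sep (fun g => ZFSet.pair g f ∈ R) d) := hwf.fix_eq _ f
  rw [e, mem_img]
  constructor
  · rintro ⟨g, hg, h⟩
    obtain ⟨hgd, hgf⟩ := ZFSet.mem_sep.1 hg
    rw [dif_pos ⟨hgd, hf, hgf⟩] at h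
    exact ⟨g, hgd, hgf, h.symm⟩
  · rintro ⟨g, hgd, hgf, rfl⟩
    exact ⟨g, ZFSet.mem_sep.2 ⟨hgd, hgf⟩, by rw [dif_pos ⟨hgd, hf, hgf⟩]⟩

/-! ## Part C: cardinals, ordinals, linear collapse -/

theorem zcard_eq (x : ZFSet.{u}) : zcard x = Cardinal.lift.{u+1, u} (ZFSet.card x) :=
  ZFSet.cardinalMk_coe_sort

theorem zcard_le {x y : ZFSet.{u}} : zcard x ≤ zcard y ↔ card x ≤ card y := by
  rw [zcard_eq, zcard_eq, Cardinal.lift_le]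

theorem zcard_lt {x y : ZFSet.{u}} : zcard x < zcard y ↔ card x < card y := by
  rw [zcard_eq, zcard_eq, Cardinal.lift_lt]

theorem zcard_eq_iff {x y : ZFSet.{u}} : zcard x = zcard y ↔ card x = card y := by
  rw [zcard_eq, zcard_eq, Cardinal.lift_inj]

theorem isOrd_iff {x : ZFSet.{u}} : IsOrd x ↔ x.IsOrdinal :=
  ZFSet.isOrdinal_iff_forall_mem_isTransitive.symm

theorem card_img_le {F : ZFSet.{u} → ZFSet.{u}} {a : ZFSet.{u}} : card (img F a) ≤ card a := by
  rw [← zcard_le]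
  have : (img F a).toSet = F '' a.toSet := by
    ext y; exact mem_img
  unfold zcard
  rw [this]
  exact Cardinal.mk_image_le

theorem card_le_of_surj {a b : ZFSet.{u}} (F : ZFSet.{u} → ZFSet.{u}) (h : ∀ y ∈ b, ∃ x ∈ a, F x = y) :
    card b ≤ card a :=
  (card_mono fun y hy => mem_img.2 (h y hy)).trans (card_img_le (F := F))

theorem card_le_of_inj {a b : ZFSet.{u}} (F : ZFSet.{u} → ZFSet.{u}) (h : ∀ x ∈ a, F x ∈ b)
    (hi : ∀ x ∈ a, ∀ y ∈ a, F x = F y → x = y) : card a ≤ card b := by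
  rw [← zcard_le]
  refine Cardinal.mk_le_of_injective (f := fun x : a.toSet => (⟨F x.1, h _ x.2⟩ : b.toSet)) ?_
  intro x y e
  exact Subtype.ext (hi _ x.2 _ y.2 (congrArg Subtype.val e))

theorem IsCard.ord {κ : ZFSet.{u}} (h : IsCard κ) : κ.IsOrdinal := isOrd_iff.1 h.1

theorem IsCard.lt {κ x : ZFSet.{u}} (h : IsCard κ) (hx : x ∈ κ) : card x < card κ := zcard_lt.1 (h.2 x hx)

theorem IsCard.mem_of_card {κ x : ZFSet.{u}} (h : IsCard κ) (hx : x.IsOrdinal) (hc : card x < card κ) :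
    x ∈ κ := by
  rcases hx.mem_or_subset h.ord with h1 | h1
  · exact h1
  · exact absurd (card_mono h1) (not_le.2 hc)

theorem exists_lin_collapse {d R κ : ZFSet.{u}} (hκ : IsCard κ)
    (lin : ∀ a ∈ d, ∀ b ∈ d, a = b ∨ ZFSet.pair a b ∈ R ∨ ZFSet.pair b a ∈ R)
    (tr : ∀ a ∈ d, ∀ b ∈ d, ∀ c ∈ d, ZFSet.pair a b ∈ R → ZFSet.pair b c ∈ R → ZFSet.pair a c ∈ R)
    (hwf : WellFounded (fun g f : ZFSet.{u} => g ∈ d ∧ f ∈ d ∧ ZFSet.pair g f ∈ R))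
    (seg : ∀ b ∈ d, card (ZFSet.sep (fun a => ZFSet.pair a b ∈ R) d) < card κ) :
    ∃ G, Collapses G d R ∧ (∀ b ∈ d, G b ∈ κ) ∧ (∀ a ∈ d, ∀ b ∈ d, G a = G b → a = b) ∧
      (card κ ≤ card d → ∀ ξ ∈ κ, ∃ b ∈ d, G b = ξ) := by
  obtain ⟨G, hG⟩ := exists_collapse d R hwf
  have htr : ∀ b ∈ d, (G b).IsTransitive := by
    intro b hb z hz y hy
    obtain ⟨g, hg, hgb, rfl⟩ := (hG b hb _).1 hz
    obtain ⟨h, hh, hhg, rfl⟩ := (hG g hg _).1 hy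
    exact (hG b hb _).2 ⟨h, hh, tr _ hh _ hg _ hb hhg hgb, rfl⟩
  have hord : ∀ b ∈ d, (G b).IsOrdinal := by
    intro b hb
    rw [ZFSet.isOrdinal_iff_forall_mem_isTransitive]
    refine ⟨htr b hb, fun y hy => ?_⟩
    obtain ⟨g, hg, hgb, rfl⟩ := (hG b hb _).1 hy
    exact htr g hg
  have hin : ∀ b ∈ d, G b ∈ κ := by
    intro b hb
    refine hκ.mem_of_card (hord b hb) (lt_of_le_of_lt ?_ (seg b hb))
    refine card_le_of_surj G fun y hy => ?_
    obtain ⟨g, hg, hgb, rfl⟩ := (hG b hb _).1 hy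
    exact ⟨g, ZFSet.mem_sep.2 ⟨hg, hgb⟩, rfl⟩
  have hinj : ∀ a ∈ d, ∀ b ∈ d, G a = G b → a = b := by
    intro a ha b hb e
    rcases lin a ha b hb with h | h | h
    · exact h
    · exact absurd ((hG b hb _).2 ⟨a, ha, h, rfl⟩) (by rw [e]; exact ZFSet.mem_irrefl _)
    · exact absurd ((hG a ha _).2 ⟨b, hb, h, rfl⟩) (by rw [e]; exact ZFSet.mem_irrefl _)
  refine ⟨G, hG, hin, hinj, fun hc => ?_⟩
  have hI : (img G d).IsOrdinal := by
    rw [ZFSet.isOrdinal_iff_forall_mem_isTransitive]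
    refine ⟨fun z hz y hy => ?_, fun y hy => ?_⟩
    · obtain ⟨b, hb, rfl⟩ := mem_img.1 hz
      obtain ⟨g, hg, hgb, rfl⟩ := (hG b hb _).1 hy
      exact mem_img.2 ⟨g, hg, rfl⟩
    · obtain ⟨b, hb, rfl⟩ := mem_img.1 hy
      exact htr b hb
  have hcard : card d ≤ card (img G d) :=
    card_le_of_inj G (fun x hx => mem_img.2 ⟨x, hx, rfl⟩) hinj
  rcases hI.mem_or_subset hκ.ord with h | h
  · exact absurd (hκ.lt h) (not_lt.2 (hc.trans hcard))
  · intro ξ hξ; exact mem_img.1 (h hξ)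

/-- infinite cardinals -/
def InfC (κ : ZFSet.{u}) : Prop := IsCard κ ∧ Cardinal.aleph0 ≤ card κ

theorem card_prod (a b : ZFSet.{u}) : card (ZFSet.prod a b) ≤ card a * card b := by
  have : zcard (ZFSet.prod a b) ≤ zcard a * zcard b := by
    unfold zcard
    rw [Cardinal.mul_def]
    refine Cardinal.mk_le_of_surjective (f := fun x : a.toSet × b.toSet =>
      (⟨ZFSet.pair x.1.1 x.2.1, by
        show _ ∈ ZFSet.prod a b
        exact ZFSet.pair_mem_prod.2 ⟨x.1.2, x.2.2⟩⟩ : (ZFSet.prod a b).toSet)) ?_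
    rintro ⟨p, hp⟩
    obtain ⟨x, hx, y, hy, rfl⟩ := ZFSet.mem_prod.1 hp
    exact ⟨⟨⟨x, hx⟩, ⟨y, hy⟩⟩, rfl⟩
  rwa [zcard_eq, zcard_eq, zcard_eq, ← Cardinal.lift_mul, Cardinal.lift_le] at this

/-- Goedel ordering on pairs -/
def GodLT (a b c e : ZFSet) : Prop :=
  a ∪ b ∈ c ∪ e ∨ (a ∪ b = c ∪ e ∧ (a ∈ c ∨ (a = c ∧ b ∈ e)))

def GodR (κ : ZFSet) : ZFSet :=
  ZFSet.sep (fun p => ∃ a, a ∈ κ ∧ ∃ b, b ∈ κ ∧ ∃ c, c ∈ κ ∧ ∃ e, e ∈ κ ∧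
    (p = ZFSet.pair (ZFSet.pair a b) (ZFSet.pair c e) ∧
    (a ∪ b ∈ c ∪ e ∨ (a ∪ b = c ∪ e ∧ (a ∈ c ∨ (a = c ∧ b ∈ e))))))
    (ZFSet.prod (ZFSet.prod κ κ) (ZFSet.prod κ κ))

instance TDef.godR {s : ZFSet → (ℕ → ZFSet) → ZFSet} [hs : TDef s] :
    TDef (fun D v => GodR (s D v)) := by
  unfold GodR; infer_instance

theorem mem_godR {κ a b c e : ZFSet} (ha : a ∈ κ) (hb : b ∈ κ) (hc : c ∈ κ) (he : e ∈ κ) :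
    ZFSet.pair (ZFSet.pair a b) (ZFSet.pair c e) ∈ GodR κ ↔ GodLT a b c e := by
  unfold GodR
  rw [ZFSet.mem_sep]
  constructor
  · rintro ⟨-, a', ha', b', hb', c', hc', e', he', h1, h2⟩
    obtain ⟨h3, h4⟩ := ZFSet.pair_inj.1 h1
    obtain ⟨rfl, rfl⟩ := ZFSet.pair_inj.1 h3
    obtain ⟨rfl, rfl⟩ := ZFSet.pair_inj.1 h4
    exact h2
  · intro h
    exact ⟨by simp [ZFSet.pair_mem_prod, *], a, ha, b, hb, c, hc, e, he, rfl, h⟩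

theorem ord_union {κ a b : ZFSet.{u}} (h : κ.IsOrdinal) (ha : a ∈ κ) (hb : b ∈ κ) : a ∪ b ∈ κ := by
  rcases (h.mem ha).subset_total (h.mem hb) with h1 | h1
  · have : a ∪ b = b := by ext z; simp only [ZFSet.mem_union]; exact ⟨fun h => h.elim (fun h => h1 h) id, Or.inr⟩
    rwa [this]
  · have : a ∪ b = a := by ext z; simp only [ZFSet.mem_union]; exact ⟨fun h => h.elim id (fun h => h1 h), Or.inl⟩
    rwa [this]

theorem exists_godel {κ : ZFSet.{u}} (h : InfC κ) : ∃ p : ZFSet.{u} → ZFSet.{u},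
    (∀ a ∈ κ, ∀ b ∈ κ, p (ZFSet.pair a b) ∈ κ) ∧
    (∀ a ∈ κ, ∀ b ∈ κ, ∀ c ∈ κ, ∀ e ∈ κ, p (ZFSet.pair a b) = p (ZFSet.pair c e) → a = c ∧ b = e) ∧
    ∀ N : ZFSet.{u}, PM N → κ ∈ N → grf p (ZFSet.prod κ κ) ∈ N := by
  obtain ⟨hκ, hinf⟩ := h
  have ho := hκ.ord
  have hm : ∀ {x}, x ∈ κ → x.IsOrdinal := fun hx => ho.mem hx
  obtain ⟨G, hG, h1, h2, -⟩ := exists_lin_collapse (d := ZFSet.prod κ κ) (R := GodR κ) hκ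
    (by
      intro x hx y hy
      obtain ⟨a, ha, b, hb, rfl⟩ := ZFSet.mem_prod.1 hx
      obtain ⟨c, hc, e, he, rfl⟩ := ZFSet.mem_prod.1 hy
      rw [mem_godR ha hb hc he, mem_godR hc he ha hb]
      unfold GodLT
      rcases (hm (ord_union ho ha hb)).mem_trichotomous (hm (ord_union ho hc he)) with h | h | h
      · exact Or.inr (Or.inl (Or.inl h))
      · rcases (hm ha).mem_trichotomous (hm hc) with h' | h' | h'
        · exact Or.inr (Or.inl (Or.inr ⟨h, Or.inl h'⟩))
        · rcases (hm hb).mem_trichotomous (hm he) with h'' | h'' | h''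
          · exact Or.inr (Or.inl (Or.inr ⟨h, Or.inr ⟨h', h''⟩⟩))
          · left; rw [h', h'']
          · exact Or.inr (Or.inr (Or.inr ⟨h.symm, Or.inr ⟨h'.symm, h''⟩⟩))
        · exact Or.inr (Or.inr (Or.inr ⟨h.symm, Or.inl h'⟩))
      · exact Or.inr (Or.inr (Or.inl h)))
    (by
      intro x hx y hy z hz
      obtain ⟨a, ha, b, hb, rfl⟩ := ZFSet.mem_prod.1 hx
      obtain ⟨c, hc, e, he, rfl⟩ := ZFSet.mem_prod.1 hy
      obtain ⟨f, hf, g, hg, rfl⟩ := ZFSet.mem_prod.1 hz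
      rw [mem_godR ha hb hc he, mem_godR hc he hf hg, mem_godR ha hb hf hg]
      unfold GodLT
      have := (hm (ord_union ho hf hg))
      rintro (h | ⟨h, h'⟩) (k | ⟨k, k'⟩)
      · exact Or.inl (this.mem_trans h k)
      · exact Or.inl (k ▸ h)
      · exact Or.inl (h ▸ k)
      · refine Or.inr ⟨h.trans k, ?_⟩
        rcases h' with h' | ⟨h', h''⟩ <;> rcases k' with k' | ⟨k', k''⟩
        · exact Or.inl ((hm hf).mem_trans h' k')
        · exact Or.inl (k' ▸ h')
        · exact Or.inl (h' ▸ k')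
        · exact Or.inr ⟨h'.trans k', (hm hg).mem_trans h'' k''⟩)
    (by
      let F : ZFSet.{u} → Ordinal.{u} × Ordinal.{u} × Ordinal.{u} := fun x =>
        if h : ∃ q : ZFSet.{u} × ZFSet.{u}, x = ZFSet.pair q.1 q.2 then
          (rank (h.choose.1 ∪ h.choose.2), rank h.choose.1, rank h.choose.2) else (0, 0, 0)
      have hF : ∀ a b : ZFSet.{u}, F (ZFSet.pair a b) = (rank (a ∪ b), rank a, rank b) := by
        intro a b
        have h : ∃ q : ZFSet.{u} × ZFSet.{u}, ZFSet.pair a b = ZFSet.pair q.1 q.2 := ⟨(a, b), rfl⟩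
        have e := h.choose_spec
        obtain ⟨e1, e2⟩ := ZFSet.pair_inj.1 e
        simp only [F, dif_pos h]
        rw [← e1, ← e2]
      have wf : WellFounded (InvImage (Prod.Lex (· < ·) (Prod.Lex (· < ·) (· < ·))) F) :=
        InvImage.wf F (WellFounded.prod_lex Ordinal.lt_wf
          (WellFounded.prod_lex Ordinal.lt_wf Ordinal.lt_wf))
      refine Subrelation.wf ?_ wf
      rintro x y ⟨hx, hy, hxy⟩
      obtain ⟨a, ha, b, hb, rfl⟩ := ZFSet.mem_prod.1 hx
      obtain ⟨c, hc, e, he, rfl⟩ := ZFSet.mem_prod.1 hy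
      rw [mem_godR ha hb hc he] at hxy
      show Prod.Lex _ _ _ _
      rw [hF, hF]
      rcases hxy with h | ⟨h0, h | ⟨h, h'⟩⟩
      · exact Prod.Lex.left _ _ (rank_lt_of_mem h)
      · rw [h0]; exact Prod.Lex.right _ (Prod.Lex.left _ _ (rank_lt_of_mem h))
      · rw [h0]; subst h; exact Prod.Lex.right _ (Prod.Lex.right _ (rank_lt_of_mem h')))
    (by
      intro y hy
      obtain ⟨c, hc, e, he, rfl⟩ := ZFSet.mem_prod.1 hy
      set m := c ∪ e
      have hmκ : m ∈ κ := ord_union ho hc he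
      refine lt_of_le_of_lt (b := card (ZFSet.prod (insert m m) (insert m m))) (card_mono ?_) ?_
      · intro x hx
        obtain ⟨hx, hxy⟩ := ZFSet.mem_sep.1 hx
        obtain ⟨a, ha, b, hb, rfl⟩ := ZFSet.mem_prod.1 hx
        rw [mem_godR ha hb hc he] at hxy
        have hs : a ∪ b ⊆ m := by
          rcases hxy with h | ⟨h, -⟩
          · exact (hm hmκ).subset_of_mem h
          · rw [h]
        have hh : ∀ {z}, z ∈ κ → z ⊆ m → z ∈ (insert m m : ZFSet) := by
          intro z hz hzm
          rw [ZFSet.mem_insert_iff]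
          exact ((hm hz).subset_iff_eq_or_mem (hm hmκ)).1 hzm
        rw [ZFSet.pair_mem_prod]
        exact ⟨hh ha fun z hz => hs (ZFSet.mem_union.2 (Or.inl hz)),
          hh hb fun z hz => hs (ZFSet.mem_union.2 (Or.inr hz))⟩
      · refine (card_prod _ _).trans_lt ?_
        have h1 : card (insert m m) < card κ := by
          refine lt_of_le_of_lt card_insert_le ?_
          exact Cardinal.add_lt_of_lt hinf (hκ.lt hmκ) (Cardinal.one_lt_aleph0.trans_le hinf)
        exact Cardinal.mul_lt_of_lt hinf h1 h1)
  refine ⟨G, fun a ha b hb => h1 _ (ZFSet.pair_mem_prod.2 ⟨ha, hb⟩), ?_, ?_⟩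
  · intro a ha b hb c hc e he h
    exact ZFSet.pair_inj.1 (h2 _ (ZFSet.pair_mem_prod.2 ⟨ha, hb⟩) _ (ZFSet.pair_mem_prod.2 ⟨hc, he⟩) h)
  · intro N hN hκN
    refine hN.collapse (hN.prod_mem hκN hκN) ?_ hG
    exact TDef.cl (t := fun D v => GodR (v 0)) N hN (env [κ]) (env_in hN (by simp [hκN]))

/-- Goedel pairing on an infinite cardinal -/
def gp (κ : ZFSet.{u}) : ZFSet.{u} → ZFSet.{u} :=
  if h : InfC κ then (exists_godel h).choose else id

theorem gp_spec {κ : ZFSet.{u}} (h : InfC κ) : (∀ a ∈ κ, ∀ b ∈ κ, gp κ (ZFSet.pair a b) ∈ κ) ∧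
    (∀ a ∈ κ, ∀ b ∈ κ, ∀ c ∈ κ, ∀ e ∈ κ, gp κ (ZFSet.pair a b) = gp κ (ZFSet.pair c e) → a = c ∧ b = e) ∧
    ∀ N : ZFSet.{u}, PM N → κ ∈ N → grf (gp κ) (ZFSet.prod κ κ) ∈ N := by
  unfold gp; rw [dif_pos h]; exact (exists_godel h).choose_spec

theorem gp_app {κ : ZFSet.{u}} (h : InfC κ) {a b : ZFSet.{u}} (ha : a ∈ κ) (hb : b ∈ κ) :
    fapp (grf (gp κ) (ZFSet.prod κ κ)) (ZFSet.pair a b) = gp κ (ZFSet.pair a b) :=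
  grf_app (ZFSet.pair_mem_prod.2 ⟨ha, hb⟩)

/-- code of the membership relation of the range of `f` -/
def codeOf (κ f : ZFSet.{u}) : ZFSet.{u} :=
  ZFSet.sep (fun ξ => ∃ a, a ∈ κ ∧ ∃ b, b ∈ κ ∧ (ξ = fapp (grf (gp κ) (ZFSet.prod κ κ)) (ZFSet.pair a b)
    ∧ fapp f a ∈ fapp f b)) κ

theorem codeOf_sub (κ f : ZFSet.{u}) : codeOf κ f ⊆ κ := fun x hx => (ZFSet.mem_sep.1 hx).1

theorem codeOf_mem {κ f N : ZFSet.{u}} (h : InfC κ) (hN : PM N) (hκ : κ ∈ N) (hf : f ∈ N) :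
    codeOf κ f ∈ N :=
  hN.sep (fun D ξ v => ∃ a, a ∈ v 0 ∧ ∃ b, b ∈ v 0 ∧ (ξ = fapp (v 1) (ZFSet.pair a b)
    ∧ fapp (v 2) a ∈ fapp (v 2) b)) (env [κ, grf (gp κ) (ZFSet.prod κ κ), f])
    (env_in hN (by simp [hκ, hf, (gp_spec h).2.2 N hN hκ])) hκ

theorem codeOf_dec {κ f N t : ZFSet.{u}} (h : InfC κ) (hN : PM N) (hκ : κ ∈ N)
    (hf : IsZFunc κ f) (ht : t.IsTransitive) (hs : SurjOnto f κ t) (hc : codeOf κ f ∈ N) :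
    f ∈ N ∧ t ∈ N := by
  have hgp := (gp_spec h).2.2 N hN hκ
  have hE : ZFSet.sep (fun q => ∃ a, a ∈ κ ∧ ∃ b, b ∈ κ ∧ (q = ZFSet.pair a b ∧
      fapp (grf (gp κ) (ZFSet.prod κ κ)) (ZFSet.pair a b) ∈ codeOf κ f)) (ZFSet.prod κ κ) ∈ N :=
    hN.sep (fun D q v => ∃ a, a ∈ v 0 ∧ ∃ b, b ∈ v 0 ∧ (q = ZFSet.pair a b ∧
      fapp (v 1) (ZFSet.pair a b) ∈ v 2)) (env [κ, grf (gp κ) (ZFSet.prod κ κ), codeOf κ f])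
      (env_in hN (by simp [hκ, hc, hgp])) (hN.prod_mem hκ hκ)
  set E := ZFSet.sep (fun q => ∃ a, a ∈ κ ∧ ∃ b, b ∈ κ ∧ (q = ZFSet.pair a b ∧
      fapp (grf (gp κ) (ZFSet.prod κ κ)) (ZFSet.pair a b) ∈ codeOf κ f)) (ZFSet.prod κ κ) with hEd
  have hEm : ∀ a ∈ κ, ∀ b ∈ κ, (ZFSet.pair a b ∈ E ↔ fapp f a ∈ fapp f b) := by
    intro a ha b hb
    rw [hEd, ZFSet.mem_sep]
    constructor
    · rintro ⟨-, a', ha', b', hb', e, hm⟩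
      obtain ⟨rfl, rfl⟩ := ZFSet.pair_inj.1 e
      obtain ⟨-, a', ha', b', hb', e, hm⟩ := ZFSet.mem_sep.1 hm
      rw [gp_app h ha hb, gp_app h ha' hb'] at e
      obtain ⟨rfl, rfl⟩ := (gp_spec h).2.1 _ ha _ hb _ ha' _ hb' e
      exact hm
    · intro hm
      refine ⟨ZFSet.pair_mem_prod.2 ⟨ha, hb⟩, a, ha, b, hb, rfl, ZFSet.mem_sep.2 ⟨?_, a, ha, b, hb, rfl, hm⟩⟩
      rw [gp_app h ha hb]; exact (gp_spec h).1 a ha b hb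
  have hG : Collapses (fun a => fapp f a) κ E := by
    intro b hb y
    constructor
    · intro hy
      obtain ⟨a, ha, rfl⟩ := hs.2 y (ht _ (hs.1 b hb) hy)
      exact ⟨a, ha, (hEm a ha b hb).2 hy, rfl⟩
    · rintro ⟨a, ha, hab, rfl⟩
      exact (hEm a ha b hb).1 hab
  have hg := hN.collapse hκ hE hG
  have e1 : grf (fun a => fapp f a) κ = f :=
    func_ext (grf_func _ _) hf fun a ha => grf_app ha
  have e2 : img (fun a => fapp f a) κ = t := by
    ext y; rw [mem_img]
    exact ⟨fun ⟨a, ha, e⟩ => e ▸ hs.1 a ha, hs.2 y⟩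
  exact ⟨e1 ▸ hg, e2 ▸ hN.img_of_grf hκ hg⟩

/-- a surjection exists by cardinality -/
theorem exists_surj {κ t : ZFSet.{u}} (hc : card t ≤ card κ) (hne : ∃ z, z ∈ t) :
    ∃ f : ZFSet.{u}, IsZFunc κ f ∧ SurjOnto f κ t := by
  obtain ⟨z, hz⟩ := hne
  rw [← zcard_le] at hc
  obtain ⟨i⟩ := Cardinal.le_def _ _ |>.1 hc
  have : Nonempty t.toSet := ⟨⟨z, hz⟩⟩
  let F : ZFSet.{u} → ZFSet.{u} := fun x => if h : x ∈ κ then (Function.invFun i ⟨x, h⟩).1 else z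
  refine ⟨grf F κ, grf_func _ _, fun a ha => ?_, fun b hb => ?_⟩
  · rw [grf_app ha]; simp only [F, dif_pos ha]; exact (Function.invFun i ⟨a, ha⟩).2
  · refine ⟨(i ⟨b, hb⟩).1, (i ⟨b, hb⟩).2, ?_⟩
    rw [grf_app (i ⟨b, hb⟩).2]
    have : (i ⟨b, hb⟩).1 ∈ κ := (i ⟨b, hb⟩).2
    simp only [F, dif_pos this]
    exact congrArg Subtype.val (Function.leftInverse_invFun i.injective ⟨b, hb⟩)

theorem exists_code {κ t : ZFSet.{u}} (h : InfC κ) (ht : t.IsTransitive) (hc : card t ≤ card κ)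
    (hne : ∃ z, z ∈ t) : ∃ A : ZFSet.{u}, A ⊆ κ ∧ ∀ N : ZFSet.{u}, PM N → κ ∈ N → A ∈ N → t ∈ N := by
  obtain ⟨f, hf, hs⟩ := exists_surj hc hne
  exact ⟨codeOf κ f, codeOf_sub _ _, fun N hN hκ hA => (codeOf_dec h hN hκ hf ht hs hA).2⟩

theorem InfC.ex2 {κ : ZFSet.{u}} (h : InfC κ) : (∅ : ZFSet.{u}) ∈ κ ∧ ({∅} : ZFSet.{u}) ∈ κ := by
  have h0 : (∅ : ZFSet.{u}) ∈ κ := h.1.mem_of_card isOrdinal_empty (by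
    rw [card_empty]; exact Cardinal.aleph0_pos.trans_le h.2)
  refine ⟨h0, h.1.mem_of_card ?_ (by rw [card_singleton]; exact Cardinal.one_lt_aleph0.trans_le h.2)⟩
  have := isOrdinal_succ isOrdinal_empty
  convert this using 1
  ext z; simp

theorem exists_merge {κ A B : ZFSet.{u}} (h : InfC κ) (hA : A ⊆ κ) (hB : B ⊆ κ) :
    ∃ C : ZFSet.{u}, C ⊆ κ ∧ (∀ N : ZFSet.{u}, PM N → κ ∈ N → (C ∈ N ↔ A ∈ N ∧ B ∈ N)) := by
  obtain ⟨h0, h1⟩ := h.ex2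
  set g := grf (gp κ) (ZFSet.prod κ κ) with hg
  have inj : ∀ a ∈ κ, ∀ b ∈ κ, ∀ c ∈ κ, ∀ e ∈ κ, fapp g (ZFSet.pair a b) = fapp g (ZFSet.pair c e) →
      a = c ∧ b = e := by
    intro a ha b hb c hc e he
    rw [gp_app h ha hb, gp_app h hc he]
    exact (gp_spec h).2.1 a ha b hb c hc e he
  have inn : ∀ a ∈ κ, ∀ b ∈ κ, fapp g (ZFSet.pair a b) ∈ κ := by
    intro a ha b hb; rw [gp_app h ha hb]; exact (gp_spec h).1 a ha b hb
  have ne : (∅ : ZFSet.{u}) ≠ {∅} := by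
    intro e
    have : (∅ : ZFSet.{u}) ∈ ({∅} : ZFSet.{u}) := by simp
    rw [← e] at this; exact ZFSet.notMem_empty _ this
  set C := ZFSet.sep (fun ξ => (∃ a, a ∈ A ∧ ξ = fapp g (ZFSet.pair ∅ a)) ∨
    (∃ a, a ∈ B ∧ ξ = fapp g (ZFSet.pair {∅} a))) κ with hC
  have hCA : ∀ a ∈ κ, (fapp g (ZFSet.pair ∅ a) ∈ C ↔ a ∈ A) := by
    intro a ha
    rw [hC, ZFSet.mem_sep]
    constructor
    · rintro ⟨-, ⟨b, hb, e⟩ | ⟨b, hb, e⟩⟩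
      · rw [(inj _ h0 _ ha _ h0 _ (hA hb) e).2]; exact hb
      · exact absurd (inj _ h0 _ ha _ h1 _ (hB hb) e).1 ne
    · exact fun h => ⟨inn _ h0 _ ha, Or.inl ⟨a, h, rfl⟩⟩
  have hCB : ∀ a ∈ κ, (fapp g (ZFSet.pair {∅} a) ∈ C ↔ a ∈ B) := by
    intro a ha
    rw [hC, ZFSet.mem_sep]
    constructor
    · rintro ⟨-, ⟨b, hb, e⟩ | ⟨b, hb, e⟩⟩
      · exact absurd (inj _ h1 _ ha _ h0 _ (hA hb) e).1 ne.symm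
      · rw [(inj _ h1 _ ha _ h1 _ (hB hb) e).2]; exact hb
    · exact fun h => ⟨inn _ h1 _ ha, Or.inr ⟨a, h, rfl⟩⟩
  refine ⟨C, fun x hx => (ZFSet.mem_sep.1 hx).1, fun N hN hκ => ?_⟩
  have hgN : g ∈ N := (gp_spec h).2.2 N hN hκ
  constructor
  · intro hCN
    constructor
    · have : ZFSet.sep (fun a => fapp g (ZFSet.pair ∅ a) ∈ C) κ ∈ N :=
        hN.sep (fun D a v => fapp (v 0) (ZFSet.pair ∅ a) ∈ v 1) (env [g, C])
          (env_in hN (by simp [hgN, hCN])) hκ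
      convert this using 1
      ext a; rw [ZFSet.mem_sep]
      exact ⟨fun h => ⟨hA h, (hCA a (hA h)).2 h⟩, fun h => (hCA a h.1).1 h.2⟩
    · have : ZFSet.sep (fun a => fapp g (ZFSet.pair {∅} a) ∈ C) κ ∈ N :=
        hN.sep (fun D a v => fapp (v 0) (ZFSet.pair {∅} a) ∈ v 1) (env [g, C])
          (env_in hN (by simp [hgN, hCN])) hκ
      convert this using 1
      ext a; rw [ZFSet.mem_sep]
      exact ⟨fun h => ⟨hB h, (hCB a (hB h)).2 h⟩, fun h => (hCB a h.1).1 h.2⟩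
  · rintro ⟨hAN, hBN⟩
    exact hN.sep (fun D ξ v => (∃ a, a ∈ v 0 ∧ ξ = fapp (v 2) (ZFSet.pair ∅ a)) ∨
      (∃ a, a ∈ v 1 ∧ ξ = fapp (v 2) (ZFSet.pair {∅} a))) (env [A, B, g])
      (env_in hN (by simp [hgN, hAN, hBN])) hκ

/-- from a surjection in `N` to a bijection in `N` -/
theorem exists_bij {κ f s N : ZFSet.{u}} (hκ : IsCard κ) (hN : PM N) (hκN : κ ∈ N) (hf : f ∈ N)
    (hs : s ∈ N) (hsur : SurjOnto f κ s) (hc : card κ ≤ card s) :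
    ∃ g ∈ N, IsBij g κ s := by
  have ho := hκ.ord
  have hRN : ZFSet.sep (fun p => ∃ x, x ∈ s ∧ ∃ y, y ∈ s ∧ (p = ZFSet.pair x y ∧
      ∃ a, a ∈ κ ∧ (fapp f a = x ∧ ∀ b, b ∈ κ → fapp f b = y → a ∈ b))) (ZFSet.prod s s) ∈ N :=
    hN.sep (fun D p v => ∃ x, x ∈ v 0 ∧ ∃ y, y ∈ v 0 ∧ (p = ZFSet.pair x y ∧
      ∃ a, a ∈ v 1 ∧ (fapp (v 2) a = x ∧ ∀ b, b ∈ v 1 → fapp (v 2) b = y → a ∈ b))) (env [s, κ, f])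
      (env_in hN (by simp [hs, hκN, hf])) (hN.prod_mem hs hs)
  set R := ZFSet.sep (fun p => ∃ x, x ∈ s ∧ ∃ y, y ∈ s ∧ (p = ZFSet.pair x y ∧
      ∃ a, a ∈ κ ∧ (fapp f a = x ∧ ∀ b, b ∈ κ → fapp f b = y → a ∈ b))) (ZFSet.prod s s) with hR
  have hRm : ∀ x ∈ s, ∀ y ∈ s, (ZFSet.pair x y ∈ R ↔
      ∃ a, a ∈ κ ∧ (fapp f a = x ∧ ∀ b, b ∈ κ → fapp f b = y → a ∈ b)) := by
    intro x hx y hy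
    rw [hR, ZFSet.mem_sep]
    constructor
    · rintro ⟨-, x', hx', y', hy', e, h⟩
      obtain ⟨rfl, rfl⟩ := ZFSet.pair_inj.1 e
      exact h
    · exact fun h => ⟨ZFSet.pair_mem_prod.2 ⟨hx, hy⟩, x, hx, y, hy, rfl, h⟩
  -- least preimage
  have hl : ∀ x ∈ s, ∃ a ∈ κ, fapp f a = x ∧ ∀ b ∈ κ, fapp f b = x → a = b ∨ a ∈ b := by
    intro x hx
    obtain ⟨a, ⟨ha, hax⟩, hmin⟩ := ZFSet.mem_wf.has_min {a : ZFSet.{u} | a ∈ κ ∧ fapp f a = x}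
      (by obtain ⟨a, ha, h⟩ := hsur.2 x hx; exact ⟨a, ha, h⟩)
    refine ⟨a, ha, hax, fun b hb hbx => ?_⟩
    rcases (ho.mem ha).mem_trichotomous (ho.mem hb) with h | h | h
    · exact Or.inr h
    · exact Or.inl h
    · exact absurd h (hmin b ⟨hb, hbx⟩)
  choose! l hl1 hl2 hl3 using hl
  have hRl : ∀ x ∈ s, ∀ y ∈ s, (ZFSet.pair x y ∈ R ↔ l x ∈ l y) := by
    intro x hx y hy
    rw [hRm x hx y hy]
    constructor
    · rintro ⟨a, ha, hax, h⟩
      have := h _ (hl1 y hy) (hl2 y hy)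
      rcases hl3 x hx a ha hax with h' | h'
      · rwa [h']
      · exact (ho.mem (hl1 y hy)).mem_trans h' this
    · intro h
      refine ⟨l x, hl1 x hx, hl2 x hx, fun b hb hby => ?_⟩
      rcases hl3 y hy b hb hby with h' | h'
      · rwa [← h']
      · exact (ho.mem hb).mem_trans h h'
  obtain ⟨G, hG, h1, h2, h3⟩ := exists_lin_collapse (d := s) (R := R) hκ
    (by
      intro x hx y hy
      rw [hRl x hx y hy, hRl y hy x hx]
      rcases (ho.mem (hl1 x hx)).mem_trichotomous (ho.mem (hl1 y hy)) with h | h | h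
      · exact Or.inr (Or.inl h)
      · left; rw [← hl2 x hx, ← hl2 y hy, h]
      · exact Or.inr (Or.inr h))
    (by
      intro x hx y hy z hz
      rw [hRl x hx y hy, hRl y hy z hz, hRl x hx z hz]
      exact fun h h' => (ho.mem (hl1 z hz)).mem_trans h h')
    (Subrelation.wf (r := InvImage (fun a b : ZFSet.{u} => a ∈ b) l)
      (fun {x y} h => (hRl x h.1 y h.2.1).1 h.2.2) (InvImage.wf l ZFSet.mem_wf))
    (by
      intro y hy
      refine lt_of_le_of_lt ?_ (hκ.lt (hl1 y hy))
      refine card_le_of_surj (fun a => fapp f a) fun x hx => ?_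
      obtain ⟨hx, hxy⟩ := ZFSet.mem_sep.1 hx
      exact ⟨l x, (hRl x hx y hy).1 hxy, hl2 x hx⟩)
  have hGN := hN.collapse hs hRN hG
  have h3 := h3 hc
  have hgN : ZFSet.sep (fun p => ∃ x, x ∈ s ∧ ∃ ξ, ξ ∈ κ ∧ (p = ZFSet.pair ξ x ∧ ZFSet.pair x ξ ∈ grf G s))
      (ZFSet.prod κ s) ∈ N :=
    hN.sep (fun D p v => ∃ x, x ∈ v 0 ∧ ∃ ξ, ξ ∈ v 1 ∧ (p = ZFSet.pair ξ x ∧ ZFSet.pair x ξ ∈ v 2))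
      (env [s, κ, grf G s]) (env_in hN (by simp [hs, hκN, hGN])) (hN.prod_mem hκN hs)
  set g := ZFSet.sep (fun p => ∃ x, x ∈ s ∧ ∃ ξ, ξ ∈ κ ∧ (p = ZFSet.pair ξ x ∧ ZFSet.pair x ξ ∈ grf G s))
      (ZFSet.prod κ s) with hg
  have hgm : ∀ ξ x, ZFSet.pair ξ x ∈ g ↔ x ∈ s ∧ ξ = G x := by
    intro ξ x
    rw [hg, ZFSet.mem_sep]
    constructor
    · rintro ⟨-, x', hx', ξ', hξ', e, h⟩
      obtain ⟨rfl, rfl⟩ := ZFSet.pair_inj.1 e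
      exact pair_mem_grf.1 h
    · rintro ⟨hx, rfl⟩
      exact ⟨ZFSet.pair_mem_prod.2 ⟨h1 x hx, hx⟩, x, hx, G x, h1 x hx, rfl, pair_mem_grf.2 ⟨hx, rfl⟩⟩
  have hgf : IsZFunc κ g := by
    constructor
    · intro p hp
      obtain ⟨-, x, hx, ξ, hξ, e, -⟩ := ZFSet.mem_sep.1 hp
      exact ⟨ξ, hξ, x, e⟩
    · intro ξ hξ
      obtain ⟨x, hx, rfl⟩ := h3 ξ hξ
      exact ⟨x, (hgm _ _).2 ⟨hx, rfl⟩, fun y hy => h2 _ ((hgm _ _).1 hy).1 _ hx ((hgm _ _).1 hy).2.symm⟩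
  have hga : ∀ x ∈ s, fapp g (G x) = x := fun x hx => fapp_eq hgf ((hgm _ _).2 ⟨hx, rfl⟩)
  refine ⟨g, hgN, hgf, ⟨fun ξ hξ => ?_, fun x hx => ⟨G x, h1 x hx, hga x hx⟩⟩, fun ξ hξ ζ hζ e => ?_⟩
  · obtain ⟨x, hx, rfl⟩ := h3 ξ hξ
    rw [hga x hx]; exact hx
  · obtain ⟨x, hx, rfl⟩ := h3 ξ hξ
    obtain ⟨y, hy, rfl⟩ := h3 ζ hζ
    rw [hga x hx, hga y hy] at e
    rw [e]

namespace Fml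
def and (a b : Fml) : Fml := .neg (.impl a (.neg b))
def iff (a b : Fml) : Fml := and (.impl a b) (.impl b a)
def ex (n : ℕ) (a : Fml) : Fml := .neg (.all n (.neg a))
end Fml

theorem sat_and {D a b} {v : ℕ → ZFSet.{u}} : Sat D (Fml.and a b) v ↔ Sat D a v ∧ Sat D b v := by
  simp only [Fml.and, Sat]; tauto
theorem sat_iff {D a b} {v : ℕ → ZFSet.{u}} : Sat D (Fml.iff a b) v ↔ (Sat D a v ↔ Sat D b v) := by
  simp only [Fml.iff, sat_and, Sat]; tauto
theorem sat_ex {D n a} {v : ℕ → ZFSet.{u}} : Sat D (Fml.ex n a) v ↔ ∃ x ∈ D, Sat D a (Function.update v n x) := by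
  simp only [Fml.ex, Sat]; push Not; rfl

def axP : Fml := .ex 2 (.all 3 (.iff (.mem 3 2) (.impl (.neg (.eq 3 0)) (.eq 3 1))))
def axU : Fml := .ex 1 (.all 2 (.iff (.mem 2 1) (.ex 3 (.and (.mem 3 0) (.mem 2 3)))))
def axS (φ : Fml) : Fml := .ex (φ.bd + 2) (.all 0 (.iff (.mem 0 (φ.bd + 2)) (.and (.mem 0 (φ.bd + 1)) φ)))
def axC (φ : Fml) : Fml := .impl (.all 0 (.impl (.mem 0 (φ.bd + 2)) (.ex 1 φ)))
  (.ex (φ.bd + 3) (.all 0 (.impl (.mem 0 (φ.bd + 2)) (.ex 1 (.and (.mem 1 (φ.bd + 3)) φ)))))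

/-- axioms of premodels -/
def PAx : Set Fml := {axP, axU} ∪ Set.range axS ∪ Set.range axC

theorem pm_of_ax {D : ZFSet.{u}} (ht : D.IsTransitive) (h0 : ∅ ∈ D)
    (h : ∀ φ ∈ PAx, ∀ v : ℕ → ZFSet.{u}, (∀ n, v n ∈ D) → Sat D.toSet φ v) : PM D := by
  refine ⟨ht, h0, ?_, ?_, ?_, ?_⟩
  · intro x hx y hy
    have := h axP (by simp [PAx]) (fun n => if n = 0 then x else y) (fun n => by
      by_cases hn : n = 0 <;> simp [hn, hx, hy])
    simp only [axP, sat_ex, sat_iff, Sat] at this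
    obtain ⟨z, hz, H⟩ := this
    convert (show z ∈ D from hz) using 1
    ext w
    constructor
    · intro hw
      have hwD : w ∈ D := by
        rcases ZFSet.mem_pair.1 hw with rfl | rfl <;> assumption
      have := H w hwD
      simp at this
      rw [this]
      rcases ZFSet.mem_pair.1 hw with rfl | rfl <;> simp
    · intro hw
      have := H w (ht.mem_trans hw hz)
      simp at this
      rw [ZFSet.mem_pair]
      have := this.1 hw
      tauto
  · intro x hx
    have := h axU (by simp [PAx]) (fun n => x) (fun n => hx)
    simp only [axU, sat_ex, sat_iff, sat_and, Sat] at this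
    obtain ⟨z, hz, H⟩ := this
    convert (show z ∈ D from hz) using 1
    ext w
    rw [ZFSet.mem_sUnion]
    constructor
    · rintro ⟨y, hy, hw⟩
      have hyD := ht.mem_trans hy hx
      have := H w (ht.mem_trans hw hyD)
      simp at this
      rw [this]
      exact ⟨y, hyD, hy, hw⟩
    · intro hw
      have := H w (ht.mem_trans hw hz)
      simp at this
      obtain ⟨y, _, h1, h2⟩ := this.1 hw
      exact ⟨y, h1, h2⟩
  · intro φ v hv a ha
    have := h (axS φ) (by simp [PAx]) (Function.update v (φ.bd + 1) a) (fun n => by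
      by_cases hn : n = φ.bd + 1
      · subst hn; simpa using ha
      · simpa [hn] using hv n)
    simp only [axS, sat_ex, sat_iff, sat_and, Sat] at this
    obtain ⟨b, hb, H⟩ := this
    refine ⟨b, hb, fun x => ?_⟩
    have key : ∀ x ∈ D, (x ∈ b ↔ x ∈ a ∧ Sat D.toSet φ (Function.update v 0 x)) := by
      intro x hx
      have := H x hx
      simp at this
      rw [this]
      refine and_congr_right fun _ => sat_bd _ _ _ _ fun n hn => ?_
      by_cases h0 : n = 0
      · simp [h0]
      · simp [h0, show n ≠ φ.bd + 1 by omega, show n ≠ φ.bd + 2 by omega]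
    constructor
    · intro hx; exact (key x (ht.mem_trans hx hb)).1 hx
    · intro hx; exact (key x (ht.mem_trans hx.1 ha)).2 hx
  · intro φ v hv a ha hyp
    have e : ∀ x y b, (Sat D.toSet φ (Function.update (Function.update (Function.update (Function.update v (φ.bd + 2) a) (φ.bd+3) b) 0 x) 1 y) ↔
      Sat D.toSet φ (Function.update (Function.update v 0 x) 1 y)) := by
      intro x y b
      refine sat_bd _ _ _ _ fun n hn => ?_
      by_cases h0 : n = 0
      · simp [h0]
      · by_cases h1 : n = 1 <;> simp [h0, h1, show n ≠ φ.bd + 3 by omega, show n ≠ φ.bd + 2 by omega]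
    have e' : ∀ x y, (Sat D.toSet φ (Function.update (Function.update (Function.update v (φ.bd + 2) a) 0 x) 1 y) ↔
      Sat D.toSet φ (Function.update (Function.update v 0 x) 1 y)) := by
      intro x y
      refine sat_bd _ _ _ _ fun n hn => ?_
      by_cases h0 : n = 0
      · simp [h0]
      · by_cases h1 : n = 1 <;> simp [h0, h1, show n ≠ φ.bd + 2 by omega]
    have := h (axC φ) (by simp [PAx]) (Function.update v (φ.bd + 2) a) (fun n => by
      by_cases hn : n = φ.bd + 2
      · subst hn; simpa using ha
      · simpa [hn] using hv n)
    simp only [axC, sat_ex, sat_and, Sat, e, e'] at this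
    obtain ⟨b, hb, H⟩ := this (by
      intro x hx hxa
      simp at hxa
      obtain ⟨y, hy, hs⟩ := hyp x hxa
      exact ⟨y, hy, hs⟩)
    refine ⟨b, hb, fun x hx => ?_⟩
    obtain ⟨y, hy, h1, h2⟩ := H x (ht.mem_trans hx ha) (by simpa using hx)
    exact ⟨y, by simpa using h1, h2⟩

theorem PM.ax {D : ZFSet.{u}} (h : PM D) : ∀ φ ∈ PAx, ∀ v : ℕ → ZFSet.{u}, (∀ n, v n ∈ D) → Sat D.toSet φ v := by
  intro φ hφ v hv
  simp only [PAx, Set.mem_union, Set.mem_insert_iff, Set.mem_singleton_iff, Set.mem_range] at hφ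
  rcases hφ with ((rfl | rfl) | ⟨φ, rfl⟩) | ⟨φ, rfl⟩
  · simp only [axP, sat_ex, sat_iff, Sat]
    refine ⟨{v 0, v 1}, h.pr _ (hv 0) _ (hv 1), fun x hx => ?_⟩
    simp; tauto
  · simp only [axU, sat_ex, sat_iff, sat_and, Sat]
    refine ⟨_, h.un _ (hv 0), fun x hx => ?_⟩
    simp
    constructor
    · rintro ⟨y, hy, hw⟩; exact ⟨y, h.mem (hv 0) hy, hy, hw⟩
    · rintro ⟨y, _, hy, hw⟩; exact ⟨y, hy, hw⟩
  · simp only [axS, sat_ex, sat_iff, sat_and, Sat]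
    obtain ⟨b, hb, H⟩ := h.sp φ v hv _ (hv (φ.bd + 1))
    refine ⟨b, hb, fun x hx => ?_⟩
    simp
    rw [H]
    refine and_congr_right fun _ => sat_bd _ _ _ _ fun n hn => ?_
    by_cases h0 : n = 0
    · simp [h0]
    · simp [h0, show n ≠ φ.bd + 2 by omega]
  · have e : ∀ x y b, (Sat D.toSet φ (Function.update (Function.update (Function.update v (φ.bd+3) b) 0 x) 1 y) ↔
      Sat D.toSet φ (Function.update (Function.update v 0 x) 1 y)) := by
      intro x y b
      refine sat_bd _ _ _ _ fun n hn => ?_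
      by_cases h0 : n = 0
      · simp [h0]
      · by_cases h1 : n = 1 <;> simp [h0, h1, show n ≠ φ.bd + 3 by omega]
    simp only [axC, sat_ex, sat_and, Sat, e]
    intro hyp
    obtain ⟨b, hb, H⟩ := h.co φ v hv _ (hv (φ.bd + 2)) (fun x hx => by
      obtain ⟨y, hy, hs⟩ := hyp x (h.mem (hv _) hx) (by simpa using hx)
      exact ⟨y, hy, hs⟩)
    refine ⟨b, hb, fun x hx hxa => ?_⟩
    simp at hxa
    obtain ⟨y, hy, hs⟩ := H x hxa
    exact ⟨y, h.mem hb hy, by simpa using hy, hs⟩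

/-- elementary maps -/
def Elem (M N : ZFSet.{u}) (j : ZFSet.{u} → ZFSet.{u}) : Prop :=
  (∀ x ∈ M, j x ∈ N) ∧ ∀ (φ : Fml) (v : ℕ → ZFSet.{u}), (∀ n, v n ∈ M) →
    (Sat M.toSet φ v ↔ Sat N.toSet φ (fun n => j (v n)))

theorem Elem.ofSub {M N : ZFSet.{u}} (h : ElemSub M.toSet N.toSet) : Elem M N id :=
  ⟨fun x hx => h.1 hx, h.2⟩

theorem Elem.pm {M N : ZFSet.{u}} {j} (h : Elem M N j) (hM : PM M) (hN : N.IsTransitive) : PM N := by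
  have h1 := h.1 _ hM.ne
  have h0 : ∅ ∈ N := by
    by_contra hne
    have : ∀ x : ZFSet.{u}, x ∉ N := by
      intro x
      induction x using ZFSet.inductionOn with
      | _ x ih =>
        intro hx
        rcases ZFSet.eq_empty_or_nonempty x with rfl | ⟨y, hy⟩
        · exact hne hx
        · exact ih y hy (hN.mem_trans hy hx)
    exact this _ h1
  refine pm_of_ax hN h0 fun φ hφ v hv => ?_
  obtain ⟨ψ, hψ⟩ := sat_closure φ
  have := (hψ M.toSet (fun _ => ∅) (fun _ => hM.ne)).2 (fun v hv => hM.ax φ hφ v hv)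
  have := (h.2 ψ (fun _ => ∅) (fun _ => hM.ne)).1 this
  exact (hψ N.toSet _ (fun _ => h1)).1 this v hv

/-- downward transfer to transitive elementary substructures -/
theorem pm_of_sub {M N : ZFSet.{u}} (h : ElemSub M.toSet N.toSet) (hN : PM N) (hM : M.IsTransitive)
    (h0 : ∅ ∈ M) : PM M := by
  refine pm_of_ax hM h0 fun φ hφ v hv => ?_
  exact (h.2 φ v hv).2 (hN.ax φ hφ v fun n => h.1 (hv n))

theorem Elem.df {M N : ZFSet.{u}} {j} (h : Elem M N j) (hM : PM M) (hN : PM N)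
    (P : ZFSet.{u} → (ℕ → ZFSet.{u}) → Prop) [hP : Def P] (v : ℕ → ZFSet.{u}) (hv : ∀ n, v n ∈ M) :
    P M v ↔ P N (fun n => j (v n)) := by
  obtain ⟨φ, hφ⟩ := hP.ex
  rw [← hφ M hM v hv, h.2 φ v hv, hφ N hN _ (fun n => h.1 _ (hv n))]

theorem Elem.dfl {M N : ZFSet.{u}} {j} (h : Elem M N j) (hM : PM M) (hN : PM N)
    (P : ZFSet.{u} → (ℕ → ZFSet.{u}) → Prop) (l : List ZFSet.{u}) (hl : ∀ x ∈ l, x ∈ M) [hP : Def P]  :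
    P M (env l) ↔ P N (fun n => j (env l n)) := h.df hM hN P _ (env_in hM hl)

theorem PM.of_model {M : ZFSet.{u}} (h : IsTransModel M) : PM M := by
  refine ⟨h.1, ?_, h.2.2.1, h.2.2.2.1, h.2.2.2.2.1, h.2.2.2.2.2.1⟩
  exact h.1.mem_trans ZFSet.omega_zero h.2.1

/-! ### omega -/
def nz (n : ℕ) : ZFSet.{u} := ZFSet.mk (PSet.ofNat n)

theorem nz_zero : nz.{u} 0 = ∅ := rfl
theorem nz_succ (n : ℕ) : nz.{u} (n + 1) = insert (nz n) (nz n) := rfl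

theorem mem_omega {z : ZFSet.{u}} : z ∈ ZFSet.omega ↔ ∃ n, z = nz n := by
  constructor
  · refine Quotient.inductionOn z fun z h => ?_
    obtain ⟨⟨n⟩, hn⟩ := h
    exact ⟨n, ZFSet.sound hn⟩
  · rintro ⟨n, rfl⟩
    exact ⟨⟨n⟩, PSet.Equiv.rfl⟩

theorem nz_ord (n : ℕ) : (nz.{u} n).IsOrdinal := by
  induction n with
  | zero => exact isOrdinal_empty
  | succ n ih => exact isOrdinal_succ ih

theorem mem_nz {n : ℕ} {z : ZFSet.{u}} : z ∈ nz n ↔ ∃ m < n, z = nz m := by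
  induction n with
  | zero => simp [nz_zero]
  | succ n ih =>
    rw [nz_succ, ZFSet.mem_insert_iff, ih]
    constructor
    · rintro (rfl | ⟨m, hm, rfl⟩)
      · exact ⟨n, by omega, rfl⟩
      · exact ⟨m, by omega, rfl⟩
    · rintro ⟨m, hm, rfl⟩
      rcases Nat.lt_succ_iff_lt_or_eq.1 hm with h | rfl
      · exact Or.inr ⟨m, h, rfl⟩
      · exact Or.inl rfl

theorem nz_inj {m n : ℕ} (h : nz.{u} m = nz n) : m = n := by
  by_contra hne
  rcases lt_or_gt_of_ne hne with h1 | h1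
  · have : nz.{u} m ∈ nz.{u} n := mem_nz.2 ⟨m, h1, rfl⟩
    rw [h] at this; exact ZFSet.mem_irrefl _ this
  · have : nz.{u} n ∈ nz.{u} m := mem_nz.2 ⟨n, h1, rfl⟩
    rw [h] at this; exact ZFSet.mem_irrefl _ this

theorem omega_tr : (ZFSet.omega.{u}).IsTransitive := by
  intro x hx y hy
  obtain ⟨n, rfl⟩ := mem_omega.1 hx
  obtain ⟨m, _, rfl⟩ := mem_nz.1 hy
  exact mem_omega.2 ⟨m, rfl⟩

theorem omega_ord : (ZFSet.omega.{u}).IsOrdinal := by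
  rw [← isOrd_iff]
  refine ⟨omega_tr, fun y hy => ?_⟩
  obtain ⟨n, rfl⟩ := mem_omega.1 hy
  exact (nz_ord n).isTransitive

theorem card_omega : card ZFSet.omega.{u} = Cardinal.aleph0 := by
  have e : zcard ZFSet.omega.{u} = Cardinal.aleph0 := by
    have : Function.Bijective (fun n : ℕ => (⟨nz n, mem_omega.2 ⟨n, rfl⟩⟩ : ZFSet.omega.{u}.toSet)) := by
      constructor
      · intro a b h; exact nz_inj (congrArg Subtype.val h)
      · rintro ⟨z, hz⟩
        obtain ⟨n, rfl⟩ := mem_omega.1 hz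
        exact ⟨n, rfl⟩
    have := Cardinal.mk_congr_lift (Equiv.ofBijective _ this)
    simp at this
    exact this.symm
  rw [zcard_eq] at e
  simpa using e

theorem nz_card (n : ℕ) : card (nz.{u} n) < Cardinal.aleph0 := by
  induction n with
  | zero => rw [nz_zero, card_empty]; exact Cardinal.aleph0_pos
  | succ n ih =>
    rw [nz_succ]
    exact (card_insert_le).trans_lt (Cardinal.add_lt_aleph0 ih Cardinal.one_lt_aleph0)

theorem omega_sub {κ : ZFSet.{u}} (h : InfC κ) : ZFSet.omega.{u} ⊆ κ := by
  intro x hx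
  obtain ⟨n, rfl⟩ := mem_omega.1 hx
  exact h.1.mem_of_card (nz_ord n) ((nz_card n).trans_le h.2)

/-- definable functions are sets -/
theorem PM.fun_of {D : ZFSet.{u}} (hD : PM D) (Q : ZFSet → ZFSet → ZFSet → (ℕ → ZFSet) → Prop)
    (l : List ZFSet.{u})
    (hl : ∀ x ∈ l, x ∈ D) {a : ZFSet.{u}} (ha : a ∈ D)
    (h : ∀ x ∈ a, ∃ y ∈ D, Q D x y (env l) ∧ ∀ z ∈ D, Q D x z (env l) → z = y)
    [hQ : Def (fun D v => Q D (v 0) (v 1) (fun n => v (n + 2)))] :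
    ∃ F ∈ D, IsZFunc a F ∧ ∀ x ∈ a, fapp F x ∈ D ∧ Q D x (fapp F x) (env l) := by
  have h' : ∀ x, ∃ y, x ∈ a → y ∈ D ∧ Q D x y (env l) ∧ ∀ z ∈ D, Q D x z (env l) → z = y := by
    intro x
    by_cases hx : x ∈ a
    · obtain ⟨y, hy⟩ := h x hx
      exact ⟨y, fun _ => hy⟩
    · exact ⟨∅, fun h => absurd h hx⟩
  choose G hG using h'
  refine ⟨MPaper.grf G a, hD.grf Q l hl ha (fun x hx => (hG x hx).1) ?_, grf_func G a, fun x hx => ?_⟩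
  · intro x hx y hy
    constructor
    · exact (hG x hx).2.2 y hy
    · rintro rfl; exact (hG x hx).2.1
  · rw [grf_app hx]; exact ⟨(hG x hx).1, (hG x hx).2.1⟩

/-- definable choice from a well-orderable superset. -/
theorem PM.choice {D : ZFSet.{u}} (hD : PM D) (hw : ∀ x ∈ D, ∃ r ∈ D, IsWellOrderOn x r)
    (Q : ZFSet → ZFSet → ZFSet → (ℕ → ZFSet) → Prop)
    (l : List ZFSet.{u})
    (hl : ∀ x ∈ l, x ∈ D) {a : ZFSet.{u}} (ha : a ∈ D)
    (h : ∀ x ∈ a, ∃ y ∈ D, Q D x y (env l))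
    [hQ : Def (fun D v => Q D (v 0) (v 1) (fun n => v (n + 2)))] :
    ∃ F ∈ D, IsZFunc a F ∧ ∀ x ∈ a, fapp F x ∈ D ∧ Q D x (fapp F x) (env l) := by
  obtain ⟨b, hb, hb'⟩ := hD.coll Q (env l) (env_in hD hl) ha h
  obtain ⟨r, hr, hwr⟩ := hw b hb
  have i1 : Def (fun D v => Q D (v 0) (v 1) (fun n => v (n + 2 + 1 + 1))) :=
    Def.ren hQ (fun n => Nat.casesOn n 0 (fun n => Nat.casesOn n 1 (fun k => k + 4)))
  have i2 : Def (fun D v => Q D (v 1) (v 0) (fun n => v (n + 2 + 1 + 1 + 1))) :=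
    Def.ren hQ (fun n => Nat.casesOn n 1 (fun n => Nat.casesOn n 0 (fun k => k + 5)))
  obtain ⟨F, hF, hf, H⟩ := hD.fun_of (fun D x y v => y ∈ v 0 ∧ Q D x y (fun n => v (n + 2)) ∧
    ∀ z, z ∈ v 0 → Q D x z (fun n => v (n + 2)) → ZFSet.pair z y ∉ v 1) (b :: r :: l)
    (by simpa [hb, hr] using hl) ha (fun x hx => by
      obtain ⟨y, hy, hQy⟩ := hb' x hx
      obtain ⟨y0, ⟨hy0, hQ0⟩, hmin⟩ := hwr.2.2.2.2 {y | y ∈ b ∧ Q D x y (env l)} (fun y hy => hy.1) ⟨y, hy, hQy⟩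
      refine ⟨y0, hD.mem hb hy0, ⟨hy0, hQ0, fun z hz hQz => hmin z ⟨hz, hQz⟩⟩, ?_⟩
      rintro z hzD ⟨hz, hQz, hzm⟩
      rcases hwr.2.1 z hz y0 hy0 with h | h | h
      · exact h
      · exact absurd h (hmin z ⟨hz, hQz⟩)
      · exact absurd h (hzm y0 hy0 hQ0))
    (hQ := @Def.and _ _ _ (@Def.and _ _ i1 (@Def.ball (fun D z v => Q D (v 0) z (fun n => v (n + 2 + 2)) → ZFSet.pair z (v 1) ∉ v 3) (fun D v => v 2) _
      (@Def.imp _ _ i2 _))))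
  exact ⟨F, hF, hf, fun x hx => ⟨(H x hx).1, (H x hx).2.2.1⟩⟩

/-! ### sets of size at most κ in a model -/
def Cov (D κ t : ZFSet.{u}) : Prop :=
  ∃ f, f ∈ D ∧ (IsZFunc κ f ∧ ∀ y, y ∈ t → ∃ ξ, ξ ∈ κ ∧ fapp f ξ = y)

instance Def.cov {s t : ZFSet → (ℕ → ZFSet) → ZFSet} [hs : TDef s] [ht : TDef t] :
    Def (fun D v => Cov D (s D v) (t D v)) := by unfold Cov; infer_instance

def HM (D κ x : ZFSet.{u}) : Prop := ∃ t, t ∈ D ∧ (t.IsTransitive ∧ x ∈ t ∧ Cov D κ t)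

instance Def.HM {s t : ZFSet → (ℕ → ZFSet) → ZFSet} [hs : TDef s] [ht : TDef t] :
    Def (fun D v => HM D (s D v) (t D v)) := by unfold MPaper.HM; infer_instance

theorem Cov.mono {D κ s t : ZFSet.{u}} (h : Cov D κ t) (hs : s ⊆ t) : Cov D κ s := by
  obtain ⟨f, h1, h2, h3⟩ := h
  exact ⟨f, h1, h2, fun y hy => h3 y (hs hy)⟩

theorem Cov.ofUnion {D κ F t : ZFSet.{u}} (hD : PM D) (hi : InfC κ) (hκ : κ ∈ D) (hF : F ∈ D)
    (h : ∀ y ∈ t, ∃ a ∈ κ, ∃ b ∈ κ, fapp (fapp F a) b = y) : Cov D κ t := by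
  have hgp := (gp_spec hi).2.2 D hD hκ
  obtain ⟨G, hG, hGf, H⟩ := hD.fun_of (fun D η y v =>
    (∃ a, a ∈ v 0 ∧ ∃ b, b ∈ v 0 ∧ (η = fapp (v 1) (ZFSet.pair a b) ∧ y = fapp (fapp (v 2) a) b)) ∨
    ((¬ ∃ a, a ∈ v 0 ∧ ∃ b, b ∈ v 0 ∧ (η = fapp (v 1) (ZFSet.pair a b))) ∧ y = ∅))
    [κ, grf (gp κ) (ZFSet.prod κ κ), F] (by simp [hκ, hgp, hF]) hκ (fun η hη => by
      by_cases hc : ∃ a, a ∈ κ ∧ ∃ b, b ∈ κ ∧ (η = fapp (grf (gp κ) (ZFSet.prod κ κ)) (ZFSet.pair a b))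
      · obtain ⟨a, ha, b, hb, e⟩ := hc
        refine ⟨fapp (fapp F a) b, hD.fapp_mem (hD.fapp_mem hF (hD.mem hκ ha)) (hD.mem hκ hb),
          Or.inl ⟨a, ha, b, hb, e, rfl⟩, ?_⟩
        rintro z hz (⟨a', ha', b', hb', e', h'⟩ | ⟨h', _⟩)
        · have e' : η = fapp (grf (gp κ) (ZFSet.prod κ κ)) (ZFSet.pair a' b') := e'
          rw [gp_app hi ha' hb'] at e'
          rw [gp_app hi ha hb, e'] at e
          obtain ⟨rfl, rfl⟩ := (gp_spec hi).2.1 _ ha' _ hb' _ ha _ hb e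
          exact h'
        · exact absurd ⟨a, ha, b, hb, e⟩ h'
      · refine ⟨∅, hD.ne, Or.inr ⟨hc, rfl⟩, ?_⟩
        rintro z hz (⟨a', ha', b', hb', e', h'⟩ | ⟨_, h'⟩)
        · exact absurd ⟨a', ha', b', hb', e'⟩ hc
        · exact h')
  refine ⟨G, hG, hGf, fun y hy => ?_⟩
  obtain ⟨a, ha, b, hb, e⟩ := h y hy
  have hη := (gp_spec hi).1 a ha b hb
  refine ⟨_, hη, ?_⟩
  rcases (H _ hη).2 with ⟨a', ha', b', hb', e', h'⟩ | ⟨h', _⟩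
  · have e' : gp κ (ZFSet.pair a b) = fapp (grf (gp κ) (ZFSet.prod κ κ)) (ZFSet.pair a' b') := e'
    rw [gp_app hi ha' hb'] at e'
    obtain ⟨rfl, rfl⟩ := (gp_spec hi).2.1 _ ha _ hb _ ha' _ hb' e'
    exact h'.trans e
  · exact absurd ⟨a, ha, b, hb, (gp_app hi ha hb).symm⟩ h'

theorem Cov.single {D κ x : ZFSet.{u}} (hD : PM D) (hi : InfC κ) (hκ : κ ∈ D) (hx : x ∈ D) : Cov D κ {x} := by
  refine ⟨_, hD.grfT (fun D v => v 1) [x] (by simp [hx]) hκ, grf_func _ _, fun y hy => ?_⟩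
  rw [ZFSet.mem_singleton] at hy
  subst hy
  exact ⟨∅, hi.ex2.1, by rw [grf_app hi.ex2.1]; rfl⟩

theorem Cov.union {D κ s t : ZFSet.{u}} (hD : PM D) (hi : InfC κ) (hκ : κ ∈ D) (hs : Cov D κ s)
    (ht : Cov D κ t) : Cov D κ (s ∪ t) := by
  obtain ⟨f, hf, hff, hs⟩ := hs
  obtain ⟨g, hg, hgf, ht⟩ := ht
  obtain ⟨F, hF, hFf, H⟩ := hD.fun_of (fun D η y v => (η = ∅ ∧ y = v 0) ∨ (¬ η = ∅ ∧ y = v 1))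
    [f, g] (by simp [hf, hg]) hκ (fun η hη => by
      by_cases hc : η = ∅
      · exact ⟨f, hf, Or.inl ⟨hc, rfl⟩, fun z _ hz => by
          rcases hz with h | h
          · exact h.2
          · exact absurd hc h.1⟩
      · exact ⟨g, hg, Or.inr ⟨hc, rfl⟩, fun z _ hz => by
          rcases hz with h | h
          · exact absurd h.1 hc
          · exact h.2⟩)
  refine Cov.ofUnion hD hi hκ hF fun y hy => ?_
  rcases ZFSet.mem_union.1 hy with hy | hy
  · obtain ⟨b, hb, e⟩ := hs y hy
    refine ⟨∅, hi.ex2.1, b, hb, ?_⟩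
    rcases (H _ hi.ex2.1).2 with h | h
    · rw [h.2]; exact e
    · exact absurd rfl h.1
  · obtain ⟨b, hb, e⟩ := ht y hy
    refine ⟨_, hi.ex2.2, b, hb, ?_⟩
    rcases (H _ hi.ex2.2).2 with h | h
    · have h1 : ∅ ∈ ({∅} : ZFSet.{u}) := ZFSet.mem_singleton.2 rfl
      have h2 : ({∅} : ZFSet.{u}) = ∅ := h.1
      rw [h2] at h1
      exact absurd h1 (ZFSet.notMem_empty _)
    · rw [h.2]; exact e

theorem Cov.self {D κ : ZFSet.{u}} (hD : PM D) (hκ : κ ∈ D) : Cov D κ κ :=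
  ⟨_, hD.grfT (fun D v => v 0) [] (by simp) hκ, grf_func _ _, fun y hy =>
    ⟨y, hy, by rw [grf_app hy]; rfl⟩⟩

/-- surjections from covers -/
theorem Cov.surj {D κ t : ZFSet.{u}} (hD : PM D) (hκ : κ ∈ D) (ht : t ∈ D) (hne : ∃ z, z ∈ t) (h : Cov D κ t) :
    ∃ f ∈ D, IsZFunc κ f ∧ SurjOnto f κ t := by
  obtain ⟨f, hf, hff, hs⟩ := h
  obtain ⟨z0, hz0⟩ := hne
  have hz0D := hD.mem ht hz0
  obtain ⟨F, hF, hFf, H⟩ := hD.fun_of (fun D η y v => (fapp (v 0) η ∈ v 1 ∧ y = fapp (v 0) η) ∨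
    (¬ fapp (v 0) η ∈ v 1 ∧ y = v 2))
    [f, t, z0] (by simp [hf, ht, hz0D]) hκ (fun η hη => by
      by_cases hc : fapp f η ∈ t
      · exact ⟨fapp f η, hD.mem ht hc, Or.inl ⟨hc, rfl⟩, fun z _ hz => by
          rcases hz with h | h
          · exact h.2
          · exact absurd hc h.1⟩
      · exact ⟨z0, hz0D, Or.inr ⟨hc, rfl⟩, fun z _ hz => by
          rcases hz with h | h
          · exact absurd h.1 hc
          · exact h.2⟩)
  refine ⟨F, hF, hFf, fun a ha => ?_, fun b hb => ?_⟩
  · rcases (H a ha).2 with h | h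
    · rw [h.2]; exact h.1
    · rw [h.2]; exact hz0
  · obtain ⟨a, ha, e⟩ := hs b hb
    refine ⟨a, ha, ?_⟩
    rcases (H a ha).2 with h | h
    · exact h.2.trans e
    · exact absurd (show fapp f a ∈ t by rw [e]; exact hb) h.1

/-- image of a covered set -/
theorem Cov.img {D κ t g : ZFSet.{u}} (hD : PM D) (hκ : κ ∈ D) (hg : g ∈ D) {s : ZFSet.{u}}
    (h : Cov D κ t) (hs : ∀ y ∈ s, ∃ x ∈ t, fapp g x = y) : Cov D κ s := by
  obtain ⟨f, hf, hff, hc⟩ := h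
  refine ⟨_, hD.grfT (fun D v => fapp (v 1) (fapp (v 2) (v 0))) [g, f] (by simp [hg, hf]) hκ, grf_func _ _, fun y hy => ?_⟩
  obtain ⟨x, hx, rfl⟩ := hs y hy
  obtain ⟨ξ, hξ, rfl⟩ := hc x hx
  exact ⟨ξ, hξ, by rw [grf_app hξ]; rfl⟩

theorem Cov.card {D κ t : ZFSet.{u}} (h : Cov D κ t) : card t ≤ card κ := by
  obtain ⟨f, hf, hff, hc⟩ := h
  exact card_le_of_surj (fun x => fapp f x) fun y hy => hc y hy

/-- the range of a function with domain in the model. -/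
theorem PM.range {D a F : ZFSet.{u}} (hD : PM D) (ha : a ∈ D) (hF : F ∈ D) : img (fun x => fapp F x) a ∈ D :=
  hD.imgT (fun D v => fapp (v 1) (v 0)) [F] (by simp [hF]) ha

def WOP (D : ZFSet.{u}) : Prop := ∀ x ∈ D, ∃ r ∈ D, IsWellOrderOn x r

theorem HM.mem {D κ x : ZFSet.{u}} (hD : PM D) (h : HM D κ x) : x ∈ D := by
  obtain ⟨t, ht, _, hx, _⟩ := h
  exact hD.mem ht hx

theorem HM.elem {D κ x y : ZFSet.{u}} (h : HM D κ x) (hy : y ∈ x) : HM D κ y := by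
  obtain ⟨t, ht, htr, hx, hc⟩ := h
  exact ⟨t, ht, htr, htr.mem_trans hy hx, hc⟩

theorem HM.cov {D κ x : ZFSet.{u}} (h : HM D κ x) : Cov D κ x := by
  obtain ⟨t, ht, htr, hx, hc⟩ := h
  exact hc.mono (htr.subset_of_mem hx)

theorem HM.of_elems {D κ x : ZFSet.{u}} (hD : PM D) (hw : WOP D) (hi : InfC κ) (hκ : κ ∈ D)
    (hx : x ∈ D) (hc : Cov D κ x) (h : ∀ y ∈ x, HM D κ y) : HM D κ x := by
  obtain ⟨g, hg, hgf, hgs⟩ := id hc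
  obtain ⟨T, hT, hTf, HT⟩ := hD.choice hw (fun D a t v => fapp (v 0) a ∈ v 1 →
    (t.IsTransitive ∧ fapp (v 0) a ∈ t ∧ Cov D (v 2) t)) [g, x, κ] (by simp [hg, hx, hκ]) hκ (fun a ha => by
      by_cases hax : fapp g a ∈ x
      · obtain ⟨t, ht, h1⟩ := h _ hax
        exact ⟨t, ht, fun _ => h1⟩
      · exact ⟨∅, hD.ne, fun h => absurd h hax⟩)
  obtain ⟨G, hG, hGf, HG⟩ := hD.choice hw (fun D a f v => fapp (v 0) a ∈ v 1 →
    ((∀ y, y ∈ fapp (v 3) a → ∃ ξ, ξ ∈ v 2 ∧ fapp f ξ = y))) [g, x, κ, T] (by simp [hg, hx, hκ, hT]) hκ (fun a ha => by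
      by_cases hax : fapp g a ∈ x
      · obtain ⟨f, hf, h1, h2⟩ := ((HT a ha).2 hax).2.2
        exact ⟨f, hf, fun _ => h2⟩
      · exact ⟨∅, hD.ne, fun h => absurd h hax⟩)
  have hs : ZFSet.sep (fun a => fapp g a ∈ x) κ ∈ D :=
    hD.sep (fun D a v => fapp (v 0) a ∈ v 1) (env [g, x]) (env_in hD (by simp [hg, hx])) hκ
  have h0 := hD.un _ (hD.range hs hT)
  set T0 : ZFSet.{u} := ⋃₀ (img (fun a => fapp T a) (ZFSet.sep (fun a => fapp g a ∈ x) κ)) with hT0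
  have m0 : ∀ z, z ∈ T0 ↔ ∃ a ∈ κ, fapp g a ∈ x ∧ z ∈ fapp T a := by
    intro z
    rw [hT0, ZFSet.mem_sUnion]
    constructor
    · rintro ⟨s, hs, hz⟩
      obtain ⟨a, ha, rfl⟩ := mem_img.1 hs
      obtain ⟨h1, h2⟩ := ZFSet.mem_sep.1 ha
      exact ⟨a, h1, h2, hz⟩
    · rintro ⟨a, ha, h1, h2⟩
      exact ⟨_, mem_img.2 ⟨a, ZFSet.mem_sep.2 ⟨ha, h1⟩, rfl⟩, h2⟩
  have c0 : Cov D κ T0 := Cov.ofUnion hD hi hκ hG fun y hy => by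
    obtain ⟨a, ha, h1, h2⟩ := (m0 y).1 hy
    obtain ⟨ξ, hξ, e⟩ := (HG a ha).2 h1 y h2
    exact ⟨a, ha, ξ, hξ, e⟩
  refine ⟨T0 ∪ {x}, hD.union_mem h0 (TDef.cl (t := fun D v => ({v 0} : ZFSet)) D hD (env [x]) (env_in hD (by simp [hx]))), ?_, ?_,
    Cov.union hD hi hκ c0 (Cov.single hD hi hκ hx)⟩
  · intro y hy z hz
    rw [ZFSet.mem_union, ZFSet.mem_singleton] at hy ⊢
    left
    rcases hy with hy | rfl
    · obtain ⟨a, ha, h1, h2⟩ := (m0 y).1 hy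
      exact (m0 z).2 ⟨a, ha, h1, ((HT a ha).2 h1).1.mem_trans hz h2⟩
    · obtain ⟨a, ha, rfl⟩ := hgs z hz
      exact (m0 _).2 ⟨a, ha, hz, ((HT a ha).2 hz).2.1⟩
  · simp

def Hset (M κ : ZFSet.{u}) : ZFSet.{u} := ZFSet.sep (fun x => HM M κ x) M

theorem mem_Hset {M κ x : ZFSet.{u}} (hM : PM M) : x ∈ Hset M κ ↔ HM M κ x := by
  rw [Hset, ZFSet.mem_sep]
  exact ⟨fun h => h.2, fun h => ⟨h.mem hM, h⟩⟩

theorem def_sat_H (φ : Fml) : ∀ (m : ZFSet.{u} → (ℕ → ZFSet.{u}) → ZFSet.{u})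
    (t : ℕ → ZFSet.{u} → (ℕ → ZFSet.{u}) → ZFSet.{u}), TDef m → (∀ k, TDef (t k)) →
    Def (fun D v => Sat (Hset D (m D v)).toSet φ (fun k => t k D v)) := by
  induction φ with
  | mem i j => intro m t hm ht; have := ht i; have := ht j; simp only [Sat]; infer_instance
  | eq i j => intro m t hm ht; have := ht i; have := ht j; simp only [Sat]; infer_instance
  | impl φ ψ ih1 ih2 =>
    intro m t hm ht; have := ih1 m t hm ht; have := ih2 m t hm ht
    simp only [Sat]; infer_instance
  | neg φ ih =>
    intro m t hm ht; have := ih m t hm ht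
    simp only [Sat]; infer_instance
  | all n φ ih =>
    intro m t hm ht
    have := ih (fun D v => m D (fun n => v (n + 1)))
      (fun k => if k = n then (fun D v => v 0) else (fun D v => t k D (fun n => v (n + 1))))
      inferInstance
      (fun k => by
        have := ht k
        by_cases hk : k = n
        · simp only [hk, if_true]; infer_instance
        · simp only [hk, if_false]; infer_instance)
    have h2 : Def (fun D v => Sat (Hset D (m D (fun n => v (n + 1)))).toSet φ (Function.update
        (fun k => t k D (fun n => v (n + 1))) n (v 0))) := by
      convert this using 5 with D v
      rename_i k
      by_cases hk : k = n
      · subst hk; simp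
      · simp [hk]
    refine Def.congr (Q := fun D v => ∀ x, x ∈ D → (HM D (m D v) x → Sat (Hset D (m D v)).toSet φ (Function.update (fun k => t k D v) n x))) ?_ ?_
    · exact @Def.allD (fun D x v => HM D (m D v) x → Sat (Hset D (m D v)).toSet φ (Function.update (fun k => t k D v) n x))
        (@Def.imp _ _ inferInstance h2)
    · intro D hD v hv
      simp only [Sat]
      constructor
      · intro h x _ hx; exact h x ((mem_Hset hD).2 hx)
      · intro h x hx; exact h x (((mem_Hset hD).1 hx).mem hD) ((mem_Hset hD).1 hx)

/-- every element has a transitive closure of size κ -/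
def Hlike (κ m : ZFSet.{u}) : Prop := ∀ y, y ∈ m → HM m κ y

theorem Hlike.wop {κ m : ZFSet.{u}} (hm : PM m) (hκ : κ ∈ m) (ho : κ.IsOrdinal) (h : Hlike κ m) : WOP m := by
  intro x hx
  obtain ⟨f, hf, hff, hs⟩ := (h x hx).cov
  let L : ZFSet.{u} → ZFSet.{u} → Prop := fun y z => ∃ a, a ∈ κ ∧ (fapp f a = y ∧ ∀ b, b ∈ κ → fapp f b = z → a ∈ b)
  have hmin : ∀ S : Set ZFSet.{u}, (∃ a ∈ κ, fapp f a ∈ S) → ∃ a ∈ κ, fapp f a ∈ S ∧ ∀ b ∈ κ, fapp f b ∈ S → ¬ b ∈ a := by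
    rintro S ⟨a, ha, hS⟩
    obtain ⟨a0, ⟨h1, h2⟩, h3⟩ := ZFSet.mem_wf.has_min {a | a ∈ κ ∧ fapp f a ∈ S} ⟨a, ha, hS⟩
    exact ⟨a0, h1, h2, fun b hb hbS hlt => h3 b ⟨hb, hbS⟩ hlt⟩
  have tri : ∀ a ∈ κ, ∀ b ∈ κ, a ∈ b ∨ a = b ∨ b ∈ a := fun a ha b hb =>
    (ho.mem ha).mem_trichotomous (ho.mem hb)
  have irr : ∀ y, (∃ a ∈ κ, fapp f a = y) → ¬ L y y := by
    rintro y - ⟨a, ha, e, h'⟩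
    exact ZFSet.mem_irrefl _ (h' a ha e)
  refine ⟨ZFSet.sep (fun p => ∃ y, y ∈ x ∧ ∃ z, z ∈ x ∧ (p = ZFSet.pair y z ∧ L y z)) (ZFSet.prod x x),
    hm.sep (fun D p v => ∃ y, y ∈ v 0 ∧ ∃ z, z ∈ v 0 ∧ (p = ZFSet.pair y z ∧ ∃ a, a ∈ v 1 ∧ (fapp (v 2) a = y ∧ ∀ b, b ∈ v 1 → fapp (v 2) b = z → a ∈ b)))
      (env [x, κ, f]) (env_in hm (by simp [hx, hκ, hf])) (hm.prod_mem hx hx), ?_⟩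
  have mr : ∀ y ∈ x, ∀ z ∈ x, (ZFSet.pair y z ∈ ZFSet.sep (fun p => ∃ y, y ∈ x ∧ ∃ z, z ∈ x ∧ (p = ZFSet.pair y z ∧ L y z)) (ZFSet.prod x x) ↔ L y z) := by
    intro y hy z hz
    rw [ZFSet.mem_sep, ZFSet.pair_mem_prod]
    constructor
    · rintro ⟨-, y', -, z', -, e, h⟩
      obtain ⟨rfl, rfl⟩ := ZFSet.pair_inj.1 e
      exact h
    · intro h; exact ⟨⟨hy, hz⟩, y, hy, z, hz, rfl, h⟩
  refine ⟨?_, ?_, ?_, ?_, ?_⟩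
  · intro p hp
    obtain ⟨-, y, hy, z, hz, e, -⟩ := ZFSet.mem_sep.1 hp
    exact ⟨y, hy, z, hz, e⟩
  · intro y hy z hz
    rw [mr y hy z hz, mr z hz y hy]
    obtain ⟨a, ha, e1, h1⟩ := hmin {y} (hs y hy)
    obtain ⟨b, hb, e2, h2⟩ := hmin {z} (hs z hz)
    rcases tri a ha b hb with h | h | h
    · right; left
      refine ⟨a, ha, e1, fun c hc e3 => ?_⟩
      rcases tri b hb c hc with h' | h' | h'
      · exact (ho.mem hc).mem_trans h h'
      · exact h' ▸ h
      · exact absurd h' (h2 c hc e3)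
    · left; rw [← Set.mem_singleton_iff.1 e1, ← Set.mem_singleton_iff.1 e2, h]
    · right; right
      refine ⟨b, hb, e2, fun c hc e3 => ?_⟩
      rcases tri a ha c hc with h' | h' | h'
      · exact (ho.mem hc).mem_trans h h'
      · exact h' ▸ h
      · exact absurd h' (h1 c hc e3)
  · intro a ha b hb c hc h1 h2
    rw [mr _ ha _ hb] at h1
    rw [mr _ hb _ hc] at h2
    rw [mr _ ha _ hc]
    obtain ⟨i, hi, e1, h1⟩ := h1
    obtain ⟨k, hk, e2, h2⟩ := h2
    exact ⟨i, hi, e1, fun l hl e => (ho.mem hl).mem_trans (h1 k hk e2) (h2 l hl e)⟩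
  · intro a ha h
    rw [mr _ ha _ ha] at h
    exact irr a (hs a ha) h
  · intro S hS ⟨y, hy⟩
    obtain ⟨a, ha, e, h⟩ := hmin S (by
      obtain ⟨a, ha, e⟩ := hs y (hS hy)
      exact ⟨a, ha, e ▸ hy⟩)
    refine ⟨_, e, fun b hb hbb => ?_⟩
    rw [mr _ (hS hb) _ (hS e)] at hbb
    obtain ⟨c, hc, rfl, h'⟩ := hbb
    exact h c hc hb (h' a ha rfl)

theorem Hset_pm {M κ : ZFSet.{u}} (hM : PM M) (hw : WOP M) (hi : InfC κ) (hκ : κ ∈ M) :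
    PM (Hset M κ) ∧ κ ∈ Hset M κ ∧ Hlike κ (Hset M κ) := by
  have hκH : HM M κ κ := HM.of_elems hM hw hi hκ hκ (Cov.self hM hκ) fun y hy =>
    ⟨κ, hκ, hi.1.ord.isTransitive, hy, Cov.self hM hκ⟩
  have hpr : ∀ x, HM M κ x → ∀ y, HM M κ y → HM M κ {x, y} := by
    intro x hx y hy
    refine HM.of_elems hM hw hi hκ (hM.pr _ (hx.mem hM) _ (hy.mem hM)) ?_ ?_
    · refine (Cov.union hM hi hκ (Cov.single hM hi hκ (hx.mem hM)) (Cov.single hM hi hκ (hy.mem hM))).mono ?_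
      intro z hz; simpa using hz
    · intro z hz
      rcases ZFSet.mem_pair.1 hz with rfl | rfl <;> assumption
  have hpm : PM (Hset M κ) := by
    refine ⟨?_, ?_, ?_, ?_, ?_, ?_⟩
    · intro x hx y hy
      rw [mem_Hset hM] at hx ⊢
      exact hx.elem hy
    · exact (mem_Hset hM).2 (hκH.elem hi.ex2.1)
    · intro x hx y hy
      rw [mem_Hset hM] at *
      exact hpr x hx y hy
    · intro x hx
      rw [mem_Hset hM] at *
      obtain ⟨t, ht, htr, hxt, hc⟩ := hx
      refine HM.of_elems hM hw hi hκ (hM.un _ (hM.mem ht hxt)) (hc.mono ?_) ?_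
      · intro z hz
        obtain ⟨y, hy, hz⟩ := ZFSet.mem_sUnion.1 hz
        exact htr.mem_trans hz (htr.mem_trans hy hxt)
      · intro z hz
        obtain ⟨y, hy, hz⟩ := ZFSet.mem_sUnion.1 hz
        exact ⟨t, ht, htr, htr.mem_trans hz (htr.mem_trans hy hxt), hc⟩
    · intro φ v hv a ha
      have ha' := (mem_Hset hM).1 ha
      have hv' : ∀ n, v n ∈ M := fun n => ((mem_Hset hM).1 (hv n)).mem hM
      have hdef : Def (fun D w => Sat (Hset D (w 1)).toSet φ (Function.update (fun n => w (n + 2)) 0 (w 0))) := by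
        have := def_sat_H φ (fun D w => w 1) (fun k => if k = 0 then (fun D w => w 0) else fun D w => w (k + 2))
          inferInstance (fun k => by by_cases hk : k = 0 <;> simp only [hk, if_true, if_false] <;> infer_instance)
        convert this using 5 with D w
        rename_i k
        by_cases hk : k = 0
        · subst hk; simp
        · simp [hk]
      have hb := hM.sep (fun D x w => Sat (Hset D (w 0)).toSet φ (Function.update (fun n => w (n + 1)) 0 x))
        (hQ := hdef) (fun n => Nat.casesOn n κ v) (fun n => by cases n; exacts [hκ, hv' _]) (ha'.mem hM)
      refine ⟨_, (mem_Hset hM).2 (HM.of_elems hM hw hi hκ hb (ha'.cov.mono ?_) ?_), fun x => ?_⟩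
      · intro z hz; exact (ZFSet.mem_sep.1 hz).1
      · intro z hz; exact ha'.elem (ZFSet.mem_sep.1 hz).1
      · exact ZFSet.mem_sep
    · intro φ v hv a ha hyp
      have ha' := (mem_Hset hM).1 ha
      have hv' : ∀ n, v n ∈ M := fun n => ((mem_Hset hM).1 (hv n)).mem hM
      have hdef : Def (fun D w => Sat (Hset D (w 2)).toSet φ (Function.update (Function.update (fun n => w (n + 3)) 0 (w 0)) 1 (w 1))) := by
        have := def_sat_H φ (fun D w => w 2) (fun k => if k = 1 then (fun D w => w 1) else if k = 0 then (fun D w => w 0) else fun D w => w (k + 3))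
          inferInstance (fun k => by
            rcases k with _ | _ | k
            · show TDef (fun D w => w 0); infer_instance
            · show TDef (fun D w => w 1); infer_instance
            · simp only [show ¬ (k + 1 + 1 = 1) by omega, show ¬ (k + 1 + 1 = 0) by omega, if_false]; infer_instance)
        convert this using 5 with D w
        rename_i k
        by_cases hk1 : k = 1
        · subst hk1; simp
        · by_cases hk : k = 0
          · subst hk; simp
          · simp [hk, hk1]
      have hcv : ∀ n : ℕ, (Nat.casesOn n κ v : ZFSet.{u}) ∈ M := fun n => by cases n; exacts [hκ, hv' _]
      have hd2 : Def (fun D w => HM D (w 2) (w 1) ∧ Sat (Hset D (w 2)).toSet φ (Function.update (Function.update (fun n => w (n + 3)) 0 (w 0)) 1 (w 1))) := inferInstance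
      obtain ⟨b, hb, hbb⟩ := hM.coll (fun D x y w => HM D (w 0) y ∧ Sat (Hset D (w 0)).toSet φ (Function.update (Function.update (fun n => w (n + 1)) 0 x) 1 y))
        (hQ := hd2) (fun n => Nat.casesOn n κ v) hcv (ha'.mem hM) (fun x hx => by
          obtain ⟨y, hy, h⟩ := hyp x hx
          exact ⟨y, ((mem_Hset hM).1 hy).mem hM, (mem_Hset hM).1 hy, h⟩)
      -- choose inside `b`
      have hR : ZFSet.sep (fun p => ∃ x, x ∈ a ∧ ∃ y, y ∈ b ∧ (p = ZFSet.pair x y ∧ (HM M κ y ∧ Sat (Hset M κ).toSet φ (Function.update (Function.update v 0 x) 1 y)))) (ZFSet.prod a b) ∈ M :=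
        hM.sep (fun D p w => ∃ x, x ∈ w 0 ∧ ∃ y, y ∈ w 1 ∧ (p = ZFSet.pair x y ∧ (HM D (w 2) y ∧ Sat (Hset D (w 2)).toSet φ (Function.update (Function.update (fun n => w (n + 3)) 0 x) 1 y))))
          (hQ := by
            have i3 : Def (fun D w => HM D (w 5) (w 0) ∧ Sat (Hset D (w 5)).toSet φ (Function.update (Function.update (fun n => w (n + 6)) 0 (w 1)) 1 (w 0))) :=
              Def.ren hd2 (fun n => match n with | 0 => 1 | 1 => 0 | 2 => 5 | k + 3 => k + 6)
            exact @Def.bex (fun D x w => ∃ y, y ∈ w 2 ∧ (w 0 = ZFSet.pair x y ∧ (HM D (w 3) y ∧ Sat (Hset D (w 3)).toSet φ (Function.update (Function.update (fun n => w (n + 4)) 0 x) 1 y)))) (fun D w => w 1) _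
              (@Def.bex (fun D y w => (w 1 = ZFSet.pair (w 0) y ∧ (HM D (w 4) y ∧ Sat (Hset D (w 4)).toSet φ (Function.update (Function.update (fun n => w (n + 5)) 0 (w 0)) 1 y)))) (fun D w => w 3) _ (@Def.and _ _ _ i3)))
          (fun n => match n with | 0 => a | 1 => b | 2 => κ | k + 3 => v k)
          (fun n => match n with | 0 => ha'.mem hM | 1 => hb | 2 => hκ | k + 3 => hv' k) (hM.prod_mem (ha'.mem hM) hb)
      set R := ZFSet.sep (fun p => ∃ x, x ∈ a ∧ ∃ y, y ∈ b ∧ (p = ZFSet.pair x y ∧ (HM M κ y ∧ Sat (Hset M κ).toSet φ (Function.update (Function.update v 0 x) 1 y)))) (ZFSet.prod a b) with hRdef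
      have mR : ∀ x y, ZFSet.pair x y ∈ R → HM M κ y ∧ Sat (Hset M κ).toSet φ (Function.update (Function.update v 0 x) 1 y) := by
        intro x y h
        rw [hRdef, ZFSet.mem_sep] at h
        obtain ⟨-, x', -, y', -, e, h⟩ := h
        obtain ⟨rfl, rfl⟩ := ZFSet.pair_inj.1 e
        exact h
      obtain ⟨F, hF, hFf, HF⟩ := hM.choice hw (fun D x y w => ZFSet.pair x y ∈ w 0) [R] (by simp [hR]) (ha'.mem hM)
        (fun x hx => by
          obtain ⟨y, hy, h⟩ := hbb x hx
          exact ⟨y, hM.mem hb hy, (show ZFSet.pair x y ∈ R from ZFSet.mem_sep.2 ⟨ZFSet.pair_mem_prod.2 ⟨hx, hy⟩, x, hx, y, hy, rfl, h⟩)⟩)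
      refine ⟨img (fun x => fapp F x) a, (mem_Hset hM).2 (HM.of_elems hM hw hi hκ (hM.range (ha'.mem hM) hF) ?_ ?_), ?_⟩
      · exact Cov.img hM hκ hF ha'.cov (fun y hy => mem_img.1 hy)
      · intro y hy
        obtain ⟨x, hx, rfl⟩ := mem_img.1 hy
        exact (mR _ _ (HF x hx).2).1
      · intro x hx
        exact ⟨_, mem_img.2 ⟨x, hx, rfl⟩, (mR _ _ (HF x hx).2).2⟩
  refine ⟨hpm, (mem_Hset hM).2 hκH, fun y hy => ?_⟩
  obtain ⟨t, ht, htr, hyt, hc⟩ := (mem_Hset hM).1 hy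
  obtain ⟨f, hf, hff, hs⟩ := Cov.surj hM hκ ht ⟨y, hyt⟩ hc
  have htH : HM M κ t := HM.of_elems hM hw hi hκ ht hc fun z hz => ⟨t, ht, htr, hz, hc⟩
  refine ⟨t, (mem_Hset hM).2 htH, htr, hyt, f, (mem_Hset hM).2 ?_, hff, hs.2⟩
  refine HM.of_elems hM hw hi hκ hf ?_ ?_
  · refine ⟨_, hM.grfT (fun D v => ZFSet.pair (v 0) (fapp (v 1) (v 0))) [f] (by simp [hf]) hκ, grf_func _ _, fun p hp => ?_⟩
    obtain ⟨a, ha, b, rfl⟩ := hff.1 p hp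
    refine ⟨a, ha, ?_⟩
    rw [grf_app ha, ← fapp_eq hff hp]; rfl
  · intro p hp
    obtain ⟨a, ha, b, rfl⟩ := hff.1 p hp
    have e := fapp_eq hff hp
    have hb : HM M κ b := htH.elem (e ▸ hs.1 a ha)
    have ha := hκH.elem ha
    rw [ZFSet.pair]
    refine hpr _ ?_ _ (hpr _ ha _ hb)
    have := hpr _ ha _ ha
    convert this using 1
    ext z; simp

structure LR (ξ x m : ZFSet.{u}) : Prop where
  pm : PM m
  om : ZFSet.omega ∈ m
  mem : ξ ∈ m
  hl : Hlike ξ m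
  uf : IsMUltrafilter ξ m x
  wa : WeaklyAmenable ξ m x
  oi : OmegaOneIntersecting x

theorem model_of_pm {m : ZFSet.{u}} (hm : PM m) (ho : ZFSet.omega ∈ m) (hw : WOP m) : IsTransModel m :=
  ⟨hm.tr, ho, hm.pr, hm.un, hm.sp, hm.co, hw⟩

theorem LR.model {ξ x m : ZFSet.{u}} (h : LR ξ x m) (ho : ξ.IsOrdinal) : IsTransModel m :=
  model_of_pm h.pm h.om (Hlike.wop h.pm h.mem ho h.hl)

theorem IsMUModel.MU_eq {κ U M : ZFSet.{u}} (h : IsMUModel κ U M) : MU κ U = M := by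
  have hx : ∃ M, IsMUModel κ U M := ⟨M, h⟩
  have hc := hx.choose_spec
  have e : MU κ U = hx.choose := dif_pos hx
  rw [e]
  have h1 := hc.2.2.2 M h.1.1 h.1.2.1 h.2.2.1
  have h2 := h.2.2.2 _ hc.1.1 hc.1.2.1 hc.2.2.1
  ext z; exact ⟨fun h => h1 h, fun h => h2 h⟩

theorem IsSUMeasure.spec {κ U : ZFSet.{u}} (h : IsSUMeasure κ U) : IsMUModel κ U (MU κ U) := by
  obtain ⟨M, hM⟩ := h.2.2
  rw [hM.MU_eq]; exact hM

theorem infC_of_weak {κ M : ZFSet.{u}} (hκ : IsCard κ) (h : IsWeakModel κ M) : InfC κ := by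
  refine ⟨hκ, ?_⟩
  rw [← zcard_eq_iff.1 h.2.2, ← card_omega]
  exact card_mono (h.1.1.subset_of_mem h.1.2.1)

theorem compl_compl_eq {κ A : ZFSet.{u}} (h : A ⊆ κ) : compl κ (compl κ A) = A := by
  ext z
  simp only [compl, ZFSet.mem_sep]
  constructor
  · rintro ⟨h1, h2⟩; by_contra h3; exact h2 ⟨h1, h3⟩
  · intro h1; exact ⟨h h1, fun h2 => h2.2 h1⟩

theorem uf_mem_of {κ m y M' A : ZFSet.{u}} (h : IsMUltrafilter κ m y) (h' : IsMUltrafilter κ M' y)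
    (hM' : PM M') (hκ : κ ∈ M') (hA : A ∈ m) (hs : A ⊆ κ) : A ∈ M' := by
  rcases h.2.2.2.2.2.1 A hA hs with h1 | h1
  · exact (h'.1 A h1).1
  · rw [← compl_compl_eq hs]
    exact hM'.compl_mem hκ (h'.1 _ h1).1

theorem IsSUMeasure.hlike {κ U : ZFSet.{u}} (hκ : IsCard κ) (h : IsSUMeasure κ U) : Hlike κ (MU κ U) := by
  have hM := h.spec
  set M := MU κ U
  have hi := infC_of_weak hκ hM.1
  have hpm := PM.of_model hM.1.1
  have hw : WOP M := hM.1.1.2.2.2.2.2.2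
  have hκM := hM.1.2.1
  obtain ⟨h1, h2, h3⟩ := Hset_pm hpm hw hi hκM
  have hκH := (mem_Hset hpm).1 h2
  have hsub : ∀ A ∈ M, A ⊆ κ → A ∈ Hset M κ := fun A hA hs => (mem_Hset hpm).2
    (HM.of_elems hpm hw hi hκM hA (hκH.cov.mono hs) fun z hz => hκH.elem (hs hz))
  have hom : ZFSet.omega ∈ Hset M κ := hsub _ hM.1.1.2.1 (omega_sub hi)
  have hHM : Hset M κ ⊆ M := fun z hz => (ZFSet.mem_sep.1 hz).1
  have huf : IsMUltrafilter κ (Hset M κ) U := by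
    obtain ⟨u1, u2, u3, u4, u5, u6, u7⟩ := hM.2.2.1
    exact ⟨fun A hA => ⟨hsub A (u1 A hA).1 (u1 A hA).2, (u1 A hA).2⟩, u2, u3, u4,
      fun A hA B hB => u5 A hA B (hHM hB), fun B hB => u6 B (hHM hB), fun f hf => u7 f (hHM hf)⟩
  have := hM.2.2.2 (Hset M κ) (model_of_pm h1 hom (Hlike.wop h1 h2 hκ.ord h3)) h2 huf
  have e : Hset M κ = M := by ext z; exact ⟨fun h => hHM h, fun h => this h⟩
  rwa [e] at h3

theorem IsRamseyMeasure.infC {κ U : ZFSet.{u}} (hκ : IsCard κ) (h : IsRamseyMeasure κ U) : InfC κ :=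
  infC_of_weak hκ h.1.spec.1

theorem IsRamseyMeasure.lr {κ U : ZFSet.{u}} (hκ : IsCard κ) (h : IsRamseyMeasure κ U) : LR κ U (MU κ U) :=
  ⟨PM.of_model h.1.spec.1.1, h.1.spec.1.1.2.1, h.1.spec.1.2.1, h.1.hlike hκ, h.1.spec.2.2.1, h.2.1, h.2.2⟩

theorem tail_inj {κ a b : ZFSet.{u}} (ho : κ.IsOrdinal) (ha : a ∈ κ) (hb : b ∈ κ) (h : tailSet κ a = tailSet κ b) : a = b := by
  rcases (ho.mem ha).mem_trichotomous (ho.mem hb) with h1 | h1 | h1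
  · have : a ∈ tailSet κ b := h ▸ ZFSet.mem_sep.2 ⟨ha, ZFSet.mem_irrefl _⟩
    exact absurd h1 (ZFSet.mem_sep.1 this).2
  · exact h1
  · have : b ∈ tailSet κ a := h ▸ ZFSet.mem_sep.2 ⟨hb, ZFSet.mem_irrefl _⟩
    exact absurd h1 (ZFSet.mem_sep.1 this).2

/-- the non-ω₁-intersecting part -/
theorem su_of {κ y m : ZFSet.{u}} (hi : InfC κ) (pm : PM m) (om : ZFSet.omega ∈ m) (mem : κ ∈ m)
    (hl : Hlike κ m) (uf : IsMUltrafilter κ m y) (hc : card m ≤ card κ) (hv : HasVkappa κ m) :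
    IsSUMeasure κ y ∧ MU κ y = m := by
  have hκ := hi.1
  have hm : IsTransModel m := model_of_pm pm om (Hlike.wop pm mem hκ.ord hl)
  have hmu : IsMUModel κ y m := by
    refine ⟨⟨hm, mem, ?_⟩, hv, uf, ?_⟩
    · exact zcard_eq_iff.2 (le_antisymm hc (card_mono (pm.tr.subset_of_mem mem)))
    · intro M' hM' hκM' huf z hz
      have pM' := PM.of_model hM'
      obtain ⟨t, ht, htr, hzt, hcov⟩ := hl z hz
      obtain ⟨f, hf, hff, hs⟩ := Cov.surj pm mem ht ⟨z, hzt⟩ hcov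
      have h1 := codeOf_mem hi pm mem hf
      have h2 := uf_mem_of uf huf pM' hκM' h1 (codeOf_sub _ _)
      exact pM'.mem (codeOf_dec hi pM' hκM' hff htr hs h2).2 hzt
  refine ⟨⟨?_, fun A hA => (uf.1 A hA).2, m, hmu⟩, hmu.MU_eq⟩
  refine zcard_eq_iff.2 (le_antisymm ((card_mono fun A hA => (uf.1 A hA).1).trans hc) ?_)
  exact card_le_of_inj (fun a => tailSet κ a) (fun a ha => uf.2.1 a ha) fun a ha b hb e => tail_inj hκ.ord ha hb e

theorem LR.ramsey {κ y m : ZFSet.{u}} (hi : InfC κ) (h : LR κ y m) (hc : card m ≤ card κ)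
    (hv : HasVkappa κ m) : IsRamseyMeasure κ y ∧ MU κ y = m := by
  obtain ⟨h1, h2⟩ := su_of hi h.pm h.om h.mem h.hl h.uf hc hv
  exact ⟨⟨h1, by rw [h2]; exact h.wa, h.oi⟩, h2⟩

theorem LR.omega_mem {κ y m : ZFSet.{u}} (hi : InfC κ) (h : LR κ y m) : ZFSet.omega ∈ κ := by
  rcases omega_ord.mem_or_subset hi.1.ord with h1 | h1
  · exact h1
  · exfalso
    have e : κ = ZFSet.omega := by ext z; exact ⟨fun h => h1 h, fun h => omega_sub hi h⟩
    obtain ⟨x, hx⟩ := h.oi (fun n => tailSet κ (nz n)) fun n => h.uf.2.1 _ (omega_sub hi (mem_omega.2 ⟨n, rfl⟩))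
    obtain ⟨n, rfl⟩ := mem_omega.1 (e ▸ (ZFSet.mem_sep.1 (hx 0)).1)
    have := (ZFSet.mem_sep.1 (hx (n + 1))).2
    rw [nz_succ] at this
    exact this (ZFSet.mem_insert_iff.2 (Or.inl rfl))

/-! ### ultrafilter calculus -/
theorem uf_and {κ M U : ZFSet.{u}} (h : IsMUltrafilter κ M U) (hM : PM M) {P Q : ZFSet.{u} → Prop}
    (hP : ZFSet.sep P κ ∈ M) (hQ : ZFSet.sep Q κ ∈ M) :
    ZFSet.sep (fun ξ => P ξ ∧ Q ξ) κ ∈ U ↔ ZFSet.sep P κ ∈ U ∧ ZFSet.sep Q κ ∈ U := by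
  constructor
  · intro h1
    exact ⟨h.2.2.2.2.1 _ h1 _ hP (fun z hz => (ZFSet.mem_sep.1 hz).1) (fun z hz => by
      rw [ZFSet.mem_sep] at *; exact ⟨hz.1, hz.2.1⟩),
      h.2.2.2.2.1 _ h1 _ hQ (fun z hz => (ZFSet.mem_sep.1 hz).1) (fun z hz => by
      rw [ZFSet.mem_sep] at *; exact ⟨hz.1, hz.2.2⟩)⟩
  · rintro ⟨h1, h2⟩
    have := h.2.2.2.1 _ h1 _ h2
    convert this using 1
    ext z; simp only [ZFSet.mem_sep, ZFSet.mem_inter]; tauto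

theorem uf_mono {κ M U : ZFSet.{u}} (h : IsMUltrafilter κ M U) {P Q : ZFSet.{u} → Prop}
    (hP : ZFSet.sep P κ ∈ U) (hQ : ZFSet.sep Q κ ∈ M) (hpq : ∀ x ∈ κ, P x → Q x) :
    ZFSet.sep Q κ ∈ U :=
  h.2.2.2.2.1 _ hP _ hQ (fun z hz => (ZFSet.mem_sep.1 hz).1) (fun z hz => by
      rw [ZFSet.mem_sep] at *; exact ⟨hz.1, hpq z hz.1 hz.2⟩)

theorem uf_not {κ M U : ZFSet.{u}} (h : IsMUltrafilter κ M U) (hM : PM M) {P : ZFSet.{u} → Prop}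
    (hP : ZFSet.sep P κ ∈ M) :
    ZFSet.sep (fun ξ => ¬ P ξ) κ ∈ U ↔ ¬ ZFSet.sep P κ ∈ U := by
  have e : compl κ (ZFSet.sep P κ) = ZFSet.sep (fun ξ => ¬ P ξ) κ := by
    ext z; simp only [compl, ZFSet.mem_sep]; tauto
  constructor
  · intro h1 h2
    have := h.2.2.2.1 _ h1 _ h2
    apply h.2.2.1
    convert this using 1
    ext z; simp only [ZFSet.mem_sep, ZFSet.mem_inter, ZFSet.notMem_empty, false_iff]; tauto
  · intro h1
    rcases h.2.2.2.2.2.1 _ hP (fun z hz => (ZFSet.mem_sep.1 hz).1) with h2 | h2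
    · exact absurd h2 h1
    · rwa [e] at h2

theorem uf_univ {κ M U : ZFSet.{u}} (h : IsMUltrafilter κ M U) (h0 : ∅ ∈ κ) (hκ : κ ∈ M) : κ ∈ U :=
  h.2.2.2.2.1 _ (h.2.1 _ h0) _ hκ (fun z hz => hz) (fun z hz => (ZFSet.mem_sep.1 hz).1)

theorem uf_all {κ M U : ZFSet.{u}} (h : IsMUltrafilter κ M U) (h0 : ∅ ∈ κ) (hκ : κ ∈ M) {P : ZFSet.{u} → Prop}
    (hP : ∀ x ∈ κ, P x) : ZFSet.sep P κ ∈ U := by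
  convert uf_univ h h0 hκ using 1
  ext z; rw [ZFSet.mem_sep]; exact ⟨fun h => h.1, fun h => ⟨h, hP z h⟩⟩

theorem uf_ex {κ M U : ZFSet.{u}} (h : IsMUltrafilter κ M U) {P : ZFSet.{u} → Prop}
    (hP : ZFSet.sep P κ ∈ U) : ∃ x ∈ κ, P x := by
  by_contra hn
  push Not at hn
  apply h.2.2.1
  convert hP using 1
  ext z; simp only [ZFSet.mem_sep, ZFSet.notMem_empty, false_iff]
  rintro ⟨h1, h2⟩; exact hn z h1 h2

theorem InfC.succ {κ a : ZFSet.{u}} (h : InfC κ) (ha : a ∈ κ) : insert a a ∈ κ := by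
  refine h.1.mem_of_card (isOrdinal_succ (h.1.ord.mem ha)) ?_
  have := h.1.lt ha
  refine (ZFSet.card_insert_le).trans_lt ?_
  by_cases hf : card a < Cardinal.aleph0
  · exact (Cardinal.add_lt_aleph0 hf Cardinal.one_lt_aleph0).trans_le h.2
  · rw [Cardinal.add_one_eq (not_lt.1 hf)]; exact this

/-! ### the ultrapower -/
def UF (κ M : ZFSet.{u}) : ZFSet.{u} := ZFSet.sep (fun f => IsZFunc κ f) M
def UR (κ M U : ZFSet.{u}) : ZFSet.{u} :=
  ZFSet.sep (fun p => ∃ f g, p = ZFSet.pair f g ∧ ZFSet.sep (fun ξ => fapp f ξ ∈ fapp g ξ) κ ∈ U)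
    (ZFSet.prod (UF κ M) (UF κ M))

theorem mem_UR {κ M U f g : ZFSet.{u}} (hf : f ∈ UF κ M) (hg : g ∈ UF κ M) :
    ZFSet.pair f g ∈ UR κ M U ↔ ZFSet.sep (fun ξ => fapp f ξ ∈ fapp g ξ) κ ∈ U := by
  rw [UR, ZFSet.mem_sep, ZFSet.pair_mem_prod]
  constructor
  · rintro ⟨-, f', g', e, h⟩
    obtain ⟨rfl, rfl⟩ := ZFSet.pair_inj.1 e
    exact h
  · intro h; exact ⟨⟨hf, hg⟩, f, g, rfl, h⟩

theorem UR_wf {κ M U : ZFSet.{u}} (h : OmegaOneIntersecting U) :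
    WellFounded (fun g f : ZFSet.{u} => g ∈ UF κ M ∧ f ∈ UF κ M ∧ ZFSet.pair g f ∈ UR κ M U) := by
  rw [wellFounded_iff_isEmpty_descending_chain]
  constructor
  rintro ⟨f, hf⟩
  obtain ⟨x, hx⟩ := h (fun n => ZFSet.sep (fun ξ => fapp (f (n + 1)) ξ ∈ fapp (f n) ξ) κ) fun n => by
    obtain ⟨h1, h2, h3⟩ := hf n
    exact (mem_UR h1 h2).1 h3
  have := ZFSet.mem_wf.{u}
  rw [wellFounded_iff_isEmpty_descending_chain] at this
  exact this.1 ⟨fun n => fapp (f n) x, fun n => (ZFSet.mem_sep.1 (hx n)).2⟩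

theorem los_set {κ M : ZFSet.{u}} (hM : PM M) (hκ : κ ∈ M) (φ : Fml) (v : ℕ → ZFSet.{u}) (hv : ∀ n, v n ∈ M) :
    ZFSet.sep (fun ξ => Sat M.toSet φ (fun n => fapp (v n) ξ)) κ ∈ M :=
  hM.sep (fun D ξ w => Sat D.toSet φ (fun n => fapp (w n) ξ))
    (hQ := def_sat_dom φ (fun k D w => fapp (w (k + 1)) (w 0)) (fun k => inferInstance)) v hv hκ

theorem env_ofFn (v : ℕ → ZFSet.{u}) : ∀ (n k : ℕ), k < n → env ((List.range n).map v) k = v k := by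
  intro n
  induction n generalizing v with
  | zero => intro k hk; omega
  | succ n ih =>
    intro k hk
    rw [List.range_succ_eq_map, List.map_cons, List.map_map]
    cases k with
    | zero => rfl
    | succ k => exact ih (v ∘ Nat.succ) k (by omega)

theorem los_choice {κ M : ZFSet.{u}} (hM : PM M) (hw : WOP M) (hκ : κ ∈ M) (φ : Fml) (n : ℕ) (v : ℕ → ZFSet.{u}) (hv : ∀ n, v n ∈ M) :
    ∃ F ∈ M, IsZFunc κ F ∧ ∀ ξ ∈ κ, (∃ x ∈ M, ¬ Sat M.toSet φ (Function.update (fun k => fapp (v k) ξ) n x)) →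
      ¬ Sat M.toSet φ (Function.update (fun k => fapp (v k) ξ) n (fapp F ξ)) := by
  set l := (List.range φ.bd).map v
  have hl : ∀ x ∈ l, x ∈ M := by
    intro x hx
    obtain ⟨k, -, rfl⟩ := List.mem_map.1 hx
    exact hv k
  have key : ∀ ξ x, Sat M.toSet φ (Function.update (fun k => fapp (v k) ξ) n x) ↔
      Sat M.toSet φ (Function.update (fun k => fapp (env l k) ξ) n x) := by
    intro ξ x
    apply sat_bd
    intro k hk
    by_cases hkn : k = n
    · subst hkn; simp
    · simp only [Function.update_of_ne hkn]; rw [env_ofFn v _ _ hk]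
  have hdef : Def (fun D w => ¬ Sat D.toSet φ (Function.update (fun k => fapp (w (k + 2)) (w 0)) n (w 1))) := by
    have := def_sat_dom φ (fun k => if k = n then (fun D w => w 1) else (fun D w => fapp (w (k + 2)) (w 0)))
      (fun k => by
        by_cases hk : k = n
        · simp only [hk, if_true]; infer_instance
        · simp only [hk, if_false]; infer_instance)
    have h2 : Def (fun D w => Sat D.toSet φ (Function.update (fun k => fapp (w (k + 2)) (w 0)) n (w 1))) := by
      convert this using 4 with D v
      funext k
      by_cases hk : k = n
      · subst hk; simp
      · simp [hk]
    infer_instance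
  have hdef2 : Def (fun D w => ¬ Sat D.toSet φ (Function.update (fun k => fapp (w (k + 2)) (w 0)) n (w 1)) ∨
     (∀ x, x ∈ D → Sat D.toSet φ (Function.update (fun k => fapp (w (k + 2)) (w 0)) n x))) := by
    have h1 : Def (fun D w => (¬ ∃ x, x ∈ D ∧ (¬ Sat D.toSet φ (Function.update (fun k => fapp (w (k + 2)) (w 0)) n x)))) := by
      have : Def (fun D w => ¬ Sat D.toSet φ (Function.update (fun k => fapp (w (k + 3)) (w 1)) n (w 0))) :=
        Def.ren hdef (fun n => match n with | 0 => 1 | 1 => 0 | k + 2 => k + 3)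
      exact @Def.not _ (@Def.exD (fun D x w => ¬ Sat D.toSet φ (Function.update (fun k => fapp (w (k + 2)) (w 0)) n x)) this)
    convert @Def.or _ _ hdef h1 using 4
    push Not; rfl
  obtain ⟨F, hF, hFf, HF⟩ := hM.choice hw (fun D ξ x w => ¬ Sat D.toSet φ (Function.update (fun k => fapp (w k) ξ) n x) ∨
     (∀ x, x ∈ D → Sat D.toSet φ (Function.update (fun k => fapp (w k) ξ) n x))) l hl hκ (hQ := hdef2)
     (fun ξ hξ => by
      by_cases hx : ∃ x ∈ M, ¬ Sat M.toSet φ (Function.update (fun k => fapp (env l k) ξ) n x)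
      · obtain ⟨x, hx, h⟩ := hx; exact ⟨x, hx, Or.inl h⟩
      · push Not at hx; exact ⟨∅, hM.ne, Or.inr hx⟩)
  refine ⟨F, hF, hFf, fun ξ hξ => ?_⟩
  rintro ⟨x, hx, hn⟩
  rw [key] at hn ⊢
  rcases (HF ξ hξ).2 with h | h
  · exact h
  · exact absurd (h x hx) hn

theorem mem_UF {κ M f : ZFSet.{u}} : f ∈ UF κ M ↔ f ∈ M ∧ IsZFunc κ f := ZFSet.mem_sep

theorem los_eq {κ M U : ZFSet.{u}} {G : ZFSet.{u} → ZFSet.{u}} (hi : InfC κ) (h : LR κ U M)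
    (hG : Collapses G (UF κ M) (UR κ M U)) {f g : ZFSet.{u}} (hf : f ∈ UF κ M) (hg : g ∈ UF κ M) :
    G f = G g ↔ ZFSet.sep (fun ξ => fapp f ξ = fapp g ξ) κ ∈ U := by
  have hM := h.pm
  have hw : WOP M := h.hl.wop hM h.mem hi.1.ord
  have sM : ∀ f ∈ M, ∀ g ∈ M, ZFSet.sep (fun ξ => fapp f ξ = fapp g ξ) κ ∈ M := fun f hf g hg =>
    hM.sep (fun D ξ v => fapp (v 0) ξ = fapp (v 1) ξ) (env [f, g]) (env_in hM (by simp [hf, hg])) h.mem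
  have sE : ∀ f ∈ M, ∀ g ∈ M, ZFSet.sep (fun ξ => fapp f ξ ∈ fapp g ξ) κ ∈ M := fun f hf g hg =>
    hM.sep (fun D ξ v => fapp (v 0) ξ ∈ fapp (v 1) ξ) (env [f, g]) (env_in hM (by simp [hf, hg])) h.mem
  constructor
  · intro e
    obtain ⟨w, hw'⟩ : ∃ w, w = G f := ⟨_, rfl⟩
    induction w using ZFSet.inductionOn generalizing f g with
    | _ w ih =>
      by_contra hne
      rw [← uf_not h.uf hM (sM _ (mem_UF.1 hf).1 _ (mem_UF.1 hg).1)] at hne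
      have hfM := (mem_UF.1 hf).1
      have hgM := (mem_UF.1 hg).1
      obtain ⟨H, hH, hHf, HH⟩ := hM.choice hw (fun D ξ y v => ¬ fapp (v 0) ξ = fapp (v 1) ξ →
        ¬ (y ∈ fapp (v 0) ξ ↔ y ∈ fapp (v 1) ξ)) [f, g] (by simp [hfM, hgM]) h.mem (fun ξ hξ => by
          by_cases hx : fapp f ξ = fapp g ξ
          · exact ⟨∅, hM.ne, fun h => absurd hx h⟩
          · obtain ⟨y, hy⟩ : ∃ y, ¬ (y ∈ fapp f ξ ↔ y ∈ fapp g ξ) := by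
              by_contra hn; push Not at hn; exact hx (ZFSet.ext hn)
            refine ⟨y, ?_, fun _ => hy⟩
            have hξM := hM.mem h.mem hξ
            by_cases hyf : y ∈ fapp f ξ
            · exact hM.mem (hM.fapp_mem hfM hξM) hyf
            · by_cases hyg : y ∈ fapp g ξ
              · exact hM.mem (hM.fapp_mem hgM hξM) hyg
              · exact absurd (iff_of_false hyf hyg) hy)
      have hHF : H ∈ UF κ M := mem_UF.2 ⟨hH, hHf⟩
      have hsd : ZFSet.sep (fun ξ => ¬ (fapp H ξ ∈ fapp f ξ ↔ fapp H ξ ∈ fapp g ξ)) κ ∈ U :=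
        uf_mono h.uf hne (hM.sep (fun D ξ v => ¬ (fapp (v 2) ξ ∈ fapp (v 0) ξ ↔ fapp (v 2) ξ ∈ fapp (v 1) ξ)) (env [f, g, H])
          (env_in hM (by simp [hfM, hgM, hH])) h.mem) fun ξ hξ hx => (HH ξ hξ).2 hx
      have key : ∀ f' g', f' ∈ UF κ M → g' ∈ UF κ M → G f' = G g' → w = G f' →
          ZFSet.sep (fun ξ => fapp H ξ ∈ fapp f' ξ) κ ∈ U → ZFSet.sep (fun ξ => fapp H ξ ∈ fapp g' ξ) κ ∈ U := by
        intro f' g' hf' hg' e' ew hE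
        have h1 : G H ∈ G f' := (hG f' hf' _).2 ⟨H, hHF, (mem_UR hHF hf').2 hE, rfl⟩
        have h1' := h1
        rw [e'] at h1
        obtain ⟨k, hk, hkE, hkG⟩ := (hG g' hg' _).1 h1
        rw [mem_UR hk hg'] at hkE
        have h2 := ih (G H) (ew ▸ h1') hHF hk hkG rfl
        have h3 := (uf_and h.uf hM (sM _ hH _ (mem_UF.1 hk).1) (sE _ (mem_UF.1 hk).1 _ (mem_UF.1 hg').1)).2 ⟨h2, hkE⟩
        refine uf_mono h.uf h3 (sE _ hH _ (mem_UF.1 hg').1) ?_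
        rintro ξ hξ ⟨h4, h5⟩
        rw [h4]; exact h5
      have c1 := key f g hf hg e hw'
      have c2 := key g f hg hf e.symm (hw'.trans e)
      have sf := sE _ hH _ hfM
      have sg := sE _ hH _ hgM
      by_cases hq : ZFSet.sep (fun ξ => fapp H ξ ∈ fapp f ξ) κ ∈ U
      · have := (uf_and h.uf hM sf sg).2 ⟨hq, c1 hq⟩
        have := (uf_and h.uf hM (h.uf.1 _ this).1 (h.uf.1 _ hsd).1).2 ⟨this, hsd⟩
        obtain ⟨x, -, hx⟩ := uf_ex h.uf this
        tauto
      · have hq' : ¬ ZFSet.sep (fun ξ => fapp H ξ ∈ fapp g ξ) κ ∈ U := fun hh => hq (c2 hh)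
        rw [← uf_not h.uf hM sf] at hq
        rw [← uf_not h.uf hM sg] at hq'
        have := (uf_and h.uf hM (h.uf.1 _ hq).1 (h.uf.1 _ hq').1).2 ⟨hq, hq'⟩
        have := (uf_and h.uf hM (h.uf.1 _ this).1 (h.uf.1 _ hsd).1).2 ⟨this, hsd⟩
        obtain ⟨x, -, hx⟩ := uf_ex h.uf this
        tauto
  · have half : ∀ f g, f ∈ UF κ M → g ∈ UF κ M → ZFSet.sep (fun ξ => fapp f ξ = fapp g ξ) κ ∈ U → ∀ y, y ∈ G f → y ∈ G g := by
      intro f g hf hg e y hy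
      rw [hG _ hf] at hy
      rw [hG _ hg]
      obtain ⟨k, hk, hkE, rfl⟩ := hy
      refine ⟨k, hk, ?_, rfl⟩
      rw [mem_UR hk hf] at hkE
      rw [mem_UR hk hg]
      refine uf_mono h.uf ((uf_and h.uf hM (h.uf.1 _ e).1 (h.uf.1 _ hkE).1).2 ⟨e, hkE⟩)
        (sE _ (mem_UF.1 hk).1 _ (mem_UF.1 hg).1) ?_
      rintro ξ hξ ⟨h4, h5⟩
      rw [← h4]; exact h5
    intro e
    have e' : ZFSet.sep (fun ξ => fapp g ξ = fapp f ξ) κ ∈ U := by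
      convert e using 3; rw [eq_comm]
    ext y; exact ⟨half f g hf hg e y, half g f hg hf e' y⟩

theorem los {κ M U : ZFSet.{u}} {G : ZFSet.{u} → ZFSet.{u}} (hi : InfC κ) (h : LR κ U M)
    (hG : Collapses G (UF κ M) (UR κ M U)) (φ : Fml) : ∀ v : ℕ → ZFSet.{u}, (∀ n, v n ∈ UF κ M) →
    (Sat (img G (UF κ M)).toSet φ (fun n => G (v n)) ↔
      ZFSet.sep (fun ξ => Sat M.toSet φ (fun n => fapp (v n) ξ)) κ ∈ U) := by
  have hM := h.pm
  have hw : WOP M := h.hl.wop hM h.mem hi.1.ord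
  have h0 := hi.ex2.1
  induction φ with
  | mem i k =>
    intro v hv
    simp only [Sat]
    rw [hG _ (hv k), ← mem_UR (hv i) (hv k)]
    constructor
    · rintro ⟨g, hg, hgE, e⟩
      rw [mem_UR (hv i) (hv k)]
      rw [mem_UR hg (hv k)] at hgE
      have := (los_eq hi h hG (hv i) hg).1 e
      refine uf_mono h.uf ((uf_and h.uf hM (h.uf.1 _ this).1 (h.uf.1 _ hgE).1).2 ⟨this, hgE⟩)
        (los_set hM h.mem (.mem i k) v (fun n => (mem_UF.1 (hv n)).1)) ?_
      rintro ξ hξ ⟨h4, h5⟩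
      show fapp (v i) ξ ∈ fapp (v k) ξ
      rw [h4]; exact h5
    · intro h; exact ⟨_, hv i, h, rfl⟩
  | eq i k =>
    intro v hv
    simp only [Sat]
    exact los_eq hi h hG (hv i) (hv k)
  | impl φ ψ ih1 ih2 =>
    intro v hv
    have hvM := fun n => (mem_UF.1 (hv n)).1
    have s1 := los_set hM h.mem φ v hvM
    have s2 := los_set hM h.mem ψ v hvM
    have s3 := los_set hM h.mem (.impl φ ψ) v hvM
    have s4 := los_set hM h.mem (.neg ψ) v hvM
    simp only [Sat] at s3 s4 ⊢
    rw [ih1 v hv, ih2 v hv, iff_comm, ← not_iff_not, ← uf_not h.uf hM s3]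
    have : ZFSet.sep (fun ξ => ¬ (Sat M.toSet φ (fun n => fapp (v n) ξ) → Sat M.toSet ψ (fun n => fapp (v n) ξ))) κ
      = ZFSet.sep (fun ξ => Sat M.toSet φ (fun n => fapp (v n) ξ) ∧ ¬ Sat M.toSet ψ (fun n => fapp (v n) ξ)) κ := by
      ext z; simp only [ZFSet.mem_sep]; tauto
    rw [this, uf_and h.uf hM s1 s4, uf_not h.uf hM s2]; tauto
  | neg φ ih =>
    intro v hv
    have hvM := fun n => (mem_UF.1 (hv n)).1
    simp only [Sat]
    rw [ih v hv, uf_not h.uf hM (los_set hM h.mem φ v hvM)]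
  | all n φ ih =>
    intro v hv
    have hvM := fun n => (mem_UF.1 (hv n)).1
    have sa := los_set hM h.mem (.all n φ) v hvM
    have hup : ∀ f, f ∈ UF κ M → ∀ k, Function.update v n f k ∈ UF κ M := by
      intro f hf k
      by_cases hk : k = n
      · subst hk; simpa using hf
      · simpa [hk] using hv k
    have e1 : ∀ f, (fun k => G (Function.update v n f k)) = Function.update (fun k => G (v k)) n (G f) := by
      intro f; ext1 k
      by_cases hk : k = n
      · subst hk; simp
      · simp [hk]
    have e2 : ∀ f ξ, (fun k => fapp (Function.update v n f k) ξ) = Function.update (fun k => fapp (v k) ξ) n (fapp f ξ) := by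
      intro f ξ; ext1 k
      by_cases hk : k = n
      · subst hk; simp
      · simp [hk]
    have step : ∀ f ∈ UF κ M, (Sat (img G (UF κ M)).toSet φ (Function.update (fun k => G (v k)) n (G f)) ↔
        ZFSet.sep (fun ξ => Sat M.toSet φ (Function.update (fun k => fapp (v k) ξ) n (fapp f ξ))) κ ∈ U) := by
      intro f hf
      have := ih _ (hup f hf)
      rw [e1] at this
      simp only [e2] at this
      exact this
    have sstep : ∀ f ∈ UF κ M, ZFSet.sep (fun ξ => Sat M.toSet φ (Function.update (fun k => fapp (v k) ξ) n (fapp f ξ))) κ ∈ M := by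
      intro f hf
      have := los_set hM h.mem φ _ (fun k => (mem_UF.1 (hup f hf k)).1)
      simp only [e2] at this
      exact this
    simp only [Sat] at sa ⊢
    constructor
    · intro H
      by_contra hn
      rw [← uf_not h.uf hM sa] at hn
      obtain ⟨F, hF, hFf, HF⟩ := los_choice hM hw h.mem φ n v hvM
      have hFF : F ∈ UF κ M := mem_UF.2 ⟨hF, hFf⟩
      have h1 := (step F hFF).1 (H _ (mem_img.2 ⟨F, hFF, rfl⟩))
      have := (uf_and h.uf hM (h.uf.1 _ hn).1 (h.uf.1 _ h1).1).2 ⟨hn, h1⟩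
      obtain ⟨ξ, hξ, h2, h3⟩ := uf_ex h.uf this
      push Not at h2
      exact HF ξ hξ h2 h3
    · intro H x hx
      obtain ⟨f, hf, rfl⟩ := mem_img.1 hx
      rw [step f hf]
      refine uf_mono h.uf H (sstep f hf) fun ξ hξ hh => hh _ ?_
      exact hM.fapp_mem (mem_UF.1 hf).1 (hM.mem h.mem hξ)

theorem ultrapower_exists {κ M U : ZFSet.{u}} (hi : InfC κ) (h : LR κ U M) :
    ∃ (N : ZFSet.{u}) (j : ZFSet.{u} → ZFSet.{u}), IsUltrapowerEmb κ M U N j := by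
  have hM := h.pm
  have hκM := h.mem
  have h0 := hi.ex2.1
  have hord := hi.1.ord
  obtain ⟨G, hG⟩ := exists_collapse (UF κ M) (UR κ M U) (UR_wf h.oi)
  have hcU : ∀ x ∈ M, grf (fun _ => x) κ ∈ UF κ M := fun x hx =>
    mem_UF.2 ⟨hM.grfT (fun D v => v 1) [x] (by simp [hx]) hκM, grf_func _ _⟩
  have hidU : grf (fun x => x) κ ∈ UF κ M :=
    mem_UF.2 ⟨hM.grfT (fun D v => v 0) [] (by simp) hκM, grf_func _ _⟩
  set N := img G (UF κ M) with hN
  have htr : N.IsTransitive := by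
    intro y hy z hz
    obtain ⟨f, hf, rfl⟩ := mem_img.1 hy
    obtain ⟨g, hg, -, rfl⟩ := (hG f hf z).1 hz
    exact mem_img.2 ⟨g, hg, rfl⟩
  have hel : Elem M N (fun x => G (grf (fun _ => x) κ)) := by
    refine ⟨fun x hx => mem_img.2 ⟨_, hcU x hx, rfl⟩, fun φ v hv => ?_⟩
    rw [los hi h hG φ (fun n => grf (fun _ => v n) κ) (fun n => hcU _ (hv n))]
    have e : ∀ ξ ∈ κ, ((fun n => fapp (grf (fun _ => v n) κ) ξ) : ℕ → ZFSet.{u}) = v := by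
      intro ξ hξ; funext n; exact grf_app hξ
    constructor
    · intro hs; exact uf_all h.uf h0 hκM (fun ξ hξ => by rw [e ξ hξ]; exact hs)
    · intro hs
      obtain ⟨ξ, hξ, hx⟩ := uf_ex h.uf hs
      rwa [e ξ hξ] at hx
  have hNpm : PM N := hel.pm hM htr
  have hcoll : ∀ {f g : ZFSet.{u}}, f ∈ UF κ M → g ∈ UF κ M → (G f ∈ G g ↔ ZFSet.sep (fun ξ => fapp f ξ ∈ fapp g ξ) κ ∈ U) := by
    intro f g hf hg
    exact los hi h hG (.mem 0 1) (fun n => if n = 0 then f else g) (fun n => by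
      by_cases hn : n = 0 <;> simp [hn, hf, hg])
  have hsepM : ∀ f ∈ M, ∀ g ∈ M, ZFSet.sep (fun ξ => fapp f ξ ∈ fapp g ξ) κ ∈ M := fun f hf g hg =>
    hM.sep (fun D ξ v => fapp (v 0) ξ ∈ fapp (v 1) ξ) (env [f, g]) (env_in hM (by simp [hf, hg])) hκM
  have hsepE : ∀ f ∈ M, ∀ g ∈ M, ZFSet.sep (fun ξ => fapp f ξ = fapp g ξ) κ ∈ M := fun f hf g hg =>
    hM.sep (fun D ξ v => fapp (v 0) ξ = fapp (v 1) ξ) (env [f, g]) (env_in hM (by simp [hf, hg])) hκM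
  -- if f < const b or f < id on a U-set then f const on U set
  have hreg : ∀ f ∈ UF κ M, ZFSet.sep (fun ξ => fapp f ξ ∈ ξ) κ ∈ U → ∃ γ ∈ κ, G f = G (grf (fun _ => γ) κ) ∧
      ZFSet.sep (fun ξ => fapp f ξ = γ) κ ∈ U := by
    intro f hf hs
    obtain ⟨hfM, hff⟩ := mem_UF.1 hf
    obtain ⟨γ, hγ, hs2⟩ := h.uf.2.2.2.2.2.2 f hfM hff hs
    refine ⟨γ, hγ, ?_, hs2⟩
    have hγM := hM.mem hκM hγ
    rw [los_eq hi h hG hf (hcU _ hγM)]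
    refine uf_mono h.uf hs2 (hsepE _ hfM _ (mem_UF.1 (hcU _ hγM)).1) fun ξ hξ e => ?_
    rw [grf_app hξ, e]
  have hconst : ∀ γ, γ ∈ κ → G (grf (fun _ => γ) κ) = γ := by
    intro γ
    induction γ using ZFSet.inductionOn with
    | _ γ ih =>
      intro hγ
      have hγM := hM.mem hκM hγ
      ext y
      constructor
      · intro hy
        obtain ⟨f, hf, hs, rfl⟩ := (hG _ (hcU _ hγM) y).1 hy
        rw [mem_UR hf (hcU _ hγM)] at hs
        have hfM := (mem_UF.1 hf).1
        have ht := h.uf.2.1 γ hγ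
        have h1 := h.uf.2.2.2.1 _ hs _ ht
        have h2 : ZFSet.sep (fun ξ => fapp f ξ ∈ ξ) κ ∈ U := by
          refine h.uf.2.2.2.2.1 _ h1 _ (hM.sep (fun D ξ v => fapp (v 0) ξ ∈ ξ) (env [f]) (env_in hM (by simp [hfM])) hκM)
            (fun z hz => (ZFSet.mem_sep.1 hz).1) ?_
          intro z hz
          obtain ⟨hz1, hz2⟩ := ZFSet.mem_inter.1 hz
          obtain ⟨hz3, hz4⟩ := ZFSet.mem_sep.1 hz1
          rw [grf_app hz3] at hz4
          obtain ⟨-, hz5⟩ := ZFSet.mem_sep.1 hz2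
          refine ZFSet.mem_sep.2 ⟨hz3, ?_⟩
          rcases (hord.mem hz3).mem_or_subset (hord.mem hγ) with h6 | h6
          · exact absurd h6 hz5
          · exact h6 hz4
        obtain ⟨δ, hδ, e, hs2⟩ := hreg f hf h2
        obtain ⟨ξ, hξ, h7⟩ := uf_ex h.uf ((uf_and h.uf hM (h.uf.1 _ hs).1 (h.uf.1 _ hs2).1).2 ⟨hs, hs2⟩)
        have hδγ : δ ∈ γ := by
          have := h7.1; rw [grf_app hξ, h7.2] at this; exact this
        rw [e, ih δ hδγ hδ]; exact hδγ
      · intro hy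
        have hyκ := hord.isTransitive.mem_trans hy hγ
        rw [← ih y hy hyκ]
        rw [hcoll (hcU _ (hM.mem hκM hyκ)) (hcU _ hγM)]
        refine uf_all h.uf h0 hκM fun ξ hξ => ?_
        rw [grf_app hξ, grf_app hξ]; exact hy
  have hid : G (grf (fun x => x) κ) = κ := by
    have hidM := (mem_UF.1 hidU).1
    ext y
    constructor
    · intro hy
      obtain ⟨f, hf, hs, rfl⟩ := (hG _ hidU y).1 hy
      rw [mem_UR hf hidU] at hs
      have hfM := (mem_UF.1 hf).1
      have h2 : ZFSet.sep (fun ξ => fapp f ξ ∈ ξ) κ ∈ U := by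
        refine uf_mono h.uf hs (hM.sep (fun D ξ v => fapp (v 0) ξ ∈ ξ) (env [f]) (env_in hM (by simp [hfM])) hκM) ?_
        intro ξ hξ hx; rwa [grf_app hξ] at hx
      obtain ⟨δ, hδ, e, hs2⟩ := hreg f hf h2
      rw [e, hconst δ hδ]; exact hδ
    · intro hy
      rw [← hconst y hy, hcoll (hcU _ (hM.mem hκM hy)) hidU]
      have ht := h.uf.2.1 _ (hi.succ hy)
      refine uf_mono h.uf ht (hsepM _ (mem_UF.1 (hcU _ (hM.mem hκM hy))).1 _ hidM) ?_
      intro ξ hξ hx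
      rw [grf_app hξ, grf_app hξ]
      rcases (hord.mem hξ).mem_trichotomous (hord.mem hy) with h6 | h6 | h6
      · exact absurd (ZFSet.mem_insert_of_mem _ h6) hx
      · exact absurd (h6 ▸ ZFSet.mem_insert _ _) hx
      · exact h6
  refine ⟨N, fun x => G (grf (fun _ => x) κ), htr, hel.1, hel.2, ?_, ?_⟩
  · intro a ha
    obtain ⟨f, hf, rfl⟩ := mem_img.1 ha
    obtain ⟨hfM, hff⟩ := mem_UF.1 hf
    refine ⟨f, hfM, hff, fun ξ hξ => hM.fapp_mem hfM (hM.mem hκM hξ), ?_⟩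
    obtain ⟨φ, hφ⟩ := (inferInstance : Def (fun D v => fapp (v 0) (v 1) = v 2)).ex
    have hv : ∀ n, (fun n : ℕ => if n = 0 then grf (fun _ => f) κ else if n = 1 then grf (fun x => x) κ else f) n ∈ UF κ M := by
      intro n; dsimp only; split_ifs
      exacts [hcU _ hfM, hidU, hf]
    have hl := los hi h hG φ (fun n => if n = 0 then grf (fun _ => f) κ else if n = 1 then grf (fun x => x) κ else f) hv
    rw [hφ N hNpm _ (fun n => mem_img.2 ⟨_, hv n, rfl⟩)] at hl
    have : fapp (G (grf (fun _ => f) κ)) (G (grf (fun x => x) κ)) = G f := by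
      refine hl.2 (uf_all h.uf h0 hκM fun ξ hξ => ?_)
      rw [hφ M hM _ (fun n => hM.fapp_mem (mem_UF.1 (hv n)).1 (hM.mem hκM hξ))]
      show fapp (fapp (grf (fun _ => f) κ) ξ) (fapp (grf (fun x => x) κ) ξ) = fapp f ξ
      rw [grf_app hξ, grf_app hξ]
    rw [hid] at this
    exact this
  · intro A hA hAκ
    have h1 : κ ∈ G (grf (fun _ => A) κ) ↔ G (grf (fun x => x) κ) ∈ G (grf (fun _ => A) κ) := by rw [hid]
    rw [h1, hcoll hidU (hcU _ hA)]
    have : ZFSet.sep (fun ξ => fapp (grf (fun x => x) κ) ξ ∈ fapp (grf (fun _ => A) κ) ξ) κ = A := by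
      ext z; rw [ZFSet.mem_sep]
      constructor
      · rintro ⟨hz, h2⟩; rwa [grf_app hz, grf_app hz] at h2
      · intro hz; refine ⟨hAκ hz, ?_⟩; rw [grf_app (hAκ hz), grf_app (hAκ hz)]; exact hz
    rw [this]

/-! ### V_κ -/
def Vk (κ : ZFSet.{u}) : ZFSet.{u} := ZFSet.vonNeumann (ZFSet.rank κ)

theorem mem_Vk {κ x : ZFSet.{u}} : x ∈ Vk κ ↔ ZFSet.rank x < ZFSet.rank κ := ZFSet.mem_vonNeumann

theorem hasV_iff {κ M : ZFSet.{u}} : HasVkappa κ M ↔ Vk κ ∈ M := by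
  constructor
  · rintro ⟨v, hv, h⟩
    have : v = Vk κ := by ext x; rw [h, mem_Vk]
    rw [← this]; exact hv
  · intro h; exact ⟨_, h, fun x => mem_Vk⟩

theorem Vk_tr (κ : ZFSet.{u}) : (Vk κ).IsTransitive := ZFSet.isTransitive_vonNeumann _

theorem Vk_sub {κ x y : ZFSet.{u}} (h : x ⊆ y) (hy : y ∈ Vk κ) : x ∈ Vk κ := ZFSet.mem_vonNeumann_of_subset h hy

theorem ord_mem_Vk {κ x : ZFSet.{u}} (hκ : κ.IsOrdinal) (hx : x.IsOrdinal) : x ∈ Vk κ ↔ x ∈ κ := by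
  rw [mem_Vk, hx.rank_lt_iff_mem hκ]

theorem sub_Vk (κ : ZFSet.{u}) : κ ⊆ Vk κ := fun x hx => mem_Vk.2 (ZFSet.rank_lt_of_mem hx)

theorem not_mem_Vk (κ : ZFSet.{u}) : κ ∉ Vk κ := fun h => lt_irrefl _ (mem_Vk.1 h)

theorem Vk_lim {κ : ZFSet.{u}} (h : InfC κ) {o : Ordinal.{u}} (ho : o < ZFSet.rank κ) : Order.succ o < ZFSet.rank κ := by
  have hκ := h.1.ord
  have h1 : o.toZFSet ∈ κ := by
    rw [← (ZFSet.isOrdinal_toZFSet o).rank_lt_iff_mem hκ, Ordinal.rank_toZFSet]; exact ho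
  have h2 := ZFSet.rank_lt_of_mem (h.succ h1)
  rw [ZFSet.rank_insert, Ordinal.rank_toZFSet] at h2
  exact (le_max_left _ _).trans_lt h2

theorem Vk_pow {κ x : ZFSet.{u}} (h : InfC κ) (hx : x ∈ Vk κ) : ZFSet.powerset x ∈ Vk κ := by
  rw [mem_Vk, ZFSet.rank_powerset]; exact Vk_lim h (mem_Vk.1 hx)

theorem Vk_pair {κ x y : ZFSet.{u}} (h : InfC κ) (hx : x ∈ Vk κ) (hy : y ∈ Vk κ) : ({x, y} : ZFSet.{u}) ∈ Vk κ := by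
  rw [mem_Vk, ZFSet.rank_pair]; exact max_lt (Vk_lim h (mem_Vk.1 hx)) (Vk_lim h (mem_Vk.1 hy))

theorem Vk_opair {κ x y : ZFSet.{u}} (h : InfC κ) (hx : x ∈ Vk κ) (hy : y ∈ Vk κ) : ZFSet.pair x y ∈ Vk κ := by
  have h1 : ({x} : ZFSet.{u}) ∈ Vk κ := by
    have := Vk_pair h hx hx
    convert this using 1; ext z; simp
  exact Vk_pair h h1 (Vk_pair h hx hy)

theorem Vk_sU {κ x : ZFSet.{u}} (hx : x ∈ Vk κ) : (⋃₀ x : ZFSet.{u}) ∈ Vk κ := by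
  rw [mem_Vk]; exact (ZFSet.rank_sUnion_le x).trans_lt (mem_Vk.1 hx)

theorem Vk_union {κ x y : ZFSet.{u}} (hx : x ∈ Vk κ) (hy : y ∈ Vk κ) : x ∪ y ∈ Vk κ := by
  rw [mem_Vk, ZFSet.rank_union]; exact max_lt (mem_Vk.1 hx) (mem_Vk.1 hy)

theorem Vk_prod {κ x y : ZFSet.{u}} (h : InfC κ) (hx : x ∈ Vk κ) (hy : y ∈ Vk κ) : ZFSet.prod x y ∈ Vk κ :=
  Vk_sub (fun z hz => by
    obtain ⟨a, ha, b, hb, rfl⟩ := ZFSet.mem_prod.1 hz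
    rw [ZFSet.mem_powerset]
    intro w hw
    rw [ZFSet.mem_powerset]
    intro q hq
    rw [ZFSet.pair, ZFSet.mem_pair] at hw
    rcases hw with rfl | rfl
    · rw [ZFSet.mem_singleton] at hq; subst hq; exact ZFSet.mem_union.2 (Or.inl ha)
    · rcases ZFSet.mem_pair.1 hq with rfl | rfl
      · exact ZFSet.mem_union.2 (Or.inl ha)
      · exact ZFSet.mem_union.2 (Or.inr hb)) (Vk_pow h (Vk_pow h (Vk_union hx hy)))

theorem Vk_card {κ x : ZFSet.{u}} (h : InfC κ) (hc : card (Vk κ) ≤ card κ) (hx : x ∈ Vk κ) : 2 ^ card x < card κ := by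
  have h1 : card (ZFSet.powerset (ZFSet.powerset x)) ≤ card κ :=
    (card_mono ((Vk_tr κ).subset_of_mem (Vk_pow h (Vk_pow h hx)))).trans hc
  rw [card_powerset, card_powerset] at h1
  exact (Cardinal.cantor _).trans_le h1

theorem Vk_card' {κ x : ZFSet.{u}} (h : InfC κ) (hc : card (Vk κ) ≤ card κ) (hx : x ∈ Vk κ) : card x < card κ :=
  (Cardinal.cantor _).trans (Vk_card h hc hx)

theorem exists_small_inj {κ x : ZFSet.{u}} (h : InfC κ) (hc : card (Vk κ) ≤ card κ) (hx : x ∈ Vk κ) :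
    ∃ γ ∈ κ, ∃ g ∈ Vk κ, IsZFunc x g ∧ MapsInto g x γ ∧ InjOnZ g x := by
  have hx' := Vk_card' h hc hx
  have hcγ : card ((card x).ord.toZFSet) = card x := by rw [Ordinal.card_toZFSet, Cardinal.card_ord]
  have hγ : (card x).ord.toZFSet ∈ κ := h.1.mem_of_card (ZFSet.isOrdinal_toZFSet _) (by rw [hcγ]; exact hx')
  obtain ⟨i⟩ := Cardinal.le_def _ _ |>.1 (zcard_le.2 hcγ.ge)
  let F : ZFSet.{u} → ZFSet.{u} := fun y => if h : y ∈ x then (i ⟨y, h⟩).1 else ∅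
  have hF : ∀ y (hy : y ∈ x), F y = (i ⟨y, hy⟩).1 := fun y hy => dif_pos hy
  refine ⟨_, hγ, grf F x, ?_, grf_func _ _, ?_, ?_⟩
  · refine Vk_sub ?_ (Vk_prod h hx (sub_Vk κ hγ))
    intro p hp
    obtain ⟨y, hy, rfl⟩ := mem_grf.1 hp
    rw [ZFSet.pair_mem_prod]
    exact ⟨hy, by rw [hF y hy]; exact (i ⟨y, hy⟩).2⟩
  · intro y hy; rw [grf_app hy, hF y hy]; exact (i ⟨y, hy⟩).2
  · intro y hy z hz e
    rw [grf_app hy, grf_app hz, hF y hy, hF z hz] at e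
    have := i.injective (Subtype.ext e)
    exact congrArg Subtype.val this

structure UE (κ U M N : ZFSet.{u}) (j : ZFSet.{u} → ZFSet.{u}) : Prop where
  hi : InfC κ
  lr : LR κ U M
  vk : Vk κ ∈ M
  cM : card M ≤ card κ
  up : IsUltrapowerEmb κ M U N j

theorem IsRamseyMeasure.ue {κ U : ZFSet.{u}} (hκ : IsCard κ) (h : IsRamseyMeasure κ U) :
    UE κ U (MU κ U) (NU κ U) (jU κ U) := by
  have hs := h.1.spec
  have hl := h.lr hκ
  have hi := h.infC hκ
  refine ⟨hi, hl, hasV_iff.1 hs.2.1, (zcard_le.1 hs.1.2.2.le), ?_⟩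
  obtain ⟨N, j, hj⟩ := ultrapower_exists hi hl
  have hex : ∃ p : ZFSet.{u} × (ZFSet.{u} → ZFSet.{u}), IsUltrapowerEmb κ (MU κ U) U p.1 p.2 := ⟨(N, j), hj⟩
  unfold NU jU upData
  rw [dif_pos hex]
  exact hex.choose_spec

namespace UE
variable {κ U M N : ZFSet.{u}} {j : ZFSet.{u} → ZFSet.{u}}

theorem el (h : UE κ U M N j) : Elem M N j := ⟨h.up.2.1, h.up.2.2.1⟩
theorem pM (h : UE κ U M N j) : PM M := h.lr.pm
theorem pN (h : UE κ U M N j) : PM N := h.el.pm h.pM h.up.1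
theorem ord (h : UE κ U M N j) : κ.IsOrdinal := h.hi.1.ord
theorem wM (h : UE κ U M N j) : WOP M := h.lr.hl.wop h.pM h.lr.mem h.ord
theorem jm (h : UE κ U M N j) {x : ZFSet.{u}} (hx : x ∈ M) : j x ∈ N := h.up.2.1 x hx
theorem uf (h : UE κ U M N j) : IsMUltrafilter κ M U := h.lr.uf
theorem κM (h : UE κ U M N j) : κ ∈ M := h.lr.mem
theorem c0 (h : UE κ U M N j) : ∅ ∈ κ := h.hi.ex2.1
theorem VM (h : UE κ U M N j) {x : ZFSet.{u}} (hx : x ∈ Vk κ) : x ∈ M := h.pM.mem h.vk hx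
theorem cV (h : UE κ U M N j) : card (Vk κ) ≤ card κ :=
  (card_mono (h.pM.tr.subset_of_mem h.vk)).trans h.cM

theorem κj (h : UE κ U M N j) : κ ∈ j κ :=
  (h.up.2.2.2.2 κ h.κM (fun _ h => h)).1 (uf_univ h.uf h.c0 h.κM)
theorem κN (h : UE κ U M N j) : κ ∈ N := h.pN.mem (h.jm h.κM) h.κj

theorem df (h : UE κ U M N j) (P : ZFSet.{u} → (ℕ → ZFSet.{u}) → Prop) (l : List ZFSet.{u}) (hl : ∀ x ∈ l, x ∈ M) [hP : Def P] :
    P M (env l) ↔ P N (fun n => j (env l n)) := h.el.dfl h.pM h.pN P l hl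

theorem jmem (h : UE κ U M N j) {x y : ZFSet.{u}} (hx : x ∈ M) (hy : y ∈ M) : x ∈ y ↔ j x ∈ j y :=
  h.df (fun D v => v 0 ∈ v 1) [x, y] (by simp [hx, hy])
theorem jeq (h : UE κ U M N j) {x y : ZFSet.{u}} (hx : x ∈ M) (hy : y ∈ M) : x = y ↔ j x = j y :=
  h.df (fun D v => v 0 = v 1) [x, y] (by simp [hx, hy])
theorem jsub (h : UE κ U M N j) {x y : ZFSet.{u}} (hx : x ∈ M) (hy : y ∈ M) : x ⊆ y ↔ j x ⊆ j y :=
  h.df (fun D v => v 0 ⊆ v 1) [x, y] (by simp [hx, hy])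

theorem refl (h : UE κ U M N j) (Q : ZFSet.{u} → ZFSet.{u} → (ℕ → ZFSet.{u}) → Prop)
    (l : List ZFSet.{u}) (hl : ∀ x ∈ l, x ∈ M)
    [hQ : Def (fun D v => Q D (v 0) (fun n => v (n + 1)))]  :
    ZFSet.sep (fun ξ => Q M ξ (env l)) κ ∈ U ↔ Q N κ (fun n => j (env l n)) := by
  have hS : ZFSet.sep (fun ξ => Q M ξ (env l)) κ ∈ M := h.pM.sep Q (env l) (env_in h.pM hl) h.κM
  rw [h.up.2.2.2.2 _ hS (fun z hz => (ZFSet.mem_sep.1 hz).1)]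
  have hd : Def (fun D v => Q D (v 0) (fun n => v (n + 3))) :=
    Def.ren hQ (fun n => Nat.casesOn n 0 (fun k => k + 3))
  have := (h.df (fun D v => ∀ x, x ∈ D → (x ∈ v 0 ↔ x ∈ v 1 ∧ Q D x (fun n => v (n + 2))))
    (ZFSet.sep (fun ξ => Q M ξ (env l)) κ :: κ :: l) (by
      intro x hx
      simp only [List.mem_cons] at hx
      rcases hx with rfl | rfl | hx
      exacts [hS, h.κM, hl x hx])).1 (fun x hx => by
        show x ∈ ZFSet.sep (fun ξ => Q M ξ (env l)) κ ↔ x ∈ κ ∧ Q M x (env l)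
        rw [ZFSet.mem_sep]) κ h.κN
  rw [show κ ∈ j (ZFSet.sep (fun ξ => Q M ξ (env l)) κ) ↔ κ ∈ j κ ∧ Q N κ (fun n => j (env l n)) from this]
  exact and_iff_right h.κj

theorem refl_all (h : UE κ U M N j) (Q : ZFSet.{u} → ZFSet.{u} → (ℕ → ZFSet.{u}) → Prop)
    (l : List ZFSet.{u}) (hl : ∀ x ∈ l, x ∈ M)
    [hQ : Def (fun D v => Q D (v 0) (fun n => v (n + 1)))] (hall : ∀ ξ ∈ κ, Q M ξ (env l)) :
    Q N κ (fun n => j (env l n)) :=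
  (h.refl Q l hl).1 (uf_all h.uf h.c0 h.κM hall)

theorem rep (h : UE κ U M N j) {a : ZFSet.{u}} (ha : a ∈ N) :
    ∃ f, f ∈ M ∧ IsZFunc κ f ∧ fapp (j f) κ = a := by
  obtain ⟨f, hf, h1, -, h2⟩ := h.up.2.2.2.1 a ha
  exact ⟨f, hf, h1, h2⟩

theorem jV (h : UE κ U M N j) {x : ZFSet.{u}} : x ∈ Vk κ → j x = x := by
  induction x using ZFSet.inductionOn with
  | _ x ih =>
    intro hx
    have hxM := h.VM hx
    ext y
    constructor
    · intro hy
      obtain ⟨f, hf, hff, rfl⟩ := h.rep (h.pN.mem (h.jm hxM) hy)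
      have hs := (h.refl (fun D ξ v => fapp (v 0) ξ ∈ v 1) [f, x] (by simp [hf, hxM])).2 hy
      obtain ⟨γ, hγ, g, hg, hgf, hgm, hgi⟩ := exists_small_inj h.hi h.cV hx
      have hgM := h.VM hg
      have hF : grf (fun ξ => fapp g (fapp f ξ)) κ ∈ M :=
        h.pM.grfT (fun D v => fapp (v 1) (fapp (v 2) (v 0))) [g, f] (by simp [hgM, hf]) h.κM
      have h1 := h.uf.2.2.2.1 _ hs _ (h.uf.2.1 γ hγ)
      obtain ⟨δ, hδ, hs2⟩ := h.uf.2.2.2.2.2.2 _ hF (grf_func _ _) (by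
        refine h.uf.2.2.2.2.1 _ h1 _ (h.pM.sep (fun D ξ v => fapp (v 0) ξ ∈ ξ) (env [grf (fun ξ => fapp g (fapp f ξ)) κ])
          (env_in h.pM (by simp [hF])) h.κM) (fun z hz => (ZFSet.mem_sep.1 hz).1) ?_
        intro z hz
        obtain ⟨hz1, hz2⟩ := ZFSet.mem_inter.1 hz
        obtain ⟨hz3, hz4⟩ := ZFSet.mem_sep.1 hz1
        obtain ⟨-, hz5⟩ := ZFSet.mem_sep.1 hz2
        refine ZFSet.mem_sep.2 ⟨hz3, ?_⟩
        show fapp (grf (fun ξ => fapp g (fapp f ξ)) κ) z ∈ z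
        rw [grf_app hz3]
        rcases (h.ord.mem hz3).mem_or_subset (h.ord.mem hγ) with h6 | h6
        · exact absurd h6 hz5
        · exact h6 (hgm _ hz4))
      have h3 := (uf_and h.uf h.pM (h.uf.1 _ hs).1 (h.uf.1 _ hs2).1).2 ⟨hs, hs2⟩
      obtain ⟨ξ, hξ, h4, h5⟩ := uf_ex h.uf h3
      have h4 : fapp f ξ ∈ x := h4
      have hfξ := h.pM.mem hxM h4
      have h6 := (h.refl (fun D ξ v => fapp (v 0) ξ = v 1) [f, fapp f ξ] (by simp [hf, hfξ])).1 (by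
        refine uf_mono h.uf h3 (h.pM.sep (fun D ξ v => fapp (v 0) ξ = v 1) (env [f, fapp f ξ]) (env_in h.pM (by simp [hf, hfξ])) h.κM) ?_
        rintro z hz ⟨h7, h8⟩
        rw [grf_app hz] at h8
        rw [grf_app hξ] at h5
        exact hgi _ h7 _ h4 (h8.trans h5.symm))
      have h6 : fapp (j f) κ = j (fapp f ξ) := h6
      rw [h6, ih _ h4 ((Vk_tr κ).mem_trans h4 hx)]; exact h4
    · intro hy
      have hyV := (Vk_tr κ).mem_trans hy hx
      rw [← ih y hy hyV]
      exact (h.jmem (h.VM hyV) hxM).1 hy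

theorem jκ (h : UE κ U M N j) {x : ZFSet.{u}} (hx : x ∈ κ) : j x = x := h.jV (sub_Vk κ hx)

/-- membership of small sets in `j X` -/
theorem memj (h : UE κ U M N j) {x X : ZFSet.{u}} (hx : x ∈ Vk κ) (hX : X ∈ M) : x ∈ j X ↔ x ∈ X := by
  rw [h.jmem (h.VM hx) hX, h.jV hx]

theorem Vsub (h : UE κ U M N j) : Vk κ ⊆ j (Vk κ) := fun x hx => (h.memj hx h.vk).2 hx

theorem subN (h : UE κ U M N j) {A : ZFSet.{u}} (hA : A ⊆ κ) : A ∈ N ↔ A ∈ M := by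
  constructor
  · intro hN
    obtain ⟨f, hf, hff, rfl⟩ := h.rep hN
    have hF : grf (fun α => ZFSet.sep (fun ξ => α ∈ fapp f ξ) κ) κ ∈ M := by
      have := h.pM.grf (fun D α y v => ∀ ξ, ξ ∈ D → (ξ ∈ y ↔ ξ ∈ v 0 ∧ α ∈ fapp (v 1) ξ)) (l := [κ, f]) (by simp [h.κM, hf]) h.κM
        (F := fun α => ZFSet.sep (fun ξ => α ∈ fapp f ξ) κ)
        (fun α hα => h.pM.sep (fun D ξ v => v 0 ∈ fapp (v 1) ξ) (env [α, f]) (env_in h.pM (by simp [h.pM.mem h.κM hα, hf])) h.κM)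
        (fun α hα y hy => by
          constructor
          · intro H; ext ξ; rw [ZFSet.mem_sep]
            constructor
            · intro hξ; exact (H ξ (h.pM.mem hy hξ)).1 hξ
            · intro hξ; exact (H ξ (h.pM.mem h.κM hξ.1)).2 hξ
          · rintro rfl ξ hξ; rw [ZFSet.mem_sep]; rfl)
      exact this
    set F := grf (fun α => ZFSet.sep (fun ξ => α ∈ fapp f ξ) κ) κ with hFd
    have hX := h.pM.range h.κM hF
    have hXU := h.lr.wa _ hX ⟨F, hF, grf_func _ _, fun y hy => by
      obtain ⟨ξ, hξ, e⟩ := mem_img.1 hy; exact ⟨ξ, hξ, e⟩⟩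
    have hB := h.pM.sep (fun D α v => fapp (v 0) α ∈ v 1) (env [F, img (fun x => fapp F x) κ ∩ U])
      (env_in h.pM (by simp [hF, hXU])) h.κM
    convert hB using 1
    ext α
    have e2 : ∀ α ∈ κ, (α ∈ fapp (j f) κ ↔ fapp F α ∈ U) := by
      intro α hα
      have := h.refl (fun D ξ v => v 0 ∈ fapp (v 1) ξ) [α, f] (by simp [h.pM.mem h.κM hα, hf])
      rw [show (fapp F α = ZFSet.sep (fun ξ => α ∈ fapp f ξ) κ) from grf_app hα]
      rw [show (ZFSet.sep (fun ξ => α ∈ fapp f ξ) κ ∈ U ↔ j α ∈ fapp (j f) κ) from this, h.jκ hα]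
    rw [ZFSet.mem_sep]
    constructor
    · intro hα
      refine ⟨hA hα, ?_⟩
      show fapp F α ∈ img (fun x => fapp F x) κ ∩ U
      exact ZFSet.mem_inter.2 ⟨mem_img.2 ⟨α, hA hα, rfl⟩, (e2 α (hA hα)).1 hα⟩
    · rintro ⟨hα, h2⟩
      exact (e2 α hα).2 (ZFSet.mem_inter.1 h2).2
  · intro hM
    have : A = j A ∩ κ := by
      ext x; rw [ZFSet.mem_inter]
      constructor
      · intro hx; exact ⟨(h.memj (sub_Vk κ (hA hx)) hM).2 hx, hA hx⟩
      · rintro ⟨h1, h2⟩; exact (h.memj (sub_Vk κ h2) hM).1 h1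
    rw [this]; exact h.pN.inter_mem (h.jm hM) h.κN

/-- transfer between models with the same subsets of `κ` -/
theorem _root_.MPaper.HM.transfer {κ M N z : ZFSet.{u}} (hi : InfC κ) (pM : PM M) (pN : PM N) (κM : κ ∈ M) (κN : κ ∈ N)
    (hs : ∀ A, A ⊆ κ → A ∈ M → A ∈ N) (h : HM M κ z) : HM N κ z := by
  obtain ⟨t, ht, htr, hz, hc⟩ := h
  obtain ⟨f, hf, hff, hsur⟩ := hc.surj pM κM ht ⟨z, hz⟩
  have := codeOf_dec hi pN κN hff htr hsur (hs _ (codeOf_sub _ _) (codeOf_mem hi pM κM hf))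
  exact ⟨t, this.2, htr, hz, f, this.1, hff, hsur.2⟩

theorem mem_iff (h : UE κ U M N j) {z : ZFSet.{u}} : z ∈ M ↔ HM N κ z := by
  constructor
  · intro hz
    exact (h.lr.hl z hz).transfer h.hi h.pM h.pN h.κM h.κN fun A hA hAM => (h.subN hA).2 hAM
  · intro hz
    exact (hz.transfer h.hi h.pN h.pM h.κN h.κM fun A hA hAM => (h.subN hA).1 hAM).mem h.pM

theorem MsubN (h : UE κ U M N j) {z : ZFSet.{u}} (hz : z ∈ M) : z ∈ N := (h.mem_iff.1 hz).mem h.pN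

theorem cN (h : UE κ U M N j) : card N ≤ card κ :=
  (card_le_of_surj (fun f => fapp (j f) κ) fun y hy => by
    obtain ⟨f, hf, -, e⟩ := h.rep hy; exact ⟨f, hf, e⟩).trans h.cM

end UE

theorem exists_rank_eq {t : ZFSet.{u}} (ht : t.IsTransitive) (o : Ordinal.{u}) : ∀ x : ZFSet.{u}, x ⊆ t → o < ZFSet.rank x →
    ∃ y ∈ t, ZFSet.rank y = o := by
  intro x
  induction x using ZFSet.inductionOn with
  | _ x ih =>
    intro hx ho
    obtain ⟨y, hy, hle⟩ := ZFSet.lt_rank_iff.1 ho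
    rcases hle.eq_or_lt with e | hlt
    · exact ⟨y, hx hy, e.symm⟩
    · exact ih y hy (ht.subset_of_mem (hx hy)) hlt

theorem card_rank_le {t : ZFSet.{u}} (ht : t.IsTransitive) : (ZFSet.rank t).card ≤ card t := by
  rw [← Ordinal.card_toZFSet]
  refine card_le_of_surj (fun y => (ZFSet.rank y).toZFSet) fun y hy => ?_
  obtain ⟨a, ha, rfl⟩ := Ordinal.mem_toZFSet_iff.1 hy
  obtain ⟨z, hz, e⟩ := exists_rank_eq ht a t (fun _ h => h) ha
  exact ⟨z, hz, by rw [e]⟩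

theorem exists_Vbound {κ ξ : ZFSet.{u}} (hi : InfC κ) (hc : card (Vk κ) ≤ card κ) (hξ : ξ ∈ κ) :
    ∃ h ∈ Vk κ, ∀ t : ZFSet.{u}, t.IsTransitive → card t ≤ card ξ → t ∈ h := by
  refine ⟨ZFSet.vonNeumann (Order.succ (card ξ)).ord, ?_, fun t ht hct => ?_⟩
  · apply ZFSet.vonNeumann_mem_of_lt
    have : ((Order.succ (card ξ)).ord).toZFSet ∈ κ := by
      apply hi.1.mem_of_card (ZFSet.isOrdinal_toZFSet _)
      rw [Ordinal.card_toZFSet, Cardinal.card_ord]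
      exact (Order.succ_le_of_lt (Cardinal.cantor _)).trans_lt (Vk_card hi hc (sub_Vk κ hξ))
    have := ZFSet.rank_lt_of_mem this
    rwa [Ordinal.rank_toZFSet] at this
  · rw [ZFSet.mem_vonNeumann, Cardinal.lt_ord, Order.lt_succ_iff]
    exact (card_rank_le ht).trans hct

namespace UE
variable {κ U M N : ZFSet.{u}} {j : ZFSet.{u} → ZFSet.{u}}

theorem Ktr (h : UE κ U M N j) : (j (Vk κ)).IsTransitive :=
  (h.df (fun D v => (v 0).IsTransitive) [Vk κ] (by simp [h.vk])).1 (Vk_tr κ)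

theorem KN (h : UE κ U M N j) : j (Vk κ) ∈ N := h.jm h.vk

theorem Ksub (h : UE κ U M N j) {x y : ZFSet.{u}} (hx : x ∈ N) (hxy : x ⊆ y) (hy : y ∈ j (Vk κ)) : x ∈ j (Vk κ) :=
  (h.df (fun D v => ∀ y, y ∈ v 0 → ∀ x, x ∈ D → x ⊆ y → x ∈ v 0) [Vk κ] (by simp [h.vk])).1
    (fun y hy x _ hxy => Vk_sub hxy hy) y hy x hx hxy

theorem KsU (h : UE κ U M N j) {x : ZFSet.{u}} (hx : x ∈ j (Vk κ)) : (⋃₀ x : ZFSet.{u}) ∈ j (Vk κ) :=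
  (h.df (fun D v => ∀ y, y ∈ v 0 → (⋃₀ y : ZFSet.{u}) ∈ v 0) [Vk κ] (by simp [h.vk])).1
    (fun y hy => Vk_sU hy) x hx

theorem Kpair (h : UE κ U M N j) {x y : ZFSet.{u}} (hx : x ∈ j (Vk κ)) (hy : y ∈ j (Vk κ)) : ({x, y} : ZFSet.{u}) ∈ j (Vk κ) :=
  (h.df (fun D v => ∀ x, x ∈ v 0 → ∀ y, y ∈ v 0 → ({x, y} : ZFSet.{u}) ∈ v 0) [Vk κ] (by simp [h.vk])).1
    (fun x hx y hy => Vk_pair h.hi hx hy) x hx y hy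

theorem Kopair (h : UE κ U M N j) {x y : ZFSet.{u}} (hx : x ∈ j (Vk κ)) (hy : y ∈ j (Vk κ)) : ZFSet.pair x y ∈ j (Vk κ) :=
  (h.df (fun D v => ∀ x, x ∈ v 0 → ∀ y, y ∈ v 0 → ZFSet.pair x y ∈ v 0) [Vk κ] (by simp [h.vk])).1
    (fun x hx y hy => Vk_opair h.hi hx hy) x hx y hy

theorem Kprod (h : UE κ U M N j) {x y : ZFSet.{u}} (hx : x ∈ j (Vk κ)) (hy : y ∈ j (Vk κ)) : ZFSet.prod x y ∈ j (Vk κ) :=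
  (h.df (fun D v => ∀ x, x ∈ v 0 → ∀ y, y ∈ v 0 → ZFSet.prod x y ∈ v 0) [Vk κ] (by simp [h.vk])).1
    (fun x hx y hy => Vk_prod h.hi hx hy) x hx y hy

theorem κK (h : UE κ U M N j) : κ ∈ j (Vk κ) :=
  (h.jsub h.κM h.vk).1 (sub_Vk κ) h.κj

/-- `M` is an element of `j (V_κ)` -/
theorem MK (h : UE κ U M N j) : M ∈ j (Vk κ) := by
  obtain ⟨H, hH, hb⟩ := h.refl_all (fun D ξ v => ∃ h, h ∈ v 0 ∧ ∀ t, t ∈ D → t.IsTransitive → Cov D ξ t → t ∈ h) [Vk κ]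
    (by simp [h.vk]) (fun ξ hξ => by
      obtain ⟨H, hH, hb⟩ := exists_Vbound h.hi h.cV hξ
      exact ⟨H, hH, fun t ht htr hc => hb t htr hc.card⟩)
  have hH : H ∈ j (Vk κ) := hH
  have hHN := h.pN.mem h.KN hH
  have e : M = ZFSet.sep (fun z => HM N κ z) (⋃₀ H) := by
    ext z
    rw [ZFSet.mem_sep, h.mem_iff]
    constructor
    · intro hz
      refine ⟨?_, hz⟩
      obtain ⟨t, ht, htr, hzt, hc⟩ := hz
      exact ZFSet.mem_sUnion.2 ⟨t, hb t ht htr hc, hzt⟩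
    · exact fun hz => hz.2
  have hMN : M ∈ N := by
    rw [e]
    exact h.pN.sep (fun D z v => HM D (v 0) z) (env [κ]) (env_in h.pN (by simp [h.κN])) (h.pN.un _ hHN)
  refine h.Ksub hMN ?_ (h.KsU hH)
  intro z hz; rw [e] at hz; exact (ZFSet.mem_sep.1 hz).1

theorem MN (h : UE κ U M N j) : M ∈ N := h.pN.mem h.KN h.MK

theorem MsubK (h : UE κ U M N j) {x : ZFSet.{u}} (hx : x ∈ M) : x ∈ j (Vk κ) := h.Ktr.mem_trans hx h.MK

theorem eqH (h : UE κ U M N j) : M = Hset N κ := by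
  ext z; rw [mem_Hset h.pN, h.mem_iff]

theorem wN (h : UE κ U M N j) : WOP N := by
  have hH : Hlike (j κ) N := fun y hy =>
    (h.df (fun D v => ∀ y, y ∈ D → HM D (v 0) y) [κ] (by simp [h.κM])).1 h.lr.hl y hy
  have ho : IsOrd (j κ) := (h.df (fun D v => IsOrd (v 0)) [κ] (by simp [h.κM])).1 (isOrd_iff.2 h.ord)
  exact hH.wop h.pN (h.jm h.κM) (isOrd_iff.1 ho)

end UE

namespace UE
variable {κ U M N : ZFSet.{u}} {j : ZFSet.{u} → ZFSet.{u}}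

theorem dec_sub (h : UE κ U M N j) {y m : ZFSet.{u}} (hy : y ∈ N) (pm : PM m) (κm : κ ∈ m) (hl : Hlike κ m)
    (uf : IsMUltrafilter κ m y) : m ⊆ M := by
  intro z hz
  refine ((hl z hz).transfer h.hi pm h.pM κm h.κM fun A hA hAm => ?_).mem h.pM
  rcases uf.2.2.2.2.2.1 A hAm hA with h1 | h1
  · exact (h.subN hA).1 (h.pN.mem hy h1)
  · have := (h.subN (uf.1 _ h1).2).1 (h.pN.mem hy h1)
    rw [← compl_compl_eq hA]
    exact h.pM.compl_mem h.κM this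

theorem dec_mem (h : UE κ U M N j) {y m : ZFSet.{u}} (hy : y ∈ N) (pm : PM m) (κm : κ ∈ m) (hl : Hlike κ m)
    (uf : IsMUltrafilter κ m y) : m ∈ N := by
  have hs := h.dec_sub hy pm κm hl uf
  set g := grf (gp κ) (ZFSet.prod κ κ) with hg
  have hgN : g ∈ N := (gp_spec h.hi).2.2 N h.pN h.κN
  have := h.pN.sep (fun D z v => ∃ t, t ∈ D ∧ (t.IsTransitive ∧ z ∈ t ∧ ∃ f, f ∈ D ∧ (IsZFunc (v 0) f ∧ SurjOnto f (v 0) t ∧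
    ((ZFSet.sep (fun ξ => ∃ a, a ∈ v 0 ∧ ∃ b, b ∈ v 0 ∧ (ξ = fapp (v 1) (ZFSet.pair a b)
    ∧ fapp f a ∈ fapp f b)) (v 0)) ∈ v 2 ∨ compl (v 0) (ZFSet.sep (fun ξ => ∃ a, a ∈ v 0 ∧ ∃ b, b ∈ v 0 ∧ (ξ = fapp (v 1) (ZFSet.pair a b)
    ∧ fapp f a ∈ fapp f b)) (v 0)) ∈ v 2))))
    (env [κ, g, y]) (env_in h.pN (by simp [h.κN, hgN, hy])) h.MN
  convert this using 1
  ext z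
  rw [ZFSet.mem_sep]
  constructor
  · intro hz
    refine ⟨hs hz, ?_⟩
    obtain ⟨t, ht, htr, hzt, hc⟩ := hl z hz
    obtain ⟨f, hf, hff, hsur⟩ := hc.surj pm κm ht ⟨z, hzt⟩
    refine ⟨t, h.MsubN (hs ht), htr, hzt, f, h.MsubN (hs hf), hff, hsur, ?_⟩
    exact uf.2.2.2.2.2.1 _ (codeOf_mem h.hi pm κm hf) (codeOf_sub κ f)
  · rintro ⟨-, t, ht, htr, hzt, f, hf, hff, hsur, hc⟩
    have hc : codeOf κ f ∈ y ∨ compl κ (codeOf κ f) ∈ y := hc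
    have : codeOf κ f ∈ m := by
      rcases hc with hc | hc
      · exact (uf.1 _ hc).1
      · rw [← compl_compl_eq (codeOf_sub κ f)]; exact pm.compl_mem κm (uf.1 _ hc).1
    exact pm.mem (codeOf_dec h.hi pm κm hff htr hsur this).2 hzt

theorem jω (h : UE κ U M N j) : j ZFSet.omega = ZFSet.omega := h.jκ (h.lr.omega_mem h.hi)

theorem oi (h : UE κ U M N j) {y : ZFSet.{u}} (hy : y ∈ N) (hsub : ∀ s ∈ y, s ⊆ κ)
    (ho : OmegaOneIntersectingIn N y) : OmegaOneIntersecting y := by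
  intro s hs
  obtain ⟨F, hF, hFF, rfl⟩ := h.rep hy
  have hsM : ∀ n, s n ∈ M := fun n => (h.subN (hsub _ (hs n))).1 (h.pN.mem hy (hs n))
  have hX := (h.refl (fun D ξ v => ∀ f, f ∈ D → IsZFunc (v 0) f → (∀ n, n ∈ v 0 → fapp f n ∈ fapp (v 1) ξ) →
    ∃ x, x ∈ D ∧ ∀ n, n ∈ v 0 → x ∈ fapp f n) [ZFSet.omega, F] (by simp [h.lr.om, hF])).2 (by
      show ∀ f, f ∈ N → IsZFunc (j ZFSet.omega) f → (∀ n, n ∈ (j ZFSet.omega) → fapp f n ∈ fapp (j F) κ) →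
        ∃ x, x ∈ N ∧ ∀ n, n ∈ (j ZFSet.omega) → x ∈ fapp f n
      rw [h.jω]
      intro f hf hff hfm
      obtain ⟨x, hx⟩ := ho f hf hff hfm
      have h0 : (∅ : ZFSet.{u}) ∈ ZFSet.omega := mem_omega.2 ⟨0, rfl⟩
      exact ⟨x, h.pN.mem (h.pN.mem hy (hfm _ h0)) (hx _ h0), hx⟩)
  have hXn : ∀ n, ZFSet.sep (fun ξ => s n ∩ ξ ∈ fapp F ξ) κ ∈ U := fun n =>
    (h.refl (fun D ξ v => v 0 ∩ ξ ∈ fapp (v 1) ξ) [s n, F] (by simp [hsM n, hF])).2 (by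
      show j (s n) ∩ κ ∈ fapp (j F) κ
      have : j (s n) ∩ κ = s n := by
        ext x; rw [ZFSet.mem_inter]
        constructor
        · rintro ⟨h1, h2⟩; exact (h.memj (sub_Vk κ h2) (hsM n)).1 h1
        · intro hx; exact ⟨(h.memj (sub_Vk κ (hsub _ (hs n) hx)) (hsM n)).2 hx, hsub _ (hs n) hx⟩
      rw [this]; exact hs n)
  obtain ⟨ξ, hξ⟩ := h.lr.oi (fun n => Nat.casesOn n _ fun n => ZFSet.sep (fun ξ => s n ∩ ξ ∈ fapp F ξ) κ) (fun n => by
    cases n with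
    | zero => exact hX
    | succ n => exact hXn n)
  have h0 := hξ 0
  obtain ⟨hξκ, h0⟩ := ZFSet.mem_sep.1 h0
  have h1 : ∀ n, s n ∩ ξ ∈ fapp F ξ := fun n => (ZFSet.mem_sep.1 (hξ (n + 1))).2
  -- the sequence
  have hun : ∀ i ∈ ZFSet.omega.{u}, ∃ n, i = nz n := fun i hi => mem_omega.1 hi
  let S : ZFSet.{u} → ZFSet.{u} := fun i => if hi : ∃ n, i = nz n then s hi.choose ∩ ξ else ∅
  have hS : ∀ n, S (nz n) = s n ∩ ξ := by
    intro n
    have hx : ∃ k, nz.{u} n = nz k := ⟨n, rfl⟩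
    show (if hi : ∃ k, nz.{u} n = nz k then s hi.choose ∩ ξ else ∅) = _
    rw [dif_pos hx, ← nz_inj hx.choose_spec]
  have hξV := sub_Vk κ hξκ
  have hSV : grf S ZFSet.omega ∈ Vk κ := by
    refine Vk_sub (y := ZFSet.prod ZFSet.omega (ZFSet.powerset ξ)) ?_ (Vk_prod h.hi (sub_Vk κ (h.lr.omega_mem h.hi)) (Vk_pow h.hi hξV))
    intro p hp
    obtain ⟨i, hi, rfl⟩ := mem_grf.1 hp
    obtain ⟨n, rfl⟩ := hun i hi
    rw [ZFSet.pair_mem_prod, ZFSet.mem_powerset, hS]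
    exact ⟨hi, fun x hx => (ZFSet.mem_inter.1 hx).2⟩
  obtain ⟨x, -, hx⟩ := h0 (grf S ZFSet.omega) (h.VM hSV) (grf_func _ _) (fun i hi => by
    have hi : i ∈ ZFSet.omega := hi
    rw [grf_app hi]
    obtain ⟨n, rfl⟩ := hun i hi
    rw [hS]; exact h1 n)
  refine ⟨x, fun n => ?_⟩
  have hn : nz n ∈ ZFSet.omega := mem_omega.2 ⟨n, rfl⟩
  have : x ∈ fapp (grf S ZFSet.omega) (nz n) := hx _ hn
  rw [grf_app hn, hS] at this
  exact (ZFSet.mem_inter.1 this).1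

theorem ramIn (h : UE κ U M N j) {y : ZFSet.{u}} : RamseyMeasureIn N κ y ↔ y ∈ N ∧ IsRamseyMeasure κ y := by
  constructor
  · rintro ⟨h1, h2, h3, h4⟩
    exact ⟨h1, h2, h3, h.oi h1 h2.2.1 h4⟩
  · rintro ⟨h1, h2, h3, h4⟩
    refine ⟨h1, h2, h3, fun f hf hff hfm => ?_⟩
    obtain ⟨x, hx⟩ := h4 (fun n => fapp f (nz n)) fun n => hfm _ (mem_omega.2 ⟨n, rfl⟩)
    exact ⟨x, fun i hi => by obtain ⟨n, rfl⟩ := mem_omega.1 hi; exact hx n⟩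

/-- if `y ∈ N` gives an ultrapower of a set model, it is in `N` -/
theorem NUmem (h : UE κ U M N j) {y m n' : ZFSet.{u}} {j' : ZFSet.{u} → ZFSet.{u}} (hy : y ∈ N) (h' : UE κ y m n' j') : n' ∈ N := by
  have hm := h.dec_mem hy h'.pM h'.κM h'.lr.hl h'.uf
  have hUF : UF κ m ∈ N := h.pN.sep (fun D f v => IsZFunc (v 0) f) (env [κ]) (env_in h.pN (by simp [h.κN])) hm
  have hUR : UR κ m y ∈ N := by
    have := h.pN.sep (fun D p v => ∃ f, f ∈ D ∧ ∃ g, g ∈ D ∧ (p = ZFSet.pair f g ∧ ZFSet.sep (fun ξ => fapp f ξ ∈ fapp g ξ) (v 0) ∈ v 1))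
      (env [κ, y]) (env_in h.pN (by simp [h.κN, hy])) (h.pN.prod_mem hUF hUF)
    convert this using 1
    ext p
    rw [UR, ZFSet.mem_sep, ZFSet.mem_sep]
    refine and_congr_right fun hp => ?_
    constructor
    · rintro ⟨f, g, rfl, hs⟩
      obtain ⟨h1, h2⟩ := ZFSet.pair_mem_prod.1 hp
      exact ⟨f, h.pN.mem hUF h1, g, h.pN.mem hUF h2, rfl, hs⟩
    · rintro ⟨f, -, g, -, rfl, hs⟩; exact ⟨f, g, rfl, hs⟩
  have hG : Collapses (fun f => fapp (j' f) κ) (UF κ m) (UR κ m y) := by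
    intro f hf z
    have hfm := (mem_UF.1 hf).1
    constructor
    · intro hz
      obtain ⟨g, hg, hgf, rfl⟩ := h'.rep (h'.pN.mem (h'.pN.fapp_mem (h'.jm hfm) h'.κN) hz)
      refine ⟨g, mem_UF.2 ⟨hg, hgf⟩, ?_, rfl⟩
      rw [mem_UR (mem_UF.2 ⟨hg, hgf⟩) hf]
      exact (h'.refl (fun D ξ v => fapp (v 0) ξ ∈ fapp (v 1) ξ) [g, f] (by simp [hg, hfm])).2 hz
    · rintro ⟨g, hg, hgf, rfl⟩
      rw [mem_UR hg hf] at hgf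
      exact (h'.refl (fun D ξ v => fapp (v 0) ξ ∈ fapp (v 1) ξ) [g, f] (by simp [(mem_UF.1 hg).1, hfm])).1 hgf
  have := h.pN.img_of_grf hUF (h.pN.collapse hUF hUR hG)
  convert this using 1
  ext z
  rw [mem_img]
  constructor
  · intro hz
    obtain ⟨g, hg, hgf, rfl⟩ := h'.rep hz
    exact ⟨g, mem_UF.2 ⟨hg, hgf⟩, rfl⟩
  · rintro ⟨g, hg, rfl⟩
    exact h'.pN.fapp_mem (h'.jm (mem_UF.1 hg).1) h'.κN

end UE

theorem oGEin_iff {Pm : ZFSet.{u} → ZFSet.{u} → ZFSet.{u} → Prop} {κ N : ZFSet.{u}} {α : Ordinal.{u+1}} :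
    oGEin Pm κ α N ↔ ∀ A ∈ N, A ⊆ κ → ∀ β < α, ∃ W ∈ N, Pm N κ W ∧ A ∈ MU κ W ∧ oGEin Pm κ β (NU κ W) := by
  unfold oGEin
  rw [WellFounded.fix_eq]
  rfl

def oGE (κ : ZFSet.{u}) (α : Ordinal.{u+1}) (N : ZFSet.{u}) : Prop := oGEin RamseyMeasureIn κ α N
def oEQ (κ : ZFSet.{u}) (α : Ordinal.{u+1}) (N : ZFSet.{u}) : Prop := oEQin RamseyMeasureIn κ α N

theorem oGE.mono {κ N : ZFSet.{u}} {α β : Ordinal.{u+1}} (h : oGE κ α N) (hb : β ≤ α) : oGE κ β N := by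
  unfold oGE at *
  rw [oGEin_iff] at *
  exact fun A hA hs γ hγ => h A hA hs γ (hγ.trans_le hb)

theorem oEQ.inj {κ N : ZFSet.{u}} {α β : Ordinal.{u+1}} (h : oEQ κ α N) (h' : oEQ κ β N) : α = β := by
  rcases lt_trichotomy α β with h1 | h1 | h1
  · exact absurd (oGE.mono h'.1 (Order.add_one_le_of_lt h1)) h.2
  · exact h1
  · exact absurd (oGE.mono h.1 (Order.add_one_le_of_lt h1)) h'.2

theorem UE.oGE_iff {κ U M N : ZFSet.{u}} {j : ZFSet.{u} → ZFSet.{u}} (h : UE κ U M N j) {α : Ordinal.{u+1}} :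
    oGE κ α N ↔ ∀ A ∈ M, A ⊆ κ → ∀ β < α, ∃ W ∈ N, IsRamseyMeasure κ W ∧ A ∈ MU κ W ∧ oGE κ β (NU κ W) := by
  unfold oGE
  rw [oGEin_iff]
  constructor
  · intro H A hA hs β hβ
    obtain ⟨W, hW, h1, h2⟩ := H A (h.MsubN hA) hs β hβ
    exact ⟨W, hW, (h.ramIn.1 h1).2, h2⟩
  · intro H A hA hs β hβ
    obtain ⟨W, hW, h1, h2⟩ := H A ((h.subN hs).1 hA) hs β hβ
    exact ⟨W, hW, h.ramIn.2 ⟨hW, h1⟩, h2⟩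

theorem witness_ge {κ : ZFSet.{u}} {𝒰 : Set ZFSet.{u}} (h : Acc (MOrder IsRamseyMeasure RamseyMeasureIn κ) 𝒰) :
    ∀ W ∈ 𝒰, oGE κ h.rank (NU κ W) := by
  induction h with
  | intro 𝒰 h ih =>
    intro W hW
    unfold oGE
    rw [oGEin_iff]
    intro A hA hs β hβ
    rw [Acc.rank_eq, Ordinal.lt_iSup_iff] at hβ
    obtain ⟨⟨𝒱, h𝒱⟩, hβ⟩ := hβ
    obtain ⟨U, hU, hUN, hg, hr⟩ := h𝒱.2.2.1 W hW A hA hs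
    refine ⟨U, hUN, hr, hg, ?_⟩
    exact oGE.mono (ih 𝒱 h𝒱 U hU) (Order.lt_succ_iff.1 hβ)

theorem exists_ge {κ : ZFSet.{u}} {β : Ordinal.{u+1}} (hb : β < oRank IsRamseyMeasure RamseyMeasureIn κ) {A : ZFSet.{u}} (hA : A ⊆ κ) :
    ∃ W, IsRamseyMeasure κ W ∧ A ∈ MU κ W ∧ oGE κ β (NU κ W) := by
  unfold oRank at hb
  have hne : { o : Ordinal.{u+1} | ∃ 𝒰 : Set ZFSet.{u}, IsWitness IsRamseyMeasure κ 𝒰 ∧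
      o = relRank (MOrder IsRamseyMeasure RamseyMeasureIn κ) 𝒰 + 1 }.Nonempty := by
    by_contra hn
    rw [Set.not_nonempty_iff_eq_empty] at hn
    rw [hn, csSup_empty] at hb
    exact not_lt_bot hb
  obtain ⟨o, ⟨𝒰, hw, rfl⟩, ho⟩ := exists_lt_of_lt_csSup hne hb
  obtain ⟨W, hW, hg⟩ := hw.2 A hA
  refine ⟨W, hw.1 W hW, hg, ?_⟩
  have hβ := Order.lt_add_one_iff.1 ho
  unfold relRank at hβ
  split_ifs at hβ with hacc
  · exact (witness_ge hacc W hW).mono hβ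
  · unfold oGE; rw [oGEin_iff]
    intro A hA hs γ hγ
    exact absurd (hγ.trans_le hβ) not_lt_zero

theorem exists_eq {κ A : ZFSet.{u}} {β : Ordinal.{u+1}} (hκ : IsCard κ) (hA : A ⊆ κ)
    (h : ∃ W, IsRamseyMeasure κ W ∧ A ∈ MU κ W ∧ oGE κ β (NU κ W)) :
    ∃ W, IsRamseyMeasure κ W ∧ A ∈ MU κ W ∧ oEQ κ β (NU κ W) := by
  classical
  obtain ⟨o, ⟨W, h1, h2, h3, rfl⟩, hmin⟩ := WellFounded.has_min (r := ((· < ·) : Ordinal.{u} → Ordinal.{u} → Prop)) wellFounded_lt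
    {o | ∃ W, IsRamseyMeasure κ W ∧ A ∈ MU κ W ∧ oGE κ β (NU κ W) ∧ o = ZFSet.rank (NU κ W)} (by
      obtain ⟨W, h1, h2, h3⟩ := h; exact ⟨_, W, h1, h2, h3, rfl⟩)
  refine ⟨W, h1, h2, h3, fun h4 => ?_⟩
  have hu := h1.ue hκ
  obtain ⟨W', hW', h5, h6, h7⟩ := hu.oGE_iff.1 h4 A h2 hA β (Order.lt_add_one_iff.2 le_rfl)
  exact hmin _ ⟨W', h5, h6, h7, rfl⟩ (ZFSet.rank_lt_of_mem (hu.NUmem hW' (h5.ue hκ)))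

theorem exists_eq_below {κ W : ZFSet.{u}} {β : Ordinal.{u+1}} (hκ : IsCard κ) (hW : IsRamseyMeasure κ W)
    (h : oGE κ β (NU κ W)) {δ : Ordinal.{u+1}} (hδ : δ < β) : ∃ x ∈ NU κ W, oEQ κ δ x := by
  classical
  have hu := hW.ue hκ
  have h0 : (∅ : ZFSet.{u}) ∈ MU κ W := hu.pM.mem hu.κM hu.c0
  have hs : (∅ : ZFSet.{u}) ⊆ κ := ZFSet.empty_subset _
  obtain ⟨o, ⟨W', h1, h2, h3, rfl⟩, hmin⟩ := WellFounded.has_min (r := ((· < ·) : Ordinal.{u} → Ordinal.{u} → Prop)) wellFounded_lt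
    {o | ∃ W' ∈ NU κ W, IsRamseyMeasure κ W' ∧ oGE κ δ (NU κ W') ∧ o = ZFSet.rank (NU κ W')} (by
      obtain ⟨W', h1, h2, h3, h4⟩ := hu.oGE_iff.1 h ∅ h0 hs δ hδ; exact ⟨_, W', h1, h2, h4, rfl⟩)
  have hN := hu.NUmem h1 (h2.ue hκ)
  refine ⟨_, hN, h3, fun h4 => ?_⟩
  have hu' := h2.ue hκ
  obtain ⟨W'', hW', h5, h6, h7⟩ := hu'.oGE_iff.1 h4 ∅ (hu'.pM.mem hu'.κM hu'.c0) hs δ (Order.lt_add_one_iff.2 le_rfl)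
  exact hmin _ ⟨W'', hu.pN.mem hN hW', h5, h7, rfl⟩ (ZFSet.rank_lt_of_mem (hu'.NUmem hW' (h5.ue hκ)))

/-- the labelling -/
theorem exists_label {κ : ZFSet.{u}} {β : Ordinal.{u+1}} (hκ : IsCard κ) 
    (h : ∃ W, IsRamseyMeasure κ W ∧ oGE κ β (NU κ W)) :
    ∃ o : ZFSet.{u} → Ordinal.{u+1}, ∀ δ ≤ β, ∃ η ∈ κ, o η = δ := by
  classical
  have h0 := h
  obtain ⟨W₁, hW₁, -⟩ := h0
  have hu₁ := hW₁.ue hκ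
  obtain ⟨W, hW, -, he⟩ := exists_eq (A := ∅) hκ (ZFSet.empty_subset _) (by
    obtain ⟨W, h1, h2⟩ := h
    have hu := h1.ue hκ
    exact ⟨W, h1, hu.pM.mem hu.κM hu.c0, h2⟩)
  have hu := hW.ue hκ
  have hc : card (insert (NU κ W) (NU κ W)) ≤ card κ := by
    refine (ZFSet.card_insert_le).trans ?_
    exact Cardinal.add_le_of_le hu.hi.2 hu.cN (Cardinal.one_le_aleph0.trans hu.hi.2)
  obtain ⟨e, hef, hes⟩ := exists_surj hc ⟨_, ZFSet.mem_insert_iff.2 (Or.inl rfl)⟩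
  refine ⟨fun η => if hx : ∃ δ, oEQ κ δ (fapp e η) then hx.choose else 0, fun δ hδ => ?_⟩
  have : ∃ x ∈ insert (NU κ W) (NU κ W), oEQ κ δ x := by
    rcases hδ.eq_or_lt with rfl | hlt
    · exact ⟨_, ZFSet.mem_insert_iff.2 (Or.inl rfl), he⟩
    · obtain ⟨x, hx, h⟩ := exists_eq_below hκ hW he.1 hlt
      exact ⟨x, ZFSet.mem_insert_iff.2 (Or.inr hx), h⟩
  obtain ⟨x, hx, hd⟩ := this
  obtain ⟨η, hη, rfl⟩ := hes.2 x hx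
  refine ⟨η, hη, ?_⟩
  have hx : ∃ δ, oEQ κ δ (fapp e η) := ⟨δ, hd⟩
  show (if hx : ∃ δ, oEQ κ δ (fapp e η) then hx.choose else 0) = δ
  rw [dif_pos hx]
  exact hx.choose_spec.inj hd

def Fml.cd : Fml → ℕ
  | .mem i j => Nat.pair 0 (Nat.pair i j)
  | .eq i j => Nat.pair 1 (Nat.pair i j)
  | .impl a b => Nat.pair 2 (Nat.pair a.cd b.cd)
  | .neg a => Nat.pair 3 a.cd
  | .all n a => Nat.pair 4 (Nat.pair n a.cd)

theorem Fml.cd_inj : ∀ a b : Fml, a.cd = b.cd → a = b := by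
  intro a
  induction a with
  | mem i j => intro b h; cases b <;> simp_all [Fml.cd, Nat.pair_eq_pair]
  | eq i j => intro b h; cases b <;> simp_all [Fml.cd, Nat.pair_eq_pair]
  | impl a1 a2 h1 h2 =>
    intro b h
    cases b <;> simp [Fml.cd, Nat.pair_eq_pair] at h
    rw [h1 _ h.1, h2 _ h.2]
  | neg a h1 =>
    intro b h
    cases b <;> simp [Fml.cd, Nat.pair_eq_pair] at h
    rw [h1 _ h]
  | all n a h1 =>
    intro b h
    cases b <;> simp [Fml.cd, Nat.pair_eq_pair] at h
    rw [h1 _ h.2, h.1]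

theorem exists_enum : ∃ e : ℕ → Fml, ∀ φ, ∃ n, e n = φ := by
  have : Countable Fml := ⟨Fml.cd, fun a b h => Fml.cd_inj a b h⟩
  have : Nonempty Fml := ⟨.mem 0 0⟩
  obtain ⟨e, he⟩ := exists_surjective_nat Fml
  exact ⟨e, he⟩

def clo (φ : Fml) : Fml := (sat_closure.{u} φ).choose

def AxS (φ : Fml) (m : ZFSet.{u}) : Prop := Sat m.toSet (clo.{u} φ) (fun _ => ∅)

theorem axS_iff {φ : Fml} {m : ZFSet.{u}} (h : ∅ ∈ m) : AxS φ m ↔ ∀ v : ℕ → ZFSet.{u}, (∀ n, v n ∈ m) → Sat m.toSet φ v :=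
  (sat_closure.{u} φ).choose_spec m.toSet _ (fun _ => h)

instance Def.axS (φ : Fml) {s : ZFSet.{u} → (ℕ → ZFSet.{u}) → ZFSet.{u}} [hs : TDef s] : Def (fun D v => AxS φ (s D v)) :=
  def_sat_in _ s (fun _ _ _ => ∅) hs (fun _ => inferInstance)

def LRf (om ξ x m : ZFSet.{u}) : Prop :=
  (m.IsTransitive ∧ ∅ ∈ m ∧ om ∈ m ∧ ξ ∈ m) ∧
  (∀ y, y ∈ m → ∃ t, t ∈ m ∧ (t.IsTransitive ∧ y ∈ t ∧ ∃ f, f ∈ m ∧ (IsZFunc ξ f ∧ ∀ y, y ∈ t → ∃ ζ, ζ ∈ ξ ∧ fapp f ζ = y))) ∧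
  IsMUltrafilter ξ m x ∧
  (∀ X, X ∈ m → (∃ f, f ∈ m ∧ (IsZFunc ξ f ∧ ∀ y, y ∈ X → ∃ ζ, ζ ∈ ξ ∧ fapp f ζ = y)) → X ∩ x ∈ m)

instance Def.LRf {o s t r : ZFSet.{u} → (ℕ → ZFSet.{u}) → ZFSet.{u}} [ho : TDef o] [hs : TDef s] [ht : TDef t] [hr : TDef r] :
    Def (fun D v => LRf (o D v) (s D v) (t D v) (r D v)) := by
  unfold MPaper.LRf
  have h1 : Def (fun D v => (r D v).IsTransitive ∧ ∅ ∈ r D v ∧ o D v ∈ r D v ∧ s D v ∈ r D v) := inferInstance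
  have h2 : Def (fun D v => ∀ y, y ∈ r D v → ∃ t, t ∈ r D v ∧ (t.IsTransitive ∧ y ∈ t ∧ ∃ f, f ∈ r D v ∧ (IsZFunc (s D v) f ∧ ∀ y, y ∈ t → ∃ ζ, ζ ∈ s D v ∧ fapp f ζ = y))) := inferInstance
  have h3 : Def (fun D v => IsMUltrafilter (s D v) (r D v) (t D v)) := by
    unfold IsMUltrafilter
    have i1 : Def (fun D v => ∀ A ∈ t D v, A ∈ r D v ∧ A ⊆ s D v) := inferInstance
    have i2 : Def (fun D v => ∀ α ∈ s D v, tailSet (s D v) α ∈ t D v) := inferInstance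
    have i3 : Def (fun D v => ∅ ∉ t D v) := inferInstance
    have i4 : Def (fun D v => ∀ A ∈ t D v, ∀ B ∈ t D v, A ∩ B ∈ t D v) := inferInstance
    have i5 : Def (fun D v => ∀ A ∈ t D v, ∀ B, B ∈ r D v → B ⊆ s D v → A ⊆ B → B ∈ t D v) := inferInstance
    have i6 : Def (fun D v => ∀ B, B ∈ r D v → B ⊆ s D v → B ∈ t D v ∨ compl (s D v) B ∈ t D v) := inferInstance
    have i7 : Def (fun D v => ∀ f ∈ r D v, IsZFunc (s D v) f → ZFSet.sep (fun ξ => fapp f ξ ∈ ξ) (s D v) ∈ t D v →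
      ∃ γ ∈ s D v, ZFSet.sep (fun ξ => fapp f ξ = γ) (s D v) ∈ t D v) := inferInstance
    infer_instance
  have h4 : Def (fun D v => ∀ X, X ∈ r D v → (∃ f, f ∈ r D v ∧ (IsZFunc (s D v) f ∧ ∀ y, y ∈ X → ∃ ζ, ζ ∈ s D v ∧ fapp f ζ = y)) → X ∩ t D v ∈ r D v) := inferInstance
  infer_instance

theorem lr_iff {ξ x m : ZFSet.{u}} : LR ξ x m ↔ LRf ZFSet.omega ξ x m ∧ (∀ φ ∈ PAx, AxS φ m) ∧ OmegaOneIntersecting x := by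
  constructor
  · intro h
    exact ⟨⟨⟨h.pm.tr, h.pm.ne, h.om, h.mem⟩, h.hl, h.uf, h.wa⟩, fun φ hφ => (axS_iff h.pm.ne).2 (h.pm.ax φ hφ), h.oi⟩
  · rintro ⟨⟨⟨h1, h2, h3, h4⟩, h5, h6, h7⟩, h8, h9⟩
    exact ⟨pm_of_ax h1 h2 fun φ hφ => (axS_iff h2).1 (h8 φ hφ), h3, h4, h5, h6, h7, h9⟩

def trip (ξ x m : ZFSet.{u}) : ZFSet.{u} := ZFSet.pair ξ (ZFSet.pair x m)

instance TDef.trip {s t r : ZFSet.{u} → (ℕ → ZFSet.{u}) → ZFSet.{u}} [hs : TDef s] [ht : TDef t] [hr : TDef r] :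
    TDef (fun D v => trip (s D v) (t D v) (r D v)) := by
  unfold MPaper.trip; infer_instance

theorem trip_inj {a b c a' b' c' : ZFSet.{u}} : trip a b c = trip a' b' c' ↔ a = a' ∧ b = b' ∧ c = c' := by
  unfold trip; rw [ZFSet.pair_inj, ZFSet.pair_inj]

def LRset (κ : ZFSet.{u}) : ZFSet.{u} :=
  ZFSet.sep (fun p => ∃ ξ ∈ κ, ∃ x ∈ Vk κ, ∃ m ∈ Vk κ, p = trip ξ x m ∧ LR ξ x m) (Vk κ)

theorem Vk_trip {κ a b c : ZFSet.{u}} (h : InfC κ) (ha : a ∈ Vk κ) (hb : b ∈ Vk κ) (hc : c ∈ Vk κ) : trip a b c ∈ Vk κ :=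
  Vk_opair h ha (Vk_opair h hb hc)

theorem mem_LRset {κ ξ x m : ZFSet.{u}} (hi : InfC κ) : trip ξ x m ∈ LRset κ ↔ ξ ∈ κ ∧ x ∈ Vk κ ∧ m ∈ Vk κ ∧ LR ξ x m := by
  unfold LRset
  rw [ZFSet.mem_sep]
  constructor
  · rintro ⟨-, ξ', h1, x', h2, m', h3, e, h4⟩
    obtain ⟨rfl, rfl, rfl⟩ := trip_inj.1 e
    exact ⟨h1, h2, h3, h4⟩
  · rintro ⟨h1, h2, h3, h4⟩
    exact ⟨Vk_trip hi (sub_Vk κ h1) h2 h3, ξ, h1, x, h2, m, h3, rfl, h4⟩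

/-- evaluating ω₁-intersection with sequences in `D` -/
def OI (om D y : ZFSet.{u}) : Prop := ∀ f, f ∈ D → IsZFunc om f → (∀ n, n ∈ om → fapp f n ∈ y) →
    ∃ x, x ∈ D ∧ ∀ n, n ∈ om → x ∈ fapp f n

instance Def.OI {s t : ZFSet.{u} → (ℕ → ZFSet.{u}) → ZFSet.{u}} [hs : TDef s] [ht : TDef t] : Def (fun D v => OI (s D v) D (t D v)) := by
  unfold MPaper.OI; infer_instance

theorem oi_to {D y : ZFSet.{u}} (pD : PM D) (hy : y ∈ D) (h : OmegaOneIntersecting y) : OI ZFSet.omega D y := by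
  intro f hf hff hfm
  obtain ⟨x, hx⟩ := h (fun n => fapp f (nz n)) fun n => hfm _ (mem_omega.2 ⟨n, rfl⟩)
  have h0 : (nz 0 : ZFSet.{u}) ∈ ZFSet.omega := mem_omega.2 ⟨0, rfl⟩
  refine ⟨x, pD.mem (pD.mem hy (hfm _ h0)) (hx 0), fun i hi => by obtain ⟨n, rfl⟩ := mem_omega.1 hi; exact hx n⟩

theorem oi_of {κ D y : ZFSet.{u}} (hi : InfC κ) (hω : ZFSet.omega ∈ κ) (hV : Vk κ ⊆ D) (hy : y ∈ Vk κ) (h : OI ZFSet.omega D y) : OmegaOneIntersecting y := by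
  intro s hs
  let S : ZFSet.{u} → ZFSet.{u} := fun i => if hi : ∃ n, i = nz n then s hi.choose else ∅
  have hS : ∀ n, S (nz n) = s n := by
    intro n
    have hx : ∃ k, nz.{u} n = nz k := ⟨n, rfl⟩
    show (if hi : ∃ k, nz.{u} n = nz k then s hi.choose else ∅) = _
    rw [dif_pos hx, ← nz_inj hx.choose_spec]
  have hSV : grf S ZFSet.omega ∈ Vk κ := by
    refine Vk_sub (y := ZFSet.prod ZFSet.omega y) ?_ (Vk_prod hi (sub_Vk κ hω) hy)
    intro p hp
    obtain ⟨i, hi, rfl⟩ := mem_grf.1 hp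
    obtain ⟨n, rfl⟩ := mem_omega.1 hi
    rw [ZFSet.pair_mem_prod, hS]
    exact ⟨hi, hs n⟩
  obtain ⟨x, -, hx⟩ := h (grf S ZFSet.omega) (hV hSV) (grf_func _ _) (fun i hi => by
    rw [grf_app hi]
    obtain ⟨n, rfl⟩ := mem_omega.1 hi
    rw [hS]; exact hs n)
  refine ⟨x, fun n => ?_⟩
  have hn : nz n ∈ ZFSet.omega := mem_omega.2 ⟨n, rfl⟩
  have := hx _ hn
  rwa [grf_app hn, hS] at this

namespace UE
variable {κ U M N : ZFSet.{u}} {j : ZFSet.{u} → ZFSet.{u}}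

theorem jLR (h : UE κ U M N j) (hL : LRset κ ∈ M) {x m : ZFSet.{u}} (hx : x ∈ j (Vk κ)) (hm : m ∈ j (Vk κ)) :
    trip κ x m ∈ j (LRset κ) ↔ LR κ x m := by
  have hxN := h.pN.mem h.KN hx
  have hmN := h.pN.mem h.KN hm
  obtain ⟨fx, hfx, hfxf, rfl⟩ := h.rep hxN
  obtain ⟨fm, hfm, hfmf, rfl⟩ := h.rep hmN
  have hω := h.lr.omega_mem h.hi
  have hl : ∀ z ∈ [fx, fm, ZFSet.omega, LRset κ, Vk κ], z ∈ M := by simp [hfx, hfm, h.lr.om, hL, h.vk]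
  have eω : (fun n => j (env [fx, fm, ZFSet.omega, LRset κ, Vk κ] n)) 2 = ZFSet.omega := h.jω
  have r0 := h.refl (fun D ξ v => trip ξ (fapp (v 0) ξ) (fapp (v 1) ξ) ∈ v 3) _ hl
  have r1 := h.refl (fun D ξ v => LRf (v 2) ξ (fapp (v 0) ξ) (fapp (v 1) ξ)) _ hl
  have r2 := fun φ => h.refl (fun D ξ v => AxS φ (fapp (v 1) ξ)) _ hl
  have r3 := h.refl (fun D ξ v => OI (v 2) D (fapp (v 0) ξ)) _ hl
  have r4 := h.refl (fun D ξ v => fapp (v 0) ξ ∈ v 4 ∧ fapp (v 1) ξ ∈ v 4) _ hl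
  simp only [eω] at r1 r3
  constructor
  · intro hp
    have hX := r0.2 hp
    have hall : ∀ ξ ∈ κ, trip ξ (fapp fx ξ) (fapp fm ξ) ∈ LRset κ → LR ξ (fapp fx ξ) (fapp fm ξ) :=
      fun ξ hξ h1 => ((mem_LRset h.hi).1 h1).2.2.2
    have k1 := r1.1 (uf_mono h.uf hX (h.pM.sep (fun D ξ v => LRf (v 2) ξ (fapp (v 0) ξ) (fapp (v 1) ξ)) _ (env_in h.pM hl) h.κM)
      fun ξ hξ h1 => (lr_iff.1 (hall ξ hξ h1)).1)
    have k2 := fun φ (hφ : φ ∈ PAx) => (r2 φ).1 (uf_mono h.uf hX (h.pM.sep (fun D ξ v => AxS φ (fapp (v 1) ξ)) _ (env_in h.pM hl) h.κM)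
      fun ξ hξ h1 => (lr_iff.1 (hall ξ hξ h1)).2.1 φ hφ)
    have k3 := r3.1 (uf_mono h.uf hX (h.pM.sep (fun D ξ v => OI (v 2) D (fapp (v 0) ξ)) _ (env_in h.pM hl) h.κM)
      fun ξ hξ h1 => oi_to h.pM (h.VM ((mem_LRset h.hi).1 h1).2.1) (lr_iff.1 (hall ξ hξ h1)).2.2)
    refine lr_iff.2 ⟨k1, k2, h.oi hxN (fun s hs => (k1.2.2.1.1 s hs).2) ?_⟩
    intro f hf hff hfm
    obtain ⟨x, -, hx⟩ := k3 f hf hff hfm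
    exact ⟨x, hx⟩
  · intro hLR
    by_contra hp
    obtain ⟨l1, l2, l3⟩ := lr_iff.1 hLR
    have hX : ¬ (ZFSet.sep (fun ξ => trip ξ (fapp fx ξ) (fapp fm ξ) ∈ LRset κ) κ ∈ U) := fun h1 => hp (r0.1 h1)
    have hS : ZFSet.sep (fun ξ => trip ξ (fapp fx ξ) (fapp fm ξ) ∈ LRset κ) κ ∈ M :=
      h.pM.sep (fun D ξ v => trip ξ (fapp (v 0) ξ) (fapp (v 1) ξ) ∈ v 3) _ (env_in h.pM hl) h.κM
    have hX := (uf_not h.uf h.pM hS).2 hX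
    have k1 := r1.2 l1
    have k2 := fun φ (hφ : φ ∈ PAx) => (r2 φ).2 (l2 φ hφ)
    have k3 := r3.2 (oi_to h.pN hxN l3)
    have k4 := r4.2 ⟨hx, hm⟩
    obtain ⟨e, he⟩ := exists_enum
    obtain ⟨ξ, hξ⟩ := h.lr.oi (fun n => match n with
      | 0 => ZFSet.sep (fun ξ => ¬ trip ξ (fapp fx ξ) (fapp fm ξ) ∈ LRset κ) κ
      | 1 => ZFSet.sep (fun ξ => LRf ZFSet.omega ξ (fapp fx ξ) (fapp fm ξ)) κ
      | 2 => ZFSet.sep (fun ξ => OI ZFSet.omega M (fapp fx ξ)) κ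
      | 3 => ZFSet.sep (fun ξ => fapp fx ξ ∈ Vk κ ∧ fapp fm ξ ∈ Vk κ) κ
      | n + 4 => if e n ∈ PAx then ZFSet.sep (fun ξ => AxS (e n) (fapp fm ξ)) κ else κ) (fun n => by
        match n with
        | 0 => exact hX
        | 1 => exact k1
        | 2 => exact k3
        | 3 => exact k4
        | n + 4 =>
          show (if e n ∈ PAx then ZFSet.sep (fun ξ => AxS (e n) (fapp fm ξ)) κ else κ) ∈ U
          split_ifs with hh
          · exact k2 _ hh
          · exact uf_univ h.uf h.c0 h.κM)
    have a0 := ZFSet.mem_sep.1 (hξ 0)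
    have a1 := ZFSet.mem_sep.1 (hξ 1)
    have a2 := ZFSet.mem_sep.1 (hξ 2)
    have a3 := ZFSet.mem_sep.1 (hξ 3)
    refine a0.2 ((mem_LRset h.hi).2 ⟨a0.1, a3.2.1, a3.2.2, lr_iff.2 ⟨a1.2, fun φ hφ => ?_, ?_⟩⟩)
    · obtain ⟨n, rfl⟩ := he φ
      have := hξ (n + 4)
      have : ξ ∈ if e n ∈ PAx then ZFSet.sep (fun ξ => AxS (e n) (fapp fm ξ)) κ else κ := this
      rw [if_pos hφ] at this
      exact (ZFSet.mem_sep.1 this).2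
    · exact oi_of h.hi hω (fun z hz => h.VM hz) a3.2.1 a2.2
end UE

def TT (κ B : ZFSet.{u}) : ZFSet.{u} → ZFSet.{u} → ZFSet.{u} → ZFSet.{u} → Prop :=
  WellFounded.fix ZFSet.mem_wf fun ξ ih η x m => LR ξ x m ∧ ∀ A ∈ m, A ⊆ ξ → ∀ ζ ∈ ξ, ZFSet.pair ζ η ∈ B →
    ZFSet.sep (fun ν => ∃ h : ν ∈ ξ, ∃ y ∈ Vk κ, ∃ m' ∈ Vk κ, ih ν h ζ y m' ∧ A ∩ ν ∈ m') ξ ∈ x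

theorem TT_iff {κ B ξ η x m : ZFSet.{u}} : TT κ B ξ η x m ↔ LR ξ x m ∧ ∀ A ∈ m, A ⊆ ξ → ∀ ζ ∈ ξ, ZFSet.pair ζ η ∈ B →
    ZFSet.sep (fun ν => ∃ y ∈ Vk κ, ∃ m' ∈ Vk κ, TT κ B ν ζ y m' ∧ A ∩ ν ∈ m') ξ ∈ x := by
  have e : TT κ B ξ = fun η x m => LR ξ x m ∧ ∀ A ∈ m, A ⊆ ξ → ∀ ζ ∈ ξ, ZFSet.pair ζ η ∈ B →
    ZFSet.sep (fun ν => ∃ h : ν ∈ ξ, ∃ y ∈ Vk κ, ∃ m' ∈ Vk κ, TT κ B ν ζ y m' ∧ A ∩ ν ∈ m') ξ ∈ x := by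
    unfold TT
    exact WellFounded.fix_eq _ _ _
  rw [e]
  have e2 : ∀ A ζ, ZFSet.sep (fun ν => ∃ h : ν ∈ ξ, ∃ y ∈ Vk κ, ∃ m' ∈ Vk κ, TT κ B ν ζ y m' ∧ A ∩ ν ∈ m') ξ =
    ZFSet.sep (fun ν => ∃ y ∈ Vk κ, ∃ m' ∈ Vk κ, TT κ B ν ζ y m' ∧ A ∩ ν ∈ m') ξ := by
    intro A ζ
    ext ν
    simp only [ZFSet.mem_sep]
    exact ⟨fun ⟨h, _, h2⟩ => ⟨h, h2⟩, fun ⟨h, h2⟩ => ⟨h, h, h2⟩⟩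
  simp only [e2]

def Tset (κ B : ZFSet.{u}) : ZFSet.{u} :=
  ZFSet.sep (fun p => ∃ η ∈ κ, ∃ ξ ∈ κ, ∃ x ∈ Vk κ, ∃ m ∈ Vk κ, p = ZFSet.pair η (trip ξ x m) ∧ TT κ B ξ η x m) (Vk κ)

theorem mem_Tset {κ B η ξ x m : ZFSet.{u}} (hi : InfC κ) :
    ZFSet.pair η (trip ξ x m) ∈ Tset κ B ↔ η ∈ κ ∧ ξ ∈ κ ∧ x ∈ Vk κ ∧ m ∈ Vk κ ∧ TT κ B ξ η x m := by
  unfold Tset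
  rw [ZFSet.mem_sep]
  constructor
  · rintro ⟨-, η', h0, ξ', h1, x', h2, m', h3, e, h4⟩
    obtain ⟨e1, e2⟩ := ZFSet.pair_inj.1 e
    obtain ⟨e3, e4, e5⟩ := trip_inj.1 e2
    subst e1 e3 e4 e5
    exact ⟨h0, h1, h2, h3, h4⟩
  · rintro ⟨h0, h1, h2, h3, h4⟩
    exact ⟨Vk_opair hi (sub_Vk κ h0) (Vk_trip hi (sub_Vk κ h1) h2 h3), η, h0, ξ, h1, x, h2, m, h3, rfl, h4⟩

/-- the trace predicate -/
def YP (V T ζ ν a : ZFSet.{u}) : Prop := ∃ y, y ∈ V ∧ (∃ m, m ∈ V ∧ (ZFSet.pair ζ (trip ν y m) ∈ T ∧ a ∈ m))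

instance Def.YP {a b c d e : ZFSet.{u} → (ℕ → ZFSet.{u}) → ZFSet.{u}} [ha : TDef a] [hb : TDef b] [hc : TDef c] [hd : TDef d] [he : TDef e] :
    Def (fun D v => YP (a D v) (b D v) (c D v) (d D v) (e D v)) := by
  unfold MPaper.YP; infer_instance

def YS (κ B ζ A : ZFSet.{u}) : ZFSet.{u} := ZFSet.sep (fun ξ => YP (Vk κ) (Tset κ B) ζ ξ (A ∩ ξ)) κ

instance TDef.YSG {a b c d e : ZFSet.{u} → (ℕ → ZFSet.{u}) → ZFSet.{u}} [ha : TDef a] [hb : TDef b] [hc : TDef c] [hd : TDef d] [he : TDef e] :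
    TDef (fun D v => ZFSet.sep (fun ν => YP (a D v) (b D v) (c D v) ν (d D v ∩ ν)) (e D v)) := by infer_instance

def TRec (κ V B L T ξ : ZFSet.{u}) : Prop := ∀ η, η ∈ κ → ∀ x, x ∈ V → ∀ m, m ∈ V →
  (ZFSet.pair η (trip ξ x m) ∈ T ↔ (trip ξ x m ∈ L ∧ ∀ A, A ∈ m → A ⊆ ξ → ∀ ζ, ζ ∈ ξ → ZFSet.pair ζ η ∈ B →
    ZFSet.sep (fun ν => YP V T ζ ν (A ∩ ν)) ξ ∈ x))

instance Def.TRec {a b c d e f : ZFSet.{u} → (ℕ → ZFSet.{u}) → ZFSet.{u}} [ha : TDef a] [hb : TDef b] [hc : TDef c] [hd : TDef d] [he : TDef e] [hf : TDef f] :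
    Def (fun D v => TRec (a D v) (b D v) (c D v) (d D v) (e D v) (f D v)) := by
  unfold MPaper.TRec
  infer_instance

theorem tRec {κ B ξ : ZFSet.{u}} (hi : InfC κ) (hξ : ξ ∈ κ) : TRec κ (Vk κ) B (LRset κ) (Tset κ B) ξ := by
  intro η hη x hx m hm
  have hκ := hi.1.ord.1
  rw [mem_Tset hi, mem_LRset hi, TT_iff]
  have key : ∀ A, ∀ ζ ∈ ξ, ZFSet.sep (fun ν => ∃ y ∈ Vk κ, ∃ m' ∈ Vk κ, TT κ B ν ζ y m' ∧ A ∩ ν ∈ m') ξ =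
      ZFSet.sep (fun ν => YP (Vk κ) (Tset κ B) ζ ν (A ∩ ν)) ξ := by
    intro A ζ hζ
    ext ν
    simp only [ZFSet.mem_sep]
    refine and_congr_right fun hν => ?_
    constructor
    · rintro ⟨y, hy, m', hm', h1, h2⟩
      exact ⟨y, hy, m', hm', (mem_Tset hi).2 ⟨hκ.mem_trans hζ hξ, hκ.mem_trans hν hξ, hy, hm', h1⟩, h2⟩
    · rintro ⟨y, hy, m', hm', h1, h2⟩
      exact ⟨y, hy, m', hm', ((mem_Tset hi).1 h1).2.2.2.2, h2⟩
  constructor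
  · rintro ⟨-, -, -, -, h1, h2⟩
    refine ⟨⟨hξ, hx, hm, h1⟩, fun A hA hAx ζ hζ hB => ?_⟩
    rw [← key A ζ hζ]
    exact h2 A hA hAx ζ hζ hB
  · rintro ⟨⟨-, -, -, h1⟩, h2⟩
    refine ⟨hη, hξ, hx, hm, h1, fun A hA hAx ζ hζ hB => ?_⟩
    rw [key A ζ hζ]
    exact h2 A hA hAx ζ hζ hB

namespace UE
variable {κ U M N : ZFSet.{u}} {j : ZFSet.{u} → ZFSet.{u}}

theorem κV (h : UE κ U M N j) {x : ZFSet.{u}} (hx : x ∈ κ) : x ∈ Vk κ := sub_Vk κ hx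

theorem interV (h : UE κ U M N j) (A : ZFSet.{u}) {x : ZFSet.{u}} (hx : x ∈ Vk κ) : A ∩ x ∈ Vk κ :=
  Vk_sub (fun z hz => (ZFSet.mem_inter.1 hz).2) hx

theorem jint (h : UE κ U M N j) {A : ZFSet.{u}} (hA : A ∈ M) (hAκ : A ⊆ κ) : j A ∩ κ = A := by
  ext z
  rw [ZFSet.mem_inter]
  constructor
  · rintro ⟨h1, h2⟩; exact (h.memj (h.κV h2) hA).1 h1
  · intro hz; exact ⟨(h.memj (h.κV (hAκ hz)) hA).2 hz, hAκ hz⟩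

theorem jYS (h : UE κ U M N j) {B A ζ : ZFSet.{u}} (hT : Tset κ B ∈ M) (hζ : ζ ∈ κ) :
    ZFSet.sep (fun ν => YP (j (Vk κ)) (j (Tset κ B)) ζ ν (A ∩ ν)) κ = YS κ B ζ A := by
  ext ν
  unfold YS
  simp only [ZFSet.mem_sep]
  refine and_congr_right fun hν => ?_
  have hl : ∀ z ∈ [Vk κ, Tset κ B, ζ, ν, A ∩ ν], z ∈ M := by
    simp [h.vk, hT, h.VM (h.κV hζ), h.VM (h.κV hν), h.VM (h.interV A (h.κV hν))]
  have := h.df (fun D v => YP (v 0) (v 1) (v 2) (v 3) (v 4)) _ hl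
  have := (show YP (Vk κ) (Tset κ B) ζ ν (A ∩ ν) ↔ YP (j (Vk κ)) (j (Tset κ B)) (j ζ) (j ν) (j (A ∩ ν)) from this)
  rw [this, h.jκ hζ, h.jκ hν, h.jV (h.interV A (h.κV hν))]

theorem YSM (h : UE κ U M N j) {B A ζ : ZFSet.{u}} (hT : Tset κ B ∈ M) (hζ : ζ ∈ κ) (hA : A ∈ M) : YS κ B ζ A ∈ M := by
  have hl : ∀ z ∈ [Vk κ, Tset κ B, ζ, A], z ∈ M := by simp [h.vk, hT, h.VM (h.κV hζ), hA]
  exact h.pM.sep (fun D ξ v => YP (v 0) (v 1) (v 2) ξ (v 3 ∩ ξ)) _ (env_in h.pM hl) h.κM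

theorem jT (h : UE κ U M N j) {B η x m : ZFSet.{u}} (hT : Tset κ B ∈ M) (hL : LRset κ ∈ M) (hB : B ∈ M) (hη : η ∈ κ)
    (hx : x ∈ j (Vk κ)) (hm : m ∈ j (Vk κ)) :
    ZFSet.pair η (trip κ x m) ∈ j (Tset κ B) ↔ LR κ x m ∧ ∀ A ∈ m, A ⊆ κ → ∀ ζ ∈ κ, ZFSet.pair ζ η ∈ B → YS κ B ζ A ∈ x := by
  have hl : ∀ z ∈ [κ, Vk κ, B, LRset κ, Tset κ B], z ∈ M := by simp [h.vk, hT, hL, hB, h.κM]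
  have := h.refl_all (fun D ξ v => TRec (v 0) (v 1) (v 2) (v 3) (v 4) ξ) _ hl (fun ξ hξ => tRec h.hi hξ)
  have := (show TRec (j κ) (j (Vk κ)) (j B) (j (LRset κ)) (j (Tset κ B)) κ from this)
  have hηj : η ∈ j κ := by
    have := (h.jmem (h.VM (h.κV hη)) h.κM).1 hη
    rwa [h.jκ hη] at this
  rw [this η hηj x hx m hm, h.jLR hL hx hm]
  refine and_congr_right fun _ => ?_
  refine forall_congr' fun A => forall_congr' fun hA => forall_congr' fun hAκ => forall_congr' fun ζ => forall_congr' fun hζ => ?_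
  rw [h.memj (Vk_opair h.hi (h.κV hζ) (h.κV hη)) hB, h.jYS hT hζ]

theorem J (h : UE κ U M N j) {B ζ A : ZFSet.{u}} (hT : Tset κ B ∈ M) (hL : LRset κ ∈ M) (hB : B ∈ M) (hζ : ζ ∈ κ) (hA : A ∈ M) (hAκ : A ⊆ κ) :
    YS κ B ζ A ∈ U ↔ ∃ y ∈ j (Vk κ), ∃ m ∈ j (Vk κ), LR κ y m ∧ A ∈ m ∧
      ∀ A' ∈ m, A' ⊆ κ → ∀ ζ' ∈ κ, ZFSet.pair ζ' ζ ∈ B → YS κ B ζ' A' ∈ y := by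
  have hl : ∀ z ∈ [Vk κ, Tset κ B, ζ, A], z ∈ M := by simp [h.vk, hT, h.VM (h.κV hζ), hA]
  have := h.refl (fun D ξ v => YP (v 0) (v 1) (v 2) ξ (v 3 ∩ ξ)) _ hl
  have := (show YS κ B ζ A ∈ U ↔ YP (j (Vk κ)) (j (Tset κ B)) (j ζ) κ (j A ∩ κ) from this)
  rw [this, h.jint hA hAκ, h.jκ hζ]
  constructor
  · rintro ⟨y, hy, m, hm, h1, h2⟩
    obtain ⟨h3, h4⟩ := (h.jT hT hL hB hζ hy hm).1 h1
    exact ⟨y, hy, m, hm, h3, h2, h4⟩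
  · rintro ⟨y, hy, m, hm, h3, h2, h4⟩
    exact ⟨y, hy, m, hm, (h.jT hT hL hB hζ hy hm).2 ⟨h3, h4⟩, h2⟩
end UE

def BB (κ : ZFSet.{u}) (o : ZFSet.{u} → Ordinal.{u+1}) : ZFSet.{u} :=
  ZFSet.sep (fun p => ∃ ζ ∈ κ, ∃ η ∈ κ, p = ZFSet.pair ζ η ∧ o ζ < o η) (Vk κ)

theorem mem_BB {κ ζ η : ZFSet.{u}} {o : ZFSet.{u} → Ordinal.{u+1}} (hi : InfC κ) (hζ : ζ ∈ κ) (hη : η ∈ κ) :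
    ZFSet.pair ζ η ∈ BB κ o ↔ o ζ < o η := by
  unfold BB
  rw [ZFSet.mem_sep]
  constructor
  · rintro ⟨-, a, -, b, -, e, h⟩
    obtain ⟨rfl, rfl⟩ := ZFSet.pair_inj.1 e
    exact h
  · intro h
    exact ⟨Vk_opair hi (sub_Vk κ hζ) (sub_Vk κ hη), _, hζ, _, hη, rfl, h⟩

theorem main_claim {κ A₁ : ZFSet.{u}} {o : ZFSet.{u} → Ordinal.{u+1}} (hκ : IsCard κ) (hi : InfC κ) (hA₁ : A₁ ⊆ κ)
    (hc : ∀ N : ZFSet.{u}, PM N → κ ∈ N → A₁ ∈ N → Vk κ ∈ N ∧ BB κ o ∈ N ∧ LRset κ ∈ N ∧ Tset κ (BB κ o) ∈ N) (γ : Ordinal.{u+1}) :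
    (∀ δ < γ, ∃ ζ ∈ κ, o ζ = δ) → ∀ W, IsRamseyMeasure κ W → A₁ ∈ MU κ W →
    (oGE κ γ (NU κ W) ↔ ∀ A ∈ MU κ W, A ⊆ κ → ∀ ζ ∈ κ, o ζ < γ → YS κ (BB κ o) ζ A ∈ W) := by
  induction γ using WellFoundedLT.induction with
  | ind γ ih =>
  intro hlab W hW hAW
  have h := hW.ue hκ
  obtain ⟨-, hB, hL, hT⟩ := hc _ h.pM h.κM hAW
  rw [h.oGE_iff]
  constructor
  · intro hge A hA hAκ ζ hζ hoz
    obtain ⟨C, hC, hCm⟩ := exists_merge hi hAκ hA₁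
    obtain ⟨W', hW'N, hW', hCW, hge'⟩ := hge C ((hCm _ h.pM h.κM).2 ⟨hA, hAW⟩) hC _ hoz
    have h' := hW'.ue hκ
    obtain ⟨hA', hA₁'⟩ := (hCm _ h'.pM h'.κM).1 hCW
    have hsub := h.dec_sub hW'N h'.pM h'.κM h'.lr.hl h'.uf
    have hm := h.dec_mem hW'N h'.pM h'.κM h'.lr.hl h'.uf
    refine (h.J hT hL hB hζ hA hAκ).2 ⟨W', h.Ksub hW'N (fun z hz => hsub (h'.uf.1 z hz).1) h.MK, _, h.Ksub hm hsub h.MK, h'.lr, hA', ?_⟩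
    intro A2 hA2 hA2κ ζ' hζ' hb
    rw [mem_BB hi hζ' hζ] at hb
    exact (ih _ hoz (fun δ hδ => hlab δ (hδ.trans hoz)) W' hW' hA₁').1 hge' A2 hA2 hA2κ ζ' hζ' hb
  · intro hall A hA hAκ δ hδ
    obtain ⟨ζ, hζ, rfl⟩ := hlab δ hδ
    obtain ⟨C, hC, hCm⟩ := exists_merge hi hAκ hA₁
    have hCM := (hCm _ h.pM h.κM).2 ⟨hA, hAW⟩
    obtain ⟨y, hy, m, hm, hLR, hCmm, hYS⟩ := (h.J hT hL hB hζ hCM hC).1 (hall C hCM hC ζ hζ hδ)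
    have hyN := h.pN.mem h.KN hy
    have hsub := h.dec_sub hyN hLR.pm hLR.mem hLR.hl hLR.uf
    obtain ⟨hA', hA₁'⟩ := (hCm _ hLR.pm hLR.mem).1 hCmm
    obtain ⟨hR, rfl⟩ := hLR.ramsey hi ((ZFSet.card_mono hsub).trans h.cM) (hasV_iff.2 (hc _ hLR.pm hLR.mem hA₁').1)
    refine ⟨y, hyN, hR, hA', (ih _ hδ (fun δ' hδ' => hlab δ' (hδ'.trans hδ)) y hR hA₁').2 ?_⟩
    intro A2 hA2 hA2κ ζ' hζ' hb
    exact hYS A2 hA2 hA2κ ζ' hζ' ((mem_BB hi hζ' hζ).2 hb)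

theorem tv {D E : Set ZFSet.{u}} (hDE : D ⊆ E)
    (h : ∀ (φ : Fml) (n : ℕ) (v : ℕ → ZFSet.{u}), (∀ k, v k ∈ D) → (∃ x ∈ E, Sat E φ (Function.update v n x)) →
      ∃ x ∈ D, Sat E φ (Function.update v n x)) : ElemSub D E := by
  refine ⟨hDE, fun φ => ?_⟩
  induction φ with
  | mem i j => intro v _; rfl
  | eq i j => intro v _; rfl
  | impl a b ha hb => intro v hv; simp only [Sat, ha v hv, hb v hv]
  | neg a ha => intro v hv; simp only [Sat, ha v hv]
  | all n a ha =>
    intro v hv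
    have hup : ∀ x ∈ D, ∀ k, Function.update v n x k ∈ D := by
      intro x hx k
      by_cases e : k = n
      · subst e; simpa using hx
      · simpa [Function.update_of_ne e] using hv k
    simp only [Sat]
    constructor
    · intro h1
      by_contra h2
      push Not at h2
      obtain ⟨x, hx, hn⟩ := h2
      obtain ⟨x', hx', hn'⟩ := h (.neg a) n v hv ⟨x, hx, hn⟩
      exact hn' ((ha _ (hup x' hx')).1 (h1 x' hx'))
    · intro h1 x hx
      exact (ha _ (hup x hx)).2 (h1 x (hDE hx))

theorem ElemSub.trans_iff {D E F : Set ZFSet.{u}} (h1 : ElemSub D F) (h2 : ElemSub E F) (h : D ⊆ E) : ElemSub D E :=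
  ⟨h, fun φ v hv => (h1.2 φ v hv).trans (h2.2 φ v fun n => h (hv n)).symm⟩

theorem union_elem {s : ℕ → ZFSet.{u}} {M M' : ZFSet.{u}} (hs : ∀ n, ElemSub (s n).toSet M.toSet) (hm : ∀ n, s n ⊆ s (n + 1))
    (hM : ∀ x, x ∈ M' ↔ ∃ n, x ∈ s n) : ElemSub M'.toSet M.toSet := by
  have hmono : ∀ m n, m ≤ n → s m ⊆ s n := by
    intro m n hmn
    induction hmn with
    | refl => exact fun z hz => hz
    | step _ ih => exact fun z hz => hm _ (ih hz)
  refine tv (fun x hx => ?_) ?_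
  · obtain ⟨n, hn⟩ := (hM x).1 hx
    exact (hs n).1 hn
  · rintro φ n v hv ⟨x, hx, hS⟩
    choose k hk using fun i => (hM (v i)).1 (hv i)
    let K := (Finset.range φ.bd).sup k
    let w : ℕ → ZFSet.{u} := fun i => if i < φ.bd then v i else v 0
    let K' := max K (k 0)
    have hw : ∀ i, w i ∈ s K' := by
      intro i
      by_cases hi : i < φ.bd
      · simp only [w, hi, if_true]
        exact hmono _ _ ((Finset.le_sup (f := k) (Finset.mem_range.2 hi)).trans (le_max_left _ _)) (hk i)
      · simp only [w, hi, if_false]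
        exact hmono _ _ (le_max_right _ _) (hk 0)
    have hag : ∀ (z : ZFSet.{u}), Sat M.toSet φ (Function.update v n z) ↔ Sat M.toSet φ (Function.update w n z) := by
      intro z
      refine sat_bd _ _ _ _ fun i hi => ?_
      by_cases e : i = n
      · subst e; simp
      · simp [Function.update_of_ne e, w, hi]
    have h1 : ¬ Sat M.toSet (.all n (.neg φ)) w := fun h => h x hx ((hag x).1 hS)
    rw [← (hs K').2 _ w hw] at h1
    simp only [Sat] at h1
    push Not at h1
    obtain ⟨z, hz, hz2⟩ := h1
    have hzw : ∀ i, Function.update w n z i ∈ s K' := by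
      intro i
      by_cases e : i = n
      · subst e; rw [Function.update_self]; exact hz
      · simpa [Function.update_of_ne e] using hw i
    exact ⟨z, (hM z).2 ⟨_, hz⟩, (hag z).2 (((hs K').2 φ _ hzw).1 hz2)⟩

theorem ls {H ξ y : ZFSet.{u}} (hξ : Cardinal.aleph0 ≤ ξ.card)
    (hH : ∀ x ∈ H, ∃ t, t ⊆ H ∧ t.IsTransitive ∧ x ∈ t ∧ t.card ≤ ξ.card) (hy : y ∈ H) :
    ∃ m, m ⊆ H ∧ m.IsTransitive ∧ y ∈ m ∧ m.card ≤ ξ.card ∧ ElemSub m.toSet H.toSet := by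
  have hF : ∀ x, ∃ f, x ∈ H → ∃ t, t ⊆ H ∧ t.IsTransitive ∧ x ∈ t ∧ SurjOnto f ξ t := by
    intro x
    by_cases hx : x ∈ H
    · obtain ⟨t, h1, h2, h3, h4⟩ := hH x hx
      obtain ⟨f, hf, hs⟩ := exists_surj h4 ⟨x, h3⟩
      exact ⟨f, fun _ => ⟨t, h1, h2, h3, hs⟩⟩
    · exact ⟨∅, fun h => absurd h hx⟩
  choose F hF using hF
  let L : FirstOrder.Language.{u+1, 0} := ⟨fun _ => (Fml × ℕ) ⊕ ξ.toSet, fun _ => Empty⟩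
  let sk : ℕ → Fml → ℕ → (ℕ → ZFSet.{u}) → ZFSet.{u} := fun k φ n v =>
    if h : ∃ x ∈ H, Sat H.toSet φ (Function.update v n x) then h.choose else y
  letI : L.Structure ZFSet.{u} :=
    { funMap := fun {k} f v => match f with
        | .inl p => sk k p.1 p.2 (fun i => if hi : i < k then v ⟨i, hi⟩ else y)
        | .inr η => if hk : 0 < k then (if v ⟨0, hk⟩ ∈ H then fapp (F (v ⟨0, hk⟩)) η else y) else y
      RelMap := fun r => r.elim }
  let S := FirstOrder.Language.Substructure.closure L ({y} : Set ZFSet.{u})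
  have hSsk : ∀ φ n v, (∀ k, v k ∈ S) → (∃ x ∈ H, Sat H.toSet φ (Function.update v n x)) → ∃ x ∈ H, x ∈ S ∧ Sat H.toSet φ (Function.update v n x) := by
    intro φ n v hv hex
    let w : ℕ → ZFSet.{u} := fun i => if hi : i < φ.bd then v i else y
    have hag : ∀ (z : ZFSet.{u}), Sat H.toSet φ (Function.update v n z) ↔ Sat H.toSet φ (Function.update w n z) := by
      intro z
      refine sat_bd _ _ _ _ fun i hi => ?_
      by_cases e : i = n
      · subst e; simp
      · simp [Function.update_of_ne e, w, hi]
    have hex' : ∃ x ∈ H, Sat H.toSet φ (Function.update w n x) := by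
      obtain ⟨x, h1, h2⟩ := hex
      exact ⟨x, h1, (hag x).1 h2⟩
    have hm := S.fun_mem (n := φ.bd) (Sum.inl (φ, n) : L.Functions φ.bd) (fun i => v i) (fun i => hv i)
    have e : sk φ.bd φ n w = hex'.choose := dif_pos hex'
    have hm : sk φ.bd φ n w ∈ S := hm
    rw [e] at hm
    exact ⟨_, hex'.choose_spec.1, hm, (hag _).2 hex'.choose_spec.2⟩
  have hyS : y ∈ S := FirstOrder.Language.Substructure.subset_closure (by simp)
  have hSF : ∀ x ∈ S, x ∈ H → ∀ η ∈ ξ, fapp (F x) η ∈ S := by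
    intro x hx hxH η hη
    have hm := S.fun_mem (n := 1) (Sum.inr ⟨η, hη⟩ : L.Functions 1) (fun _ => x) (fun i => hx)
    have hm : (if hk : 0 < 1 then (if x ∈ H then fapp (F x) η else y) else y) ∈ S := hm
    simpa [hxH] using hm
  have hcard : Cardinal.mk S ≤ Cardinal.lift.{u+1} ξ.card := by
    have h1 := FirstOrder.Language.Substructure.lift_card_closure_le (L := L) (s := ({y} : Set ZFSet.{u}))
    have hz : Cardinal.mk ξ.toSet = Cardinal.lift.{u+1} ξ.card := zcard_eq ξ
    have hal : Cardinal.aleph0.{u+1} ≤ Cardinal.lift.{u+1} ξ.card := by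
      exact Cardinal.aleph0_le_lift.2 hξ
    have h2 : Cardinal.mk ((i : ℕ) × L.Functions i) ≤ Cardinal.lift.{u+1} ξ.card := by
      have e : Cardinal.mk ((i : ℕ) × L.Functions i) = Cardinal.mk (ℕ × ((Fml × ℕ) ⊕ ξ.toSet)) :=
        Cardinal.mk_congr (Equiv.sigmaEquivProd _ _)
      rw [e, Cardinal.mk_prod, Cardinal.mk_sum, hz]
      have hc : Countable Fml := ⟨Fml.cd, fun a b h => Fml.cd_inj a b h⟩
      have hc2 : Cardinal.lift.{u+1} (Cardinal.mk (Fml × ℕ)) ≤ Cardinal.aleph0 := by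
        rw [Cardinal.lift_le_aleph0]; exact Cardinal.mk_le_aleph0
      simp only [Cardinal.lift_lift, Cardinal.lift_id, Cardinal.mk_nat, Cardinal.lift_aleph0, Cardinal.lift_id']
      refine Cardinal.mul_le_of_le hal hal ?_
      exact Cardinal.add_le_of_le hal (hc2.trans hal) (by simp)
    simp only [Cardinal.lift_id] at h1
    refine le_trans h1 (max_le hal (Cardinal.add_le_of_le hal ?_ h2))
    rw [Cardinal.mk_singleton]
    exact Cardinal.one_le_aleph0.trans hal
  let m := ZFSet.sep (fun x => x ∈ S) H
  have hmm : ∀ x, x ∈ m ↔ x ∈ H ∧ x ∈ S := fun x => ZFSet.mem_sep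
  refine ⟨m, fun x hx => ((hmm x).1 hx).1, ?_, (hmm y).2 ⟨hy, hyS⟩, ?_, tv (fun x hx => ((hmm x).1 hx).1) ?_⟩
  · intro x hx z hz
    obtain ⟨hxH, hxS⟩ := (hmm x).1 hx
    obtain ⟨t, h1, h2, h3, h4⟩ := hF x hxH
    have hzt := h2.mem_trans hz h3
    obtain ⟨η, hη, rfl⟩ := h4.2 z hzt
    exact (hmm _).2 ⟨h1 hzt, hSF x hxS hxH η hη⟩
  · have : zcard m ≤ Cardinal.mk S := by
      refine Cardinal.mk_le_mk_of_subset (fun x hx => ?_)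
      exact ((hmm x).1 hx).2
    rw [zcard_eq] at this
    exact Cardinal.lift_le.1 (this.trans hcard)
  · rintro φ n v hv hx
    obtain ⟨x, h1, h2, h3⟩ := hSsk φ n v (fun k => ((hmm _).1 (hv k)).2) hx
    exact ⟨x, (hmm x).2 ⟨h1, h2⟩, h3⟩

def appL : List ZFSet.{u} → (ℕ → ZFSet.{u}) → ℕ → ZFSet.{u}
  | [], v => v
  | x :: l, v => fun n => Nat.casesOn n x (appL l v)

theorem appL_snoc (l : List ZFSet.{u}) (x : ZFSet.{u}) (v : ℕ → ZFSet.{u}) :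
    appL (l ++ [x]) v = appL l (fun n => Nat.casesOn n x v) := by
  induction l with
  | nil => rfl
  | cons a l ih => simp only [List.cons_append, appL, ih]

theorem appL_lt (l : List ZFSet.{u}) (v : ℕ → ZFSet.{u}) (k : ℕ) (hk : k < l.length) : appL l v k = env l k := by
  induction l generalizing k with
  | nil => simp at hk
  | cons a l ih =>
    cases k with
    | zero => rfl
    | succ k => exact ih k (by simpa using hk)

theorem appL_ge (l : List ZFSet.{u}) (v : ℕ → ZFSet.{u}) (k : ℕ) : appL l v (l.length + k) = v k := by
  induction l with
  | nil => simp [appL]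
  | cons a l ih =>
    have : (a :: l).length + k = (l.length + k) + 1 := by simp; omega
    rw [this]; exact ih

theorem def_allL (P : ZFSet.{u} → (ℕ → ZFSet.{u}) → Prop) (hP : Def P) (n : ℕ) :
    ∀ (t : ZFSet.{u} → (ℕ → ZFSet.{u}) → ZFSet.{u}), TDef t →
    Def (fun D v => ∀ l : List ZFSet.{u}, l.length = n → (∀ x ∈ l, x ∈ t D v) → P D (appL l v)) := by
  induction n with
  | zero =>
    intro t ht
    refine Def.congr hP fun D hD v hv => ?_
    constructor
    · intro h; exact h [] rfl (by simp)
    · intro h l hl _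
      rw [List.length_eq_zero_iff] at hl
      subst hl; exact h
  | succ n ih =>
    intro t ht
    have h1 := ih (fun D v => t D (fun n => v (n + 1))) inferInstance
    have h2 : Def (fun D v => ∀ x, x ∈ t D v → ∀ l : List ZFSet.{u}, l.length = n → (∀ z ∈ l, z ∈ t D v) →
        P D (appL l (fun n => Nat.casesOn n x v))) := by
      refine @Def.ball (fun D x v => ∀ l : List ZFSet.{u}, l.length = n → (∀ z ∈ l, z ∈ t D v) →
        P D (appL l (fun n => Nat.casesOn n x v))) t ht ?_
      refine Def.congr h1 fun D hD v hv => ?_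
      have e : (fun n => Nat.casesOn n (v 0) (fun n => v (n + 1)) : ℕ → ZFSet.{u}) = v := by
        funext n; cases n <;> rfl
      refine forall_congr' fun l => forall_congr' fun hl => forall_congr' fun _ => ?_
      exact iff_of_eq (congrArg (fun w => P D (appL l w)) e)
    refine Def.congr h2 fun D hD v hv => ?_
    constructor
    · intro h x hx l hl hlt
      rw [← appL_snoc]
      refine h _ (by simp [hl]) ?_
      intro z hz
      rcases List.mem_append.1 hz with hz | hz
      · exact hlt z hz
      · rw [List.mem_singleton.1 hz]; exact hx
    · intro h l hl hlt
      rcases List.eq_nil_or_concat l with rfl | ⟨l', x, rfl⟩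
      · simp at hl
      · rw [List.concat_eq_append] at *
        rw [appL_snoc]
        exact h x (hlt x (by simp)) l' (by simpa using hl) fun z hz => hlt z (by simp [hz])

def GG (φ : Fml) (D m ξ : ZFSet.{u}) : Prop := ∀ l : List ZFSet.{u}, l.length = φ.bd → (∀ x ∈ l, x ∈ m) →
  (Sat m.toSet φ (env l) ↔ Sat (Hset D ξ).toSet φ (env l))

theorem def_GG0 (φ : Fml) : Def (fun D v => GG.{u} φ D (v 0) (v 1)) := by
  have a1 : Def (fun D v => Sat (v φ.bd : ZFSet.{u}).toSet φ (fun k => v k)) :=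
    def_sat_in φ (fun D v => v φ.bd) (fun k D v => v k) inferInstance (fun k => inferInstance)
  have a2 : Def (fun D v => Sat (Hset D (v (φ.bd + 1) : ZFSet.{u})).toSet φ (fun k => v k)) :=
    def_sat_H φ (fun D v => v (φ.bd + 1)) (fun k D v => v k) inferInstance (fun k => inferInstance)
  have a3 := def_allL _ (Def.iff (hP := a1) (hQ := a2)) φ.bd (fun D v => v 0) inferInstance
  refine Def.congr a3 fun D hD v hv => ?_
  unfold GG
  refine forall_congr' fun l => forall_congr' fun hl => forall_congr' fun _ => ?_
  have e1 : appL l v φ.bd = v 0 := by rw [← hl]; exact appL_ge l v 0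
  have e2 : appL l v (φ.bd + 1) = v 1 := by rw [← hl]; exact appL_ge l v 1
  rw [e1, e2]
  rw [sat_bd _ φ (appL l v) (env l) (fun n hn => appL_lt l v n (by omega)),
    sat_bd (Hset D (v 1)).toSet φ (appL l v) (env l) (fun n hn => appL_lt l v n (by omega))]

theorem GG_iff {D m ξ : ZFSet.{u}} (h0 : ∃ z, z ∈ m) : (∀ φ, GG φ D m ξ) ↔ ∀ (φ : Fml) (v : ℕ → ZFSet.{u}), (∀ n, v n ∈ m) →
    (Sat m.toSet φ v ↔ Sat (Hset D ξ).toSet φ v) := by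
  constructor
  · intro h φ v hv
    have hl : ((List.range φ.bd).map v).length = φ.bd := by simp
    have h1 := h φ ((List.range φ.bd).map v) hl (by
      intro x hx
      obtain ⟨i, -, rfl⟩ := List.mem_map.1 hx
      exact hv i)
    have he : ∀ n < φ.bd, v n = env ((List.range φ.bd).map v) n := by
      have : ∀ (l : List ZFSet.{u}) (n : ℕ) (h : n < l.length), env l n = l[n] := by
        intro l
        induction l with
        | nil => intro n h; simp at h
        | cons a l ih =>
          intro n h
          cases n with
          | zero => rfl
          | succ n => exact ih n (by simpa using h)
      intro n hn
      rw [this _ _ (by simpa using hn)]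
      simp
    rw [sat_bd _ φ _ _ he, sat_bd (Hset D ξ).toSet φ _ _ he]
    exact h1
  · intro h φ l hl hlm
    obtain ⟨z, hz⟩ := h0
    have h1 := h φ (appL l fun _ => z) (by
      intro n
      by_cases hn : n < l.length
      · rw [appL_lt _ _ _ hn]
        have : ∀ (l : List ZFSet.{u}) (n : ℕ) (h : n < l.length), env l n ∈ l := by
          intro l
          induction l with
          | nil => intro n h; simp at h
          | cons a l ih =>
            intro n h
            cases n with
            | zero => exact List.mem_cons_self
            | succ n => exact List.mem_cons_of_mem _ (ih n (by simpa using h))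
        exact hlm _ (this l n hn)
      · have : n = l.length + (n - l.length) := by omega
        rw [this, appL_ge]; exact hz)
    rw [sat_bd _ φ (appL l _) (env l) (fun n hn => appL_lt l _ n (by omega)),
      sat_bd (Hset D ξ).toSet φ (appL l _) (env l) (fun n hn => appL_lt l _ n (by omega))] at h1
    exact h1

instance Def.GG {φ : Fml} {s t : ZFSet.{u} → (ℕ → ZFSet.{u}) → ZFSet.{u}} [hs : TDef s] [ht : TDef t] :
    Def (fun D v => GG φ D (s D v) (t D v)) := Def.subst2 (Q := fun D m ξ => MPaper.GG φ D m ξ) (def_GG0 φ)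

def HH (κ ξ : ZFSet.{u}) : ZFSet.{u} := ZFSet.sep (fun x => ∃ t : ZFSet.{u}, t.IsTransitive ∧ x ∈ t ∧ t.card ≤ ξ.card) (Vk κ)

def Lam (κ : ZFSet.{u}) : ZFSet.{u} := ZFSet.sep (fun p => ∃ ξ ∈ κ, ∃ m ∈ Vk κ, p = ZFSet.pair ξ m ∧
  m.IsTransitive ∧ (∃ z, z ∈ m) ∧ m.card ≤ ξ.card ∧ ElemSub m.toSet (HH κ ξ).toSet) (Vk κ)

theorem mem_Lam {κ ξ m : ZFSet.{u}} (hi : InfC κ) (hξ : ξ ∈ κ) : ZFSet.pair ξ m ∈ Lam κ ↔ m ∈ Vk κ ∧ m.IsTransitive ∧ (∃ z, z ∈ m) ∧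
    m.card ≤ ξ.card ∧ ElemSub m.toSet (HH κ ξ).toSet := by
  unfold Lam
  rw [ZFSet.mem_sep]
  constructor
  · rintro ⟨-, ξ', h1, m', h2, e, h3⟩
    obtain ⟨e1, e2⟩ := ZFSet.pair_inj.1 e
    subst e1 e2
    exact ⟨h2, h3⟩
  · rintro ⟨h2, h3⟩
    exact ⟨Vk_opair hi (sub_Vk κ hξ) h2, ξ, hξ, m, h2, rfl, h3⟩

namespace UE
variable {κ U M N : ZFSet.{u}} {j : ZFSet.{u} → ZFSet.{u}}

theorem covV (h : UE κ U M N j) {ξ t : ZFSet.{u}} (hξ : ξ ∈ κ) (ht : t ∈ Vk κ) (h0 : ∃ z, z ∈ t) (hc : t.card ≤ ξ.card) : Cov M ξ t := by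
  obtain ⟨f, hf, hs⟩ := exists_surj hc h0
  refine ⟨f, h.VM (Vk_sub (y := ZFSet.prod ξ t) ?_ (Vk_prod h.hi (h.κV hξ) ht)), hf, hs.2⟩
  intro p hp
  obtain ⟨a, ha, b, rfl⟩ := hf.1 p hp
  rw [ZFSet.pair_mem_prod]
  refine ⟨ha, ?_⟩
  rw [← fapp_eq hf hp]
  exact hs.1 a ha

theorem hsetM (h : UE κ U M N j) {ξ : ZFSet.{u}} (hξ : ξ ∈ κ) : Hset M ξ = HH κ ξ := by
  obtain ⟨b, hb, hbt⟩ := exists_Vbound h.hi h.cV hξ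
  ext x
  rw [mem_Hset h.pM]
  unfold HH
  rw [ZFSet.mem_sep]
  constructor
  · rintro ⟨t, ht, h1, h2, h3⟩
    have := hbt t h1 h3.card
    exact ⟨(Vk_tr κ).mem_trans h2 ((Vk_tr κ).mem_trans this hb), t, h1, h2, h3.card⟩
  · rintro ⟨-, t, h1, h2, h3⟩
    have := (Vk_tr κ).mem_trans (hbt t h1 h3) hb
    exact ⟨t, h.VM this, h1, h2, h.covV hξ this ⟨x, h2⟩ h3⟩

theorem lam_ex (h : UE κ U M N j) (hΛ : Lam κ ∈ M) {y : ZFSet.{u}} (hy : y ∈ M) :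
    ∃ m ∈ M, y ∈ m ∧ m.IsTransitive ∧ Cov M κ m ∧ ElemSub m.toSet M.toSet := by
  have hl : ∀ z ∈ [Vk κ, Lam κ, ZFSet.omega], z ∈ M := by simp [h.vk, hΛ, h.lr.om]
  have r1 := h.refl_all (fun D ξ v => v 2 ⊆ ξ → ∀ y, y ∈ D → HM D ξ y → ∃ m, m ∈ v 0 ∧ (y ∈ m ∧ ZFSet.pair ξ m ∈ v 1)) _ hl (by
    intro ξ hξ hω y hy hH
    obtain ⟨b, hb, hbt⟩ := exists_Vbound h.hi h.cV hξ
    have hy' : y ∈ HH κ ξ := by rw [← h.hsetM hξ]; exact (mem_Hset h.pM).2 hH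
    obtain ⟨m, m1, m2, m3, m4, m5⟩ := ls (H := HH κ ξ) (ξ := ξ) (card_omega ▸ ZFSet.card_mono hω) (by
      intro x hx
      obtain ⟨hxV, t, t1, t2, t3⟩ := ZFSet.mem_sep.1 hx
      refine ⟨t, fun z hz => ZFSet.mem_sep.2 ⟨(Vk_tr κ).mem_trans hz ((Vk_tr κ).mem_trans (hbt t t1 t3) hb), t, t1, hz, t3⟩, t1, t2, t3⟩) hy'
    have hmV := (Vk_tr κ).mem_trans (hbt m m2 m4) hb
    exact ⟨m, hmV, m3, (mem_Lam h.hi hξ).2 ⟨hmV, m2, ⟨y, m3⟩, m4, m5⟩⟩)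
  have r2 := h.refl_all (fun D ξ v => ∀ m, m ∈ v 0 → ZFSet.pair ξ m ∈ v 1 → (m.IsTransitive ∧ Cov D ξ m ∧ ∀ z, z ∈ m → HM D ξ z)) _ hl (by
    intro ξ hξ m hm hp
    obtain ⟨-, m2, m3, m4, m5⟩ := (mem_Lam h.hi hξ).1 hp
    refine ⟨m2, h.covV hξ hm m3 m4, fun z hz => ?_⟩
    have := m5.1 hz
    rw [← h.hsetM hξ] at this
    exact (mem_Hset h.pM).1 this)
  have r3 := fun φ => h.refl_all (fun D ξ v => ∀ m, m ∈ v 0 → ZFSet.pair ξ m ∈ v 1 → GG φ D m ξ) _ hl (by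
    intro ξ hξ m hm hp
    obtain ⟨-, m2, m3, m4, m5⟩ := (mem_Lam h.hi hξ).1 hp
    refine (GG_iff m3).2 ?_ φ
    rw [h.hsetM hξ]
    exact m5.2)
  obtain ⟨m, hmK, hym, hmp⟩ := r1 (by rw [show (fun n => j (env [Vk κ, Lam κ, ZFSet.omega] n)) 2 = ZFSet.omega from h.jω]; exact omega_sub h.hi) y (h.MsubN hy) (h.mem_iff.1 hy)
  obtain ⟨m1, m2, m4⟩ := r2 m hmK hmp
  have m3 := (GG_iff (D := N) (ξ := κ) ⟨y, hym⟩).1 fun φ => r3 φ m hmK hmp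
  rw [← h.eqH] at m3
  have hmN := h.pN.mem h.KN hmK
  have hmM : m ∈ M := h.mem_iff.2 (HM.of_elems h.pN h.wN h.hi h.κN hmN m2 m4)
  exact ⟨m, hmM, hym, m1, (h.lr.hl m hmM).cov, fun z hz => h.mem_iff.2 (m4 z hz), m3⟩
end UE

theorem tr_pair {t a b : ZFSet.{u}} (ht : t.IsTransitive) (h : ZFSet.pair a b ∈ t) : a ∈ t ∧ b ∈ t := by
  have h1 : ({a, b} : ZFSet.{u}) ∈ t := ht.mem_trans (by unfold ZFSet.pair; simp) h
  exact ⟨ht.mem_trans (by simp) h1, ht.mem_trans (by simp) h1⟩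

structure SpecS (κ M : ZFSet.{u}) (s : ℕ → ZFSet.{u}) : Prop where
  mem : ∀ n, s n ∈ M
  sub : ∀ n, s n ⊆ s (n + 1)
  el : ∀ n, ElemSub (s n).toSet M.toSet
  bij : ∀ n, ∃ f ∈ M.toSet, IsBij f κ (s n)
  un : ∀ x, x ∈ M ↔ ∃ n, x ∈ s n
  tr : ∀ n, (s n).IsTransitive
  km : ∀ n, κ ∈ s n
  vm : ∀ n, Vk κ ∈ s n

theorem SpecS.special {κ M : ZFSet.{u}} {s : ℕ → ZFSet.{u}} (h : SpecS κ M s) : OmegaSpecial κ M :=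
  ⟨s, h.mem, fun n => h.sub n, h.el, h.bij, h.un⟩

theorem UE.chain {κ W M N : ZFSet.{u}} {j : ZFSet.{u} → ZFSet.{u}} (h : UE κ W M N j) (hΛ : Lam κ ∈ M) {y : ZFSet.{u}} (hy : y ∈ M) :
    ∃ M', ElemSub M'.toSet M.toSet ∧ y ∈ M' ∧ Vk κ ∈ M' ∧ LR κ (W ∩ M') M' ∧ ∃ s, SpecS κ M' s := by
  have hL : ∀ y : ZFSet.{u}, ∃ m, y ∈ M → m ∈ M ∧ y ∈ m ∧ m.IsTransitive ∧ Cov M κ m ∧ ElemSub m.toSet M.toSet := by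
    intro y
    by_cases hy : y ∈ M
    · obtain ⟨m, hm⟩ := h.lam_ex hΛ hy; exact ⟨m, fun _ => hm⟩
    · exact ⟨∅, fun h => absurd h hy⟩
  choose L hL using hL
  let s : ℕ → ZFSet.{u} := fun n => Nat.rec (L (ZFSet.pair y (ZFSet.pair κ (ZFSet.pair ZFSet.omega (Vk κ)))))
    (fun _ m => L (ZFSet.pair m (m ∩ W))) n
  have hs0 : s 0 = L (ZFSet.pair y (ZFSet.pair κ (ZFSet.pair ZFSet.omega (Vk κ)))) := rfl
  have hsS : ∀ n, s (n + 1) = L (ZFSet.pair (s n) (s n ∩ W)) := fun _ => rfl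
  clear_value s
  have hp := h.pM
  have t0 := hp.pair_mem hy (hp.pair_mem h.κM (hp.pair_mem h.lr.om h.vk))
  have key0 := hL _ t0
  rw [← hs0] at key0
  have hpairInt : ∀ n, (s n ∈ M ∧ (s n).IsTransitive ∧ Cov M κ (s n) ∧ ElemSub (s n).toSet M.toSet) → ZFSet.pair (s n) (s n ∩ W) ∈ M := by
    intro n ⟨h1, h2, h3, h4⟩
    exact hp.pair_mem h1 (h.lr.wa _ h1 h3)
  have key : ∀ n, (s n ∈ M ∧ (s n).IsTransitive ∧ Cov M κ (s n) ∧ ElemSub (s n).toSet M.toSet) := by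
    intro n
    induction n with
    | zero => exact ⟨key0.1, key0.2.2⟩
    | succ n ih =>
      have := hL _ (hpairInt n ih)
      rw [← hsS] at this
      exact ⟨this.1, this.2.2⟩
  have keyS : ∀ n, s n ∈ s (n + 1) ∧ s n ∩ W ∈ s (n + 1) := by
    intro n
    have := hL _ (hpairInt n (key n))
    rw [← hsS] at this
    exact tr_pair this.2.2.1 this.2.1
  have hm : ∀ n, s n ⊆ s (n + 1) := fun n => (key (n + 1)).2.1.subset_of_mem (keyS n).1
  obtain ⟨M', hM'⟩ : ∃ M' : ZFSet.{u}, ∀ x, x ∈ M' ↔ ∃ n, x ∈ s n :=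
    ⟨ZFSet.sep (fun x => ∃ n, x ∈ s n) M, fun x => by
      rw [ZFSet.mem_sep]
      exact ⟨fun h => h.2, fun ⟨n, hn⟩ => ⟨(key n).2.2.2.1 hn, n, hn⟩⟩⟩
  have hE : ElemSub M'.toSet M.toSet := union_elem (fun n => (key n).2.2.2) hm hM'
  have hsM : ∀ x, x ∈ M' → x ∈ M := fun x hx => hE.1 hx
  have htr : M'.IsTransitive := by
    intro x hx z hz
    obtain ⟨n, hn⟩ := (hM' x).1 hx
    exact (hM' z).2 ⟨n, (key n).2.1.mem_trans hz hn⟩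
  obtain ⟨q1, q2⟩ := tr_pair key0.2.2.1 key0.2.1
  obtain ⟨q2, q3⟩ := tr_pair key0.2.2.1 q2
  obtain ⟨q3, q4⟩ := tr_pair key0.2.2.1 q3
  have k0 : ∀ x, x ∈ s 0 → x ∈ M' := fun x hx => (hM' x).2 ⟨0, hx⟩
  have κM' := k0 _ q2
  have pm : PM M' := pm_of_sub hE hp htr (htr.mem_trans h.c0 κM')
  have snM : ∀ n, s n ∈ M' := fun n => (hM' _).2 ⟨n + 1, (keyS n).1⟩
  have hl : Hlike κ M' := fun z hz => 
    ((Elem.ofSub hE).dfl pm hp (fun D v => HM D (v 0) (v 1)) [κ, z] (by simp [κM', hz])).2 (h.lr.hl z (hsM z hz))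
  have mI : ∀ {z}, z ∈ W ∩ M' ↔ z ∈ W ∧ z ∈ M' := ZFSet.mem_inter
  have hκn : ∀ n, κ ∈ s n ∧ Vk κ ∈ s n := by
    intro n
    induction n with
    | zero => exact ⟨q2, q4⟩
    | succ n ih => exact ⟨hm n ih.1, hm n ih.2⟩
  refine ⟨M', hE, k0 _ q1, k0 _ q4, ⟨pm, k0 _ q3, κM', hl, ?_, ?_, ?_⟩, s, snM, fun n => hm n, fun n => ElemSub.trans_iff (key n).2.2.2 hE fun z hz => (hM' z).2 ⟨n, hz⟩, ?_, hM', fun n => (key n).2.1, fun n => (hκn n).1, fun n => (hκn n).2⟩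
  · refine ⟨fun A hA => ⟨(mI.1 hA).2, (h.uf.1 A (mI.1 hA).1).2⟩, ?_, fun h0 => h.uf.2.2.1 (mI.1 h0).1, ?_, ?_, ?_, ?_⟩
    · intro α hα
      refine mI.2 ⟨h.uf.2.1 α hα, ?_⟩
      exact pm.sep (fun D ξ v => ξ ∉ v 0) (env [α]) (env_in pm (by simp [pm.mem κM' hα])) κM'
    · intro A hA B hB
      exact mI.2 ⟨h.uf.2.2.2.1 A (mI.1 hA).1 B (mI.1 hB).1, pm.inter_mem (mI.1 hA).2 (mI.1 hB).2⟩
    · intro A hA B hB h1 h2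
      exact mI.2 ⟨h.uf.2.2.2.2.1 A (mI.1 hA).1 B (hsM _ hB) h1 h2, hB⟩
    · intro B hB h1
      rcases h.uf.2.2.2.2.2.1 B (hsM _ hB) h1 with h2 | h2
      · exact Or.inl (mI.2 ⟨h2, hB⟩)
      · exact Or.inr (mI.2 ⟨h2, pm.compl_mem κM' hB⟩)
    · intro f hf hff hr
      obtain ⟨γ, hγ, h1⟩ := h.uf.2.2.2.2.2.2 f (hsM _ hf) hff (mI.1 hr).1
      refine ⟨γ, hγ, mI.2 ⟨h1, ?_⟩⟩
      exact pm.sep (fun D ξ v => fapp (v 0) ξ = v 1) (env [f, γ]) (env_in pm (by simp [hf, pm.mem κM' hγ])) κM'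
  · intro X hX _
    obtain ⟨n, hn⟩ := (hM' X).1 hX
    have : X ∩ (W ∩ M') = X ∩ (s n ∩ W) := by
      ext z
      simp only [ZFSet.mem_inter]
      constructor
      · rintro ⟨a, b, c⟩; exact ⟨a, (key n).2.1.mem_trans a hn, b⟩
      · rintro ⟨a, b, c⟩; exact ⟨a, c, (hM' z).2 ⟨n, b⟩⟩
    rw [this]
    exact pm.inter_mem hX ((hM' _).2 ⟨n + 1, (keyS n).2⟩)
  · intro f hf
    exact h.lr.oi f fun n => (mI.1 (hf n)).1
  · intro n
    have hκn := (hκn n).1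
    obtain ⟨f, hf, h1, h2⟩ := (hl _ (snM n)).cov.surj pm κM' (snM n) ⟨κ, hκn⟩
    exact exists_bij h.hi.1 pm κM' hf (snM n) h2 (card_mono ((key n).2.1.subset_of_mem hκn))

theorem Vk_code {κ : ZFSet.{u}} (hi : InfC κ) (hc : card (Vk κ) ≤ card κ) {X : ZFSet.{u}} (hX : X ⊆ Vk κ) :
    ∃ A : ZFSet.{u}, A ⊆ κ ∧ ∀ N : ZFSet.{u}, PM N → κ ∈ N → A ∈ N → X ∈ N := by
  have h0 : (insert X (Vk κ)).IsTransitive := by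
    intro x hx z hz
    rcases ZFSet.mem_insert_iff.1 hx with rfl | hx
    · exact ZFSet.mem_insert_iff.2 (Or.inr (hX hz))
    · exact ZFSet.mem_insert_iff.2 (Or.inr ((Vk_tr κ).mem_trans hz hx))
  have h1 : card (insert X (Vk κ)) ≤ card κ := by
    refine (ZFSet.card_insert_le).trans ?_
    refine Cardinal.add_le_of_le hi.2 hc ?_
    exact Cardinal.one_le_aleph0.trans hi.2
  obtain ⟨A, hA, H⟩ := exists_code hi h0 h1 ⟨X, by simp⟩
  exact ⟨A, hA, fun N hN hκ hAN => hN.mem (H N hN hκ hAN) (by simp)⟩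

theorem codes5 {κ a b c d e f : ZFSet.{u}} (hi : InfC κ) (hc : card (Vk κ) ≤ card κ) (ha : a ⊆ Vk κ) (hb : b ⊆ Vk κ)
    (hcc : c ⊆ Vk κ) (hd : d ⊆ Vk κ) (he : e ⊆ Vk κ) :
    ∃ A : ZFSet.{u}, A ⊆ κ ∧ ∀ N : ZFSet.{u}, PM N → κ ∈ N → A ∈ N → a ∈ N ∧ b ∈ N ∧ c ∈ N ∧ d ∈ N ∧ e ∈ N := by
  obtain ⟨A, hA, HA⟩ := Vk_code hi hc ha
  obtain ⟨B, hB, HB⟩ := Vk_code hi hc hb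
  obtain ⟨C, hC, HC⟩ := Vk_code hi hc hcc
  obtain ⟨D, hD, HD⟩ := Vk_code hi hc hd
  obtain ⟨E, hE, HE⟩ := Vk_code hi hc he
  obtain ⟨F, hF, HF⟩ := exists_merge hi hA hB
  obtain ⟨G, hG, HG⟩ := exists_merge hi hF hC
  obtain ⟨H, hH, HH⟩ := exists_merge hi hG hD
  obtain ⟨I, hI, HI⟩ := exists_merge hi hH hE
  refine ⟨I, hI, fun N hN hκ hIN => ?_⟩
  obtain ⟨i1, i2⟩ := (HI N hN hκ).1 hIN
  obtain ⟨i1, i3⟩ := (HH N hN hκ).1 i1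
  obtain ⟨i1, i4⟩ := (HG N hN hκ).1 i1
  obtain ⟨i1, i5⟩ := (HF N hN hκ).1 i1
  exact ⟨HA N hN hκ i1, HB N hN hκ i5, HC N hN hκ i4, HD N hN hκ i3, HE N hN hκ i2⟩

theorem main_exists {κ : ZFSet.{u}} {β : Ordinal.{u+1}} (hκ : IsCard κ) (hb : β < oRank IsRamseyMeasure RamseyMeasureIn κ)
    {A : ZFSet.{u}} (hA : A ⊆ κ) :
    ∃ U, IsRamseyMeasure κ U ∧ A ∈ MU κ U ∧ (∃ s, SpecS κ (MU κ U) s) ∧ oEQ κ β (NU κ U) := by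
  obtain ⟨W₀, hW₀, -, h0⟩ := exists_ge hb hA
  have hi := hW₀.infC hκ
  obtain ⟨o, ho⟩ := exists_label hκ ⟨W₀, hW₀, h0⟩
  have hsep : ∀ P : ZFSet.{u} → Prop, ZFSet.sep P (Vk κ) ⊆ Vk κ := fun P z hz => (ZFSet.mem_sep.1 hz).1
  obtain ⟨A₁, hA₁, H⟩ := codes5 (a := Vk κ) (b := BB κ o) (c := LRset κ) (d := Tset κ (BB κ o)) (e := Lam κ) (f := ∅)
    hi (hW₀.ue hκ).cV (fun _ h => h) (hsep _) (hsep _) (hsep _) (hsep _)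
  obtain ⟨A₂, hA₂, H₂⟩ := exists_merge hi hA hA₁
  obtain ⟨W, hW, hAW, hβ⟩ := exists_eq hκ hA₂ (exists_ge hb hA₂)
  have hu := hW.ue hκ
  obtain ⟨hAW, hA₁W⟩ := (H₂ _ hu.pM hu.κM).1 hAW
  obtain ⟨e1, e2, e3, e4, e5⟩ := H _ hu.pM hu.κM hA₁W
  have mc := main_claim (o := o) hκ hi hA₁ (fun N hN h1 h2 => ⟨(H N hN h1 h2).1, (H N hN h1 h2).2.1, (H N hN h1 h2).2.2.1, (H N hN h1 h2).2.2.2.1⟩)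
  have l1 : ∀ δ < β, ∃ ζ ∈ κ, o ζ = δ := fun δ hδ => ho δ hδ.le
  have l2 : ∀ δ < β + 1, ∃ ζ ∈ κ, o ζ = δ := fun δ hδ => ho δ (Order.lt_add_one_iff.1 hδ)
  have n1 := hβ.2
  change ¬ oGE κ (β + 1) (NU κ W) at n1
  rw [mc (β + 1) l2 W hW hA₁W] at n1
  push Not at n1
  obtain ⟨A₀, a1, a2, ζ₀, z1, z2, z3⟩ := n1
  have g1 := (mc β l1 W hW hA₁W).1 hβ.1
  obtain ⟨M', E1, E2, E3, E4, E5⟩ := hu.chain e5 (hu.pM.pair_mem hAW (hu.pM.pair_mem hA₁W a1))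
  obtain ⟨c1, c2⟩ := tr_pair E4.pm.tr E2
  obtain ⟨c2, c3⟩ := tr_pair E4.pm.tr c2
  have hsM : M' ⊆ MU κ W := fun z hz => E1.1 hz
  obtain ⟨r1, r2⟩ := E4.ramsey hi ((card_mono hsM).trans hu.cM) (hasV_iff.2 E3)
  have hu' := r1.ue hκ
  have hT' : Tset κ (BB κ o) ∈ M' := (H _ E4.pm E4.mem c2).2.2.2.1
  rw [← r2] at hT'
  refine ⟨_, r1, by rw [r2]; exact c1, by rw [r2]; exact E5, ?_, ?_⟩
  · change oGE κ β _
    rw [mc β l1 _ r1 (by rw [r2]; exact c2)]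
    intro B hB hBκ ζ hζ hoζ
    rw [ZFSet.mem_inter]
    refine ⟨g1 B ?_ hBκ ζ hζ hoζ, ?_⟩
    · rw [r2] at hB; exact hsM hB
    · have := hu'.YSM hT' hζ hB
      rwa [r2] at this
  · change ¬ oGE κ (β + 1) _
    rw [mc (β + 1) l2 _ r1 (by rw [r2]; exact c2)]
    intro HH
    exact z3 (ZFSet.mem_inter.1 (HH A₀ (by rw [r2]; exact c3) a2 ζ₀ z1 z2)).1

def RF (t g : ZFSet.{u}) : Prop := t.IsTransitive ∧ ∀ z, z ∈ t → ((∀ a, a ∈ fapp g z → ∃ w, w ∈ z ∧ a ⊆ fapp g w) ∧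
  ∀ w, w ∈ z → fapp g w ∈ fapp g z)

instance Def.RF {s t : ZFSet.{u} → (ℕ → ZFSet.{u}) → ZFSet.{u}} [hs : TDef s] [ht : TDef t] :
    Def (fun D v => RF (s D v) (t D v)) := by unfold MPaper.RF; infer_instance

theorem RF.rank {t g : ZFSet.{u}} (h : RF t g) (z : ZFSet.{u}) : z ∈ t → ZFSet.rank (fapp g z) = ZFSet.rank z := by
  induction z using ZFSet.inductionOn with
  | _ z ih =>
    intro hz
    have ih : ∀ w ∈ z, ZFSet.rank (fapp g w) = ZFSet.rank w := fun w hw => ih w hw (h.1.mem_trans hw hz)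
    obtain ⟨h1, h2⟩ := h.2 z hz
    apply le_antisymm
    · rw [ZFSet.rank_le_iff]
      intro a ha
      obtain ⟨w, hw, hs⟩ := h1 a ha
      exact ((ZFSet.rank_mono hs).trans (ih w hw).le).trans_lt (ZFSet.rank_lt_of_mem hw)
    · rw [ZFSet.rank_le_iff]
      intro w hw
      rw [← ih w hw]
      exact ZFSet.rank_lt_of_mem (h2 w hw)

theorem exists_RF {κ y : ZFSet.{u}} (hi : InfC κ) (hy : y ∈ Vk κ) : ∃ t ∈ Vk κ, ∃ g ∈ Vk κ, y ∈ t ∧ RF t g ∧ 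
    fapp g y = (ZFSet.rank y).toZFSet := by
  have hr := Vk_lim hi (mem_Vk.1 hy)
  set o := Order.succ (ZFSet.rank y) with ho
  have ht : ZFSet.vonNeumann o ∈ Vk κ := ZFSet.vonNeumann_mem_of_lt hr
  have hot : o.toZFSet ∈ Vk κ := by rw [mem_Vk, Ordinal.rank_toZFSet]; exact hr
  have happ : ∀ z ∈ ZFSet.vonNeumann o, fapp (grf (fun z => (ZFSet.rank z).toZFSet) (ZFSet.vonNeumann o)) z = (ZFSet.rank z).toZFSet :=
    fun z hz => grf_app hz
  have htr : (ZFSet.vonNeumann o).IsTransitive := ZFSet.isTransitive_vonNeumann o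
  have hyt : y ∈ ZFSet.vonNeumann o := by rw [ZFSet.mem_vonNeumann]; exact Order.lt_succ _
  refine ⟨_, ht, grf (fun z => (ZFSet.rank z).toZFSet) (ZFSet.vonNeumann o), ?_, hyt, ⟨htr, ?_⟩, happ y hyt⟩
  · refine Vk_sub (fun p hp => ?_) (Vk_prod hi ht hot)
    obtain ⟨x, hx, rfl⟩ := mem_grf.1 hp
    rw [ZFSet.pair_mem_prod]
    refine ⟨hx, ?_⟩
    rw [Ordinal.toZFSet_mem_toZFSet_iff]
    exact ZFSet.mem_vonNeumann.1 hx
  · intro z hz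
    rw [happ z hz]
    constructor
    · intro a ha
      obtain ⟨b, hb, rfl⟩ := Ordinal.mem_toZFSet_iff.1 ha
      obtain ⟨w, hw, hbw⟩ := ZFSet.lt_rank_iff.1 hb
      refine ⟨w, hw, ?_⟩
      rw [happ w (htr.mem_trans hw hz), Ordinal.toZFSet_subset_toZFSet_iff]
      exact hbw
    · intro w hw
      rw [happ w (htr.mem_trans hw hz), Ordinal.toZFSet_mem_toZFSet_iff]
      exact ZFSet.rank_lt_of_mem hw

namespace UE
variable {κ U M N : ZFSet.{u}} {j : ZFSet.{u} → ZFSet.{u}}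

theorem star (h : UE κ U M N j) : ZFSet.sep (fun x => ZFSet.rank x < ZFSet.rank (j κ)) N = j (Vk κ) := by
  have hl : ∀ z ∈ [Vk κ, κ], z ∈ M := by simp [h.vk, h.κM]
  have a1 := (h.df (fun D v => ∀ x, x ∈ v 0 → ∃ t, t ∈ v 0 ∧ ∃ g, g ∈ v 0 ∧ (x ∈ t ∧ RF t g ∧ fapp g x ∈ v 1)) _ hl).1 (by
    intro x hx
    obtain ⟨t, ht, g, hg, h1, h2, h3⟩ := exists_RF h.hi hx
    refine ⟨t, ht, g, hg, h1, h2, ?_⟩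
    rw [h3]
    have := mem_Vk.1 hx
    rw [← Ordinal.toZFSet_mem_toZFSet_iff, h.ord.toZFSet_rank_eq] at this
    exact this)
  have a2 := (h.df (fun D v => ∀ x, x ∈ D → (x ⊆ v 0 → (x ∉ v 0 → ∀ η, η ∈ v 1 → ∃ y, y ∈ x ∧ ∃ t, t ∈ v 0 ∧ ∃ g, g ∈ v 0 ∧
      (y ∈ t ∧ RF t g ∧ η ⊆ fapp g y)))) _ hl).1 (by
    intro x hx hxV hxn η hη
    have h1 : ZFSet.rank η < ZFSet.rank x := by
      refine (ZFSet.rank_lt_of_mem hη).trans_le ?_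
      by_contra hn
      exact hxn (mem_Vk.2 (not_le.1 hn))
    obtain ⟨y, hy, hyr⟩ := ZFSet.lt_rank_iff.1 h1
    obtain ⟨t, ht, g, hg, h1, h2, h3⟩ := exists_RF h.hi (hxV hy)
    refine ⟨y, hy, t, ht, g, hg, h1, h2, ?_⟩
    rw [h3, ← Ordinal.toZFSet_subset_toZFSet_iff, (h.ord.mem hη).toZFSet_rank_eq] at *
    exact hyr)
  have a1 : ∀ x, x ∈ j (Vk κ) → ∃ t, t ∈ j (Vk κ) ∧ ∃ g, g ∈ j (Vk κ) ∧ (x ∈ t ∧ RF t g ∧ fapp g x ∈ j κ) := a1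
  have a2 : ∀ x, x ∈ N → (x ⊆ j (Vk κ) → (x ∉ j (Vk κ) → ∀ η, η ∈ j κ → ∃ y, y ∈ x ∧ ∃ t, t ∈ j (Vk κ) ∧ ∃ g, g ∈ j (Vk κ) ∧
      (y ∈ t ∧ RF t g ∧ η ⊆ fapp g y))) := a2
  ext x
  rw [ZFSet.mem_sep]
  constructor
  · induction x using ZFSet.inductionOn with
    | _ x ih =>
      rintro ⟨hx, hr⟩
      by_contra hn
      have hs : x ⊆ j (Vk κ) := fun y hy => ih y hy ⟨h.pN.mem hx hy, (ZFSet.rank_lt_of_mem hy).trans hr⟩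
      have := a2 x hx hs hn
      refine absurd hr (not_lt.2 ?_)
      rw [ZFSet.rank_le_iff]
      intro η hη
      obtain ⟨y, hy, t, -, g, -, h1, h2, h3⟩ := this η hη
      refine ((ZFSet.rank_mono h3).trans (h2.rank y h1).le).trans_lt (ZFSet.rank_lt_of_mem hy)
  · intro hx
    obtain ⟨t, -, g, -, h1, h2, h3⟩ := a1 x hx
    refine ⟨h.pN.mem h.KN hx, ?_⟩
    rw [← h2.rank x h1]
    exact ZFSet.rank_lt_of_mem h3

theorem fK (h : UE κ U M N j) {f x d : ZFSet.{u}} (hf : f ∈ N) (hff : IsZFunc d f) (hd : d ∈ j (Vk κ)) (hx : x ∈ j (Vk κ))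
    (hfx : ∀ a ∈ d, fapp f a ∈ x) : f ∈ j (Vk κ) := by
  refine h.Ksub hf (fun p hp => ?_) (h.Kprod hd hx)
  obtain ⟨a, ha, b, rfl⟩ := hff.1 p hp
  rw [ZFSet.pair_mem_prod]
  refine ⟨ha, ?_⟩
  rw [← fapp_eq hff hp]
  exact hfx a ha

theorem ramK (h : UE κ U M N j) {y : ZFSet.{u}} : RamseyMeasureIn (j (Vk κ)) κ y ↔ RamseyMeasureIn N κ y := by
  have hωK : ZFSet.omega ∈ j (Vk κ) := h.MsubK h.lr.om
  constructor
  · rintro ⟨h1, h2, h3, h4⟩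
    refine ⟨h.pN.mem h.KN h1, h2, h3, fun f hf hff hfy => h4 f ?_ hff hfy⟩
    exact h.fK hf hff hωK h1 hfy
  · rintro ⟨h1, h2, h3, h4⟩
    refine ⟨?_, h2, h3, fun f hf hff hfy => h4 f ?_ hff hfy⟩
    · refine h.Ksub h1 (fun A hA => ?_) h.MK
      exact (h.subN (h2.2.1 A hA)).1 (h.pN.mem h1 hA)
    · exact h.pN.mem h.KN hf

theorem oGEK (h : UE κ U M N j) {γ : Ordinal.{u+1}} : oGE κ γ (j (Vk κ)) ↔ oGE κ γ N := by
  unfold oGE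
  rw [oGEin_iff, oGEin_iff]
  constructor
  · intro H A hA hAκ β hβ
    obtain ⟨W, h1, h2, h3⟩ := H A (h.MsubK ((h.subN hAκ).1 hA)) hAκ β hβ
    exact ⟨W, h.pN.mem h.KN h1, h.ramK.1 h2, h3⟩
  · intro H A hA hAκ β hβ
    obtain ⟨W, h1, h2, h3⟩ := H A (h.pN.mem h.KN hA) hAκ β hβ
    exact ⟨W, (h.ramK.2 h2).1, h.ramK.2 h2, h3⟩

theorem regM (h : UE κ U M N j) {ξ x : ZFSet.{u}} (hξ : ξ ∈ κ) (hx : x ∈ M) (hxV : x ⊆ Vk κ) (hc : Cov M ξ x) : x ∈ Vk κ := by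
  obtain ⟨f, hf, hff, hs⟩ := hc
  have hξM := h.VM (h.κV hξ)
  have e : j x = x := by
    ext y
    constructor
    · intro hy
      have := (h.df (fun D v => ∀ y, y ∈ v 0 → ∃ i, i ∈ v 1 ∧ fapp (v 2) i = y) [x, ξ, f] (by simp [hx, hf, hξM])).1 hs
      obtain ⟨i, hi, e⟩ := (show ∀ y, y ∈ j x → ∃ i, i ∈ j ξ ∧ fapp (j f) i = y from this) y hy
      rw [h.jκ hξ] at hi
      have hiκ : i ∈ κ := h.ord.mem_trans hi hξ
      have hiM := h.VM (h.κV hiκ)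
      have hfi := h.pM.fapp_mem hf hiM
      have e2 : j (fapp f i) = fapp (j f) (j i) := 
        (h.df (fun D v => v 0 = fapp (v 1) (v 2)) [fapp f i, f, i] (by simp [hf, hiM, hfi])).1 rfl
      rw [h.jκ hiκ, e] at e2
      rw [← e2] at hy ⊢
      have hx' := (h.jmem hfi hx).2 hy
      rwa [h.jV (hxV hx')]
    · intro hy
      exact (h.memj (hxV hy) hx).2 hy
  rw [h.jmem hx h.vk, e]
  exact h.Ksub (h.MsubN hx) hxV (h.MsubK h.vk)

theorem regK (h : UE κ U M N j) {x : ZFSet.{u}} (hx : x ∈ N) (hxK : x ⊆ j (Vk κ)) (hc : Cov N κ x) : x ∈ j (Vk κ) := by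
  have := h.refl_all (fun D ξ v => ∀ x, x ∈ D → (x ⊆ v 0 → (Cov D ξ x → x ∈ v 0))) [Vk κ] (by simp [h.vk])
    (fun ξ hξ x hx hxV hc => h.regM hξ hx hxV hc)
  exact this x hx hxK hc

end UE

theorem def_sat_up (φ : Fml) (n : ℕ) (m x : ZFSet.{u} → (ℕ → ZFSet.{u}) → ZFSet.{u})
    (t : ℕ → ZFSet.{u} → (ℕ → ZFSet.{u}) → ZFSet.{u}) (hm : TDef m) (hx : TDef x) (ht : ∀ k, TDef (t k)) :
    Def (fun D v => Sat (m D v).toSet φ (Function.update (fun k => t k D v) n (x D v))) := by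
  refine def_sat_in φ m (fun k D v => Function.update (fun k => t k D v) n (x D v) k) hm fun k => ?_
  by_cases hk : k = n
  · subst hk
    simp only [Function.update_self]
    exact hx
  · simp only [Function.update_of_ne hk]
    exact ht k

namespace UE
variable {κ U M N : ZFSet.{u}} {j : ZFSet.{u} → ZFSet.{u}}

theorem skolem (h : UE κ U M N j) {s : ZFSet.{u}} (hsM : ElemSub s.toSet M.toSet) (htr : s.IsTransitive) (hκ : κ ∈ s) (hV : Vk κ ∈ s)
    (φ : Fml) (n : ℕ) (f : ℕ → ZFSet.{u}) (hf : ∀ i, f i ∈ s)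
    (hex : ∃ x ∈ j (Vk κ), Sat (j (Vk κ)).toSet φ (Function.update (fun i => fapp (j (f i)) κ) n x)) :
    ∃ F ∈ s, fapp (j F) κ ∈ j (Vk κ) ∧ Sat (j (Vk κ)).toSet φ (Function.update (fun i => fapp (j (f i)) κ) n (fapp (j F) κ)) := by
  have ps : PM s := pm_of_sub hsM h.pM htr (htr.mem_trans h.c0 hκ)
  have hl : Hlike κ s := fun z hz => 
    ((Elem.ofSub hsM).dfl ps h.pM (fun D v => HM D (v 0) (v 1)) [κ, z] (by simp [hκ, hz])).2 (h.lr.hl z (hsM.1 hz))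
  have hw := hl.wop ps hκ h.ord
  let w : ℕ → ZFSet.{u} := fun k => Nat.casesOn k κ (fun k => Nat.casesOn k (Vk κ) f)
  have hws : ∀ k, w k ∈ s := by
    intro k
    rcases k with _ | _ | k
    · exact hκ
    · exact hV
    · exact hf k
  have d1 : Def (fun D v => Sat (v 4 : ZFSet.{u}).toSet φ (Function.update (fun i => fapp (v (i + 5)) (v 1)) n (v 0))) :=
    def_sat_up φ n (fun D v => v 4) (fun D v => v 0) (fun k D v => fapp (v (k + 5)) (v 1)) inferInstance inferInstance (fun k => inferInstance)
  have d2 : Def (fun D v => (v 2 : ZFSet.{u}) = ZFSet.pair (v 1) (v 0)) := inferInstance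
  have d3 := Def.and (hP := d2) (hQ := d1)
  have d4 := @Def.bex (fun D x v => (v 1 : ZFSet.{u}) = ZFSet.pair (v 0) x ∧ Sat (v 3 : ZFSet.{u}).toSet φ (Function.update (fun i => fapp (v (i + 4)) (v 0)) n x)) (fun D v => v 3) inferInstance d3
  have d5 := @Def.bex (fun D ξ v => ∃ x, x ∈ (v 2 : ZFSet.{u}) ∧ ((v 0 : ZFSet.{u}) = ZFSet.pair ξ x ∧ Sat (v 2 : ZFSet.{u}).toSet φ (Function.update (fun i => fapp (v (i + 3)) ξ) n x))) (fun D v => v 1) inferInstance d4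
  obtain ⟨S, hS, hSm⟩ : ∃ S ∈ s, ∀ ξ ∈ κ, ∀ x ∈ Vk κ, (ZFSet.pair ξ x ∈ S ↔ Sat (Vk κ).toSet φ (Function.update (fun i => fapp (f i) ξ) n x)) := by
    refine ⟨_, ps.sep (fun D p v => ∃ ξ, ξ ∈ (v 0 : ZFSet.{u}) ∧ (∃ x, x ∈ (v 1 : ZFSet.{u}) ∧ (p = ZFSet.pair ξ x ∧ Sat (v 1 : ZFSet.{u}).toSet φ (Function.update (fun i => fapp (v (i + 2)) ξ) n x))))
      w hws (ps.prod_mem hκ hV) (hQ := d5), ?_⟩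
    intro ξ hξ x hx
    rw [ZFSet.mem_sep]
    constructor
    · rintro ⟨-, ξ', h1, x', h2, e, h3⟩
      obtain ⟨e1, e2⟩ := ZFSet.pair_inj.1 e
      subst e1 e2
      exact h3
    · intro h3
      exact ⟨ZFSet.pair_mem_prod.2 ⟨hξ, hx⟩, ξ, hξ, x, hx, rfl, h3⟩
  obtain ⟨F, hF, hFF, H⟩ := ps.choice hw (fun D ξ y v => (∃ x, x ∈ v 0 ∧ ZFSet.pair ξ x ∈ v 1) → (y ∈ v 0 ∧ ZFSet.pair ξ y ∈ v 1))
    [Vk κ, S] (by simp [hV, hS]) hκ (by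
      intro ξ hξ
      by_cases hx : ∃ x ∈ Vk κ, ZFSet.pair ξ x ∈ S
      · obtain ⟨x, h1, h2⟩ := hx
        exact ⟨x, ps.mem hV h1, fun _ => ⟨h1, h2⟩⟩
      · exact ⟨κ, hκ, fun h => absurd h hx⟩)
  have hFM := hsM.1 hF
  have hSM := hsM.1 hS
  have a1 := h.refl_all (fun D ξ v => (∃ x, x ∈ v 0 ∧ ZFSet.pair ξ x ∈ v 1) → (fapp (v 2) ξ ∈ v 0 ∧ ZFSet.pair ξ (fapp (v 2) ξ) ∈ v 1))
    [Vk κ, S, F] (by simp [h.vk]; exact ⟨hSM, hFM⟩) (fun ξ hξ => (H ξ hξ).2)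
  have a1 : (∃ x, x ∈ j (Vk κ) ∧ ZFSet.pair κ x ∈ j S) → (fapp (j F) κ ∈ j (Vk κ) ∧ ZFSet.pair κ (fapp (j F) κ) ∈ j S) := a1
  have c1 : Def (fun D v => Sat (v 3 : ZFSet.{u}).toSet φ (Function.update (fun i => fapp (v (i + 5)) (v 1)) n (v 0))) :=
    def_sat_up φ n (fun D v => v 3) (fun D v => v 0) (fun k D v => fapp (v (k + 5)) (v 1)) inferInstance inferInstance (fun k => inferInstance)
  have c2 : Def (fun D v => ZFSet.pair (v 1) (v 0) ∈ (v 4 : ZFSet.{u})) := inferInstance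
  have c3 := Def.iff (hP := c2) (hQ := c1)
  have c4 := @Def.ball (fun D x v => ZFSet.pair (v 0) x ∈ (v 3 : ZFSet.{u}) ↔ Sat (v 2 : ZFSet.{u}).toSet φ (Function.update (fun i => fapp (v (i + 4)) (v 0)) n x)) (fun D v => v 2) inferInstance c3
  have c5 := @Def.ball (fun D ξ v => ∀ x, x ∈ (v 1 : ZFSet.{u}) → (ZFSet.pair ξ x ∈ (v 2 : ZFSet.{u}) ↔ Sat (v 1 : ZFSet.{u}).toSet φ (Function.update (fun i => fapp (v (i + 3)) ξ) n x))) (fun D v => v 0) inferInstance c4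
  let w' : ℕ → ZFSet.{u} := fun k => Nat.casesOn k κ (fun k => Nat.casesOn k (Vk κ) (fun k => Nat.casesOn k S f))
  have hws' : ∀ k, w' k ∈ M := by
    intro k
    rcases k with _ | _ | _ | k
    · exact h.κM
    · exact h.vk
    · exact hSM
    · exact hsM.1 (hf k)
  have a2 := (h.el.df h.pM h.pN _ (hP := c5) w' hws').1 hSm
  have a2 : ∀ x, x ∈ j (Vk κ) → (ZFSet.pair κ x ∈ j S ↔ Sat (j (Vk κ)).toSet φ (Function.update (fun i => fapp (j (f i)) κ) n x)) := a2 κ h.κj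
  obtain ⟨x, hx, hsx⟩ := hex
  obtain ⟨b1, b2⟩ := a1 ⟨x, hx, (a2 x hx).2 hsx⟩
  exact ⟨F, hF, b1, (a2 _ b1).1 b2⟩

theorem specK (h : UE κ U M N j) {s : ℕ → ZFSet.{u}} (hs : SpecS κ M s) : OmegaSpecial κ (j (Vk κ)) := by
  have hsM : ∀ n x, x ∈ s n → x ∈ M := fun n x hx => (hs.el n).1 hx
  have ps : ∀ n, PM (s n) := fun n => pm_of_sub (hs.el n) h.pM (hs.tr n) ((hs.tr n).mem_trans h.c0 (hs.km n))
  let S : ℕ → ZFSet.{u} := fun n => ZFSet.sep (fun z => ∃ f ∈ s n, fapp (j f) κ = z) (j (Vk κ))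
  have mS : ∀ n z, z ∈ S n ↔ z ∈ j (Vk κ) ∧ ∃ f ∈ s n, fapp (j f) κ = z := fun n z => ZFSet.mem_sep
  clear_value S
  have je : ∀ n, ∃ e ∈ N, ∀ z, (∃ f ∈ s n, fapp (j f) κ = z) ↔ ∃ ξ ∈ κ, fapp e ξ = z := by
    intro n
    obtain ⟨e, he, hb⟩ := hs.bij n
    have he : e ∈ M := he
    refine ⟨_, h.pN.grfT (fun D v => fapp (fapp (v 1) (v 0)) (v 2)) [j e, κ] (by simp [h.jm he, h.κN]) h.κN, fun z => ?_⟩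
    have hj : ∀ ξ ∈ κ, fapp (j e) ξ = j (fapp e ξ) := by
      intro ξ hξ
      have hξM := h.VM (h.κV hξ)
      have e2 : j (fapp e ξ) = fapp (j e) (j ξ) := 
        (h.df (fun D v => v 0 = fapp (v 1) (v 2)) [fapp e ξ, e, ξ] (by simp [he, hξM, h.pM.fapp_mem he hξM])).1 rfl
      rw [e2, h.jκ hξ]
    constructor
    · rintro ⟨f, hf, rfl⟩
      obtain ⟨ξ, hξ, rfl⟩ := hb.2.1.2 f hf
      refine ⟨ξ, hξ, ?_⟩
      rw [grf_app hξ]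
      change fapp (fapp (j e) ξ) κ = _
      rw [hj ξ hξ]
    · rintro ⟨ξ, hξ, rfl⟩
      refine ⟨fapp e ξ, hb.2.1.1 ξ hξ, ?_⟩
      rw [grf_app hξ]
      change _ = fapp (fapp (j e) ξ) κ
      rw [hj ξ hξ]
  have SN : ∀ n, S n ∈ N ∧ Cov N κ (S n) := by
    intro n
    obtain ⟨e, he, H⟩ := je n
    have heq : S n = ZFSet.sep (fun z => ∃ ξ, ξ ∈ κ ∧ fapp e ξ = z) (j (Vk κ)) := by
      ext z
      rw [mS, ZFSet.mem_sep, H]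
    constructor
    · rw [heq]
      exact h.pN.sep (fun D z v => ∃ ξ, ξ ∈ v 0 ∧ fapp (v 1) ξ = z) (env [κ, e]) (env_in h.pN (by simp [h.κN, he])) h.KN
    · refine Cov.img (g := e) h.pN h.κN he (Cov.self h.pN h.κN) ?_
      intro y hy
      rw [heq, ZFSet.mem_sep] at hy
      exact hy.2
  have SK : ∀ n, S n ∈ j (Vk κ) := fun n => h.regK (SN n).1 (fun z hz => ((mS n z).1 hz).1) (SN n).2
  have κS : ∀ n, κ ⊆ S n := by
    intro n ξ hξ
    have hξs := (hs.tr n).mem_trans hξ (hs.km n)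
    have hc := (ps n).grfT (fun D v => v 1) [ξ] (by simp [hξs]) (hs.km n)
    refine (mS n ξ).2 ⟨h.Vsub (h.κV hξ), _, hc, ?_⟩
    have := h.refl_all (fun D η v => fapp (v 0) η = v 1) [_, ξ] (by simp [h.VM (h.κV hξ)]; exact hsM n _ hc) (fun η hη => grf_app hη)
    refine (show fapp (j _) κ = j ξ from this).trans (h.jκ hξ)
  refine ⟨S, SK, ?_, ?_, ?_, ?_⟩
  · intro n z hz
    obtain ⟨h1, f, hf, h2⟩ := (mS n z).1 hz
    exact (mS (n + 1) z).2 ⟨h1, f, hs.sub n hf, h2⟩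
  · intro n
    refine tv (fun z hz => ((mS n z).1 hz).1) ?_
    intro φ k v hv hex
    have hv' : ∀ i, ∃ f ∈ s n, fapp (j f) κ = v i := fun i => ((mS n _).1 (hv i)).2
    choose f hf hfv using hv'
    have e : v = fun i => fapp (j (f i)) κ := by funext i; rw [hfv]
    rw [e] at hex ⊢
    obtain ⟨F, hF, h1, h2⟩ := h.skolem (hs.el n) (hs.tr n) (hs.km n) (hs.vm n) φ k f hf hex
    exact ⟨_, (mS n _).2 ⟨h1, F, hF, rfl⟩, h2⟩
  · intro n
    obtain ⟨f, hf, h1, h2⟩ := (SN n).2.surj h.pN h.κN (SN n).1 ⟨∅, κS n h.c0⟩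
    obtain ⟨g, hg, hgb⟩ := exists_bij h.hi.1 h.pN h.κN hf (SN n).1 h2 (card_mono (κS n))
    exact ⟨g, h.fK hg hgb.1 h.κK (SK n) hgb.2.1.1, hgb⟩
  · intro z
    constructor
    · intro hz
      obtain ⟨f, hf, -, e⟩ := h.rep (h.pN.mem h.KN hz)
      obtain ⟨n, hn⟩ := (hs.un f).1 hf
      exact ⟨n, (mS n z).2 ⟨hz, f, hn, e⟩⟩
    · rintro ⟨n, hn⟩
      exact ((mS n z).1 hn).1

end UE

theorem final_aux {κ : ZFSet.{u}} {β : Ordinal.{u+1}} (hκ : IsCard κ) (hb : β < oRank IsRamseyMeasure RamseyMeasureIn κ)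
    {A : ZFSet.{u}} (hA : A ⊆ κ) :
    ∃ U, IsRamseyMeasure κ U ∧ AGood κ A U ∧ OmegaSpecial κ (MU κ U) ∧ oEQin RamseyMeasureIn κ β (NU κ U) ∧
      OmegaSpecial κ (MUstar κ U) ∧ oEQin RamseyMeasureIn κ β (MUstar κ U) := by
  obtain ⟨U, h1, h2, ⟨s, h3⟩, h4⟩ := main_exists hκ hb hA
  have h := h1.ue hκ
  have e : MUstar κ U = jU κ U (Vk κ) := h.star
  refine ⟨U, h1, h2, h3.special, h4, ?_, ?_⟩
  · rw [e]; exact h.specK h3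
  · rw [e]
    exact ⟨h.oGEK.2 h4.1, fun hn => h4.2 (h.oGEK.1 hn)⟩

end

/-- Suppose `o_Ram(κ) = α > 0`. Then for every `A ⊆ κ` and every `β < α`
there is an `A`-good Ramsey measure `U` on `κ` such that `M_U` is `ω`-special and
`N_U ⊨ o_Ram(κ) = β`; consequently `M_U⋆` is `ω`-special and `M_U⋆ ⊨ o_Ram(κ) = β`. -/
theorem omegaSpecial_measure_of_rank (κ : ZFSet) (hκ : IsCard κ) (α : Ordinal)
    (hα : oRank IsRamseyMeasure RamseyMeasureIn κ = α) (hpos : 0 < α) :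
    ∀ A : ZFSet, A ⊆ κ → ∀ β < α,
      ∃ U : ZFSet, IsRamseyMeasure κ U ∧ AGood κ A U ∧
        OmegaSpecial κ (MU κ U) ∧ oEQin RamseyMeasureIn κ β (NU κ U) ∧
        OmegaSpecial κ (MUstar κ U) ∧ oEQin RamseyMeasureIn κ β (MUstar κ U) := by
  intro A hA β hβ
  exact final_aux hκ (by rw [hα]; exact hβ) hA

end MPaper
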